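/- There exist absolute constants c, C > 0 with the following property. Let q be a prime power and n an integer with n > C, and let G be any group with SL_n(q) ≤ G ≤ GL_n(q). Let k be an integer with k > q^C, choose x_1, …, x_k independently and uniformly at random from G, and set S = {x_1^{±1}, …, x_k^{±1}}. Then with probability at least 1 − q^{−c·n}, the subgroup ⟨S⟩ generated by S contains SL_n(q) and every element of ⟨S⟩ is a product of at most q²·n^C elements of S. -/

import Mathlib

set_option linter.unusedSectionVars false

/-- The average of a real function on a finite type. -/
noncomputable def ex {Ω : Type*} (f : Ω → ℝ) : ℝ := (∑ᶠ ω, f ω) / Nat.card Ω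

/-- The proportion of elements of a finite type satisfying a predicate. -/
noncomputable def pr {Ω : Type*} (p : Ω → Prop) : ℝ := (Nat.card {ω // p ω} : ℝ) / Nat.card Ω

section Averages

variable {Ω Ω' : Type*} [Finite Ω] [Finite Ω']

theorem ex_eq_sum [Fintype Ω] (f : Ω → ℝ) : ex f = (∑ ω, f ω) / Nat.card Ω := by
  rw [ex, finsum_eq_sum_of_fintype]

theorem ex_add (f g : Ω → ℝ) : ex (fun ω => f ω + g ω) = ex f + ex g := by
  have := Fintype.ofFinite Ω
  simp only [ex_eq_sum, Finset.sum_add_distrib, add_div]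

theorem ex_sub (f g : Ω → ℝ) : ex (fun ω => f ω - g ω) = ex f - ex g := by
  have := Fintype.ofFinite Ω
  simp only [ex_eq_sum, Finset.sum_sub_distrib, sub_div]

theorem ex_mul_left (c : ℝ) (f : Ω → ℝ) : ex (fun ω => c * f ω) = c * ex f := by
  have := Fintype.ofFinite Ω
  simp only [ex_eq_sum, ← Finset.mul_sum, mul_div_assoc]

theorem ex_sum {ι : Type*} (s : Finset ι) (f : ι → Ω → ℝ) :
    ex (fun ω => ∑ i ∈ s, f i ω) = ∑ i ∈ s, ex (f i) := by
  have := Fintype.ofFinite Ω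
  simp only [ex_eq_sum, ← Finset.sum_div]
  rw [Finset.sum_comm]

theorem ex_const [Nonempty Ω] (c : ℝ) : ex (fun _ : Ω => c) = c := by
  have := Fintype.ofFinite Ω
  have h : (Nat.card Ω : ℝ) ≠ 0 := by exact_mod_cast Nat.card_pos.ne'
  rw [ex_eq_sum, Finset.sum_const, Finset.card_univ, nsmul_eq_mul, ← Nat.card_eq_fintype_card]
  field_simp

theorem ex_mono {f g : Ω → ℝ} (h : ∀ ω, f ω ≤ g ω) : ex f ≤ ex g := by
  have := Fintype.ofFinite Ω
  rw [ex_eq_sum, ex_eq_sum]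
  gcongr
  exact h _

theorem ex_nonneg {f : Ω → ℝ} (h : ∀ ω, 0 ≤ f ω) : 0 ≤ ex f := by
  have := Fintype.ofFinite Ω
  rw [ex_eq_sum]
  exact div_nonneg (Finset.sum_nonneg fun i _ => h i) (by positivity)

theorem le_ex_of_le {f : Ω → ℝ} {c : ℝ} [Nonempty Ω] (h : ∀ ω, c ≤ f ω) : c ≤ ex f :=
  (ex_const c).symm.le.trans (ex_mono h)

open Classical in
theorem pr_eq_ex (p : Ω → Prop) : pr p = ex (fun ω => if p ω then (1 : ℝ) else 0) := by
  have := Fintype.ofFinite Ω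
  rw [ex_eq_sum, pr, Finset.sum_boole, Nat.card_eq_fintype_card, Fintype.card_subtype]

theorem pr_nonneg (p : Ω → Prop) : 0 ≤ pr p := by
  rw [pr]; positivity

theorem pr_mono {p p' : Ω → Prop} (h : ∀ ω, p ω → p' ω) : pr p ≤ pr p' := by
  classical
  rw [pr_eq_ex, pr_eq_ex]
  refine ex_mono fun ω => ?_
  by_cases h1 : p ω
  · simp [h1, h ω h1]
  · simp only [h1, if_false]; split_ifs <;> norm_num

theorem pr_le_one (p : Ω → Prop) : pr p ≤ 1 := by
  rw [pr]
  refine div_le_one_of_le₀ ?_ (by positivity)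
  exact_mod_cast Nat.card_le_card_of_injective _ Subtype.val_injective

theorem pr_false : pr (fun _ : Ω => False) = 0 := by
  classical
  rw [pr_eq_ex]
  simp only [if_false]
  simpa using ex_mul_left (Ω := Ω) 0 (fun _ => 0)

theorem pr_eq_zero {p : Ω → Prop} (h : ∀ ω, ¬ p ω) : pr p = 0 := by
  rw [show p = fun _ => False from funext fun ω => by simp [h ω]]
  exact pr_false

theorem pr_or_le (p p' : Ω → Prop) : pr (fun ω => p ω ∨ p' ω) ≤ pr p + pr p' := by
  classical
  rw [pr_eq_ex, pr_eq_ex, pr_eq_ex, ← ex_add]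
  refine ex_mono fun ω => ?_
  by_cases h1 : p ω <;> by_cases h2 : p' ω <;> simp [h1, h2]

theorem pr_exists_le {ι : Type*} [Fintype ι] (p : ι → Ω → Prop) :
    pr (fun ω => ∃ i, p i ω) ≤ ∑ i, pr (p i) := by
  classical
  simp only [pr_eq_ex]
  rw [← ex_sum]
  refine ex_mono fun ω => ?_
  by_cases h : ∃ i, p i ω
  · obtain ⟨i, hi⟩ := h
    rw [if_pos ⟨i, hi⟩]
    calc (1 : ℝ) = if p i ω then 1 else 0 := by simp [hi]
      _ ≤ _ := Finset.single_le_sum (f := fun i => if p i ω then (1 : ℝ) else 0)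
        (fun j _ => by positivity) (Finset.mem_univ i)
  · rw [if_neg h]
    exact Finset.sum_nonneg fun j _ => by positivity

theorem pr_not [Nonempty Ω] (p : Ω → Prop) : pr (fun ω => ¬ p ω) = 1 - pr p := by
  classical
  have h1 := ex_const (Ω := Ω) 1
  rw [pr_eq_ex, pr_eq_ex, ← h1, ← ex_sub]
  congr 1; funext ω
  by_cases h : p ω <;> simp [h, h1]

theorem ex_mul_pr_le {f : Ω → ℝ} {c : ℝ} {p : Ω → Prop} (hf : ∀ ω, 0 ≤ f ω)
    (h : ∀ ω, p ω → c ≤ f ω) : c * pr p ≤ ex f := by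
  classical
  rw [pr_eq_ex, ← ex_mul_left]
  refine ex_mono fun ω => ?_
  by_cases hp : p ω
  · simpa [hp] using h ω hp
  · simpa [hp] using hf ω

theorem pr_le_ex_div {f : Ω → ℝ} {c : ℝ} {p : Ω → Prop} (hc : 0 < c) (hf : ∀ ω, 0 ≤ f ω)
    (h : ∀ ω, p ω → c ≤ f ω) : pr p ≤ ex f / c := by
  rw [le_div_iff₀ hc, mul_comm]
  exact ex_mul_pr_le hf h

theorem ex_prod (f : Ω × Ω' → ℝ) : ex f = ex (fun a => ex (fun b => f (a, b))) := by
  have := Fintype.ofFinite Ω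
  have := Fintype.ofFinite Ω'
  simp only [ex_eq_sum, Fintype.sum_prod_type, Nat.card_prod, Nat.cast_mul]
  rw [← Finset.sum_div, div_div, mul_comm]

theorem ex_comm (f : Ω → Ω' → ℝ) :
    ex (fun a => ex (fun b => f a b)) = ex (fun b => ex (fun a => f a b)) := by
  have := Fintype.ofFinite Ω
  have := Fintype.ofFinite Ω'
  simp only [ex_eq_sum, ← Finset.sum_div]
  rw [Finset.sum_comm, div_div, div_div, mul_comm]

theorem ex_equiv (e : Ω ≃ Ω') (f : Ω' → ℝ) : ex (fun a => f (e a)) = ex f := by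
  have := Fintype.ofFinite Ω
  have := Fintype.ofFinite Ω'
  rw [ex_eq_sum, ex_eq_sum, Nat.card_congr e]
  congr 1
  exact Equiv.sum_comp e f

theorem pr_equiv (e : Ω ≃ Ω') (p : Ω' → Prop) : pr (fun a => p (e a)) = pr p := by
  classical
  rw [pr_eq_ex, pr_eq_ex]
  exact ex_equiv e (fun b => if p b then (1 : ℝ) else 0)

theorem pr_prod (p : Ω × Ω' → Prop) : pr p = ex (fun a => pr (fun b => p (a, b))) := by
  classical
  rw [pr_eq_ex, ex_prod]
  congr 1; funext a
  rw [pr_eq_ex]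

/-- If the first coordinate is good outside an event and, for every good first coordinate, the
conditional probability is at most `ε`, then the total probability is at most the sum. -/
theorem pr_prod_le [Nonempty Ω] {p : Ω → Prop} {p' : Ω × Ω' → Prop} {ε : ℝ} (hε : 0 ≤ ε)
    (h : ∀ a, p a → pr (fun b => p' (a, b)) ≤ ε) : pr p' ≤ pr (fun a => ¬ p a) + ε := by
  classical
  rw [pr_prod, pr_eq_ex, ← ex_const (Ω := Ω) ε, ← ex_add]
  refine ex_mono fun a => ?_
  by_cases ha : p a
  · simpa [ha] using h a ha
  · simp only [ha, not_false_iff, if_true]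
    linarith [pr_le_one (fun b => p' (a, b))]

theorem ex_comp_inl {ι κ X : Type*} [Finite ι] [Finite κ] [Finite X] [Nonempty X]
    (f : (ι → X) → ℝ) : ex (fun x : ι ⊕ κ → X => f (fun i => x (Sum.inl i))) = ex f := by
  have h := ex_equiv (Equiv.sumArrowEquivProdArrow ι κ X) (fun y => f y.1)
  rw [ex_prod] at h
  rw [show ex f = ex fun a => ex fun _ : κ → X => f a from by simp only [ex_const]]
  rw [← h]
  rfl

/-- Restricting a uniformly random function along an injection gives a uniformly random
function. -/
theorem pr_comp_injective {ι κ X : Type*} [Finite ι] [Finite κ] [Finite X] [Nonempty X]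
    {e : ι → κ} (he : Function.Injective e) (p : (ι → X) → Prop) :
    pr (fun x : κ → X => p (fun i => x (e i))) = pr p := by
  classical
  let E : ι ⊕ {k // k ∉ Set.range e} ≃ κ :=
    (Equiv.sumCongr (Equiv.ofInjective e he) (Equiv.refl _)).trans (Equiv.Set.sumCompl (Set.range e))
  have h := ex_comp_inl (κ := {k // k ∉ Set.range e}) (X := X)
    (fun y : ι → X => if p y then (1 : ℝ) else 0)
  rw [pr_eq_ex, pr_eq_ex, ← h, ← ex_equiv (Equiv.arrowCongr E.symm (Equiv.refl X))]
  congr 1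

theorem pr_sum_arrow {ι κ X : Type*} [Finite ι] [Finite κ] [Finite X]
    (p : (ι → X) → (κ → X) → Prop) :
    pr (fun x : ι ⊕ κ → X => p (fun i => x (Sum.inl i)) (fun i => x (Sum.inr i))) =
      pr (fun y : (ι → X) × (κ → X) => p y.1 y.2) := by
  rw [← pr_equiv (Equiv.sumArrowEquivProdArrow ι κ X)]
  rfl

theorem ex_sum_arrow {ι κ X : Type*} [Finite ι] [Finite κ] [Finite X]
    (f : (ι → X) → (κ → X) → ℝ) :
    ex (fun x : ι ⊕ κ → X => f (fun i => x (Sum.inl i)) (fun i => x (Sum.inr i))) =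
      ex (fun y : (ι → X) × (κ → X) => f y.1 y.2) := by
  rw [← ex_equiv (Equiv.sumArrowEquivProdArrow ι κ X)]
  rfl

/-- A function on a finite type is bounded below by its contribution along an injection:
transfer of nonnegative averages to a larger type. -/
theorem ex_le_of_injective [Nonempty Ω] {e : Ω → Ω'} (he : Function.Injective e) {f : Ω' → ℝ}
    (hf : ∀ b, 0 ≤ f b) : ex (fun a => f (e a)) ≤ (Nat.card Ω' / Nat.card Ω : ℝ) * ex f := by
  classical
  have := Fintype.ofFinite Ω
  have := Fintype.ofFinite Ω'
  have h1 : (Nat.card Ω : ℝ) ≠ 0 := by exact_mod_cast Nat.card_pos.ne'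
  have : Nonempty Ω' := ⟨e (Classical.arbitrary Ω)⟩
  have h2 : (Nat.card Ω' : ℝ) ≠ 0 := by exact_mod_cast Nat.card_pos.ne'
  rw [ex_eq_sum, ex_eq_sum]
  have h3 : ∑ a, f (e a) ≤ ∑ b, f b := by
    rw [← Finset.sum_image (f := f) (s := Finset.univ) (g := e) (fun a _ b _ h => he h)]
    exact Finset.sum_le_sum_of_subset_of_nonneg (Finset.subset_univ _) fun b _ _ => hf b
  calc (∑ a, f (e a)) / (Nat.card Ω : ℝ) ≤ (∑ b, f b) / (Nat.card Ω : ℝ) := by gcongr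
    _ = _ := by field_simp

theorem pr_le_of_injective [Nonempty Ω] {e : Ω → Ω'} (he : Function.Injective e) (p : Ω' → Prop) :
    pr (fun a => p (e a)) ≤ (Nat.card Ω' / Nat.card Ω : ℝ) * pr p := by
  classical
  rw [pr_eq_ex, pr_eq_ex]
  exact ex_le_of_injective he (f := fun b => if p b then (1 : ℝ) else 0) (fun b => by positivity)

end Averages

section Counting

theorem card_le_mul_of_fibre_le {A B : Type*} [Finite A] [Finite B] (f : A → B) (k : ℕ)
    (h : ∀ b, Nat.card {a // f a = b} ≤ k) : Nat.card A ≤ Nat.card B * k := by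
  have := Fintype.ofFinite B
  rw [← Nat.card_congr (Equiv.sigmaFiberEquiv f), Nat.card_sigma]
  calc ∑ b, Nat.card {a // f a = b} ≤ ∑ _b : B, k := Finset.sum_le_sum fun b _ => h b
    _ = Nat.card B * k := by simp [Nat.card_eq_fintype_card]

theorem card_subtype_eq_sum {A : Type*} [Fintype A] (p : A → Prop) [DecidablePred p] :
    Nat.card {a // p a} = ∑ a, if p a then 1 else 0 := by
  rw [Nat.card_eq_fintype_card, Fintype.card_subtype, Finset.sum_boole, Nat.cast_id]

theorem card_sigma_subtype {A B : Type*} [Fintype A] [Finite B] (p : A → B → Prop) :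
    Nat.card {x : A × B // p x.1 x.2} = ∑ a, Nat.card {b // p a b} := by
  have := Fintype.ofFinite B
  rw [← Nat.card_sigma]
  exact Nat.card_congr
    ⟨fun x => ⟨x.1.1, x.1.2, x.2⟩, fun y => ⟨(y.1, y.2.1), y.2.2⟩, fun _ => rfl, fun _ => rfl⟩

/-- The source of a surjective additive map is the product of the target and the kernel. -/
noncomputable def equivProdKer {A B : Type*} [AddCommGroup A] [AddCommGroup B] (L : A →+ B)
    (hL : Function.Surjective L) : A ≃ B × L.ker where
  toFun a := (L a, ⟨a - Function.surjInv hL (L a), by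
    rw [AddMonoidHom.mem_ker, map_sub, Function.surjInv_eq hL, sub_self]⟩)
  invFun y := Function.surjInv hL y.1 + y.2
  left_inv a := by simp
  right_inv y := by
    have h2 : L y.2 = 0 := y.2.2
    ext <;> simp [Function.surjInv_eq hL, h2]

theorem ex_comp_surjective {A B : Type*} [AddCommGroup A] [AddCommGroup B] [Finite A] [Finite B]
    (L : A →+ B) (hL : Function.Surjective L) (f : B → ℝ) : ex (fun a => f (L a)) = ex f := by
  have h := ex_equiv (equivProdKer L hL) (fun y => f y.1)
  rw [ex_prod] at h
  simp only [ex_const] at h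
  rw [← h]
  rfl

theorem pr_comp_surjective {A B : Type*} [AddCommGroup A] [AddCommGroup B] [Finite A] [Finite B]
    (L : A →+ B) (hL : Function.Surjective L) (p : B → Prop) : pr (fun a => p (L a)) = pr p := by
  classical
  rw [pr_eq_ex, pr_eq_ex]
  exact ex_comp_surjective L hL (fun b => if p b then (1 : ℝ) else 0)

theorem pr_eq_singleton {B : Type*} [Finite B] (b : B) : pr (fun x => x = b) = 1 / Nat.card B := by
  rw [pr]
  congr 1
  simp

theorem card_mul_pr {B : Type*} [Finite B] [Nonempty B] (p : B → Prop) :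
    (Nat.card {b // p b} : ℝ) = Nat.card B * pr p := by
  have : (Nat.card B : ℝ) ≠ 0 := by exact_mod_cast Nat.card_pos.ne'
  rw [pr]
  field_simp

theorem card_fibre_surjective {A B : Type*} [AddCommGroup A] [AddCommGroup B] [Finite A] [Finite B]
    (L : A →+ B) (hL : Function.Surjective L) (b : B) :
    Nat.card {a // L a = b} * Nat.card B = Nat.card A := by
  have h := pr_comp_surjective L hL (fun x => x = b)
  rw [pr_eq_singleton, pr] at h
  have h1 : (Nat.card B : ℝ) ≠ 0 := by exact_mod_cast Nat.card_pos.ne'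
  have h2 : (Nat.card A : ℝ) ≠ 0 := by exact_mod_cast Nat.card_pos.ne'
  field_simp at h
  exact_mod_cast h

end Counting

section LinearTuples

variable {F : Type*} [Field F] [Finite F]

theorem card_vec (ι : Type*) [Finite ι] : Nat.card (ι → F) = Nat.card F ^ Nat.card ι := by
  rw [Nat.card_fun]

theorem one_lt_card_field : 1 < Nat.card F := Finite.one_lt_card

/-- A random tuple extending an independent tuple is rarely dependent. -/
theorem pr_not_linearIndependent_elim {V : Type*} [AddCommGroup V] [Module F V] [Finite V]
    {κ ι : Type*} [Finite κ] [Finite ι] {x : κ → V} (hx : LinearIndependent F x) :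
    pr (fun y : ι → V => ¬ LinearIndependent F (Sum.elim x y)) ≤
      (Nat.card F : ℝ) ^ (Nat.card κ + Nat.card ι) / Nat.card V := by
  classical
  have := Fintype.ofFinite κ
  have := Fintype.ofFinite ι
  have := Fintype.ofFinite F
  have key : ∀ y : ι → V, ¬ LinearIndependent F (Sum.elim x y) →
      ∃ ab : (κ → F) × (ι → F), ab.2 ≠ 0 ∧ ∑ i, ab.2 i • y i = - ∑ k, ab.1 k • x k := by
    intro y hy
    rw [Fintype.linearIndependent_iff] at hy
    push Not at hy
    obtain ⟨g, hg, i, hi⟩ := hy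
    rw [Fintype.sum_sum_type] at hg
    simp only [Sum.elim_inl, Sum.elim_inr] at hg
    refine ⟨(fun k => g (Sum.inl k), fun k => g (Sum.inr k)), ?_, ?_⟩
    · intro h0
      have h1 : ∀ k, g (Sum.inr k) = 0 := fun k => congrFun h0 k
      simp only [h1, zero_smul, Finset.sum_const_zero, add_zero] at hg
      have h2 := Fintype.linearIndependent_iff.1 hx _ hg
      rcases i with i | i
      · exact hi (h2 i)
      · exact hi (h1 i)
    · rw [eq_neg_iff_add_eq_zero, add_comm]; exact hg
  refine (pr_mono key).trans ((pr_exists_le _).trans ?_)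
  have hb : ∀ ab : (κ → F) × (ι → F),
      pr (fun y : ι → V => ab.2 ≠ 0 ∧ ∑ i, ab.2 i • y i = - ∑ k, ab.1 k • x k) ≤
        1 / Nat.card V := by
    intro ab
    by_cases h0 : ab.2 = 0
    · rw [pr_eq_zero (by simp [h0])]; positivity
    · obtain ⟨i, hi⟩ : ∃ i, ab.2 i ≠ 0 := by
        by_contra! h; exact h0 (funext h)
      let L : (ι → V) →+ V :=
        { toFun := fun y => ∑ i, ab.2 i • y i
          map_zero' := by simp
          map_add' := fun y z => by simp [Finset.sum_add_distrib] }
      have hL : Function.Surjective L := by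
        intro v
        refine ⟨Pi.single i ((ab.2 i)⁻¹ • v), ?_⟩
        change ∑ j, ab.2 j • (Pi.single i ((ab.2 i)⁻¹ • v) : ι → V) j = v
        rw [Finset.sum_eq_single i]
        · simp [smul_smul, hi]
        · intro j _ hj; simp [hj]
        · simp
      refine (pr_mono (fun y hy => hy.2)).trans ?_
      rw [← pr_eq_singleton (- ∑ k, ab.1 k • x k), ← pr_comp_surjective L hL]
      exact le_rfl
  refine (Finset.sum_le_sum fun ab _ => hb ab).trans ?_
  rw [Finset.sum_const, Finset.card_univ, nsmul_eq_mul, ← Nat.card_eq_fintype_card,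
    Nat.card_prod, card_vec, card_vec, pow_add]
  push_cast
  rw [mul_one_div]

theorem pr_not_linearIndependent {V : Type*} [AddCommGroup V] [Module F V] [Finite V]
    {ι : Type*} [Finite ι] :
    pr (fun y : ι → V => ¬ LinearIndependent F y) ≤ (Nat.card F : ℝ) ^ Nat.card ι / Nat.card V := by
  have hx : LinearIndependent F (fun i : Empty => (i.elim : V)) := linearIndependent_empty_type
  have h := pr_not_linearIndependent_elim (ι := ι) hx
  rw [show Nat.card Empty = 0 from Finite.card_eq_zero_iff.2 inferInstance, zero_add] at h
  refine (pr_mono fun y hy hy' => hy ?_).trans h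
  exact hy'.comp Sum.inr Sum.inr_injective

end LinearTuples

section SLAction

open Matrix

variable {F : Type*} [Field F] [Finite F] {n : ℕ}

/-- `G` contains the special linear group. -/
def ContainsSL (G : Subgroup (GL (Fin n) F)) : Prop :=
  ∀ A : SpecialLinearGroup (Fin n) F, SpecialLinearGroup.toGL A ∈ G

theorem exists_SL_mulVec_eq {ι : Type*} [Finite ι] (hι : Nat.card ι < n) {x y : ι → Fin n → F}
    (hx : LinearIndependent F x) (hy : LinearIndependent F y) :
    ∃ A : SpecialLinearGroup (Fin n) F, ∀ i, A.1 *ᵥ x i = y i := by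
  classical
  have := Fintype.ofFinite ι
  let b₁ := Module.Basis.sumExtend hx
  let b₂ := Module.Basis.sumExtend hy
  have f1 : Finite (ι ⊕ Module.Basis.sumExtendIndex hx) := Module.Finite.finite_basis b₁
  have f2 : Finite (ι ⊕ Module.Basis.sumExtendIndex hy) := Module.Finite.finite_basis b₂
  have f3 : Finite (Module.Basis.sumExtendIndex hx) :=
    Finite.of_injective (Sum.inr : _ → ι ⊕ _) Sum.inr_injective
  have f4 : Finite (Module.Basis.sumExtendIndex hy) :=
    Finite.of_injective (Sum.inr : _ → ι ⊕ _) Sum.inr_injective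
  have := Fintype.ofFinite (Module.Basis.sumExtendIndex hx)
  have := Fintype.ofFinite (Module.Basis.sumExtendIndex hy)
  have c1 := Module.finrank_eq_nat_card_basis b₁
  have c2 := Module.finrank_eq_nat_card_basis b₂
  rw [Nat.card_sum] at c1 c2
  have c3 : Module.finrank F (Fin n → F) = n := by simp
  rw [c3] at c1 c2
  obtain ⟨e⟩ : Nonempty (Module.Basis.sumExtendIndex hx ≃ Module.Basis.sumExtendIndex hy) :=
    (Finite.card_eq).1 (by omega)
  obtain ⟨k₀⟩ : Nonempty (Module.Basis.sumExtendIndex hy) := (Finite.card_pos_iff).1 (by omega)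
  let E : (Fin n → F) ≃ₗ[F] (Fin n → F) := b₁.equiv b₂ (Equiv.sumCongr (Equiv.refl ι) e)
  let δ : F := LinearMap.det (E : (Fin n → F) →ₗ[F] (Fin n → F))
  have hδ : δ ≠ 0 := (LinearEquiv.isUnit_det' E).ne_zero
  let D : ι ⊕ Module.Basis.sumExtendIndex hy → F := Function.update 1 (Sum.inr k₀) δ⁻¹
  let f : (Fin n → F) →ₗ[F] (Fin n → F) :=
    (Matrix.toLin b₂ b₂ (Matrix.diagonal D)) ∘ₗ (E : (Fin n → F) →ₗ[F] (Fin n → F))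
  have hdet : (LinearMap.toMatrix' f).det = 1 := by
    rw [LinearMap.det_toMatrix', LinearMap.det_comp, LinearMap.det_toLin, Matrix.det_diagonal,
      Finset.prod_update_of_mem (Finset.mem_univ _)]
    simp only [Pi.one_apply, Finset.prod_const_one, mul_one]
    exact inv_mul_cancel₀ hδ
  refine ⟨⟨LinearMap.toMatrix' f, hdet⟩, fun i => ?_⟩
  change LinearMap.toMatrix' f *ᵥ x i = y i
  rw [← Matrix.toLin'_apply, Matrix.toLin'_toMatrix']
  have h1 : x i = b₁ (Sum.inl i) := by
    simp only [b₁, Module.Basis.sumExtend, Module.Basis.reindex_apply,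
      Module.Basis.extend_apply_self]
    rfl
  have h2 : y i = b₂ (Sum.inl i) := by
    simp only [b₂, Module.Basis.sumExtend, Module.Basis.reindex_apply,
      Module.Basis.extend_apply_self]
    rfl
  rw [h1, h2]
  change Matrix.toLin b₂ b₂ (Matrix.diagonal D) (E (b₁ (Sum.inl i))) = _
  have h3 : E (b₁ (Sum.inl i)) = b₂ (Sum.inl i) := by simp [E]
  rw [h3, Matrix.toLin_self, Finset.sum_eq_single (Sum.inl i)]
  · simp [D]
  · intro j _ hj; rw [Matrix.diagonal_apply_ne _ hj, zero_smul]
  · simp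

variable {G : Subgroup (GL (Fin n) F)}

/-- The set of elements of `G` with prescribed values on an independent family is large. -/
theorem card_le_card_mulVec_eq (hG : ContainsSL G) {ι : Type*} [Finite ι] (hι : Nat.card ι < n)
    {x y : ι → Fin n → F} (hx : LinearIndependent F x) (hy : LinearIndependent F y) :
    Nat.card G ≤ Nat.card F ^ (n * Nat.card ι) *
      Nat.card {g : G // ∀ i, g.1.1 *ᵥ x i = y i} := by
  obtain ⟨A, hA⟩ := exists_SL_mulVec_eq hι hx hy
  let g₀ : G := ⟨SpecialLinearGroup.toGL A, hG A⟩
  have hg₀ : ∀ i, g₀.1.1 *ᵥ x i = y i := hA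
  have h := card_le_mul_of_fibre_le (fun (g : G) (i : ι) => g.1.1 *ᵥ x i)
    (Nat.card {g : G // ∀ i, g.1.1 *ᵥ x i = y i}) (by
      intro z
      rcases isEmpty_or_nonempty {g : G // (fun i => g.1.1 *ᵥ x i) = z} with he | ⟨⟨g₁, h₁⟩⟩
      · simp
      · refine Nat.card_le_card_of_injective
          (fun g => (⟨g₀ * g₁⁻¹ * g.1, fun i => ?_⟩ : {g : G // ∀ i, g.1.1 *ᵥ x i = y i})) ?_
        · have e1 : g.1.1.1 *ᵥ x i = g₁.1.1 *ᵥ x i := by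
            rw [congrFun g.2 i, congrFun h₁ i]
          change (g₀.1.1 * (g₁.1⁻¹).1 * g.1.1.1) *ᵥ x i = y i
          rw [← Matrix.mulVec_mulVec, e1, Matrix.mulVec_mulVec, Matrix.mul_assoc]
          have : (g₁.1⁻¹).1 * g₁.1.1 = 1 := by
            rw [← Units.val_mul, inv_mul_cancel, Units.val_one]
          rw [this, Matrix.mul_one, hg₀]
        · intro g g' h
          exact Subtype.ext (mul_left_cancel (Subtype.ext_iff.1 h)))
  have e : Nat.card (ι → Fin n → F) = Nat.card F ^ (n * Nat.card ι) := by
    rw [Nat.card_fun, card_vec, Nat.card_fin, pow_mul]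
  rwa [e] at h

theorem card_matrix (m k : ℕ) : Nat.card (Matrix (Fin m) (Fin k) F) = Nat.card F ^ (m * k) := by
  rw [show Nat.card (Matrix (Fin m) (Fin k) F) = Nat.card (Fin m → Fin k → F) from rfl,
    Nat.card_fun, card_vec, Nat.card_fin, Nat.card_fin, ← pow_mul, mul_comm]

theorem card_GL_le (hG : ContainsSL G) : Nat.card (GL (Fin n) F) ≤ Nat.card F * Nat.card G := by
  refine card_le_mul_of_fibre_le (fun g : GL (Fin n) F => g.1.det) _ ?_
  intro δ
  rcases isEmpty_or_nonempty {g : GL (Fin n) F // g.1.det = δ} with he | ⟨⟨g₁, h₁⟩⟩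
  · rw [Nat.card_of_isEmpty]; exact Nat.zero_le _
  · refine Nat.card_le_card_of_injective
      (fun g => (⟨g₁⁻¹ * g.1, ?_⟩ : G)) ?_
    · have hd : (g₁⁻¹ * g.1).1.det = 1 := by
        rw [Units.val_mul, Matrix.det_mul, g.2, ← h₁, ← Matrix.det_mul, ← Units.val_mul]
        simp
      have := hG ⟨(g₁⁻¹ * g.1).1, hd⟩
      convert this
      ext i j
      rfl
    · intro g g' h
      exact Subtype.ext (mul_left_cancel (Subtype.ext_iff.1 h))

theorem card_matrix_le_card_GL (hn : 0 < n) :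
    (Nat.card (Matrix (Fin n) (Fin n) F) : ℝ) ≤ 4 * Nat.card (GL (Fin n) F) := by
  have := Fintype.ofFinite F
  set q := Nat.card F with hq
  have hq2 : 2 ≤ q := one_lt_card_field
  obtain ⟨m, rfl⟩ : ∃ m, n = m + 1 := ⟨n - 1, by omega⟩
  rw [Matrix.card_GL_field, ← Nat.card_eq_fintype_card, ← hq, card_matrix, ← hq]
  have hcast : ∀ i : Fin (m + 1), ((q ^ (m + 1) - q ^ (i : ℕ) : ℕ) : ℝ) =
      (q : ℝ) ^ (m + 1) - (q : ℝ) ^ (i : ℕ) := by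
    intro i
    rw [Nat.cast_sub (Nat.pow_le_pow_right (by omega) (by omega))]
    push_cast; rfl
  rw [Nat.cast_prod, Finset.prod_congr rfl fun i _ => hcast i, Fin.prod_univ_castSucc]
  simp only [Fin.val_castSucc, Fin.val_last]
  have hqr : (2 : ℝ) ≤ q := by exact_mod_cast hq2
  have key : ∀ k ≤ m, (q : ℝ) ^ ((m + 1) * k) * (1 - (q : ℝ) ^ k / (q : ℝ) ^ (m + 1)) ≤
      ∏ i : Fin k, ((q : ℝ) ^ (m + 1) - (q : ℝ) ^ (i : ℕ)) := by
    intro k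
    induction k with
    | zero => intro _; simp
    | succ k ih =>
      intro hk
      rw [Fin.prod_univ_castSucc]
      simp only [Fin.val_castSucc, Fin.val_last]
      have h1 := ih (by omega)
      have h2 : (q : ℝ) ^ k ≤ (q : ℝ) ^ (m + 1) := pow_le_pow_right₀ (by linarith) (by omega)
      refine le_trans ?_ (mul_le_mul_of_nonneg_right h1 (by linarith))
      have hp : (0 : ℝ) < (q : ℝ) ^ (m + 1) := by positivity
      set Q := (q : ℝ) ^ (m + 1)
      have hqk : (0 : ℝ) < (q : ℝ) ^ k := by positivity
      have e1 : (q : ℝ) ^ ((m + 1) * (k + 1)) = (q : ℝ) ^ ((m + 1) * k) * Q := by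
        rw [mul_add, pow_add, mul_one]
      rw [e1, mul_assoc, mul_assoc]
      refine mul_le_mul_of_nonneg_left ?_ (by positivity)
      have e2 : Q * (1 - (q : ℝ) ^ (k + 1) / Q) = Q - q * (q : ℝ) ^ k := by
        field_simp; ring
      have e3 : (1 - (q : ℝ) ^ k / Q) * (Q - (q : ℝ) ^ k) =
        Q - 2 * (q : ℝ) ^ k + ((q : ℝ) ^ k) ^ 2 / Q := by field_simp; ring
      rw [e2, e3]
      have : 0 ≤ ((q : ℝ) ^ k) ^ 2 / Q := by positivity
      nlinarith
  have h := key m le_rfl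
  have e2 : (q : ℝ) ^ m / (q : ℝ) ^ (m + 1) ≤ 1 / 2 := by
    rw [pow_succ, div_le_div_iff₀ (by positivity) (by norm_num)]
    have : (0 : ℝ) < (q : ℝ) ^ m := by positivity
    nlinarith
  have e3 : (q : ℝ) ^ (m + 1) / 2 ≤ (q : ℝ) ^ (m + 1) - (q : ℝ) ^ m := by
    have : (0 : ℝ) < (q : ℝ) ^ m := by positivity
    rw [pow_succ]
    nlinarith
  have e4 : (q : ℝ) ^ ((m + 1) * m) * (1 / 2) ≤
      ∏ i : Fin m, ((q : ℝ) ^ (m + 1) - (q : ℝ) ^ (i : ℕ)) :=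
    le_trans (mul_le_mul_of_nonneg_left (by linarith) (by positivity)) h
  have e5 := mul_le_mul e4 e3 (by positivity) (le_trans (by positivity) e4)
  calc (((q ^ ((m + 1) * (m + 1)) : ℕ)) : ℝ)
      = 4 * ((q : ℝ) ^ ((m + 1) * m) * (1 / 2) * ((q : ℝ) ^ (m + 1) / 2)) := by
        push_cast
        rw [mul_add, pow_add, mul_one]; ring
    _ ≤ _ := by gcongr

/-- The full matrix algebra is at most `4 * q` times larger than `G`. -/
theorem card_matrix_div_le (hn : 0 < n) (hG : ContainsSL G) :
    (Nat.card (Matrix (Fin n) (Fin n) F) : ℝ) / Nat.card G ≤ 4 * Nat.card F := by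
  have h0 : (0 : ℝ) < Nat.card G := by exact_mod_cast Nat.card_pos
  rw [div_le_iff₀ h0]
  have h1 : (Nat.card (GL (Fin n) F) : ℝ) ≤ Nat.card F * Nat.card G := by
    exact_mod_cast card_GL_le hG
  linarith [card_matrix_le_card_GL (F := F) hn]

end SLAction

section Paths

open Matrix

variable {F : Type*} [Field F] [Finite F] {n : ℕ} {G : Subgroup (GL (Fin n) F)}
variable {ι : Type*} [Finite ι]

/-- The group element attached to a signed letter. -/
def signedLetter {M : Type*} [Group M] (τ : ι → M) (b : ι × Bool) : M :=
  if b.2 then τ b.1 else (τ b.1)⁻¹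

/-- The product of the first `k` steps of a sequence of signed letters, later steps on the left. -/
def pathProd {M : Type*} [Group M] (τ : ι → M) (s : ℕ → ι × Bool) : ℕ → M
  | 0 => 1
  | k + 1 => signedLetter τ (s k) * pathProd τ s k

/-- Two consecutive signed letters do not cancel. -/
def NoCancel (a b : ι × Bool) : Prop := ¬ (a.1 = b.1 ∧ a.2 ≠ b.2)

/-- Index shift identifying roots and later nodes. -/
def nodeEquiv (κ : Type*) (L : ℕ) : κ × Fin (L + 1) ≃ κ ⊕ κ × Fin L where
  toFun p := Fin.cases (Sum.inl p.1) (fun i => Sum.inr (p.1, i)) p.2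
  invFun := Sum.elim (fun c => (c, 0)) (fun p => (p.1, p.2.succ))
  left_inv p := by
    obtain ⟨c, i⟩ := p
    refine Fin.cases ?_ (fun j => ?_) i <;> simp
  right_inv p := by
    rcases p with c | ⟨c, i⟩ <;> simp

theorem signedLetter_mulVec_iff (τ : ι → G) (b : ι × Bool) (v w : Fin n → F) :
    (signedLetter τ b).1.1 *ᵥ v = w ↔
      (τ b.1).1.1 *ᵥ (if b.2 then v else w) = (if b.2 then w else v) := by
  obtain ⟨b, e⟩ := b
  cases e
  · simp only [signedLetter, Bool.false_eq_true, if_false]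
    change ((τ b).1⁻¹).1 *ᵥ v = w ↔ _
    constructor
    · rintro rfl
      rw [Matrix.mulVec_mulVec, ← Units.val_mul, mul_inv_cancel, Units.val_one, Matrix.one_mulVec]
    · rintro rfl
      rw [Matrix.mulVec_mulVec, ← Units.val_mul, inv_mul_cancel, Units.val_one, Matrix.one_mulVec]
  · simp [signedLetter]

theorem pr_path_dependent (hG : ContainsSL G) {κ : Type*} [Finite κ] {x : κ → Fin n → F}
    (hx : LinearIndependent F x) (s : ℕ → ι × Bool) (L : ℕ)
    (hs : ∀ i, i + 1 < L → NoCancel (s i) (s (i + 1))) :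
    pr (fun τ : ι → G => ¬ LinearIndependent F
      (fun p : κ × Fin (L + 1) => (pathProd τ s p.2).1.1 *ᵥ x p.1)) ≤
      (Nat.card F : ℝ) ^ (Nat.card κ * (L + 1)) / (Nat.card F : ℝ) ^ n := by
  classical
  have := Fintype.ofFinite ι
  have := Fintype.ofFinite κ
  have hq1 : (1 : ℝ) ≤ Nat.card F := by exact_mod_cast (one_lt_card_field (F := F)).le
  by_cases hκ : n ≤ Nat.card κ * L
  · refine (pr_le_one _).trans ?_
    rw [one_le_div (by positivity)]
    exact pow_le_pow_right₀ hq1 (hκ.trans (Nat.mul_le_mul_left _ (by omega)))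
  push Not at hκ
  -- compare with a uniformly random assignment of the nodes
  have hD := pr_not_linearIndependent_elim (ι := κ × Fin L) hx
  have hcard : Nat.card (Fin n → F) = Nat.card F ^ n := by rw [card_vec, Nat.card_fin]
  rw [hcard, Nat.card_prod, Nat.card_fin, Nat.cast_pow,
    show Nat.card κ + Nat.card κ * L = Nat.card κ * (L + 1) by ring] at hD
  refine le_trans ?_ hD
  have e1 := pr_not (fun τ : ι → G => LinearIndependent F
      (fun p : κ × Fin (L + 1) => (pathProd τ s p.2).1.1 *ᵥ x p.1))
  have e2 := pr_not (fun y : κ × Fin L → Fin n → F => LinearIndependent F (Sum.elim x y))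
  rw [e1, e2]
  refine sub_le_sub_left ?_ 1
  let full : (κ × Fin L → Fin n → F) → κ × Fin (L + 1) → Fin n → F :=
    fun y p => Sum.elim x y (nodeEquiv κ L p)
  have full_zero : ∀ y c, full y (c, 0) = x c := fun y c => rfl
  have full_li : ∀ y, LinearIndependent F (Sum.elim x y) → LinearIndependent F (full y) :=
    fun y hy => hy.comp _ (nodeEquiv κ L).injective
  let src : Fin L → Fin (L + 1) := fun i => if (s i).2 then i.castSucc else i.succ
  let tgt : Fin L → Fin (L + 1) := fun i => if (s i).2 then i.succ else i.castSucc
  let Fits : (κ × Fin L → Fin n → F) → ι → G → Prop := fun y b g =>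
    ∀ e : κ × {i : Fin L // (s i).1 = b},
      g.1.1 *ᵥ full y (e.1, src e.2.1) = full y (e.1, tgt e.2.1)
  have fits_nodes : ∀ y (τ : ι → G), (∀ b, Fits y b (τ b)) →
      ∀ c (i : ℕ) (hi : i < L + 1), (pathProd τ s i).1.1 *ᵥ x c = full y (c, ⟨i, hi⟩) := by
    intro y τ h c i
    induction i with
    | zero => intro hi; simp only [pathProd]; simp; rfl
    | succ i ih =>
      intro hi
      have hi' : i < L := by omega
      have h1 := ih (by omega)
      change ((signedLetter τ (s i)).1.1 * (pathProd τ s i).1.1) *ᵥ x c = _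
      rw [← Matrix.mulVec_mulVec, h1, signedLetter_mulVec_iff]
      have h2 := h (s i).1 (c, ⟨⟨i, hi'⟩, rfl⟩)
      have hc : (⟨i, hi'⟩ : Fin L).castSucc = ⟨i, by omega⟩ := rfl
      have hsc : (⟨i, hi'⟩ : Fin L).succ = ⟨i + 1, by omega⟩ := rfl
      simp only [src, tgt, hc, hsc] at h2
      by_cases hb : (s i).2
      · simpa [hb] using h2
      · simpa [hb] using h2
  -- the number of letters fitting an independent assignment
  have count : ∀ y, LinearIndependent F (Sum.elim x y) →
      Nat.card (ι → G) ≤ Nat.card F ^ (n * (Nat.card κ * L)) *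
        Nat.card {τ : ι → G // ∀ b, Fits y b (τ b)} := by
    intro y hy
    have hy' := full_li y hy
    have inj_aux : ∀ b (f : Fin L → Fin (L + 1)), (f = src ∨ f = tgt) →
        Function.Injective (fun e : κ × {i : Fin L // (s i).1 = b} => (e.1, f e.2.1)) := by
      rintro b f hf ⟨c, i, hi⟩ ⟨c', j, hj⟩ h
      simp only [Prod.mk.injEq] at h
      obtain ⟨rfl, h⟩ := h
      suffices i = j by subst this; rfl
      by_contra hij
      have hij' : i.1 ≠ j.1 := fun h => hij (Fin.ext h)
      have h3 : (f i).1 = (f j).1 := by rw [h]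
      have n1 := fun h' : i.1 + 1 = j.1 => hs i.1 (by omega)
      have n2 := fun h' : j.1 + 1 = i.1 => hs j.1 (by omega)
      rcases hf with rfl | rfl
      all_goals
        simp only [src, tgt] at h3
        by_cases b1 : (s i).2 <;> by_cases b2 : (s j).2 <;> simp [b1, b2] at h3
        · omega
        · first
            | exact n1 (by omega) ⟨by rw [show i.1 + 1 = j.1 by omega, hi, hj], by
                rw [show i.1 + 1 = j.1 by omega, b1]; simpa using b2⟩
            | exact n2 (by omega) ⟨by rw [show j.1 + 1 = i.1 by omega, hi, hj], by
                rw [show j.1 + 1 = i.1 by omega, b1]; simpa using b2⟩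
        · first
            | exact n1 (by omega) ⟨by rw [show i.1 + 1 = j.1 by omega, hi, hj], by
                rw [show i.1 + 1 = j.1 by omega, b2]; simpa using b1⟩
            | exact n2 (by omega) ⟨by rw [show j.1 + 1 = i.1 by omega, hi, hj], by
                rw [show j.1 + 1 = i.1 by omega, b2]; simpa using b1⟩
        · omega
    have hfin : ∀ b, Nat.card {i : Fin L // (s i).1 = b} ≤ L := fun b => by
      simpa using Nat.card_le_card_of_injective (Subtype.val : {i : Fin L // (s i).1 = b} → Fin L)
        Subtype.val_injective
    have hb : ∀ b, Nat.card G ≤ Nat.card F ^ (n * (Nat.card κ * Nat.card {i : Fin L // (s i).1 = b})) *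
        Nat.card {g : G // Fits y b g} := by
      intro b
      have := card_le_card_mulVec_eq hG (ι := κ × {i : Fin L // (s i).1 = b})
        (by rw [Nat.card_prod]; exact (Nat.mul_le_mul_left _ (hfin b)).trans_lt hκ)
        (hy'.comp _ (inj_aux b src (Or.inl rfl))) (hy'.comp _ (inj_aux b tgt (Or.inr rfl)))
      rwa [Nat.card_prod] at this
    have hsum : ∑ b, Nat.card {i : Fin L // (s i).1 = b} = L := by
      rw [← Nat.card_sigma, Nat.card_congr (Equiv.sigmaFiberEquiv fun i : Fin L => (s i).1),
        Nat.card_fin]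
    calc Nat.card (ι → G) = ∏ _b : ι, Nat.card G := by simp [Nat.card_fun]
      _ ≤ ∏ b, (Nat.card F ^ (n * (Nat.card κ * Nat.card {i : Fin L // (s i).1 = b})) *
        Nat.card {g : G // Fits y b g}) := Finset.prod_le_prod' fun b _ => hb b
      _ = _ := by
        rw [Finset.prod_mul_distrib, Finset.prod_pow_eq_pow_sum, ← Finset.mul_sum,
          ← Finset.mul_sum, hsum, Nat.card_congr (Equiv.subtypePiEquivPi (p := fun b => Fits y b)),
          Nat.card_pi]
  have := Fintype.ofFinite {y : κ × Fin L → Fin n → F // LinearIndependent F (Sum.elim x y)}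
  have hinj : ∑ y : {y : κ × Fin L → Fin n → F // LinearIndependent F (Sum.elim x y)},
      Nat.card {τ : ι → G // ∀ b, Fits y.1 b (τ b)} ≤
      Nat.card {τ : ι → G // LinearIndependent F
        (fun p : κ × Fin (L + 1) => (pathProd τ s p.2).1.1 *ᵥ x p.1)} := by
    rw [← Nat.card_sigma]
    refine Nat.card_le_card_of_injective (fun z => ⟨z.2.1, ?_⟩) ?_
    · have h := full_li z.1.1 z.1.2
      convert h using 1
      funext p
      exact fits_nodes z.1.1 z.2.1 z.2.2 p.1 p.2.1 p.2.2
    · rintro ⟨⟨y, hy⟩, τ, hτ⟩ ⟨⟨y', hy'⟩, τ', hτ'⟩ h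
      simp only [Subtype.mk.injEq] at h
      subst h
      have : y = y' := by
        funext p
        have h1 := fits_nodes y τ hτ p.1 (p.2.1 + 1) (by omega)
        have h2 := fits_nodes y' τ hτ' p.1 (p.2.1 + 1) (by omega)
        exact h1.symm.trans h2
      subst this
      rfl
  rw [pr, pr]
  have hcY : Nat.card (κ × Fin L → Fin n → F) = Nat.card F ^ (n * (Nat.card κ * L)) := by
    rw [Nat.card_fun, hcard, Nat.card_prod, Nat.card_fin, ← pow_mul]
  have hpos : (0 : ℝ) < Nat.card (ι → G) := by exact_mod_cast Nat.card_pos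
  rw [hcY, div_le_div_iff₀ (by exact_mod_cast pow_pos Nat.card_pos _) hpos]
  have : Nat.card {y : κ × Fin L → Fin n → F // LinearIndependent F (Sum.elim x y)} *
      Nat.card (ι → G) ≤ Nat.card {τ : ι → G // LinearIndependent F
        (fun p : κ × Fin (L + 1) => (pathProd τ s p.2).1.1 *ᵥ x p.1)} *
        Nat.card F ^ (n * (Nat.card κ * L)) := by
    refine le_trans ?_ (Nat.mul_le_mul_right _ hinj)
    rw [Finset.sum_mul, Nat.card_eq_fintype_card, ← smul_eq_mul, ← Finset.card_univ,
      ← Finset.sum_const]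
    refine Finset.sum_le_sum fun y _ => ?_
    rw [mul_comm (Nat.card _)]
    exact count y.1 y.2
  exact_mod_cast this

end Paths

section Words

open Matrix Polynomial

variable {F : Type*} [Field F] [Finite F] {n : ℕ} {G : Subgroup (GL (Fin n) F)}
variable {ι : Type*} [Finite ι]

/-- The value of a positive word. -/
def wordProd {M : Type*} [Group M] (τ : ι → M) (u : List ι) : M := (u.map τ).prod

/-- The signed letters along the path spelled by `u⁻¹ v`, read from the right. -/
def quotientPath (u v : List ι) : List (ι × Bool) :=
  v.reverse.map (fun a => (a, true)) ++ u.map (fun a => (a, false))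

theorem length_quotientPath (u v : List ι) : (quotientPath u v).length = v.length + u.length := by
  simp [quotientPath]

theorem signedLetter_prod_quotientPath {M : Type*} [Group M] (τ : ι → M) (u v : List ι) :
    ((quotientPath u v).map (signedLetter τ)).reverse.prod =
      (wordProd τ u)⁻¹ * wordProd τ v := by
  simp only [quotientPath, List.map_append, List.map_map, List.reverse_append, List.prod_append,
    wordProd, List.map_reverse, List.reverse_reverse, List.prod_inv_reverse]
  rfl

theorem isChain_quotientPath {u v : List ι} (h : u.head? ≠ v.head?) :
    (quotientPath u v).IsChain NoCancel := by
  rw [quotientPath, List.isChain_append]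
  refine ⟨?_, ?_, ?_⟩
  · rw [List.isChain_map, List.isChain_iff_getElem]
    intro i hi; simp [NoCancel]
  · rw [List.isChain_map, List.isChain_iff_getElem]
    intro i hi; simp [NoCancel]
  · intro a ha b hb
    simp only [List.getLast?_map, List.head?_map, Option.mem_def, Option.map_eq_some_iff,
      List.getLast?_reverse] at ha hb
    obtain ⟨a, ha, rfl⟩ := ha
    obtain ⟨b, hb, rfl⟩ := hb
    rintro ⟨h1, -⟩
    simp only at h1
    rw [ha, hb, h1] at h
    exact h rfl

theorem noCancel_quotientPath_ends {u v : List ι} (h : u.getLast? ≠ v.getLast?) (hu : u ≠ [])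
    (hv : v ≠ []) :
    ∀ a ∈ (quotientPath u v).getLast?, ∀ b ∈ (quotientPath u v).head?, NoCancel a b := by
  intro a ha b hb
  rw [quotientPath, List.getLast?_append_of_ne_nil _ (by simpa using hu)] at ha
  rw [quotientPath, List.head?_append_of_ne_nil _ (by simpa using hv)] at hb
  simp only [List.getLast?_map, List.head?_map, Option.mem_def, Option.map_eq_some_iff,
    List.head?_reverse] at ha hb
  obtain ⟨a, ha, rfl⟩ := ha
  obtain ⟨b, hb, rfl⟩ := hb
  rintro ⟨h1, -⟩
  simp only at h1
  rw [ha, hb, h1] at h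
  exact h rfl

/-- Two distinct lists of equal length, after removing a common initial segment. -/
theorem exists_strip_common_head : ∀ {u v : List ι}, u.length = v.length → u ≠ v →
    ∃ p u' v' : List ι, u = p ++ u' ∧ v = p ++ v' ∧ u'.length = v'.length ∧
      u'.head? ≠ v'.head?
  | [], [], _, h => absurd rfl h
  | [], _ :: _, h, _ => by simp at h
  | _ :: _, [], h, _ => by simp at h
  | a :: u, b :: v, h, hne => by
    by_cases hab : a = b
    · subst hab
      obtain ⟨p, u', v', h1, h2, h3, h4⟩ := exists_strip_common_head (u := u) (v := v)
        (by simpa using h) (fun h' => hne (by rw [h']))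
      exact ⟨a :: p, u', v', by simp [h1], by simp [h2], h3, h4⟩
    · exact ⟨[], a :: u, b :: v, rfl, rfl, h, by simpa using hab⟩

theorem ne_nil_of_head?_ne {u v : List ι} (h : u.length = v.length) (hhead : u.head? ≠ v.head?) :
    u ≠ [] ∧ v ≠ [] := by
  constructor
  · rintro rfl
    rw [List.eq_nil_of_length_eq_zero (l := v) (by simpa using h.symm)] at hhead
    exact hhead rfl
  · rintro rfl
    rw [List.eq_nil_of_length_eq_zero (l := u) (by simpa using h)] at hhead
    exact hhead rfl

/-- Two distinct lists of equal length, after removing common initial and final segments. -/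
theorem exists_strip_both {u v : List ι} (h : u.length = v.length) (hne : u ≠ v) :
    ∃ p t u' v' : List ι, u = p ++ u' ++ t ∧ v = p ++ v' ++ t ∧ u'.length = v'.length ∧
      u'.head? ≠ v'.head? ∧ u'.getLast? ≠ v'.getLast? := by
  obtain ⟨t, u₁, v₁, h1, h2, h3, h4⟩ := exists_strip_common_head (u := u.reverse) (v := v.reverse)
    (by simpa using h) (fun h' => hne (List.reverse_injective h'))
  have hne1 : u₁.reverse ≠ v₁.reverse := by
    intro h'; exact h4 (by rw [List.reverse_injective h'])
  obtain ⟨p, u₂, v₂, h5, h6, h7, h8⟩ := exists_strip_common_head (by simpa using h3) hne1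
  obtain ⟨n1, n2⟩ := ne_nil_of_head?_ne h7 h8
  refine ⟨p, t.reverse, u₂, v₂, ?_, ?_, h7, h8, ?_⟩
  · rw [← h5, ← List.reverse_append, ← h1, List.reverse_reverse]
  · rw [← h6, ← List.reverse_append, ← h2, List.reverse_reverse]
  · intro h9
    apply h4
    rw [← List.getLast?_reverse, ← List.getLast?_reverse, h5, h6,
      List.getLast?_append_of_ne_nil _ n1, List.getLast?_append_of_ne_nil _ n2, h9]

/-- The periodic sequence repeating a nonempty list. -/
def cyclicSeq {α : Type*} (l : List α) (hl : 0 < l.length) (i : ℕ) : α :=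
  l[i % l.length]'(Nat.mod_lt _ hl)

theorem pathProd_succ_front {M : Type*} [Group M] (τ : ι → M) (s : ℕ → ι × Bool) (k : ℕ) :
    pathProd τ s (k + 1) = pathProd τ (fun i => s (i + 1)) k * signedLetter τ (s 0) := by
  induction k with
  | zero => simp [pathProd]
  | succ k ih =>
    rw [pathProd, ih, pathProd, mul_assoc]

theorem pathProd_add {M : Type*} [Group M] (τ : ι → M) (s : ℕ → ι × Bool) (a b : ℕ) :
    pathProd τ s (a + b) = pathProd τ (fun i => s (a + i)) b * pathProd τ s a := by
  induction b with
  | zero => simp [pathProd]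
  | succ k ih =>
    rw [← add_assoc, pathProd, ih, pathProd, mul_assoc]

theorem pathProd_congr {M : Type*} [Group M] (τ : ι → M) {s s' : ℕ → ι × Bool} (k : ℕ)
    (h : ∀ i < k, s i = s' i) : pathProd τ s k = pathProd τ s' k := by
  induction k with
  | zero => rfl
  | succ k ih => rw [pathProd, pathProd, ih fun i hi => h i (by omega), h k (by omega)]

theorem pathProd_list {M : Type*} [Group M] (τ : ι → M) : ∀ (l : List (ι × Bool))
    (s : ℕ → ι × Bool), (∀ (i : ℕ) (hi : i < l.length), s i = l[i]) →
      pathProd τ s l.length = (l.map (signedLetter τ)).reverse.prod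
  | [], _, _ => rfl
  | b :: l, s, h => by
    rw [List.length_cons, pathProd_succ_front, pathProd_list τ l (fun i => s (i + 1))
      (fun i hi => by have := h (i + 1) (by simpa using hi); simpa using this)]
    have h0 := h 0 (by simp)
    simp only [List.getElem_cons_zero] at h0
    simp [h0]

theorem pathProd_cyclicSeq {M : Type*} [Group M] (τ : ι → M) (l : List (ι × Bool))
    (hl : 0 < l.length) (m : ℕ) :
    pathProd τ (cyclicSeq l hl) (l.length * m) = ((l.map (signedLetter τ)).reverse.prod) ^ m := by
  have h1 := pathProd_list τ l (cyclicSeq l hl) (fun i hi => by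
    simp [cyclicSeq, Nat.mod_eq_of_lt hi])
  induction m with
  | zero => simp [pathProd]
  | succ m ih =>
    rw [mul_add, mul_one, add_comm, pathProd_add, h1, pathProd_congr (s' := cyclicSeq l hl), ih,
      pow_succ]
    intro i _
    simp [cyclicSeq]

theorem noCancel_cyclicSeq {l : List (ι × Bool)} (hl : 0 < l.length) (hc : l.IsChain NoCancel)
    (i : ℕ) (hi : i + 1 < l.length ∨ ∀ a ∈ l.getLast?, ∀ b ∈ l.head?, NoCancel a b) :
    NoCancel (cyclicSeq l hl i) (cyclicSeq l hl (i + 1)) := by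
  rw [List.isChain_iff_getElem] at hc
  by_cases h : i % l.length + 1 < l.length
  · have := hc (i % l.length) h
    have e : (i + 1) % l.length = i % l.length + 1 := by
      rw [Nat.add_mod, Nat.mod_eq_of_lt (a := 1) (by omega), Nat.mod_eq_of_lt h]
    simpa [cyclicSeq, e] using this
  · have hlt := Nat.mod_lt i hl
    have e0 : i % l.length = l.length - 1 := by omega
    rcases hi with hi | hi
    · rw [Nat.mod_eq_of_lt (by omega)] at e0; omega
    · have e : (i + 1) % l.length = 0 := by
        rw [Nat.add_mod, e0]
        rcases Nat.lt_or_ge 1 l.length with h1 | h1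
        · rw [Nat.mod_eq_of_lt h1, Nat.sub_add_cancel hl, Nat.mod_self]
        · have : l.length = 1 := by omega
          rw [this]
      refine hi _ ?_ _ ?_
      · simp only [cyclicSeq, e0, Option.mem_def]
        rw [List.getLast?_eq_getElem?, List.getElem?_eq_getElem]
      · simp only [cyclicSeq, e, Option.mem_def]
        rw [List.head?_eq_getElem?, List.getElem?_eq_getElem]

theorem linearIndependent_mulVec_iff {κ : Type*} (g : GL (Fin n) F) (x : κ → Fin n → F) :
    LinearIndependent F (fun c => g.1 *ᵥ x c) ↔ LinearIndependent F x := by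
  have hinj : Function.Injective (Matrix.mulVecLin g.1) := by
    rw [Matrix.coe_mulVecLin]
    exact Matrix.mulVec_injective_of_isUnit g.isUnit
  exact (Matrix.mulVecLin g.1).linearIndependent_iff_of_injOn (v := x) hinj.injOn

theorem wordProd_append {M : Type*} [Group M] (τ : ι → M) (u v : List ι) :
    wordProd τ (u ++ v) = wordProd τ u * wordProd τ v := by
  simp [wordProd]

theorem mulVec_inv_mulVec (g h : G) (v : Fin n → F) :
    (g.1⁻¹).1 *ᵥ (h.1.1 *ᵥ v) = (g⁻¹ * h).1.1 *ᵥ v := by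
  rw [Matrix.mulVec_mulVec]; rfl

theorem pr_cyclic_endpoint_dependent (hG : ContainsSL G) {κ : Type*} [Finite κ]
    {x : κ → Fin n → F} (hx : LinearIndependent F x) (l : List (ι × Bool)) {N : ℕ}
    (hN : l.length = N) (hl : 0 < N) (hc : l.IsChain NoCancel) :
    pr (fun τ : ι → G => ¬ LinearIndependent F
      (Sum.elim x (fun c => ((l.map (signedLetter τ)).reverse.prod).1.1 *ᵥ x c) :
        κ ⊕ κ → Fin n → F)) ≤
      (Nat.card F : ℝ) ^ (Nat.card κ * (N + 1)) / (Nat.card F : ℝ) ^ n := by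
  have hl' : 0 < l.length := hN ▸ hl
  have hP := pr_path_dependent hG hx (cyclicSeq l hl') N
    (fun i hi => noCancel_cyclicSeq hl' hc i (Or.inl (hN ▸ hi)))
  refine hP.trans' ?_
  refine pr_mono fun τ hτ hn => hτ ?_
  let f : κ ⊕ κ → κ × Fin (N + 1) := Sum.elim (fun c => (c, 0)) (fun c => (c, Fin.last N))
  have hf : Function.Injective f := by
    rintro (a | a) (b | b) h
    · simpa [f] using h
    · simp [f, Fin.ext_iff] at h; omega
    · simp [f, Fin.ext_iff] at h; omega
    · simpa [f] using h
  have h1 := hn.comp f hf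
  have hw := pathProd_cyclicSeq τ l hl' 1
  rw [mul_one, pow_one, hN] at hw
  convert h1 using 1
  funext z
  rcases z with c | c
  · simp [f, pathProd]
  · simp [f, hw]

theorem pr_cyclic_krylov_dependent (hG : ContainsSL G) {x : Fin n → F} (hx : x ≠ 0)
    (l : List (ι × Bool)) {N : ℕ} (hN : l.length = N) (hl : 0 < N) (hc : l.IsChain NoCancel)
    (hends : ∀ a ∈ l.getLast?, ∀ b ∈ l.head?, NoCancel a b) (t : ℕ) :
    pr (fun τ : ι → G => ¬ LinearIndependent F
      (fun i : Fin (t + 1) => (((l.map (signedLetter τ)).reverse.prod).1.1 ^ (i : ℕ)) *ᵥ x)) ≤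
      (Nat.card F : ℝ) ^ (N * t + 1) / (Nat.card F : ℝ) ^ n := by
  have hl' : 0 < l.length := hN ▸ hl
  have hP := pr_path_dependent (κ := Unit) (x := fun _ => x) hG
    (LinearIndependent.of_subsingleton () hx) (cyclicSeq l hl') (N * t)
    (fun i _ => noCancel_cyclicSeq hl' hc i (Or.inr hends))
  rw [Nat.card_unique (α := Unit), one_mul] at hP
  refine hP.trans' ?_
  refine pr_mono fun τ hτ hn => hτ ?_
  let f : Fin (t + 1) → Unit × Fin (N * t + 1) := fun i =>
    ((), ⟨N * i, Nat.lt_succ_of_le (Nat.mul_le_mul_left _ (Nat.le_of_lt_succ i.2))⟩)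
  have hf : Function.Injective f := by
    intro i j hij
    simp only [f, Prod.mk.injEq, Fin.mk.injEq, true_and] at hij
    exact Fin.ext (Nat.eq_of_mul_eq_mul_left hl hij)
  have h1 := hn.comp f hf
  convert h1 using 1
  funext i
  have hw := pathProd_cyclicSeq τ l hl' i
  rw [hN] at hw
  simp only [Function.comp, f, hw]
  rw [Subgroup.coe_pow, Units.val_pow_eq_pow_val]

/-- The images of an independent family under two distinct random words are jointly independent
with high probability. -/
theorem pr_words_dependent (hG : ContainsSL G) {κ : Type*} [Finite κ] {x : κ → Fin n → F}
    (hx : LinearIndependent F x) {u v : List ι} {ℓ : ℕ} (hu : u.length = ℓ) (hv : v.length = ℓ)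
    (huv : u ≠ v) :
    pr (fun τ : ι → G => ¬ LinearIndependent F
      (Sum.elim (fun c => (wordProd τ u).1.1 *ᵥ x c) (fun c => (wordProd τ v).1.1 *ᵥ x c) :
        κ ⊕ κ → Fin n → F)) ≤
      (Nat.card F : ℝ) ^ (Nat.card κ * (2 * ℓ + 1)) / (Nat.card F : ℝ) ^ n := by
  have hq1 : (1 : ℝ) ≤ Nat.card F := by exact_mod_cast (one_lt_card_field (F := F)).le
  obtain ⟨p, u', v', rfl, rfl, hlen, hhead⟩ := exists_strip_common_head (hu.trans hv.symm) huv
  obtain ⟨hu', hv'⟩ := ne_nil_of_head?_ne hlen hhead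
  have hlen' : (quotientPath u' v').length ≤ 2 * ℓ := by
    rw [length_quotientPath]
    simp only [List.length_append] at hu hv
    omega
  have hP := pr_cyclic_endpoint_dependent hG hx (quotientPath u' v') rfl
    (by rw [length_quotientPath]; have := List.length_pos_of_ne_nil hu'; omega)
    (isChain_quotientPath hhead)
  refine le_trans ?_ (hP.trans ?_)
  · refine pr_mono fun τ hτ hn => hτ ?_
    rw [signedLetter_prod_quotientPath] at hn
    rw [← linearIndependent_mulVec_iff (wordProd τ (p ++ u')).1⁻¹]
    convert hn using 1
    funext z
    rcases z with c | c
    · simp only [Sum.elim_inl]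
      rw [mulVec_inv_mulVec, inv_mul_cancel, Subgroup.coe_one, Units.val_one, Matrix.one_mulVec]
    · simp only [Sum.elim_inr]
      rw [mulVec_inv_mulVec, wordProd_append, wordProd_append, _root_.mul_inv_rev, mul_assoc,
        inv_mul_cancel_left]
  · gcongr

/-- `A` is good: nonzero polynomials of degree at most `t` evaluated at `A` have kernel of
dimension at most `g`. -/
def GoodElt (t g : ℕ) (A : Matrix (Fin n) (Fin n) F) : Prop :=
  ∀ p : F[X], p ≠ 0 → p.natDegree ≤ t →
    Nat.card {x : Fin n → F // (aeval A p) *ᵥ x = 0} ≤ Nat.card F ^ g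

theorem mul_aeval_of_mul_eq {R : Type*} [Ring R] [Algebra F R] {S A B : R} (h : S * B = A * S)
    (p : F[X]) : S * aeval B p = aeval A p * S := by
  rw [aeval_eq_sum_range, aeval_eq_sum_range, Finset.mul_sum, Finset.sum_mul]
  refine Finset.sum_congr rfl fun i _ => ?_
  have h2 : SemiconjBy S (B ^ i) (A ^ i) := SemiconjBy.pow_right h i
  rw [mul_smul_comm, smul_mul_assoc, h2.eq]

theorem GoodElt.conj {t g : ℕ} {A B : Matrix (Fin n) (Fin n) F} (hA : GoodElt t g A)
    (S : GL (Fin n) F) (h : S.1 * B = A * S.1) : GoodElt t g B := by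
  intro p hp hd
  refine le_trans ?_ (hA p hp hd)
  refine Nat.card_le_card_of_injective (fun x => ⟨S.1 *ᵥ x.1, ?_⟩) ?_
  · rw [Matrix.mulVec_mulVec, ← mul_aeval_of_mul_eq h, ← Matrix.mulVec_mulVec, x.2,
      Matrix.mulVec_zero]
  · intro x y hxy
    exact Subtype.ext (Matrix.mulVec_injective_of_isUnit S.isUnit (Subtype.ext_iff.1 hxy))

/-- If `x` is killed by a nonzero polynomial of degree at most `t` in `A` then its Krylov
sequence of length `t + 1` is dependent. -/
theorem krylov_dependent {t : ℕ} {A : Matrix (Fin n) (Fin n) F} {p : F[X]} (hp : p ≠ 0)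
    (hd : p.natDegree ≤ t) {x : Fin n → F} (hx : (aeval A p) *ᵥ x = 0) :
    ¬ LinearIndependent F (fun i : Fin (t + 1) => (A ^ (i : ℕ)) *ᵥ x) := by
  intro h
  rw [Fintype.linearIndependent_iff] at h
  have h1 := h (fun i => p.coeff i) (by
    rw [aeval_eq_sum_range' (n := t + 1) (by omega), Matrix.sum_mulVec] at hx
    rw [← hx, Finset.sum_range]
    exact Finset.sum_congr rfl fun i _ => by rw [Matrix.smul_mulVec])
  apply hp
  ext i
  by_cases hi : i < t + 1
  · exact h1 ⟨i, hi⟩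
  · rw [coeff_eq_zero_of_natDegree_lt (by omega), coeff_zero]

/-- The quotient of two distinct random words is good with high probability. -/
theorem pr_not_good (hG : ContainsSL G) {u v : List ι} {ℓ : ℕ} (hu : u.length = ℓ)
    (hv : v.length = ℓ) (huv : u ≠ v) (t g : ℕ) :
    pr (fun τ : ι → G => ¬ GoodElt t g ((wordProd τ u)⁻¹ * wordProd τ v).1.1) ≤
      (Nat.card F : ℝ) ^ (2 * ℓ * t + 2) / (Nat.card F : ℝ) ^ g := by
  classical
  have := Fintype.ofFinite F
  have hq1 : (2 : ℝ) ≤ Nat.card F := by exact_mod_cast (one_lt_card_field (F := F))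
  obtain ⟨p, r, u', v', rfl, rfl, hlen, hhead, hlast⟩ := exists_strip_both (hu.trans hv.symm) huv
  obtain ⟨hu', hv'⟩ := ne_nil_of_head?_ne hlen hhead
  have hlen' : (quotientPath u' v').length ≤ 2 * ℓ := by
    rw [length_quotientPath]
    simp only [List.length_append] at hu hv
    omega
  let k : (ι → G) → G := fun τ => (wordProd τ u')⁻¹ * wordProd τ v'
  have hk : ∀ x : Fin n → F, x ≠ 0 → pr (fun τ : ι → G => ¬ LinearIndependent F
      (fun i : Fin (t + 1) => ((k τ).1.1 ^ (i : ℕ)) *ᵥ x)) ≤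
      (Nat.card F : ℝ) ^ (2 * ℓ * t + 1) / (Nat.card F : ℝ) ^ n := by
    intro x hx
    have hP := pr_cyclic_krylov_dependent hG hx (quotientPath u' v') rfl
      (by rw [length_quotientPath]; have := List.length_pos_of_ne_nil hu'; omega)
      (isChain_quotientPath hhead) (noCancel_quotientPath_ends hlast hu' hv') t
    simp only [signedLetter_prod_quotientPath] at hP
    refine hP.trans ?_
    gcongr
    linarith
  have hgood : ∀ τ : ι → G, ¬ GoodElt t g ((wordProd τ (p ++ u' ++ r))⁻¹ *
      wordProd τ (p ++ v' ++ r)).1.1 → (Nat.card F : ℝ) ^ g ≤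
        ∑ x : Fin n → F, if ¬ LinearIndependent F
          (fun i : Fin (t + 1) => ((k τ).1.1 ^ (i : ℕ)) *ᵥ x) then (1 : ℝ) else 0 := by
    intro τ hτ
    have h1 : ¬ GoodElt t g (k τ).1.1 := by
      intro h
      refine hτ (h.conj (wordProd τ r).1 ?_)
      rw [← Units.val_mul, ← Units.val_mul, ← Subgroup.coe_mul, ← Subgroup.coe_mul]
      congr 2
      simp only [k, wordProd_append, _root_.mul_inv_rev, mul_assoc, inv_mul_cancel_left,
        mul_inv_cancel_left]
    unfold GoodElt at h1
    push Not at h1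
    obtain ⟨f, hf, hfd, hcard⟩ := h1
    rw [Finset.sum_boole]
    rw [Nat.card_eq_fintype_card (α := {x : Fin n → F // _}), Fintype.card_subtype] at hcard
    have : Nat.card F ^ g ≤ (Finset.univ.filter fun x : Fin n → F => ¬ LinearIndependent F
          (fun i : Fin (t + 1) => ((k τ).1.1 ^ (i : ℕ)) *ᵥ x)).card := by
      refine hcard.le.trans (Finset.card_le_card ?_)
      intro x hx
      simp only [Finset.mem_filter, Finset.mem_univ, true_and] at hx ⊢
      exact krylov_dependent hf hfd hx
    exact_mod_cast this
  refine (pr_le_ex_div (by positivity) (fun τ => Finset.sum_nonneg fun x _ => by positivity)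
    hgood).trans ?_
  gcongr
  rw [ex_sum]
  have hpr : ∀ x : Fin n → F, ex (fun τ : ι → G => if ¬ LinearIndependent F
      (fun i : Fin (t + 1) => ((k τ).1.1 ^ (i : ℕ)) *ᵥ x) then (1 : ℝ) else 0) =
      pr (fun τ : ι → G => ¬ LinearIndependent F
      (fun i : Fin (t + 1) => ((k τ).1.1 ^ (i : ℕ)) *ᵥ x)) := fun x => by
    rw [pr_eq_ex]; congr!
  simp only [hpr]
  rw [← Finset.add_sum_erase _ _ (Finset.mem_univ 0)]
  have h2 : ∑ x ∈ Finset.univ.erase (0 : Fin n → F), pr (fun τ : ι → G => ¬ LinearIndependent F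
      (fun i : Fin (t + 1) => ((k τ).1.1 ^ (i : ℕ)) *ᵥ x)) ≤ (Nat.card F : ℝ) ^ (2 * ℓ * t + 1) := by
    refine (Finset.sum_le_sum fun x hx => hk x (Finset.ne_of_mem_erase hx)).trans ?_
    rw [Finset.sum_const, nsmul_eq_mul]
    have : ((Finset.univ.erase (0 : Fin n → F)).card : ℝ) ≤ (Nat.card F : ℝ) ^ n := by
      have h3 : (Finset.univ.erase (0 : Fin n → F)).card ≤ Nat.card F ^ n := by
        refine (Finset.card_le_univ _).trans_eq ?_
        rw [← Nat.card_eq_fintype_card, card_vec, Nat.card_fin]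
      exact_mod_cast h3
    refine (mul_le_mul_of_nonneg_right this (by positivity)).trans_eq ?_
    field_simp
  have h3 := pr_le_one (fun τ : ι → G => ¬ LinearIndependent F
      (fun i : Fin (t + 1) => ((k τ).1.1 ^ (i : ℕ)) *ᵥ (0 : Fin n → F)))
  have h4 : (1 : ℝ) ≤ (Nat.card F : ℝ) ^ (2 * ℓ * t + 1) := one_le_pow₀ (by linarith)
  have h5 : (Nat.card F : ℝ) ^ (2 * ℓ * t + 2) =
    Nat.card F * (Nat.card F : ℝ) ^ (2 * ℓ * t + 1) := by ring
  nlinarith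

end Words

section Duality

open Matrix Polynomial Module

variable {F : Type*} [Field F] [Finite F] {n : ℕ}

theorem card_eq_pow_finrank' (V : Type*) [AddCommGroup V] [Module F V] [Module.Finite F V] :
    Nat.card V = Nat.card F ^ finrank F V :=
  Module.natCard_eq_pow_finrank

/-- The kernel of a linear map and the annihilator of its range, counted. -/
theorem card_ker_mul_card {A B C : Type*} [AddCommGroup A] [Module F A] [Module.Finite F A]
    [AddCommGroup B] [Module F B] [Module.Finite F B] [AddCommGroup C] [Module F C]
    [Module.Finite F C] (L : A →ₗ[F] B) (P : C →ₗ[F] Dual F B) (hP : Function.Injective P)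
    (hBC : finrank F C = finrank F B) :
    Nat.card {a // L a = 0} * Nat.card B = Nat.card A * Nat.card {c // ∀ a, P c (L a) = 0} := by
  let e : C ≃ₗ[F] Dual F B := LinearMap.linearEquivOfInjective P hP
    (hBC.trans Subspace.dual_finrank_eq.symm)
  have h1 : Nat.card {c // ∀ a, P c (L a) = 0} = Nat.card (LinearMap.ker L.dualMap) := by
    refine Nat.card_congr (Equiv.subtypeEquiv e.toEquiv fun c => ?_)
    rw [LinearMap.mem_ker, LinearMap.ext_iff]
    rfl
  have h2 : Nat.card {a // L a = 0} = Nat.card (LinearMap.ker L) := rfl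
  rw [h1, h2, card_eq_pow_finrank' (F := F) B, card_eq_pow_finrank' (F := F) A,
    card_eq_pow_finrank' (F := F) (LinearMap.ker L),
    card_eq_pow_finrank' (F := F) (LinearMap.ker L.dualMap), ← pow_add, ← pow_add]
  congr 1
  have h3 := LinearMap.finrank_range_add_finrank_ker L
  have h4 := LinearMap.finrank_range_add_finrank_ker L.dualMap
  rw [LinearMap.finrank_range_dualMap_eq_finrank_range, Subspace.dual_finrank_eq] at h4
  omega

/-- The trace pairing between tuples of matrices. -/
def tracePairing (I : Type*) [Fintype I] (m k : ℕ) :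
    (I → Matrix (Fin k) (Fin m) F) →ₗ[F] Dual F (I → Matrix (Fin m) (Fin k) F) :=
  LinearMap.mk₂ F (fun c b => ∑ i, (c i * b i).trace)
    (fun c c' b => by simp [Matrix.add_mul, Finset.sum_add_distrib])
    (fun a c b => by simp [Finset.mul_sum])
    (fun c b b' => by simp [Matrix.mul_add, Finset.sum_add_distrib])
    (fun a c b => by simp [Finset.mul_sum])

theorem tracePairing_apply {I : Type*} [Fintype I] {m k : ℕ} (c : I → Matrix (Fin k) (Fin m) F)
    (b : I → Matrix (Fin m) (Fin k) F) : tracePairing I m k c b = ∑ i, (c i * b i).trace := rfl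

theorem tracePairing_injective (I : Type*) [Fintype I] (m k : ℕ) :
    Function.Injective (tracePairing (F := F) I m k) := by
  classical
  rw [injective_iff_map_eq_zero]
  intro c hc
  funext i
  rw [Pi.zero_apply, Matrix.ext_iff_trace_mul_right]
  intro x
  have h := LinearMap.congr_fun hc (Pi.single i x)
  rw [tracePairing_apply, Finset.sum_eq_single i] at h
  · simpa using h
  · intro j _ hj
    simp [Pi.single_eq_of_ne hj]
  · simp

theorem card_functional_comp_eq_zero {V : Type*} [AddCommGroup V] [Module F V] [Module.Finite F V]
    (A : V →ₗ[F] V) : Nat.card {μ : Dual F V // μ ∘ₗ A = 0} = Nat.card {x // A x = 0} := by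
  have h2 := card_ker_mul_card A (LinearMap.id : Dual F V →ₗ[F] Dual F V) Function.injective_id
    Subspace.dual_finrank_eq
  have : Finite V := Module.finite_of_finite F
  rw [mul_comm] at h2
  have h3 := Nat.eq_of_mul_eq_mul_left Nat.card_pos h2
  rw [h3]
  refine Nat.card_congr (Equiv.subtypeEquivRight fun μ => ?_)
  rw [LinearMap.ext_iff]; rfl

theorem mulVecLin_aeval (k : Matrix (Fin n) (Fin n) F) (p : F[X]) :
    aeval k.mulVecLin p = (aeval k p).mulVecLin := by
  have h := Polynomial.aeval_algHom_apply (Matrix.toLinAlgEquiv' (R := F) (n := Fin n)).toAlgHom k p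
  exact h

theorem comp_aeval_of_comp_eq {V U : Type*} [AddCommGroup V] [Module F V] [AddCommGroup U]
    [Module F U] {k : V →ₗ[F] V} {θ : U →ₗ[F] U} {Ψ : V →ₗ[F] U} (h : Ψ ∘ₗ k = θ ∘ₗ Ψ) (p : F[X]) :
    Ψ ∘ₗ aeval k p = aeval θ p ∘ₗ Ψ := by
  induction p using Polynomial.induction_on' with
  | add p q hp hq => rw [map_add, map_add, LinearMap.comp_add, LinearMap.add_comp, hp, hq]
  | monomial i a =>
    have h2 : ∀ i : ℕ, Ψ ∘ₗ (k ^ i) = (θ ^ i) ∘ₗ Ψ := by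
      intro i
      induction i with
      | zero => rfl
      | succ i ih =>
        rw [pow_succ, pow_succ, Module.End.mul_eq_comp, Module.End.mul_eq_comp, ← LinearMap.comp_assoc,
          ih, LinearMap.comp_assoc, h, LinearMap.comp_assoc]
    rw [aeval_monomial, aeval_monomial, ← Algebra.smul_def, ← Algebra.smul_def, LinearMap.comp_smul,
      LinearMap.smul_comp, h2]

/-- A linear functional satisfies a polynomial relation of degree at most the dimension of its
orbit. -/
theorem exists_aeval_functional_eq_zero {U : Type*} [AddCommGroup U] [Module F U]
    [Module.Finite F U] (θ : U →ₗ[F] U) (lam : Dual F U) {e : ℕ}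
    (he : finrank F (Submodule.span F (Set.range fun i : ℕ => (lam ∘ₗ (θ ^ i) : Dual F U))) = e) :
    ∃ p : F[X], p ≠ 0 ∧ p.natDegree ≤ e ∧ lam ∘ₗ aeval θ p = 0 := by
  let v : Fin (e + 1) → Dual F U := fun i => lam ∘ₗ (θ ^ (i : ℕ))
  have hv : ¬ LinearIndependent F v := by
    intro h
    have h1 := linearIndependent_iff_card_le_finrank_span.1 h
    rw [Fintype.card_fin, Set.finrank] at h1
    have h2 : Submodule.span F (Set.range v) ≤
        Submodule.span F (Set.range fun i : ℕ => (lam ∘ₗ (θ ^ i) : Dual F U)) := by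
      refine Submodule.span_mono ?_
      rintro _ ⟨i, rfl⟩
      exact ⟨i, rfl⟩
    have h3 := h1.trans ((Submodule.finrank_mono h2).trans he.le)
    omega
  obtain ⟨c, hc, i, hi⟩ := Fintype.not_linearIndependent_iff.1 hv
  have hcoeff : ∀ j : Fin (e + 1), (∑ i : Fin (e + 1), monomial (i : ℕ) (c i)).coeff j = c j := by
    intro j
    rw [finsetSum_coeff, Finset.sum_eq_single j]
    · simp
    · intro b _ hb
      rw [coeff_monomial, if_neg (fun h => hb (Fin.ext h))]
    · simp
  refine ⟨∑ i : Fin (e + 1), monomial (i : ℕ) (c i), ?_, ?_, ?_⟩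
  · intro h0
    apply hi
    rw [← hcoeff i, h0, coeff_zero]
  · refine natDegree_sum_le_of_forall_le _ _ fun i _ => ?_
    exact (natDegree_monomial_le _).trans (Nat.le_of_lt_succ i.2)
  · rw [map_sum]
    simp only [aeval_monomial, ← Algebra.smul_def]
    rw [← hc]
    ext x
    simp [v, LinearMap.sum_apply]

/-- Few linear maps intertwine a good matrix with a given endomorphism. -/
theorem card_intertwiner_le {t g : ℕ} {k : Matrix (Fin n) (Fin n) F} (hk : GoodElt t g k)
    (htg : n ≤ g * (t + 1)) (m : ℕ) : ∀ (U : Type*) [AddCommGroup U] [Module F U]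
    [Module.Finite F U], finrank F U = m → ∀ θ : U →ₗ[F] U,
    Nat.card {Ψ : (Fin n → F) →ₗ[F] U // Ψ ∘ₗ k.mulVecLin = θ ∘ₗ Ψ} ≤ Nat.card F ^ (g * m) := by
  induction m using Nat.strong_induction_on with
  | _ m ih =>
  intro U _ _ _ hU θ
  have hFinU : Finite U := Module.finite_of_finite F
  have hFinH : Finite ((Fin n → F) →ₗ[F] U) := Module.finite_of_finite F
  have hFinD : Finite (Dual F (Fin n → F)) := Module.finite_of_finite F
  have hq : 0 < Nat.card F := Nat.card_pos
  rcases subsingleton_or_nontrivial U with hs | hs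
  · have : Subsingleton {Ψ : (Fin n → F) →ₗ[F] U // Ψ ∘ₗ k.mulVecLin = θ ∘ₗ Ψ} :=
      ⟨fun a b => Subtype.ext (LinearMap.ext fun x => Subsingleton.elim _ _)⟩
    exact (Finite.card_le_one_iff_subsingleton.2 this).trans (Nat.one_le_pow _ _ hq)
  obtain ⟨lam, hlam⟩ := exists_ne (0 : Dual F U)
  set Λ : Submodule F (Dual F U) :=
    Submodule.span F (Set.range fun i : ℕ => (lam ∘ₗ (θ ^ i) : Dual F U)) with hΛ
  obtain ⟨e, he⟩ : ∃ e, finrank F Λ = e := ⟨_, rfl⟩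
  have hlamΛ : lam ∈ Λ := Submodule.subset_span ⟨0, rfl⟩
  have he0 : 0 < e := by
    rw [← he]
    have : Nontrivial Λ := ⟨⟨lam, hlamΛ⟩, 0, fun h => hlam (congrArg Subtype.val h)⟩
    exact Module.finrank_pos (R := F) (M := Λ)
  obtain ⟨p, hp0, hpd, hp⟩ := exists_aeval_functional_eq_zero θ lam he
  let U' : Submodule F U := Λ.dualCoannihilator
  have hU' : finrank F U' = m - e := by
    have := Subspace.finrank_add_finrank_dualCoannihilator_eq (K := F) (V := U) Λ
    rw [he, hU] at this
    change finrank F Λ.dualCoannihilator = _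
    omega
  have hem : e ≤ m := by
    have := Subspace.finrank_add_finrank_dualCoannihilator_eq (K := F) (V := U) Λ
    omega
  have hmemU' : ∀ x : U, (∀ i : ℕ, lam ((θ ^ i) x) = 0) → x ∈ U' := by
    intro x hx
    rw [Submodule.mem_dualCoannihilator]
    intro φ hφ
    induction hφ using Submodule.span_induction with
    | mem φ h => obtain ⟨i, rfl⟩ := h; exact hx i
    | zero => rfl
    | add a b _ _ ha hb => rw [LinearMap.add_apply, ha, hb, add_zero]
    | smul c a _ ha => rw [LinearMap.smul_apply, ha, smul_zero]
  have hU'mem : ∀ x ∈ U', ∀ i : ℕ, lam ((θ ^ i) x) = 0 := fun x hx i =>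
    (Submodule.mem_dualCoannihilator x).1 hx _ (Submodule.subset_span ⟨i, rfl⟩)
  have hθU' : ∀ x ∈ U', θ x ∈ U' := fun x hx => hmemU' _ fun i => by
    have := hU'mem x hx (i + 1)
    rwa [pow_succ] at this
  let S := {Ψ : (Fin n → F) →ₗ[F] U // Ψ ∘ₗ k.mulVecLin = θ ∘ₗ Ψ}
  let S' := {Ψ : (Fin n → F) →ₗ[F] U' // Ψ ∘ₗ k.mulVecLin = (θ.restrict hθU') ∘ₗ Ψ}
  let T := {μ : Dual F (Fin n → F) // μ ∘ₗ aeval k.mulVecLin p = 0}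
  have hT : Nat.card T ≤ Nat.card F ^ (g * e) := by
    by_cases het : e ≤ t
    · rw [show Nat.card T = _ from card_functional_comp_eq_zero _, mulVecLin_aeval]
      refine (hk p hp0 (hpd.trans het)).trans (Nat.pow_le_pow_right hq ?_)
      exact Nat.le_mul_of_pos_right _ he0
    · refine (Nat.card_le_card_of_injective _ Subtype.val_injective).trans ?_
      rw [card_eq_pow_finrank' (F := F) (Dual F (Fin n → F)), Subspace.dual_finrank_eq,
        Module.finrank_fin_fun]
      refine Nat.pow_le_pow_right hq (htg.trans (Nat.mul_le_mul_left _ (by omega)))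
  have hFinH' : Finite ((Fin n → F) →ₗ[F] U') := Module.finite_of_finite F
  have hFinS' : Finite S' := Subtype.finite
  have hS' : Nat.card S' ≤ Nat.card F ^ (g * (m - e)) := ih (m - e) (by omega) U' hU' _
  let f : S → T := fun Ψ => ⟨lam ∘ₗ Ψ.1, by
    rw [LinearMap.comp_assoc, comp_aeval_of_comp_eq Ψ.2, ← LinearMap.comp_assoc, hp,
      LinearMap.zero_comp]⟩
  have hfib : ∀ μ : T, Nat.card {Ψ : S // f Ψ = μ} ≤ Nat.card F ^ (g * (m - e)) := by
    intro μ
    refine le_trans ?_ hS'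
    rcases isEmpty_or_nonempty {Ψ : S // f Ψ = μ} with hE | ⟨⟨Ψ₀, h₀⟩⟩
    · simp
    have hdiff : ∀ Ψ : {Ψ : S // f Ψ = μ}, ∀ x, Ψ.1.1 x - Ψ₀.1 x ∈ U' := by
      intro Ψ x
      refine hmemU' _ fun i => ?_
      have h1 : ∀ Ψ : S, ∀ x, (θ ^ i) (Ψ.1 x) = Ψ.1 ((k.mulVecLin ^ i) x) := by
        intro Ψ x
        have := LinearMap.congr_fun (comp_aeval_of_comp_eq Ψ.2 (X ^ i)) x
        simpa using this.symm
      rw [map_sub, h1, h1, map_sub]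
      have h2 : f Ψ.1 = f Ψ₀ := Ψ.2.trans h₀.symm
      have h3 := LinearMap.congr_fun (congrArg Subtype.val h2) ((k.mulVecLin ^ i) x)
      exact sub_eq_zero.2 h3
    refine Nat.card_le_card_of_injective (fun Ψ => (⟨(Ψ.1.1 - Ψ₀.1).codRestrict U' (hdiff Ψ), ?_⟩ : S'))
      ?_
    · ext x : 2
      apply Subtype.ext
      have h1 := LinearMap.congr_fun Ψ.1.2
      have h2 := LinearMap.congr_fun Ψ₀.2
      simp only [LinearMap.comp_apply] at h1 h2
      simp only [LinearMap.comp_apply, LinearMap.codRestrict_apply, LinearMap.sub_apply,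
        LinearMap.coe_restrict_apply, map_sub, h1, h2]
    · intro Ψ Ψ' h
      apply Subtype.ext
      apply Subtype.ext
      refine LinearMap.ext fun x => ?_
      have h1 := congrArg Subtype.val (LinearMap.congr_fun (congrArg Subtype.val h) x)
      simpa using h1
  have hfin := card_le_mul_of_fibre_le f _ hfib
  refine hfin.trans ((Nat.mul_le_mul_right _ hT).trans_eq ?_)
  rw [← pow_add, ← mul_add, Nat.add_sub_of_le hem]

end Duality

section Intertwiners

open Matrix Polynomial Module

variable {F : Type*} [Field F] [Finite F] {n : ℕ}

/-- The trace pairing between matrices. -/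
def traceForm (m k : ℕ) :
    Matrix (Fin k) (Fin m) F →ₗ[F] Dual F (Matrix (Fin m) (Fin k) F) :=
  LinearMap.mk₂ F (fun c b => (c * b).trace)
    (fun c c' b => by simp [Matrix.add_mul])
    (fun a c b => by simp)
    (fun c b b' => by simp [Matrix.mul_add])
    (fun a c b => by simp)

theorem traceForm_injective (m k : ℕ) : Function.Injective (traceForm (F := F) m k) := by
  rw [injective_iff_map_eq_zero]
  intro c hc
  rw [Matrix.ext_iff_trace_mul_right]
  intro x
  have h := LinearMap.congr_fun hc x
  rw [Matrix.zero_mul, Matrix.trace_zero]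
  exact h

/-- Few matrices satisfy a twisted intertwining relation with a good matrix. -/
theorem card_twisted_intertwiner_le {t g : ℕ} {k : Matrix (Fin n) (Fin n) F}
    (hk : GoodElt t g k) (htg : n ≤ g * (t + 1)) {d ρ : ℕ} (M₁ M₂ : Matrix (Fin d) (Fin ρ) F)
    (h₂ : Function.Injective M₂.mulVec) :
    Nat.card {Ψ : Matrix (Fin ρ) (Fin n) F // M₁ * Ψ = M₂ * Ψ * k} ≤ Nat.card F ^ (g * ρ) := by
  let S := {Ψ : Matrix (Fin ρ) (Fin n) F // M₁ * Ψ = M₂ * Ψ * k}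
  let U : Submodule F (Fin ρ → F) := ⨆ Ψ : S, LinearMap.range Ψ.1.mulVecLin
  have hΨU : ∀ (Ψ : S) x, Ψ.1.mulVecLin x ∈ U := fun Ψ x =>
    (le_iSup (fun Ψ : S => LinearMap.range Ψ.1.mulVecLin) Ψ) ⟨x, rfl⟩
  let m₂ : U →ₗ[F] (Fin d → F) := M₂.mulVecLin ∘ₗ U.subtype
  have hm₂ : Function.Injective m₂ := by
    intro x y h
    exact Subtype.ext (h₂ h)
  have hrange : ∀ u : U, (M₁.mulVecLin ∘ₗ U.subtype) u ∈ LinearMap.range m₂ := by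
    rintro ⟨u, hu⟩
    have hle : U ≤ (LinearMap.range m₂).comap M₁.mulVecLin := by
      refine iSup_le fun Ψ => ?_
      rintro _ ⟨x, rfl⟩
      rw [Submodule.mem_comap]
      refine ⟨⟨Ψ.1.mulVecLin (k *ᵥ x), hΨU Ψ _⟩, ?_⟩
      simp only [m₂, LinearMap.comp_apply, Submodule.subtype_apply, Matrix.mulVecLin_apply,
        Matrix.mulVec_mulVec]
      rw [Ψ.2, Matrix.mul_assoc]
    exact hle hu
  let E := LinearEquiv.ofInjective m₂ hm₂
  let θ : U →ₗ[F] U := E.symm.toLinearMap ∘ₗ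
    (M₁.mulVecLin ∘ₗ U.subtype).codRestrict (LinearMap.range m₂) hrange
  have hθ : ∀ u : U, M₂ *ᵥ (θ u : Fin ρ → F) = M₁ *ᵥ (u : Fin ρ → F) := by
    intro u
    have h := congrArg Subtype.val (E.apply_symm_apply
      ((M₁.mulVecLin ∘ₗ U.subtype).codRestrict (LinearMap.range m₂) hrange u))
    exact h
  have hFinH : Finite ((Fin n → F) →ₗ[F] U) := Module.finite_of_finite F
  have hH := card_intertwiner_le hk htg _ U rfl θ
  have hUρ : finrank F U ≤ ρ := (Submodule.finrank_le U).trans_eq (Module.finrank_fin_fun F)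
  refine le_trans ?_ (hH.trans (Nat.pow_le_pow_right Nat.card_pos (Nat.mul_le_mul_left g hUρ)))
  refine Nat.card_le_card_of_injective
    (fun Ψ : S => ⟨Ψ.1.mulVecLin.codRestrict U (hΨU Ψ), ?_⟩) ?_
  · refine LinearMap.ext fun x => Subtype.ext (h₂ ?_)
    rw [LinearMap.comp_apply, LinearMap.comp_apply, hθ]
    simp only [LinearMap.codRestrict_apply, Matrix.mulVecLin_apply, Matrix.mulVec_mulVec]
    rw [Ψ.2, Matrix.mul_assoc]
  · intro Ψ Ψ' h
    apply Subtype.ext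
    apply Matrix.toLin'.injective
    refine LinearMap.ext fun x => ?_
    exact congrArg Subtype.val (LinearMap.congr_fun (congrArg Subtype.val h) x)

theorem card_intertwining_matrices_le {t g : ℕ} {k : Matrix (Fin n) (Fin n) F}
    (hk : GoodElt t g k) (htg : n ≤ g * (t + 1)) {d ρ : ℕ} (M₁ M₂ : Matrix (Fin d) (Fin ρ) F)
    (h₂ : Function.Injective M₂.mulVec) :
    Nat.card {X : Matrix (Fin n) (Fin d) F // X * M₁ = k * X * M₂} * Nat.card F ^ (n * ρ) ≤
      Nat.card F ^ (n * d) * Nat.card F ^ (g * ρ) := by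
  let L : Matrix (Fin n) (Fin d) F →ₗ[F] Matrix (Fin n) (Fin ρ) F :=
    { toFun := fun X => X * M₁ - k * X * M₂
      map_add' := fun X Y => by simp only [Matrix.add_mul, Matrix.mul_add]; abel
      map_smul' := fun a X => by
        simp only [Matrix.smul_mul, Matrix.mul_smul, smul_sub, RingHom.id_apply] }
  have h := card_ker_mul_card L (traceForm n ρ) (traceForm_injective n ρ)
    (by simp [Module.finrank_matrix, mul_comm])
  rw [card_matrix, card_matrix] at h
  have h1 : Nat.card {X : Matrix (Fin n) (Fin d) F // X * M₁ = k * X * M₂} =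
      Nat.card {X // L X = 0} :=
    Nat.card_congr (Equiv.subtypeEquivRight fun X => sub_eq_zero.symm)
  rw [h1, h]
  refine Nat.mul_le_mul_left _ (le_trans ?_ (card_twisted_intertwiner_le hk htg M₁ M₂ h₂))
  refine Nat.card_le_card_of_injective (fun Ψ => ⟨Ψ.1, ?_⟩) ?_
  · rw [Matrix.ext_iff_trace_mul_right]
    intro X
    have hX : (Ψ.1 * (X * M₁ - k * X * M₂)).trace = 0 := Ψ.2 X
    rw [Matrix.mul_sub, Matrix.trace_sub, sub_eq_zero, ← Matrix.mul_assoc, Matrix.trace_mul_comm,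
      ← Matrix.mul_assoc, ← Matrix.mul_assoc, Matrix.trace_mul_comm (Ψ.1 * (k * X)),
      ← Matrix.mul_assoc, ← Matrix.mul_assoc] at hX
    exact hX
  · intro Ψ Ψ' h
    exact Subtype.ext (Subtype.mk.inj h)

end Intertwiners

section Companion

open Matrix Polynomial Module

variable {F : Type*} [Field F] [Finite F] {n d : ℕ}

/-- The companion matrix of a monic polynomial of degree `d`. -/
def companion (d : ℕ) (f : F[X]) : Matrix (Fin d) (Fin d) F :=
  Matrix.of fun i j => if (j : ℕ) + 1 < d then (if (i : ℕ) = j + 1 then 1 else 0) else -f.coeff i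

theorem companion_mulVec_single (f : F[X]) (j : Fin d) (hj : (j : ℕ) + 1 < d) :
    companion d f *ᵥ Pi.single j 1 = Pi.single ⟨j + 1, hj⟩ 1 := by
  rw [Matrix.mulVec_single_one]
  funext i
  simp [companion, Matrix.col_apply, hj, Pi.single_apply, Fin.ext_iff]

theorem companion_pow_mulVec (f : F[X]) (hd : 0 < d) (i : ℕ) (hi : i < d) :
    companion d f ^ i *ᵥ Pi.single (⟨0, hd⟩ : Fin d) 1 = Pi.single (⟨i, hi⟩ : Fin d) 1 := by
  induction i with
  | zero => rw [pow_zero, Matrix.one_mulVec]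
  | succ i ih =>
    rw [pow_succ', ← Matrix.mulVec_mulVec, ih (by omega), companion_mulVec_single f ⟨i, _⟩ hi]

theorem aeval_mulVec_eq_sum (A : Matrix (Fin n) (Fin n) F) {p : F[X]} {m : ℕ}
    (hp : p.natDegree < m) (x : Fin n → F) :
    aeval A p *ᵥ x = ∑ i : Fin m, p.coeff i • (A ^ (i : ℕ) *ᵥ x) := by
  rw [aeval_eq_sum_range' hp, Matrix.sum_mulVec, Finset.sum_range]
  exact Finset.sum_congr rfl fun i _ => by rw [Matrix.smul_mulVec]

theorem aeval_companion_mulVec_of_degree_lt (f : F[X]) (hd : 0 < d) {p : F[X]}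
    (hp : p.natDegree < d) :
    aeval (companion d f) p *ᵥ Pi.single (⟨0, hd⟩ : Fin d) 1 = fun i : Fin d => p.coeff i := by
  rw [aeval_mulVec_eq_sum _ hp]
  have : ∀ i : Fin d, p.coeff i • (companion d f ^ (i : ℕ) *ᵥ Pi.single (⟨0, hd⟩ : Fin d) 1) =
      Pi.single i (p.coeff i) := by
    intro i
    rw [companion_pow_mulVec f hd i i.2, ← Pi.single_smul, smul_eq_mul, mul_one]
  rw [Finset.sum_congr rfl fun i _ => this i]
  exact Finset.univ_sum_single (fun i : Fin d => p.coeff i)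

theorem companion_pow_self_mulVec (f : F[X]) (hd : 0 < d) :
    companion d f ^ d *ᵥ Pi.single (⟨0, hd⟩ : Fin d) 1 = fun i : Fin d => -f.coeff i := by
  obtain ⟨m, rfl⟩ : ∃ m, d = m + 1 := ⟨d - 1, by omega⟩
  rw [pow_succ', ← Matrix.mulVec_mulVec, companion_pow_mulVec f hd m (by omega),
    Matrix.mulVec_single_one]
  funext i
  simp [companion, Matrix.col_apply]

/-- A matrix vanishing on the orbit of the cyclic vector of a companion matrix is zero. -/
theorem eq_zero_of_mul_companion_pow (f : F[X]) (hd : 0 < d) {m : ℕ} (A : Matrix (Fin m) (Fin d) F)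
    (h : ∀ i < d, A *ᵥ (companion d f ^ i *ᵥ Pi.single (⟨0, hd⟩ : Fin d) 1) = 0) : A = 0 := by
  ext i j
  have h1 := h j j.2
  rw [companion_pow_mulVec f hd j j.2, Matrix.mulVec_single_one] at h1
  exact congrFun h1 i

theorem aeval_companion_self (f : F[X]) (hf : f.Monic) (hd : 0 < d) (hfd : f.natDegree = d) :
    aeval (companion d f) f = 0 := by
  have h0 : aeval (companion d f) f *ᵥ Pi.single (⟨0, hd⟩ : Fin d) 1 = 0 := by
    rw [aeval_mulVec_eq_sum _ (m := d + 1) (by omega), Fin.sum_univ_castSucc]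
    simp only [Fin.val_castSucc, Fin.val_last]
    have h1 : f.coeff d = 1 := by rw [← hfd]; exact hf.coeff_natDegree
    rw [companion_pow_self_mulVec f hd, h1, one_smul]
    have : ∀ i : Fin d, f.coeff i • (companion d f ^ (i : ℕ) *ᵥ Pi.single (⟨0, hd⟩ : Fin d) 1) =
        Pi.single i (f.coeff i) := by
      intro i
      rw [companion_pow_mulVec f hd i i.2, ← Pi.single_smul, smul_eq_mul, mul_one]
    rw [Finset.sum_congr rfl fun i _ => this i]
    rw [Finset.univ_sum_single (fun i : Fin d => f.coeff i)]
    funext i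
    simp
  refine eq_zero_of_mul_companion_pow f hd _ fun i _ => ?_
  have hc : aeval (companion d f) f * companion d f ^ i =
      companion d f ^ i * aeval (companion d f) f := by
    have : companion d f ^ i = aeval (companion d f) (X ^ i : F[X]) := by simp
    rw [this, ← map_mul, ← map_mul, mul_comm]
  rw [Matrix.mulVec_mulVec, hc, ← Matrix.mulVec_mulVec, h0, Matrix.mulVec_zero]

theorem aeval_companion_mulVec_eq_zero_iff (f : F[X]) (hf : f.Monic) (hd : 0 < d)
    (hfd : f.natDegree = d) (p : F[X]) :
    aeval (companion d f) p *ᵥ Pi.single (⟨0, hd⟩ : Fin d) 1 = 0 ↔ f ∣ p := by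
  have hdiv := modByMonic_add_div p f
  constructor
  · intro h
    rw [← hdiv, map_add, map_mul, aeval_companion_self f hf hd hfd, zero_mul, add_zero,
      aeval_companion_mulVec_of_degree_lt f hd] at h
    · rw [← modByMonic_eq_zero_iff_dvd hf]
      by_contra hne
      have hlt := natDegree_modByMonic_lt p hf (by rintro rfl; simp at hfd; omega)
      have := congrFun h ⟨(p %ₘ f).natDegree, by omega⟩
      simp at this
      exact hne this
    · have := natDegree_modByMonic_lt p hf (by rintro rfl; simp at hfd; omega)
      omega
  · rintro ⟨r, rfl⟩
    rw [map_mul, aeval_companion_self f hf hd hfd, zero_mul, Matrix.zero_mulVec]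

theorem isUnit_companion (f : F[X]) (hf : f.Monic) (hd : 0 < d) (hfd : f.natDegree = d)
    (h0 : f.coeff 0 ≠ 0) : IsUnit (companion d f) := by
  have h := aeval_companion_self f hf hd hfd
  have h3 : aeval (companion d f) (f.divX * X + C (f.coeff 0)) = 0 := by rw [divX_mul_X_add]; exact h
  rw [map_add, map_mul, aeval_X, aeval_C] at h3
  rw [Matrix.isUnit_iff_isUnit_det]
  have h2 : aeval (companion d f) (C (-(f.coeff 0)⁻¹) * f.divX) * companion d f = 1 := by
    have := eq_neg_of_add_eq_zero_left h3
    rw [map_mul, aeval_C, mul_assoc, this, mul_neg, ← map_mul, ← map_neg, ← neg_mul, neg_neg,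
      inv_mul_cancel₀ h0, map_one]
  exact Matrix.isUnit_det_of_left_inverse h2

theorem companion_mulVec_succ (f : F[X]) {z : Fin d → F} (j : ℕ) (hj : j + 1 < d)
    (hz : z ⟨d - 1, by omega⟩ = 0) :
    (companion d f *ᵥ z) ⟨j + 1, hj⟩ = z ⟨j, by omega⟩ := by
  rw [Matrix.mulVec, dotProduct, Finset.sum_eq_single (⟨j, by omega⟩ : Fin d)]
  · simp [companion, hj]
  · intro k _ hk
    by_cases hkd : (k : ℕ) + 1 < d
    · have : j ≠ k := fun h => hk (Fin.ext h.symm)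
      simp [companion, hkd, this]
    · have : k = ⟨d - 1, by omega⟩ := Fin.ext (by simp; omega)
      rw [this, hz, mul_zero]
  · simp

/-- The last basis vector is cyclic for the transpose of a companion matrix. -/
theorem eq_zero_of_mul_companion_transpose_pow (f : F[X]) (hd : 0 < d) {m : ℕ}
    (A : Matrix (Fin m) (Fin d) F)
    (h : ∀ i < d, A *ᵥ ((companion d f)ᵀ ^ i *ᵥ
      Pi.single (⟨d - 1, by omega⟩ : Fin d) 1) = 0) : A = 0 := by
  have key : ∀ y : Fin d → F, (∀ i < d, (companion d f ^ i *ᵥ y) ⟨d - 1, by omega⟩ = 0) → y = 0 := by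
    intro y hy
    have hshift : ∀ i < d, ∀ j, ∀ hj : j + i < d,
        (companion d f ^ i *ᵥ y) ⟨j + i, hj⟩ = y ⟨j, by omega⟩ := by
      intro i
      induction i with
      | zero => intro _ j hj; simp
      | succ i ih =>
        intro hi j hj
        rw [pow_succ', ← Matrix.mulVec_mulVec]
        exact (companion_mulVec_succ f (j + i) hj (hy i (by omega))).trans (ih (by omega) j _)
    funext j
    have h1 := hshift (d - 1 - j) (by omega) j (by omega)
    have h2 := hy (d - 1 - j) (by omega)
    rw [← h1, Pi.zero_apply, ← h2]
    congr 1
    exact Fin.ext (by simp; omega)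
  ext i j
  have := key (A i) fun k hk => by
    have h1 := congrFun (h k hk) i
    rw [Matrix.mulVec_mulVec, Matrix.mulVec_single_one, Matrix.col_apply, ← Matrix.transpose_pow]
      at h1
    simp only [Matrix.mul_apply, Matrix.transpose_apply, Pi.zero_apply] at h1
    simpa only [Matrix.mulVec, dotProduct, mul_comm] using h1
  exact congrFun this j

end Companion

section Annihilator

open Matrix Polynomial Module

variable {F : Type*} [Field F] [Finite F] {n d : ℕ}

/-- The number of vectors whose annihilator under `w` is generated by `f`. -/
noncomputable def annCount (w : Matrix (Fin n) (Fin n) F) (f : F[X]) : ℕ :=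
  Nat.card {x : Fin n → F // ∀ p : F[X], aeval w p *ᵥ x = 0 ↔ f ∣ p}

/-- The polynomials annihilating a vector. -/
noncomputable def annIdeal (w : Matrix (Fin n) (Fin n) F) (x : Fin n → F) : Ideal F[X] where
  carrier := {p | aeval w p *ᵥ x = 0}
  add_mem' {p p'} hp hp' := by
    simp only [Set.mem_ofPred_eq] at *
    rw [map_add, Matrix.add_mulVec, hp, hp', add_zero]
  zero_mem' := by simp
  smul_mem' c p hp := by
    simp only [Set.mem_ofPred_eq, smul_eq_mul] at *
    rw [map_mul, ← Matrix.mulVec_mulVec, hp, Matrix.mulVec_zero]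

theorem exists_monic_annihilator (w : Matrix (Fin n) (Fin n) F) (x : Fin n → F) {f : F[X]}
    (hf : f ≠ 0) (h : aeval w f *ᵥ x = 0) :
    ∃ g : F[X], g.Monic ∧ ∀ p : F[X], aeval w p *ᵥ x = 0 ↔ g ∣ p := by
  obtain ⟨g, hg⟩ := (IsPrincipalIdealRing.principal (annIdeal w x)).principal
  have hg' : ∀ p : F[X], aeval w p *ᵥ x = 0 ↔ g ∣ p := by
    intro p
    rw [← Ideal.mem_span_singleton]
    change p ∈ annIdeal w x ↔ _
    rw [hg]
  have hg0 : g ≠ 0 := by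
    rintro rfl
    exact hf (zero_dvd_iff.mp ((hg' f).1 h))
  refine ⟨g * C g.leadingCoeff⁻¹, monic_mul_leadingCoeff_inv hg0, fun p => ?_⟩
  rw [hg', (isUnit_C.2 (isUnit_iff_ne_zero.2
    (inv_ne_zero (leadingCoeff_ne_zero.2 hg0)))).mul_right_dvd]

theorem finite_monic_dvd {f : F[X]} (hf : f ≠ 0) : Finite {g : F[X] // g.Monic ∧ g ∣ f} := by
  have hfin : Finite (degreeLT F (f.natDegree + 1)) :=
    Finite.of_equiv _ (degreeLTEquiv F (f.natDegree + 1)).toEquiv.symm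
  refine Finite.of_injective (β := degreeLT F (f.natDegree + 1)) (fun g => ⟨g.1, ?_⟩) ?_
  · rw [mem_degreeLT]
    refine (degree_le_natDegree).trans_lt ?_
    exact_mod_cast Nat.lt_succ_of_le (natDegree_le_of_dvd g.2.2 hf)
  · intro g g' h
    exact Subtype.ext (congrArg (fun z : degreeLT F (f.natDegree + 1) => (z : F[X])) h)

theorem card_ker_aeval_eq_sum (w : Matrix (Fin n) (Fin n) F) {f : F[X]} (hf : f ≠ 0)
    [Fintype {g : F[X] // g.Monic ∧ g ∣ f}] :
    Nat.card {x : Fin n → F // aeval w f *ᵥ x = 0} =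
      ∑ g : {g : F[X] // g.Monic ∧ g ∣ f}, annCount w g.1 := by
  unfold annCount
  rw [← Nat.card_sigma]
  symm
  refine Nat.card_congr (Equiv.ofBijective
    (fun s => ⟨s.2.1, (s.2.2 f).2 s.1.2.2⟩) ⟨?_, ?_⟩)
  · rintro ⟨⟨g, hg, hgf⟩, ⟨x, hx⟩⟩ ⟨⟨g', hg', hgf'⟩, ⟨x', hx'⟩⟩ h
    obtain rfl : x = x' := congrArg Subtype.val h
    have : g = g' := eq_of_monic_of_associated hg hg'
      (associated_of_dvd_dvd ((hx _).1 ((hx' _).2 dvd_rfl)) ((hx' _).1 ((hx _).2 dvd_rfl)))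
    subst this
    rfl
  · rintro ⟨x, hx⟩
    obtain ⟨g, hg, hgx⟩ := exists_monic_annihilator w x hf hx
    exact ⟨⟨⟨g, hg, (hgx f).1 hx⟩, ⟨x, hgx⟩⟩, rfl⟩

theorem card_ker_mulVec_transpose (A : Matrix (Fin n) (Fin n) F) :
    Nat.card {x : Fin n → F // Aᵀ *ᵥ x = 0} = Nat.card {x : Fin n → F // A *ᵥ x = 0} := by
  have h : ∀ B : Matrix (Fin n) (Fin n) F, Nat.card {x : Fin n → F // B *ᵥ x = 0} =
      Nat.card F ^ (n - B.rank) := by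
    intro B
    have h1 := card_eq_pow_finrank' (F := F) (LinearMap.ker B.mulVecLin)
    have h2 := LinearMap.finrank_range_add_finrank_ker B.mulVecLin
    rw [Module.finrank_fin_fun] at h2
    rw [Matrix.rank, show n - finrank F (LinearMap.range B.mulVecLin) =
      finrank F (LinearMap.ker B.mulVecLin) from by omega]
    exact h1
  rw [h, h, Matrix.rank_transpose]

theorem aeval_transpose (w : Matrix (Fin n) (Fin n) F) (p : F[X]) :
    aeval wᵀ p = (aeval w p)ᵀ := by
  induction p using Polynomial.induction_on' with
  | add p p' hp hp' => rw [map_add, map_add, Matrix.transpose_add, hp, hp']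
  | monomial k a => simp [aeval_monomial, Algebra.algebraMap_eq_smul_one]

theorem annCount_transpose (w : Matrix (Fin n) (Fin n) F) (f : F[X]) (hf : f.Monic) :
    annCount wᵀ f = annCount w f := by
  induction hd : f.natDegree using Nat.strong_induction_on generalizing f with
  | _ k ih =>
    classical
    have := finite_monic_dvd hf.ne_zero
    have := Fintype.ofFinite {g : F[X] // g.Monic ∧ g ∣ f}
    have h1 := card_ker_aeval_eq_sum w hf.ne_zero
    have h2 := card_ker_aeval_eq_sum wᵀ hf.ne_zero
    rw [aeval_transpose, card_ker_mulVec_transpose, h1,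
      ← Finset.add_sum_erase _ _ (Finset.mem_univ (⟨f, hf, dvd_rfl⟩ : {g : F[X] // g.Monic ∧ g ∣ f})),
      ← Finset.add_sum_erase _ (fun g : {g : F[X] // g.Monic ∧ g ∣ f} => annCount wᵀ g.1)
        (Finset.mem_univ (⟨f, hf, dvd_rfl⟩ : {g : F[X] // g.Monic ∧ g ∣ f}))] at h2
    have h3 : ∀ g ∈ Finset.univ.erase (⟨f, hf, dvd_rfl⟩ : {g : F[X] // g.Monic ∧ g ∣ f}),
        annCount w g.1 = annCount wᵀ g.1 := by
      intro g hg
      refine (ih g.1.natDegree ?_ g.1 g.2.1 rfl).symm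
      rw [← hd]
      refine lt_of_le_of_ne (natDegree_le_of_dvd g.2.2 hf.ne_zero) fun h => ?_
      have : g.1 = f :=
        (eq_of_monic_of_associated g.2.1 hf (associated_of_dvd_of_natDegree_le g.2.2 hf.ne_zero h.symm.le))
      exact (Finset.mem_erase.1 hg).1 (Subtype.ext this)
    rw [Finset.sum_congr rfl h3] at h2
    exact (Nat.add_right_cancel h2).symm

theorem annCount_le (w : Matrix (Fin n) (Fin n) F) (f : F[X]) :
    annCount w f ≤ Nat.card F ^ n := by
  have h := Nat.card_le_card_of_injective _
    (Subtype.val_injective (p := fun x : Fin n → F => ∀ p : F[X], aeval w p *ᵥ x = 0 ↔ f ∣ p))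
  rwa [card_vec, Nat.card_fin] at h

theorem exists_coeff_eq (hd : 0 < d) (y : Fin d → F) :
    ∃ p : F[X], p.natDegree < d ∧ ∀ i : Fin d, p.coeff i = y i := by
  refine ⟨∑ i : Fin d, monomial i (y i), ?_, fun i => ?_⟩
  · refine lt_of_le_of_lt ((natDegree_le_iff_coeff_eq_zero (n := d - 1)).2 fun N hN => ?_) (by omega)
    rw [finsetSum_coeff]
    refine Finset.sum_eq_zero fun i _ => ?_
    rw [coeff_monomial, if_neg (by omega)]
  · rw [finsetSum_coeff, Finset.sum_eq_single i]
    · simp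
    · intro j _ hj
      rw [coeff_monomial, if_neg fun h => hj (Fin.ext h)]
    · simp

theorem card_intertwining_eq_annCount (w : Matrix (Fin n) (Fin n) F) (f : F[X]) (hf : f.Monic)
    (hd : 0 < d) (hfd : f.natDegree = d) :
    Nat.card {X : Matrix (Fin n) (Fin d) F // Function.Injective X.mulVec ∧
      w * X = X * companion d f} = annCount w f := by
  set e : Fin d → F := Pi.single (⟨0, hd⟩ : Fin d) 1 with he
  have hcomm : ∀ X : Matrix (Fin n) (Fin d) F, w * X = X * companion d f → ∀ p : F[X],
      aeval w p * X = X * aeval (companion d f) p := by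
    intro X hX p
    induction p using Polynomial.induction_on' with
    | add p p' hp hp' => rw [map_add, map_add, Matrix.add_mul, Matrix.mul_add, hp, hp']
    | monomial k a =>
      have : ∀ k : ℕ, w ^ k * X = X * companion d f ^ k := by
        intro k
        induction k with
        | zero => simp
        | succ k ih => rw [pow_succ, Matrix.mul_assoc, hX, ← Matrix.mul_assoc, ih, pow_succ,
            Matrix.mul_assoc]
      rw [aeval_monomial, aeval_monomial, Algebra.algebraMap_eq_smul_one,
        Algebra.algebraMap_eq_smul_one, smul_one_mul, smul_one_mul, Matrix.smul_mul,
        Matrix.mul_smul, this]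
  refine Nat.card_congr (Equiv.ofBijective (fun X => ⟨X.1 *ᵥ e, fun p => ?_⟩) ⟨?_, ?_⟩)
  · rw [Matrix.mulVec_mulVec, hcomm _ X.2.2, ← Matrix.mulVec_mulVec,
      ← aeval_companion_mulVec_eq_zero_iff f hf hd hfd]
    constructor
    · intro h
      exact X.2.1 (by rw [h, Matrix.mulVec_zero])
    · intro h
      rw [h, Matrix.mulVec_zero]
  · rintro ⟨A, hA1, hA2⟩ ⟨B, hB1, hB2⟩ h
    have h1 : A *ᵥ e = B *ᵥ e := congrArg Subtype.val h
    refine Subtype.ext (sub_eq_zero.1 (eq_zero_of_mul_companion_pow f hd _ fun i _ => ?_))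
    have hp : companion d f ^ i = aeval (companion d f) (X : F[X]) ^ i := by simp
    rw [hp, ← map_pow, Matrix.mulVec_mulVec, Matrix.sub_mul, ← hcomm A hA2, ← hcomm B hB2,
      ← Matrix.mul_sub, ← Matrix.mulVec_mulVec, Matrix.sub_mulVec, h1, sub_self,
      Matrix.mulVec_zero]
  · rintro ⟨x, hx⟩
    set A : Matrix (Fin n) (Fin d) F := Matrix.of fun a i => (w ^ (i : ℕ) *ᵥ x) a with hA
    have hlow : ∀ p : F[X], p.natDegree < d →
        A *ᵥ (aeval (companion d f) p *ᵥ e) = aeval w p *ᵥ x := by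
      intro p hp
      rw [aeval_companion_mulVec_of_degree_lt f hd hp, aeval_mulVec_eq_sum w hp]
      funext a
      simp [hA, Matrix.mulVec, dotProduct, Finset.sum_apply, mul_comm]
    have hall : ∀ p : F[X], A *ᵥ (aeval (companion d f) p *ᵥ e) = aeval w p *ᵥ x := by
      intro p
      have h1 := hlow (p %ₘ f) (by
        have := natDegree_modByMonic_lt p hf (by rintro rfl; simp at hfd; omega)
        omega)
      have h2 : ∀ (m : ℕ) (B : Matrix (Fin m) (Fin m) F) (y : Fin m → F), aeval B f *ᵥ y = 0 →
          aeval B p *ᵥ y = aeval B (p %ₘ f) *ᵥ y := by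
        intro m B y hy
        conv_lhs => rw [← modByMonic_add_div p f]
        rw [map_add, Matrix.add_mulVec, mul_comm, map_mul, ← Matrix.mulVec_mulVec, hy,
          Matrix.mulVec_zero, add_zero]
      rw [h2 _ _ _ ((aeval_companion_mulVec_eq_zero_iff f hf hd hfd f).2 dvd_rfl),
        h2 _ _ _ ((hx f).2 dvd_rfl), h1]
    have hwA : w * A = A * companion d f := by
      refine sub_eq_zero.1 (eq_zero_of_mul_companion_pow f hd _ fun i _ => ?_)
      have h1 := hall (X ^ i)
      have h2 := hall (X ^ (i + 1))
      simp only [map_pow, aeval_X] at h1 h2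
      rw [pow_succ', pow_succ', ← Matrix.mulVec_mulVec, ← Matrix.mulVec_mulVec] at h2
      rw [Matrix.sub_mulVec, ← Matrix.mulVec_mulVec, ← Matrix.mulVec_mulVec, h1, h2, sub_self]
    refine ⟨⟨A, ?_, hwA⟩, ?_⟩
    · have : ∀ y, A *ᵥ y = 0 → y = 0 := by
        intro y hy
        obtain ⟨p, hp, hpy⟩ := exists_coeff_eq hd y
        have h1 := aeval_companion_mulVec_of_degree_lt f hd hp
        have h2 : (fun i : Fin d => p.coeff i) = y := funext hpy
        rw [h2] at h1
        rw [← h1]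
        rw [← h1, hall, hx] at hy
        exact (aeval_companion_mulVec_eq_zero_iff f hf hd hfd p).2 hy
      intro y y' h
      refine sub_eq_zero.1 (this _ ?_)
      rw [Matrix.mulVec_sub]
      exact sub_eq_zero.2 h
    · have := hall 1
      simpa using this

end Annihilator

section StableCount

open Matrix Polynomial Module

variable {F : Type*} [Field F] [Finite F] {n d : ℕ}

theorem exists_monic_of_stable_ker (A T : Matrix (Fin d) (Fin d) F)
    (h : ∀ y, A *ᵥ y = 0 → A *ᵥ (T *ᵥ y) = 0) :
    ∃ p : F[X], p.Monic ∧ p.natDegree = A.rank ∧ A * aeval T p = 0 := by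
  set K := LinearMap.ker A.mulVecLin with hK
  have hle : K ≤ K.comap T.mulVecLin := fun y hy => h y hy
  set θ := K.mapQ K T.mulVecLin hle with hθ
  have hpow : ∀ p : F[X], ∀ y : Fin d → F, aeval θ p (K.mkQ y) = K.mkQ (aeval T p *ᵥ y) := by
    intro p
    induction p using Polynomial.induction_on' with
    | add p p' hp hp' =>
      intro y
      rw [map_add, map_add, LinearMap.add_apply, hp, hp', Matrix.add_mulVec, map_add]
    | monomial k a =>
      intro y
      have h1 : ∀ (k : ℕ) y, (θ ^ k) (K.mkQ y) = K.mkQ (T ^ k *ᵥ y) := by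
        intro k
        induction k with
        | zero => intro y; simp
        | succ k ih =>
          intro y
          rw [pow_succ, Module.End.mul_apply, pow_succ, ← Matrix.mulVec_mulVec, ← ih]
          rfl
      rw [aeval_monomial, aeval_monomial, Algebra.algebraMap_eq_smul_one,
        Algebra.algebraMap_eq_smul_one, smul_one_mul, smul_one_mul, LinearMap.smul_apply, h1,
        Matrix.smul_mulVec, map_smul]
  refine ⟨θ.charpoly, θ.charpoly_monic, ?_, ?_⟩
  · rw [LinearMap.charpoly_natDegree]
    have h1 := K.finrank_quotient_add_finrank
    have h2 := LinearMap.finrank_range_add_finrank_ker A.mulVecLin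
    rw [← h2] at h1
    exact Nat.add_right_cancel h1
  · refine Matrix.toLin'.injective (LinearMap.ext fun y => ?_)
    have h1 := hpow θ.charpoly y
    rw [LinearMap.aeval_self_charpoly, LinearMap.zero_apply] at h1
    have h2 := (Submodule.Quotient.mk_eq_zero K).1 h1.symm
    replace h2 : A *ᵥ (aeval T θ.charpoly *ᵥ y) = 0 := h2
    rw [Matrix.toLin'_apply, ← Matrix.mulVec_mulVec, h2, map_zero, LinearMap.zero_apply]

/-- Matrices of rank `ρ` whose kernel is stable under a matrix with a cyclic vector. -/
theorem card_rank_stable_le (T : Matrix (Fin d) (Fin d) F) (e : Fin d → F)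
    (he : ∀ A : Matrix (Fin d) (Fin d) F, (∀ i < d, A *ᵥ (T ^ i *ᵥ e) = 0) → A = 0)
    {ρ : ℕ} (hρ : 0 < ρ) :
    Nat.card {A : Matrix (Fin d) (Fin d) F // A.rank = ρ ∧
      ∀ y, A *ᵥ y = 0 → A *ᵥ (T *ᵥ y) = 0} ≤ Nat.card F ^ ((d + 1) * ρ) := by
  have hcard : Nat.card ((Fin ρ → (Fin d → F)) × (Fin ρ → F)) = Nat.card F ^ ((d + 1) * ρ) := by
    simp only [Nat.card_prod, Nat.card_fun, Nat.card_fin]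
    ring
  rw [← hcard]
  have hex : ∀ A : {A : Matrix (Fin d) (Fin d) F // A.rank = ρ ∧
      ∀ y, A *ᵥ y = 0 → A *ᵥ (T *ᵥ y) = 0}, ∃ p : F[X], p.Monic ∧ p.natDegree = ρ ∧
        A.1 * aeval T p = 0 := fun A => by
    obtain ⟨p, h1, h2, h3⟩ := exists_monic_of_stable_ker A.1 T A.2.2
    exact ⟨p, h1, h2.trans A.2.1, h3⟩
  choose p hp1 hp2 hp3 using hex
  refine Nat.card_le_card_of_injective
    (fun A => (fun i => A.1 *ᵥ (T ^ (i : ℕ) *ᵥ e), fun i => (p A).coeff i)) ?_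
  intro A B h
  have h1 := congrArg Prod.fst h
  have h2 := congrArg Prod.snd h
  have hpAB : p A = p B := by
    ext k
    rcases lt_trichotomy k ρ with hk | hk | hk
    · exact congrFun h2 ⟨k, hk⟩
    · have hA := (hp1 A).coeff_natDegree
      have hB := (hp1 B).coeff_natDegree
      rw [hp2] at hA hB
      rw [hk, hA, hB]
    · rw [coeff_eq_zero_of_natDegree_lt (by rw [hp2]; exact hk),
        coeff_eq_zero_of_natDegree_lt (by rw [hp2]; exact hk)]
  have hred : ∀ A, ∀ r : F[X], A.1 *ᵥ (aeval T r *ᵥ e) =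
      ∑ i : Fin ρ, (r %ₘ p A).coeff i • (A.1 *ᵥ (T ^ (i : ℕ) *ᵥ e)) := by
    intro A r
    have hlt := natDegree_modByMonic_lt r (hp1 A) (by
      intro h; have := hp2 A; rw [h, natDegree_one] at this; omega)
    rw [hp2] at hlt
    conv_lhs => rw [← modByMonic_add_div r (p A), map_add, map_mul, Matrix.add_mulVec,
      Matrix.mulVec_add, ← Matrix.mulVec_mulVec, Matrix.mulVec_mulVec _ A.1 (aeval T (p A)),
      hp3, Matrix.zero_mulVec, add_zero, aeval_mulVec_eq_sum T hlt, Matrix.mulVec_sum]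
    exact Finset.sum_congr rfl fun i _ => by rw [Matrix.mulVec_smul]
  refine Subtype.ext (sub_eq_zero.1 (he _ fun i _ => ?_))
  have hA := hred A (X ^ i)
  have hB := hred B (X ^ i)
  rw [map_pow, aeval_X] at hA hB
  rw [Matrix.sub_mulVec, hA, hB, hpAB, sub_eq_zero]
  exact Finset.sum_congr rfl fun i _ => by
    rw [show A.1 *ᵥ (T ^ (i : ℕ) *ᵥ e) = B.1 *ᵥ (T ^ (i : ℕ) *ᵥ e) from congrFun h1 i]

theorem exists_mul_mulVec_injective {m : ℕ} (A : Matrix (Fin m) (Fin d) F) :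
    ∃ S : Matrix (Fin d) (Fin A.rank) F, Function.Injective (A * S).mulVec := by
  let b : Basis (Fin A.rank) F (LinearMap.range A.mulVecLin) := Module.finBasis F _
  have h : ∀ i, ∃ y, A *ᵥ y = (b i : Fin m → F) := fun i => (b i).2
  choose s hs using h
  refine ⟨Matrix.of fun a i => s i a, ?_⟩
  rw [Matrix.mulVec_injective_iff]
  have h1 := b.linearIndependent.map' (LinearMap.range A.mulVecLin).subtype
    (Submodule.ker_subtype _)
  have h2 : (A * Matrix.of fun a i => s i a).col =
      (LinearMap.range A.mulVecLin).subtype ∘ b := by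
    funext i
    exact hs i
  rw [h2]
  exact h1

/-- The number of matrices with prescribed products with an injective matrix on the right and a
surjective matrix on the left. -/
theorem card_sandwich_le (A A' : Matrix (Fin n) (Fin d) F) (C C' : Matrix (Fin d) (Fin n) F)
    (hA : Function.Injective A.mulVec) (hC : Function.Injective Cᵀ.mulVec) :
    Nat.card {z : Matrix (Fin n) (Fin n) F // z * A = A' ∧ C * z = C'} ≤
      Nat.card F ^ ((n - d) * (n - d)) := by
  obtain ⟨K, hK⟩ := Submodule.exists_isCompl (LinearMap.range A.mulVecLin)
  have hrA : finrank F (LinearMap.range A.mulVecLin) = d := by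
    rw [LinearMap.finrank_range_of_inj hA, Module.finrank_fin_fun]
  have hrC : finrank F (LinearMap.range C.mulVecLin) = d := by
    have : C.rank = d := by
      rw [← Matrix.rank_transpose, Matrix.rank, LinearMap.finrank_range_of_inj hC,
        Module.finrank_fin_fun]
    exact this
  have hkC := LinearMap.finrank_range_add_finrank_ker C.mulVecLin
  have hkA := Submodule.finrank_add_eq_of_isCompl hK
  rw [Module.finrank_fin_fun] at hkC hkA
  have hcard : Nat.card (K →ₗ[F] LinearMap.ker C.mulVecLin) =
      Nat.card F ^ ((n - d) * (n - d)) := by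
    rw [card_eq_pow_finrank' (F := F), Module.finrank_linearMap]
    congr 2 <;> omega
  rw [← hcard]
  rcases isEmpty_or_nonempty {z : Matrix (Fin n) (Fin n) F // z * A = A' ∧ C * z = C'} with h | h
  · rw [Nat.card_of_isEmpty]; exact Nat.zero_le _
  obtain ⟨z₀⟩ := h
  have : Finite (K →ₗ[F] LinearMap.ker C.mulVecLin) := Module.finite_of_finite F
  refine Nat.card_le_card_of_injective (fun z =>
    ((z.1 - z₀.1).mulVecLin.domRestrict K).codRestrict (LinearMap.ker C.mulVecLin) fun y => ?_) ?_
  · rw [LinearMap.mem_ker]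
    change C *ᵥ ((z.1 - z₀.1) *ᵥ (y : Fin n → F)) = 0
    rw [Matrix.mulVec_mulVec, Matrix.mul_sub, z.2.2, z₀.2.2, sub_self, Matrix.zero_mulVec]
  · intro z z' h
    have h1 : ∀ y ∈ K, z.1 *ᵥ y = z'.1 *ᵥ y := by
      intro y hy
      have h2 := congrArg Subtype.val (LinearMap.congr_fun h ⟨y, hy⟩)
      change (z.1 - z₀.1) *ᵥ y = (z'.1 - z₀.1) *ᵥ y at h2
      rw [Matrix.sub_mulVec, Matrix.sub_mulVec] at h2
      exact sub_left_injective h2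
    refine Subtype.ext (Matrix.toLin'.injective (LinearMap.ext fun y => ?_))
    obtain ⟨a, ⟨b, rfl⟩, c, hc, rfl⟩ := Submodule.mem_sup.1 (hK.sup_eq_top ▸ Submodule.mem_top (x := y))
    rw [Matrix.toLin'_apply, Matrix.toLin'_apply, Matrix.mulVec_add, Matrix.mulVec_add, h1 c hc,
      Matrix.mulVecLin_apply, Matrix.mulVec_mulVec, Matrix.mulVec_mulVec, z.2.1, z'.2.1]

end StableCount

section Cyclic

open Fin.CommRing

theorem fin_cyclic_induction {J : ℕ} {P : Fin (J + 1) → Prop} (a : Fin (J + 1)) (h : P a)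
    (step : ∀ i, P i → P (i + 1)) (b : Fin (J + 1)) : P b := by
  have h1 : ∀ m : ℕ, P (a + (m : Fin (J + 1))) := by
    intro m
    induction m with
    | zero => simpa using h
    | succ m ih =>
      have := step _ ih
      rwa [add_assoc, ← Nat.cast_succ] at this
  have h2 := h1 (b - a).val
  rwa [Fin.cast_val_eq_self, add_sub_cancel] at h2

theorem fin_cyclic_induction_back {J : ℕ} {P : Fin (J + 1) → Prop} (a : Fin (J + 1)) (h : P a)
    (step : ∀ i, P (i + 1) → P i) (b : Fin (J + 1)) : P b := by
  have h1 : ∀ m : ℕ, P (a - (m : Fin (J + 1))) := by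
    intro m
    induction m with
    | zero => simpa using h
    | succ m ih =>
      refine step _ ?_
      rwa [Nat.cast_succ, sub_add_eq_sub_sub, sub_add_cancel]
  have h2 := h1 (a - b).val
  rwa [Fin.cast_val_eq_self, sub_sub_cancel] at h2

end Cyclic

section Tuples

open Matrix Polynomial Module Fin.CommRing

variable {F : Type*} [Field F] [Finite F] {n d J : ℕ}

/-- The matrix `T` at the last index and the identity elsewhere. -/
def twist (T : Matrix (Fin d) (Fin d) F) (i : Fin (J + 1)) : Matrix (Fin d) (Fin d) F :=
  if i = Fin.last J then T else 1

theorem isUnit_twist {T : Matrix (Fin d) (Fin d) F} (hT : IsUnit T) (i : Fin (J + 1)) :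
    IsUnit (twist T i) := by
  unfold twist
  split_ifs
  · exact hT
  · exact isUnit_one

/-- Cyclic tuples of injective matrices intertwining the matrices `a i` with `T`. -/
def Primal (T : Matrix (Fin d) (Fin d) F) (a : Fin (J + 1) → Matrix (Fin n) (Fin n) F)
    (X : Fin (J + 1) → Matrix (Fin n) (Fin d) F) : Prop :=
  ∀ i, Function.Injective (X i).mulVec ∧ a i * X i = X (i + 1) * twist T i

/-- Cyclic tuples of surjective matrices intertwining the matrices `a i` with the transpose
of `T`. -/
def DualTuple (T : Matrix (Fin d) (Fin d) F) (a : Fin (J + 1) → Matrix (Fin n) (Fin n) F)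
    (Y : Fin (J + 1) → Matrix (Fin d) (Fin n) F) : Prop :=
  ∀ i, Function.Injective (Y i)ᵀ.mulVec ∧ Y (i + 1) * a i = (twist T i)ᵀ * Y i

/-- The products `a (k-1) * ⋯ * a 0`. -/
def partialProd (a : Fin (J + 1) → Matrix (Fin n) (Fin n) F) : ℕ → Matrix (Fin n) (Fin n) F
  | 0 => 1
  | k + 1 => a (k : Fin (J + 1)) * partialProd a k

/-- The products `a J * ⋯ * a k`, indexed by the number of factors. -/
def suffixProd (a : Fin (J + 1) → Matrix (Fin n) (Fin n) F) : ℕ → Matrix (Fin n) (Fin n) F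
  | 0 => 1
  | k + 1 => suffixProd a k * a (((J - k : ℕ)) : Fin (J + 1))

theorem suffixProd_mul_partialProd (a : Fin (J + 1) → Matrix (Fin n) (Fin n) F) (k : ℕ)
    (hk : k ≤ J + 1) : suffixProd a k * partialProd a (J + 1 - k) = partialProd a (J + 1) := by
  induction k with
  | zero => simp [suffixProd]
  | succ k ih =>
    rw [← ih (by omega), suffixProd, show J + 1 - k = (J - k) + 1 from by omega, partialProd,
      show J + 1 - (k + 1) = J - k from by omega, Matrix.mul_assoc]

theorem injective_mulVec_of_mul {m k l : ℕ} {A : Matrix (Fin m) (Fin k) F}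
    {B : Matrix (Fin k) (Fin l) F}
    (h : Function.Injective (A * B).mulVec) : Function.Injective B.mulVec := by
  intro x y hxy
  apply h
  rw [← Matrix.mulVec_mulVec, ← Matrix.mulVec_mulVec, hxy]

theorem injective_mulVec_mul {m k l : ℕ} {A : Matrix (Fin m) (Fin k) F}
    {B : Matrix (Fin k) (Fin l) F} (hA : Function.Injective A.mulVec)
    (hB : Function.Injective B.mulVec) : Function.Injective (A * B).mulVec := by
  intro x y hxy
  rw [← Matrix.mulVec_mulVec, ← Matrix.mulVec_mulVec] at hxy
  exact hB (hA hxy)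

theorem injective_mulVec_of_isUnit {T : Matrix (Fin d) (Fin d) F} (hT : IsUnit T) :
    Function.Injective T.mulVec := Matrix.mulVec_injective_iff_isUnit.2 hT

theorem natCast_ne_last {k : ℕ} (hk : k < J) : (k : Fin (J + 1)) ≠ Fin.last J := by
  intro h
  have := congrArg Fin.val h
  rw [Fin.val_natCast, Nat.mod_eq_of_lt (by omega), Fin.val_last] at this
  omega

theorem natCast_eq_last : (J : Fin (J + 1)) = Fin.last J := by
  apply Fin.ext
  rw [Fin.val_natCast, Nat.mod_eq_of_lt (by omega), Fin.val_last]

theorem card_primal {T : Matrix (Fin d) (Fin d) F} (hT : IsUnit T)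
    (a : Fin (J + 1) → Matrix (Fin n) (Fin n) F) :
    Nat.card {X // Primal T a X} = Nat.card {X : Matrix (Fin n) (Fin d) F //
      Function.Injective X.mulVec ∧ partialProd a (J + 1) * X = X * T} := by
  have hval : ∀ X, Primal T a X → ∀ k ≤ J, X (k : Fin (J + 1)) = partialProd a k * X 0 := by
    intro X hX k
    induction k with
    | zero => intro _; simp [partialProd]
    | succ k ih =>
      intro hk
      have h1 := (hX (k : Fin (J + 1))).2
      rw [twist, if_neg (natCast_ne_last (by omega)), Matrix.mul_one] at h1
      rw [Nat.cast_succ, ← h1, ih (by omega), partialProd, Matrix.mul_assoc]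
  refine Nat.card_congr (Equiv.ofBijective (fun X => ⟨X.1 0, (X.2 0).1, ?_⟩) ⟨?_, ?_⟩)
  · have h1 := (X.2 (J : Fin (J + 1))).2
    rw [twist, if_pos natCast_eq_last, hval X.1 X.2 J le_rfl, ← Matrix.mul_assoc] at h1
    rw [partialProd, h1, natCast_eq_last, Fin.last_add_one]
  · rintro ⟨X, hX⟩ ⟨Y, hY⟩ h
    have h0 : X 0 = Y 0 := congrArg Subtype.val h
    refine Subtype.ext (funext fun i => ?_)
    have h1 := hval X hX i (by omega)
    have h2 := hval Y hY i (by omega)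
    rw [Fin.cast_val_eq_self] at h1 h2
    change X i = Y i
    rw [h1, h2, h0]
  · rintro ⟨X, hX, hwX⟩
    refine ⟨⟨fun i => partialProd a i * X, fun i => ⟨?_, ?_⟩⟩, ?_⟩
    · have h1 := suffixProd_mul_partialProd a (J + 1 - i) (by omega)
      rw [show J + 1 - (J + 1 - i) = (i : ℕ) from by omega] at h1
      have h2 : Function.Injective (suffixProd a (J + 1 - i) * (partialProd a i * X)).mulVec := by
        rw [← Matrix.mul_assoc, h1, hwX]
        exact injective_mulVec_mul hX (injective_mulVec_of_isUnit hT)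
      exact injective_mulVec_of_mul h2
    · beta_reduce
      rcases eq_or_ne i (Fin.last J) with rfl | hi
      · rw [Fin.last_add_one, twist, if_pos rfl, Fin.val_zero, partialProd, Matrix.one_mul, ← hwX,
          ← Matrix.mul_assoc, Fin.val_last, partialProd, natCast_eq_last]
      · have h1 : ((i + 1 : Fin (J + 1)) : ℕ) = i + 1 :=
          Fin.val_add_one_of_lt (lt_of_le_of_ne (Fin.le_last i) hi)
        rw [twist, if_neg hi, Matrix.mul_one, h1, partialProd, Fin.cast_val_eq_self,
          Matrix.mul_assoc]
    · exact Subtype.ext (by simp [partialProd])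

theorem le_card_dualTuple {T : Matrix (Fin d) (Fin d) F} (hT : IsUnit T)
    (a : Fin (J + 1) → Matrix (Fin n) (Fin n) F) :
    Nat.card {X : Matrix (Fin n) (Fin d) F // Function.Injective X.mulVec ∧
      (partialProd a (J + 1))ᵀ * X = X * T} ≤ Nat.card {Y // DualTuple T a Y} := by
  have hT' : IsUnit Tᵀ.det := by rw [Matrix.det_transpose]; exact (Matrix.isUnit_iff_isUnit_det _).1 hT
  have hT1 : Tᵀ * Tᵀ⁻¹ = 1 := Matrix.mul_nonsing_inv _ hT'
  have hT2 : Tᵀ⁻¹ * Tᵀ = 1 := Matrix.nonsing_inv_mul _ hT'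
  have hw : ∀ X : Matrix (Fin n) (Fin d) F, (partialProd a (J + 1))ᵀ * X = X * T →
      Xᵀ * partialProd a (J + 1) = Tᵀ * Xᵀ := by
    intro X h
    have := congrArg Matrix.transpose h
    rwa [Matrix.transpose_mul, Matrix.transpose_mul, Matrix.transpose_transpose] at this
  have h0 : ∀ X : Matrix (Fin n) (Fin d) F, (partialProd a (J + 1))ᵀ * X = X * T →
      Tᵀ⁻¹ * Xᵀ * suffixProd a (J + 1) = Xᵀ := by
    intro X h
    have h1 := suffixProd_mul_partialProd a (J + 1) le_rfl
    rw [Nat.sub_self, partialProd, Matrix.mul_one] at h1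
    rw [h1, Matrix.mul_assoc, hw X h, ← Matrix.mul_assoc, hT2, Matrix.one_mul]
  refine Nat.card_le_card_of_injective (fun X =>
    ⟨fun i => Tᵀ⁻¹ * X.1ᵀ * suffixProd a (J + 1 - i), fun i => ⟨?_, ?_⟩⟩) ?_
  · have h1 := suffixProd_mul_partialProd a (J + 1 - i) (by omega)
    rw [show J + 1 - (J + 1 - i) = (i : ℕ) from by omega] at h1
    have h2 : Tᵀ⁻¹ * X.1ᵀ * suffixProd a (J + 1 - i) * partialProd a i = X.1ᵀ := by
      rw [Matrix.mul_assoc, h1, Matrix.mul_assoc, hw X.1 X.2.2, ← Matrix.mul_assoc, hT2,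
        Matrix.one_mul]
    refine injective_mulVec_of_mul (A := (partialProd a i)ᵀ) ?_
    rw [← Matrix.transpose_mul, h2, Matrix.transpose_transpose]
    exact X.2.1
  · beta_reduce
    rcases eq_or_ne i (Fin.last J) with rfl | hi
    · rw [Fin.last_add_one, twist, if_pos rfl, Fin.val_zero, Nat.sub_zero, h0 X.1 X.2.2,
        Fin.val_last, Nat.add_sub_cancel_left, ← Matrix.mul_assoc, ← Matrix.mul_assoc, hT1,
        Matrix.one_mul, suffixProd, suffixProd, Matrix.one_mul, Nat.sub_zero, natCast_eq_last]
    · have hlt := lt_of_le_of_ne (Fin.le_last i) hi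
      have h1 : ((i + 1 : Fin (J + 1)) : ℕ) = i + 1 := Fin.val_add_one_of_lt hlt
      have h2 : (i : ℕ) < J := hlt
      rw [twist, if_neg hi, Matrix.transpose_one, Matrix.one_mul, h1,
        show J + 1 - i = (J + 1 - (i + 1)) + 1 from by omega, suffixProd,
        show J - (J + 1 - (↑i + 1)) = (i : ℕ) from by omega, Fin.cast_val_eq_self,
        ← Matrix.mul_assoc]
  · intro X Y h
    have h1 := congrFun (congrArg Subtype.val h) 0
    simp only [Fin.val_zero, Nat.sub_zero] at h1
    rw [h0 X.1 X.2.2, h0 Y.1 Y.2.2] at h1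
    exact Subtype.ext (Matrix.transpose_injective h1)

end Tuples

section SecondMoment

open Matrix Polynomial Module

variable {F : Type*} [Field F] [Finite F] {n d J : ℕ}

/-- Pairs of tuples dual to consistent pairs of primal and dual tuples. -/
def ConsistentPair (T : Matrix (Fin d) (Fin d) F) (k : Fin (J + 1) → Matrix (Fin n) (Fin n) F)
    (X : Fin (J + 1) → Matrix (Fin n) (Fin d) F) (E : Fin (J + 1) → Matrix (Fin d) (Fin d) F) :
    Prop :=
  (∀ i, Function.Injective (X i).mulVec) ∧
    ∀ i, X (i + 1) * twist T i * E i = k (i + 1) * X (i + 1) * (E (i + 1) * (twist T (i + 1))ᵀ)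

theorem card_tuple (m l : ℕ) (I : Type*) [Finite I] :
    Nat.card (I → Matrix (Fin m) (Fin l) F) = Nat.card F ^ (m * l * Nat.card I) := by
  rw [Nat.card_fun, card_matrix, ← pow_mul]

theorem card_consistent_dual (T : Matrix (Fin d) (Fin d) F)
    (k : Fin (J + 1) → Matrix (Fin n) (Fin n) F)
    (X : Fin (J + 1) → Matrix (Fin n) (Fin d) F) :
    Nat.card {Y : Fin (J + 1) → Matrix (Fin d) (Fin n) F //
        ∀ i, Y (i + 1) * X (i + 1) * twist T i = (twist T i)ᵀ * Y i * k i * X i} *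
        Nat.card F ^ (d * d * (J + 1)) =
      Nat.card F ^ (d * n * (J + 1)) * Nat.card {E : Fin (J + 1) → Matrix (Fin d) (Fin d) F //
        ∀ i, X (i + 1) * twist T i * E i =
          k (i + 1) * X (i + 1) * (E (i + 1) * (twist T (i + 1))ᵀ)} := by
  let L : (Fin (J + 1) → Matrix (Fin d) (Fin n) F) →ₗ[F] (Fin (J + 1) → Matrix (Fin d) (Fin d) F) :=
    { toFun := fun Y i => Y (i + 1) * X (i + 1) * twist T i - (twist T i)ᵀ * Y i * k i * X i
      map_add' := fun Y Z => by
        funext i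
        simp only [Pi.add_apply, Matrix.add_mul, Matrix.mul_add]; abel
      map_smul' := fun a X => by
        funext i
        simp only [Pi.smul_apply, Matrix.smul_mul, Matrix.mul_smul, smul_sub, RingHom.id_apply] }
  have h := card_ker_mul_card L (tracePairing (Fin (J + 1)) d d)
    (tracePairing_injective (Fin (J + 1)) d d) rfl
  rw [card_tuple, card_tuple, Nat.card_fin] at h
  have h1 : Nat.card {Y // L Y = 0} = Nat.card {Y : Fin (J + 1) → Matrix (Fin d) (Fin n) F //
        ∀ i, Y (i + 1) * X (i + 1) * twist T i = (twist T i)ᵀ * Y i * k i * X i} := by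
    refine Nat.card_congr (Equiv.subtypeEquivRight fun Y => ?_)
    rw [funext_iff]
    exact forall_congr' fun i => sub_eq_zero
  rw [← h1, h]
  congr 1
  refine Nat.card_congr (Equiv.subtypeEquivRight fun E => ?_)
  have hval : ∀ Y, tracePairing (Fin (J + 1)) d d E (L Y) = tracePairing (Fin (J + 1)) n d Y
      (fun i => X i * twist T (i - 1) * E (i - 1) - k i * X i * (E i * (twist T i)ᵀ)) := by
    intro Y
    rw [tracePairing_apply, tracePairing_apply]
    simp only [L, LinearMap.coe_mk, AddHom.coe_mk, Matrix.mul_sub, Matrix.trace_sub,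
      Finset.sum_sub_distrib]
    congr 1
    · conv_rhs => rw [← Equiv.sum_comp (Equiv.addRight (1 : Fin (J + 1)))]
      refine Finset.sum_congr rfl fun i _ => ?_
      simp only [Equiv.coe_addRight, add_sub_cancel_right]
      rw [Matrix.trace_mul_comm]
      simp only [Matrix.mul_assoc]
    · refine Finset.sum_congr rfl fun i _ => ?_
      rw [show E i * ((twist T i)ᵀ * Y i * k i * X i) = (E i * (twist T i)ᵀ) * (Y i * (k i * X i)) from
        by simp only [Matrix.mul_assoc], Matrix.trace_mul_comm]
      simp only [Matrix.mul_assoc]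
  constructor
  · intro hE i
    have h2 : tracePairing (Fin (J + 1)) d n
      (fun i => X i * twist T (i - 1) * E (i - 1) - k i * X i * (E i * (twist T i)ᵀ)) = 0 := by
      refine LinearMap.ext fun Y => ?_
      have := hE Y
      rw [hval, tracePairing_apply] at this
      rw [tracePairing_apply, LinearMap.zero_apply, ← this]
      exact Finset.sum_congr rfl fun i _ => Matrix.trace_mul_comm _ _
    have h3 := congrFun ((injective_iff_map_eq_zero _).1
      (tracePairing_injective (F := F) (Fin (J + 1)) d n) _ h2) (i + 1)
    simp only [add_sub_cancel_right, Pi.zero_apply] at h3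
    exact sub_eq_zero.1 h3
  · intro hE Y
    have h2 : (fun i => X i * twist T (i - 1) * E (i - 1) - k i * X i * (E i * (twist T i)ᵀ)) = 0 := by
      funext i
      have := hE (i - 1)
      rw [sub_add_cancel] at this
      rw [this, sub_self, Pi.zero_apply]
    rw [hval, h2, map_zero]

theorem card_sandwich_tuple_le {A A' : Fin (J + 1) → Matrix (Fin n) (Fin d) F}
    {C C' : Fin (J + 1) → Matrix (Fin d) (Fin n) F}
    (hA : ∀ i, Function.Injective (A i).mulVec) (hC : ∀ i, Function.Injective (C i)ᵀ.mulVec) :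
    Nat.card {z : Fin (J + 1) → Matrix (Fin n) (Fin n) F //
      ∀ i, z i * A i = A' i ∧ C i * z i = C' i} ≤ Nat.card F ^ ((n - d) * (n - d) * (J + 1)) := by
  rw [Nat.card_congr (Equiv.subtypePiEquivPi
    (p := fun i (z : Matrix (Fin n) (Fin n) F) => z * A i = A' i ∧ C i * z = C' i)), Nat.card_pi]
  refine (Finset.prod_le_prod' fun i _ => card_sandwich_le (A i) (A' i) (C i) (C' i) (hA i) (hC i)).trans ?_
  rw [Finset.prod_const, Finset.card_univ, Fintype.card_fin, ← pow_mul]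

/-- The second moment of the number of primal tuples is controlled by consistent pairs. -/
theorem sum_primal_mul_dual_le (hdn : d ≤ n) (T : Matrix (Fin d) (Fin d) F)
    (u v : Fin (J + 1) → GL (Fin n) F) [Fintype (Fin (J + 1) → Matrix (Fin n) (Fin n) F)] :
    (∑ z : Fin (J + 1) → Matrix (Fin n) (Fin n) F,
        Nat.card {X // Primal T (fun i => z i * (u i).1) X} *
        Nat.card {Y // DualTuple T (fun i => z i * (v i).1) Y}) * Nat.card F ^ (n * d * (J + 1)) ≤
      Nat.card F ^ (n * n * (J + 1)) *
        Nat.card {p : (Fin (J + 1) → Matrix (Fin n) (Fin d) F) ×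
          (Fin (J + 1) → Matrix (Fin d) (Fin d) F) //
            ConsistentPair T (fun i => ((v i)⁻¹ * u i).1) p.1 p.2} := by
  classical
  have := Fintype.ofFinite (Fin (J + 1) → Matrix (Fin n) (Fin d) F)
  set q := Nat.card F with hq
  set k : Fin (J + 1) → Matrix (Fin n) (Fin n) F := fun i => ((v i)⁻¹ * u i).1 with hk
  set cons : (Fin (J + 1) → Matrix (Fin n) (Fin d) F) →
      (Fin (J + 1) → Matrix (Fin d) (Fin n) F) → Prop := fun X Y =>
    (∀ i, Function.Injective (X i).mulVec) ∧
      ∀ i, Y (i + 1) * X (i + 1) * twist T i = (twist T i)ᵀ * Y i * k i * X i with hcons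
  -- pairs of tuples
  have h1 : ∑ z : Fin (J + 1) → Matrix (Fin n) (Fin n) F,
        Nat.card {X // Primal T (fun i => z i * (u i).1) X} *
        Nat.card {Y // DualTuple T (fun i => z i * (v i).1) Y} ≤
      Nat.card {p : (Fin (J + 1) → Matrix (Fin n) (Fin d) F) ×
        (Fin (J + 1) → Matrix (Fin d) (Fin n) F) // cons p.1 p.2} *
          q ^ ((n - d) * (n - d) * (J + 1)) := by
    have h2 : ∑ z : Fin (J + 1) → Matrix (Fin n) (Fin n) F,
        Nat.card {X // Primal T (fun i => z i * (u i).1) X} *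
        Nat.card {Y // DualTuple T (fun i => z i * (v i).1) Y} =
      Nat.card (Σ z : Fin (J + 1) → Matrix (Fin n) (Fin n) F,
        {X // Primal T (fun i => z i * (u i).1) X} ×
        {Y // DualTuple T (fun i => z i * (v i).1) Y}) := by
      rw [Nat.card_sigma]
      simp only [Nat.card_prod]
    rw [h2]
    refine card_le_mul_of_fibre_le (fun s => ⟨(s.2.1.1, s.2.2.1), fun i => (s.2.1.2 i).1, fun i => ?_⟩)
      _ ?_
    swap
    · have hX := (s.2.1.2 i).2
      have hY := (s.2.2.2 i).2
      have hv : (v i).1 * ((v i)⁻¹).1 = 1 := by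
        rw [← Units.val_mul, mul_inv_cancel, Units.val_one]
      rw [Matrix.mul_assoc, ← hX, ← hY]
      simp only [hk, Units.val_mul, Matrix.mul_assoc]
      rw [← Matrix.mul_assoc (v i).1, hv, Matrix.one_mul]
    · rintro ⟨⟨X, Y⟩, hXY⟩
      by_cases hY : ∀ i, Function.Injective (Y i)ᵀ.mulVec
      · refine le_trans (Nat.card_le_card_of_injective (fun s => (⟨s.1.1, fun i => ?_⟩ :
          {z : Fin (J + 1) → Matrix (Fin n) (Fin n) F //
            ∀ i, z i * ((u i).1 * X i) = X (i + 1) * twist T i ∧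
              Y (i + 1) * z i = (twist T i)ᵀ * Y i * ((v i)⁻¹).1})) ?_)
          (card_sandwich_tuple_le (fun i => injective_mulVec_mul
            (injective_mulVec_of_isUnit (u i).isUnit) (hXY.1 i)) fun i => hY (i + 1))
        · have hs := congrArg Subtype.val s.2
          have hs1 : s.1.2.1.1 = X := congrArg Prod.fst hs
          have hs2 : s.1.2.2.1 = Y := congrArg Prod.snd hs
          have hX' := (s.1.2.1.2 i).2
          have hY' := (s.1.2.2.2 i).2
          rw [hs1] at hX'
          rw [hs2] at hY'
          refine ⟨by rw [← Matrix.mul_assoc]; exact hX', ?_⟩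
          have hv : (v i).1 * ((v i)⁻¹).1 = 1 := by
            rw [← Units.val_mul, mul_inv_cancel, Units.val_one]
          rw [← hY', Matrix.mul_assoc, Matrix.mul_assoc, hv, Matrix.mul_one]
        · rintro ⟨⟨z, ⟨X₁, hX₁⟩, ⟨Y₁, hY₁⟩⟩, hs⟩ ⟨⟨z', ⟨X₂, hX₂⟩, ⟨Y₂, hY₂⟩⟩, hs'⟩ h
          obtain rfl : z = z' := congrArg Subtype.val h
          have e1 := congrArg Subtype.val (hs.trans hs'.symm)
          obtain rfl : X₁ = X₂ := congrArg Prod.fst e1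
          obtain rfl : Y₁ = Y₂ := congrArg Prod.snd e1
          rfl
      · refine le_of_eq_of_le ?_ (Nat.zero_le _)
        rw [Nat.card_eq_zero]
        refine Or.inl ⟨fun s => hY fun i => ?_⟩
        have hs2 : s.1.2.2.1 = Y := congrArg Prod.snd (congrArg Subtype.val s.2)
        rw [← hs2]
        exact (s.1.2.2.2 i).1
  have h3 : Nat.card {p : (Fin (J + 1) → Matrix (Fin n) (Fin d) F) ×
        (Fin (J + 1) → Matrix (Fin d) (Fin n) F) // cons p.1 p.2} * q ^ (d * d * (J + 1)) =
      q ^ (d * n * (J + 1)) * Nat.card {p : (Fin (J + 1) → Matrix (Fin n) (Fin d) F) ×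
          (Fin (J + 1) → Matrix (Fin d) (Fin d) F) // ConsistentPair T k p.1 p.2} := by
    rw [card_sigma_subtype, card_sigma_subtype, Finset.sum_mul, Finset.mul_sum]
    refine Finset.sum_congr rfl fun X _ => ?_
    by_cases hX : ∀ i, Function.Injective (X i).mulVec
    · have := card_consistent_dual T k X
      simp only [hcons, ConsistentPair, hX, implies_true, true_and]
      exact this
    · simp [hcons, ConsistentPair, hX]
  set R := Nat.card {p : (Fin (J + 1) → Matrix (Fin n) (Fin d) F) ×
          (Fin (J + 1) → Matrix (Fin d) (Fin d) F) // ConsistentPair T k p.1 p.2}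
  have hqpos : 0 < q ^ (d * d * (J + 1)) := pow_pos Nat.card_pos _
  refine Nat.le_of_mul_le_mul_right ?_ hqpos
  calc _ ≤ (Nat.card {p : (Fin (J + 1) → Matrix (Fin n) (Fin d) F) ×
        (Fin (J + 1) → Matrix (Fin d) (Fin n) F) // cons p.1 p.2} *
          q ^ ((n - d) * (n - d) * (J + 1))) * q ^ (n * d * (J + 1)) * q ^ (d * d * (J + 1)) := by
        gcongr
    _ = (q ^ (d * n * (J + 1)) * R) * q ^ ((n - d) * (n - d) * (J + 1)) * q ^ (n * d * (J + 1)) := by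
        rw [← h3]; ring
    _ = q ^ (n * n * (J + 1)) * R * q ^ (d * d * (J + 1)) := by
        obtain ⟨r, rfl⟩ := Nat.exists_eq_add_of_le hdn
        rw [Nat.add_sub_cancel_left]
        ring

end SecondMoment

section ConsistentCount

open Matrix Polynomial Module

variable {F : Type*} [Field F] [Finite F] {n d J : ℕ}

namespace ConsistentPair

variable {T : Matrix (Fin d) (Fin d) F} {k : Fin (J + 1) → GL (Fin n) F}
  {X X' : Fin (J + 1) → Matrix (Fin n) (Fin d) F} {E E' : Fin (J + 1) → Matrix (Fin d) (Fin d) F}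

theorem mulVec_eq_zero_iff (hT : IsUnit T) (h : ConsistentPair T (fun i => (k i).1) X E)
    (i : Fin (J + 1)) (y : Fin d → F) :
    E i *ᵥ y = 0 ↔ (E (i + 1) * (twist T (i + 1))ᵀ) *ᵥ y = 0 := by
  have h1 := congrArg (fun A => A *ᵥ y) (h.2 i)
  simp only [← Matrix.mulVec_mulVec] at h1 ⊢
  have hX := h.1 (i + 1)
  have hk := injective_mulVec_of_isUnit (k (i + 1)).isUnit
  have hB := injective_mulVec_of_isUnit (isUnit_twist hT i)
  constructor
  · intro h0
    rw [h0, Matrix.mulVec_zero, Matrix.mulVec_zero] at h1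
    apply hX
    apply hk
    rw [← h1, Matrix.mulVec_zero, Matrix.mulVec_zero]
  · intro h0
    rw [h0, Matrix.mulVec_zero, Matrix.mulVec_zero] at h1
    apply hB
    apply hX
    rw [h1, Matrix.mulVec_zero, Matrix.mulVec_zero]

theorem stable (hT : IsUnit T) (h : ConsistentPair T (fun i => (k i).1) X E)
    (i : Fin (J + 1)) (y : Fin d → F) (hy : E i *ᵥ y = 0) : E i *ᵥ (Tᵀ *ᵥ y) = 0 := by
  have hall : ∀ i, ∀ y, E i *ᵥ y = 0 ↔ E (Fin.last J) *ᵥ y = 0 := by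
    refine fin_cyclic_induction (Fin.last J) (fun y => Iff.rfl) fun i hi y => ?_
    by_cases hl : i + 1 = Fin.last J
    · rw [hl]
    · rw [← hi y, h.mulVec_eq_zero_iff hT i y, twist, if_neg hl, Matrix.transpose_one,
        Matrix.mul_one]
  have h1 := h.mulVec_eq_zero_iff hT (Fin.last J - 1) y
  rw [sub_add_cancel, twist, if_pos rfl, hall, ← Matrix.mulVec_mulVec] at h1
  rw [hall]
  exact h1.1 ((hall i y).1 hy)

theorem determined (hT : IsUnit T) (h : ConsistentPair T (fun i => (k i).1) X E)
    (h' : ConsistentPair T (fun i => (k i).1) X' E') (p : Fin (J + 1))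
    (hX : ∀ i, i ≠ p + 1 → X i = X' i) (hE : E p = E' p) : E = E' := by
  funext i
  refine fin_cyclic_induction_back (P := fun i => E i = E' i) p hE (fun i hi => ?_) i
  by_cases hip : i = p
  · rw [hip]; exact hE
  have hne : i + 1 ≠ p + 1 := fun hh => hip (add_right_cancel hh)
  have h1 := h.2 i
  have h2 := h'.2 i
  rw [hi, hX _ hne, ← h2] at h1
  have hinj : Function.Injective (X' (i + 1) * twist T i).mulVec :=
    injective_mulVec_mul (h'.1 _) (injective_mulVec_of_isUnit (isUnit_twist hT i))
  refine Matrix.toLin'.injective (LinearMap.ext fun y => hinj ?_)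
  have := congrArg (fun A => A *ᵥ y) h1
  simpa only [← Matrix.mulVec_mulVec, Matrix.toLin'_apply] using this

theorem rank_eq (hT : IsUnit T) (h : ConsistentPair T (fun i => (k i).1) X E) (i : Fin (J + 1)) :
    (E (i + 1) * (twist T (i + 1))ᵀ).rank = (E i).rank := by
  have hker : LinearMap.ker (E (i + 1) * (twist T (i + 1))ᵀ).mulVecLin =
      LinearMap.ker (E i).mulVecLin := by
    ext y
    exact (h.mulVec_eq_zero_iff hT i y).symm
  have h1 := LinearMap.finrank_range_add_finrank_ker (E (i + 1) * (twist T (i + 1))ᵀ).mulVecLin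
  have h2 := LinearMap.finrank_range_add_finrank_ker (E i).mulVecLin
  rw [hker, ← h2] at h1
  exact Nat.add_right_cancel h1

end ConsistentPair

theorem card_consistent_rank_le {T : Matrix (Fin d) (Fin d) F} (hT : IsUnit T) (e : Fin d → F)
    (he : ∀ A : Matrix (Fin d) (Fin d) F, (∀ i < d, A *ᵥ (Tᵀ ^ i *ᵥ e) = 0) → A = 0)
    (k : Fin (J + 1) → GL (Fin n) F) (p : Fin (J + 1)) {t g : ℕ}
    (hgood : GoodElt t g (k (p + 1)).1) (htg : n ≤ g * (t + 1)) {ρ : ℕ} (hρ : 0 < ρ) :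
    Nat.card {x : (Fin (J + 1) → Matrix (Fin n) (Fin d) F) ×
        (Fin (J + 1) → Matrix (Fin d) (Fin d) F) //
          ConsistentPair T (fun i => (k i).1) x.1 x.2 ∧ (x.2 p).rank = ρ} * Nat.card F ^ (n * ρ) ≤
      Nat.card F ^ (n * d * (J + 1)) * Nat.card F ^ ((d + 1 + g) * ρ) := by
  have key : ∀ A : Matrix (Fin d) (Fin d) F, A.rank = ρ →
      ∃ S : Matrix (Fin d) (Fin ρ) F, Function.Injective (A * S).mulVec := by
    rintro A rfl
    exact exists_mul_mulVec_injective A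
  set q := Nat.card F with hq
  have hqpos : 0 < q := Nat.card_pos
  set St := {A : Matrix (Fin d) (Fin d) F // A.rank = ρ ∧ ∀ y, A *ᵥ y = 0 → A *ᵥ (Tᵀ *ᵥ y) = 0}
    with hSt
  have hStc : Nat.card St ≤ q ^ ((d + 1) * ρ) := card_rank_stable_le Tᵀ e he hρ
  set Rest := {i : Fin (J + 1) // i ≠ p + 1} → Matrix (Fin n) (Fin d) F with hRest
  have hRc : Nat.card Rest = q ^ (n * d * J) := by
    have h1 : Nat.card {i : Fin (J + 1) // i ≠ p + 1} = J := by
      rw [Nat.card_eq_fintype_card, Fintype.card_subtype_compl, Fintype.card_fin,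
        Fintype.card_subtype_eq]
      simp
    rw [hRest, card_tuple, h1]
  set Sol := {x : (Fin (J + 1) → Matrix (Fin n) (Fin d) F) ×
        (Fin (J + 1) → Matrix (Fin d) (Fin d) F) //
          ConsistentPair T (fun i => (k i).1) x.1 x.2 ∧ (x.2 p).rank = ρ} with hSol
  let φ : Sol → Rest × St := fun x => (fun i => x.1.1 i.1,
    ⟨x.1.2 p, x.2.2, x.2.1.stable hT p⟩)
  set κ := q ^ (n * d) * q ^ (g * ρ) / q ^ (n * ρ) with hκ
  have hfib : ∀ b, Nat.card {x // φ x = b} ≤ κ := by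
    intro b
    rcases isEmpty_or_nonempty {x // φ x = b} with hem | hne
    · rw [Nat.card_of_isEmpty]; exact Nat.zero_le _
    obtain ⟨⟨x₀, h₀⟩⟩ := hne
    have hdet : ∀ x : {x // φ x = b}, x.1.1.2 = x₀.1.2 := by
      intro x
      have hx := x.2.trans h₀.symm
      refine x.1.2.1.determined hT x₀.2.1 p (fun i hi => ?_) ?_
      · exact congrFun (congrArg Prod.fst hx) ⟨i, hi⟩
      · exact congrArg Subtype.val (congrArg Prod.snd hx)
    have hrank := (x₀.2.1.rank_eq hT p).trans x₀.2.2
    obtain ⟨S, hS⟩ : ∃ S : Matrix (Fin d) (Fin ρ) F,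
        Function.Injective (x₀.1.2 (p + 1) * (twist T (p + 1))ᵀ * S).mulVec := by
      exact key _ hrank
    have hI := card_intertwining_matrices_le hgood htg (twist T p * x₀.1.2 p * S)
      (x₀.1.2 (p + 1) * (twist T (p + 1))ᵀ * S) hS
    rw [hκ, Nat.le_div_iff_mul_le (pow_pos hqpos _)]
    refine le_trans (Nat.mul_le_mul_right _ ?_) hI
    refine Nat.card_le_card_of_injective (fun x => ⟨x.1.1.1 (p + 1), ?_⟩) ?_
    · have := x.1.2.1.2 p
      rw [hdet x] at this
      simp only [← Matrix.mul_assoc] at this ⊢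
      rw [this]
    · rintro ⟨⟨⟨X, E⟩, h⟩, hx⟩ ⟨⟨⟨X', E'⟩, h'⟩, hx'⟩ heq
      have h1 : X (p + 1) = X' (p + 1) := congrArg Subtype.val heq
      have hE : E = E' := (hdet ⟨⟨⟨X, E⟩, h⟩, hx⟩).trans (hdet ⟨⟨⟨X', E'⟩, h'⟩, hx'⟩).symm
      have hX : X = X' := by
        funext i
        by_cases hi : i = p + 1
        · rw [hi, h1]
        · exact congrFun (congrArg Prod.fst (hx.trans hx'.symm)) ⟨i, hi⟩
      subst hE hX
      rfl
  have h1 := card_le_mul_of_fibre_le φ κ hfib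
  calc Nat.card Sol * q ^ (n * ρ) ≤ Nat.card (Rest × St) * κ * q ^ (n * ρ) := by gcongr
    _ ≤ Nat.card (Rest × St) * (q ^ (n * d) * q ^ (g * ρ)) := by
      rw [mul_assoc]; exact Nat.mul_le_mul_left _ (Nat.div_mul_le_self _ _)
    _ ≤ (q ^ (n * d * J) * q ^ ((d + 1) * ρ)) * (q ^ (n * d) * q ^ (g * ρ)) := by
      rw [Nat.card_prod, hRc]; gcongr
    _ = _ := by ring

theorem card_consistent_rank_zero_le {T : Matrix (Fin d) (Fin d) F} (hT : IsUnit T)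
    (k : Fin (J + 1) → GL (Fin n) F) (p : Fin (J + 1)) :
    Nat.card {x : (Fin (J + 1) → Matrix (Fin n) (Fin d) F) ×
        (Fin (J + 1) → Matrix (Fin d) (Fin d) F) //
          ConsistentPair T (fun i => (k i).1) x.1 x.2 ∧ (x.2 p).rank = 0} ≤
      Nat.card F ^ (n * d * (J + 1)) := by
  have h := card_tuple (F := F) n d (Fin (J + 1))
  rw [Nat.card_fin] at h
  rw [← h]
  refine Nat.card_le_card_of_injective (fun x => x.1.1) fun x y hxy => ?_
  have h0 : ∀ x : {x : (Fin (J + 1) → Matrix (Fin n) (Fin d) F) ×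
        (Fin (J + 1) → Matrix (Fin d) (Fin d) F) //
          ConsistentPair T (fun i => (k i).1) x.1 x.2 ∧ (x.2 p).rank = 0}, x.1.2 = 0 := by
    intro x
    refine x.2.1.determined (X' := x.1.1) (E' := 0) hT ⟨x.2.1.1, fun i => ?_⟩ p (fun i _ => rfl) ?_
    · simp
    · have := x.2.2
      rw [Matrix.rank, Submodule.finrank_eq_zero, LinearMap.range_eq_bot] at this
      exact Matrix.toLin'.injective (this.trans (map_zero _).symm)
  exact Subtype.ext (Prod.ext hxy ((h0 x).trans (h0 y).symm))

theorem geom_tail_le {x : ℝ} (h0 : 0 ≤ x) (h1 : x ≤ 1 / 2) (m : ℕ) :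
    ∑ i ∈ Finset.range m, x ^ (i + 1) ≤ 2 * x := by
  have h := geom_sum_mul_neg x m
  have hS : ∑ i ∈ Finset.range m, x ^ i ≤ 2 := by
    have hn : 0 ≤ ∑ i ∈ Finset.range m, x ^ i := Finset.sum_nonneg fun i _ => pow_nonneg h0 i
    nlinarith [pow_nonneg h0 m]
  calc _ = (∑ i ∈ Finset.range m, x ^ i) * x := by
        rw [Finset.sum_mul]; exact Finset.sum_congr rfl fun i _ => pow_succ x i
    _ ≤ _ := by gcongr

theorem card_consistent_le {T : Matrix (Fin d) (Fin d) F} (hT : IsUnit T) (e : Fin d → F)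
    (he : ∀ A : Matrix (Fin d) (Fin d) F, (∀ i < d, A *ᵥ (Tᵀ ^ i *ᵥ e) = 0) → A = 0)
    (k : Fin (J + 1) → GL (Fin n) F) (p : Fin (J + 1)) {t g s : ℕ}
    (hgood : GoodElt t g (k p).1) (htg : n ≤ g * (t + 1)) (hs : 0 < s)
    (hsn : d + 1 + g + s ≤ n) :
    (Nat.card {x : (Fin (J + 1) → Matrix (Fin n) (Fin d) F) ×
        (Fin (J + 1) → Matrix (Fin d) (Fin d) F) //
          ConsistentPair T (fun i => (k i).1) x.1 x.2} : ℝ) ≤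
      (Nat.card F : ℝ) ^ (n * d * (J + 1)) * (1 + 2 / (Nat.card F : ℝ) ^ s) := by
  have hq2 : (2 : ℝ) ≤ Nat.card F := by exact_mod_cast (one_lt_card_field (F := F))
  obtain ⟨p, rfl⟩ : ∃ p', p = p' + 1 := ⟨p - 1, by rw [sub_add_cancel]⟩
  set N : ℕ → ℕ := fun ρ => Nat.card {x : (Fin (J + 1) → Matrix (Fin n) (Fin d) F) ×
        (Fin (J + 1) → Matrix (Fin d) (Fin d) F) //
          ConsistentPair T (fun i => (k i).1) x.1 x.2 ∧ (x.2 p).rank = ρ} with hN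
  have h1 : Nat.card {x : (Fin (J + 1) → Matrix (Fin n) (Fin d) F) ×
        (Fin (J + 1) → Matrix (Fin d) (Fin d) F) //
          ConsistentPair T (fun i => (k i).1) x.1 x.2} ≤ ∑ ρ ∈ Finset.range (d + 1), N ρ := by
    rw [Finset.sum_range, ← Nat.card_sigma]
    refine Nat.card_le_card_of_injective (fun x => ⟨⟨(x.1.2 p).rank, ?_⟩, ⟨x.1, x.2, rfl⟩⟩) ?_
    · have := Matrix.rank_le_width (x.1.2 p)
      omega
    · intro x y hxy
      have := congrArg (fun s : (ρ : Fin (d + 1)) × {x : (Fin (J + 1) → Matrix (Fin n) (Fin d) F) ×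
        (Fin (J + 1) → Matrix (Fin d) (Fin d) F) //
          ConsistentPair T (fun i => (k i).1) x.1 x.2 ∧ (x.2 p).rank = ρ} => s.2.1) hxy
      exact Subtype.ext this
  set Q : ℝ := (Nat.card F : ℝ) with hQ
  have hQ0 : 0 < Q := by linarith
  have h2 : ∀ ρ, (N (ρ + 1) : ℝ) ≤ Q ^ (n * d * (J + 1)) * (1 / Q ^ s) ^ (ρ + 1) := by
    intro ρ
    have h3 : (N (ρ + 1) : ℝ) * Q ^ (n * (ρ + 1)) ≤
        Q ^ (n * d * (J + 1)) * Q ^ ((d + 1 + g) * (ρ + 1)) := by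
      rw [hQ]
      exact_mod_cast card_consistent_rank_le hT e he k p hgood htg (Nat.succ_pos ρ)
    rw [div_pow, one_pow, ← pow_mul, mul_one_div, le_div_iff₀ (pow_pos hQ0 _)]
    have h4 : Q ^ ((d + 1 + g) * (ρ + 1)) * Q ^ (s * (ρ + 1)) ≤ Q ^ (n * (ρ + 1)) := by
      rw [← pow_add, ← add_mul]
      exact pow_le_pow_right₀ (by linarith) (Nat.mul_le_mul_right _ hsn)
    have h5 : 0 < Q ^ ((d + 1 + g) * (ρ + 1)) := pow_pos hQ0 _
    refine le_of_mul_le_mul_right ?_ h5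
    calc (N (ρ + 1) : ℝ) * Q ^ (s * (ρ + 1)) * Q ^ ((d + 1 + g) * (ρ + 1)) =
        N (ρ + 1) * (Q ^ ((d + 1 + g) * (ρ + 1)) * Q ^ (s * (ρ + 1))) := by ring
      _ ≤ N (ρ + 1) * Q ^ (n * (ρ + 1)) := by gcongr
      _ ≤ _ := h3
  have h6 : (N 0 : ℝ) ≤ Q ^ (n * d * (J + 1)) := by
    rw [hQ]
    exact_mod_cast card_consistent_rank_zero_le hT k p
  have h7 : 1 / Q ^ s ≤ 1 / 2 := by
    refine one_div_le_one_div_of_le (by norm_num) (hq2.trans ?_)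
    exact le_self_pow₀ (by linarith) (by omega)
  calc _ ≤ ((∑ ρ ∈ Finset.range (d + 1), N ρ : ℕ) : ℝ) := by exact_mod_cast h1
    _ = ∑ ρ ∈ Finset.range d, (N (ρ + 1) : ℝ) + N 0 := by
      rw [Finset.sum_range_succ']; push_cast; rfl
    _ ≤ ∑ ρ ∈ Finset.range d, Q ^ (n * d * (J + 1)) * (1 / Q ^ s) ^ (ρ + 1) +
        Q ^ (n * d * (J + 1)) := by
      gcongr with ρ _
      exact h2 ρ
    _ ≤ Q ^ (n * d * (J + 1)) * (2 * (1 / Q ^ s)) + Q ^ (n * d * (J + 1)) := by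
      rw [← Finset.mul_sum]
      gcongr
      exact geom_tail_le (by positivity) h7 d
    _ = _ := by ring

end ConsistentCount

section Moments

open Matrix Polynomial Module

variable {F : Type*} [Field F] [Finite F] {n d J : ℕ}

theorem exists_mul_eq_one_of_injective {ι κ : Type*} [Fintype ι] [DecidableEq ι] [Fintype κ]
    [DecidableEq κ] {A : Matrix ι κ F}
    (hA : Function.Injective A.mulVec) : ∃ B : Matrix κ ι F, B * A = 1 := by
  obtain ⟨g, hg⟩ := LinearMap.exists_leftInverse_of_injective A.toLin'
    (LinearMap.ker_eq_bot.2 (by exact hA))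
  refine ⟨LinearMap.toMatrix' g, ?_⟩
  apply Matrix.toLin'.injective
  rw [Matrix.toLin'_mul, Matrix.toLin'_toMatrix', hg, Matrix.toLin'_one]

/-- The number of tuples of matrices with prescribed products. -/
theorem card_tuple_mul_eq {A A' : Fin (J + 1) → Matrix (Fin n) (Fin d) F}
    (hA : ∀ i, Function.Injective (A i).mulVec) :
    Nat.card {z : Fin (J + 1) → Matrix (Fin n) (Fin n) F // ∀ i, z i * A i = A' i} *
      Nat.card F ^ (n * d * (J + 1)) = Nat.card F ^ (n * n * (J + 1)) := by
  choose B hB using fun i => exists_mul_eq_one_of_injective (hA i)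
  let L : (Fin (J + 1) → Matrix (Fin n) (Fin n) F) →+ (Fin (J + 1) → Matrix (Fin n) (Fin d) F) :=
    { toFun := fun z i => z i * A i
      map_zero' := by funext i; simp
      map_add' := fun z z' => by funext i; simp [Matrix.add_mul] }
  have hL : Function.Surjective L := by
    intro Y
    refine ⟨fun i => Y i * B i, ?_⟩
    funext i
    change Y i * B i * A i = Y i
    rw [Matrix.mul_assoc, hB, Matrix.mul_one]
  have h := card_fibre_surjective L hL A'
  rw [card_tuple, card_tuple, Nat.card_fin] at h
  rw [← h]
  congr 1
  exact Nat.card_congr (Equiv.subtypeEquivRight fun z => (funext_iff (f := L z) (g := A')).symm)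

theorem sum_card_primal {T : Matrix (Fin d) (Fin d) F} (u : Fin (J + 1) → GL (Fin n) F)
    [Fintype (Fin (J + 1) → Matrix (Fin n) (Fin n) F)] :
    (∑ z : Fin (J + 1) → Matrix (Fin n) (Fin n) F,
        Nat.card {X // Primal T (fun i => z i * (u i).1) X}) * Nat.card F ^ (n * d * (J + 1)) =
      Nat.card F ^ (n * n * (J + 1)) *
        Nat.card {X : Fin (J + 1) → Matrix (Fin n) (Fin d) F //
          ∀ i, Function.Injective (X i).mulVec} := by
  classical
  have := Fintype.ofFinite (Fin (J + 1) → Matrix (Fin n) (Fin d) F)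
  have h1 : ∑ z : Fin (J + 1) → Matrix (Fin n) (Fin n) F,
        Nat.card {X // Primal T (fun i => z i * (u i).1) X} =
      ∑ X : Fin (J + 1) → Matrix (Fin n) (Fin d) F,
        Nat.card {z : Fin (J + 1) → Matrix (Fin n) (Fin n) F //
          Primal T (fun i => z i * (u i).1) X} := by
    rw [← card_sigma_subtype (fun (z : Fin (J + 1) → Matrix (Fin n) (Fin n) F)
        (X : Fin (J + 1) → Matrix (Fin n) (Fin d) F) => Primal T (fun i => z i * (u i).1) X),
      ← card_sigma_subtype (fun (X : Fin (J + 1) → Matrix (Fin n) (Fin d) F)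
        (z : Fin (J + 1) → Matrix (Fin n) (Fin n) F) => Primal T (fun i => z i * (u i).1) X)]
    exact Nat.card_congr ((Equiv.prodComm _ _).subtypeEquiv fun x => Iff.rfl)
  rw [h1, card_subtype_eq_sum, Finset.sum_mul, Finset.mul_sum]
  refine Finset.sum_congr rfl fun X _ => ?_
  by_cases hX : ∀ i, Function.Injective (X i).mulVec
  · rw [if_pos hX, mul_one, ← card_tuple_mul_eq (A := fun i => (u i).1 * X i)
      (A' := fun i => X (i + 1) * twist T i) (fun i => injective_mulVec_mul
        (injective_mulVec_of_isUnit (u i).isUnit) (hX i))]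
    congr 1
    refine Nat.card_congr (Equiv.subtypeEquivRight fun z => ?_)
    simp only [Primal, hX, true_and, Matrix.mul_assoc]
  · rw [if_neg hX, mul_zero]
    have : IsEmpty {z : Fin (J + 1) → Matrix (Fin n) (Fin n) F //
        Primal T (fun i => z i * (u i).1) X} := ⟨fun z => hX fun i => (z.2 i).1⟩
    rw [Nat.card_of_isEmpty, zero_mul]

theorem pr_not_injective_mulVec :
    pr (fun X : Matrix (Fin n) (Fin d) F => ¬ Function.Injective X.mulVec) ≤
      (Nat.card F : ℝ) ^ d / (Nat.card F : ℝ) ^ n := by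
  have h := pr_not_linearIndependent (F := F) (V := Fin n → F) (ι := Fin d)
  rw [Nat.card_fin, card_vec, Nat.card_fin] at h
  push_cast at h
  have h' := pr_equiv (Matrix.transposeAddEquiv (Fin n) (Fin d) F).toEquiv
    (fun y : Fin d → Fin n → F => ¬ LinearIndependent F y)
  refine (h'.trans_le h).trans' (pr_mono fun X hX => ?_)
  rw [Matrix.mulVec_injective_iff] at hX
  exact hX

theorem pr_tuple_not_injective :
    pr (fun X : Fin (J + 1) → Matrix (Fin n) (Fin d) F => ¬ ∀ i, Function.Injective (X i).mulVec) ≤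
      (J + 1) * ((Nat.card F : ℝ) ^ d / (Nat.card F : ℝ) ^ n) := by
  simp only [not_forall]
  refine (pr_exists_le _).trans ?_
  have h : ∀ i : Fin (J + 1), pr (fun X : Fin (J + 1) → Matrix (Fin n) (Fin d) F =>
      ¬ Function.Injective (X i).mulVec) ≤ (Nat.card F : ℝ) ^ d / (Nat.card F : ℝ) ^ n := by
    intro i
    have h1 := pr_comp_injective (X := Matrix (Fin n) (Fin d) F) (e := fun _ : Unit => i)
      (fun _ _ _ => rfl) (fun x => ¬ Function.Injective (x ()).mulVec)
    rw [h1, ← pr_equiv (Equiv.funUnique Unit (Matrix (Fin n) (Fin d) F)).symm]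
    exact pr_not_injective_mulVec
  refine (Finset.sum_le_sum fun i _ => h i).trans_eq ?_
  simp

variable {f : F[X]}

theorem card_primal_companion (hf : f.Monic) (hd : 0 < d) (hfd : f.natDegree = d)
    (h0 : f.coeff 0 ≠ 0) (a : Fin (J + 1) → Matrix (Fin n) (Fin n) F) :
    Nat.card {X // Primal (companion d f) a X} = annCount (partialProd a (J + 1)) f := by
  rw [card_primal (isUnit_companion f hf hd hfd h0), card_intertwining_eq_annCount _ f hf hd hfd]

theorem annCount_le_card_dual (hf : f.Monic) (hd : 0 < d) (hfd : f.natDegree = d)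
    (h0 : f.coeff 0 ≠ 0) (a : Fin (J + 1) → Matrix (Fin n) (Fin n) F) :
    annCount (partialProd a (J + 1)) f ≤ Nat.card {Y // DualTuple (companion d f) a Y} := by
  refine le_trans (le_of_eq ?_) (le_card_dualTuple (isUnit_companion f hf hd hfd h0) a)
  rw [card_intertwining_eq_annCount _ f hf hd hfd, annCount_transpose _ f hf]

theorem ex_annCount (hf : f.Monic) (hd : 0 < d) (hfd : f.natDegree = d)
    (h0 : f.coeff 0 ≠ 0) (u : Fin (J + 1) → GL (Fin n) F) :
    ex (fun z : Fin (J + 1) → Matrix (Fin n) (Fin n) F =>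
      (annCount (partialProd (fun i => z i * (u i).1) (J + 1)) f : ℝ)) =
    pr (fun X : Fin (J + 1) → Matrix (Fin n) (Fin d) F => ∀ i, Function.Injective (X i).mulVec) := by
  classical
  have := Fintype.ofFinite (Fin (J + 1) → Matrix (Fin n) (Fin n) F)
  have hq0 : (0 : ℝ) < Nat.card F := by exact_mod_cast Nat.card_pos
  rw [ex_eq_sum, pr, card_tuple, card_tuple, Nat.card_fin]
  push_cast
  rw [div_eq_div_iff (by positivity)
    (by positivity)]
  simp only [← card_primal_companion hf hd hfd h0]
  have h := sum_card_primal (T := companion d f) u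
  rw [mul_comm (Nat.card F ^ (n * n * (J + 1)))] at h
  exact_mod_cast h

theorem ex_annCount_mul_le (hf : f.Monic) (hd : 0 < d) (hfd : f.natDegree = d)
    (h0 : f.coeff 0 ≠ 0) (u v : Fin (J + 1) → GL (Fin n) F) (p : Fin (J + 1)) {t g s : ℕ}
    (hgood : GoodElt t g ((v p)⁻¹ * u p).1) (htg : n ≤ g * (t + 1)) (hs : 0 < s)
    (hsn : d + 1 + g + s ≤ n) :
    ex (fun z : Fin (J + 1) → Matrix (Fin n) (Fin n) F =>
      (annCount (partialProd (fun i => z i * (u i).1) (J + 1)) f : ℝ) *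
      (annCount (partialProd (fun i => z i * (v i).1) (J + 1)) f : ℝ)) ≤
    1 + 2 / (Nat.card F : ℝ) ^ s := by
  classical
  have := Fintype.ofFinite (Fin (J + 1) → Matrix (Fin n) (Fin n) F)
  have hq0 : (0 : ℝ) < Nat.card F := by exact_mod_cast Nat.card_pos
  have hT := isUnit_companion f hf hd hfd h0
  have h1 := sum_primal_mul_dual_le (F := F) (by omega : d ≤ n) (companion d f) u v
  have h2 := card_consistent_le hT _
    (fun A => eq_zero_of_mul_companion_transpose_pow f hd A) (fun i => (v i)⁻¹ * u i) p hgood htg hs hsn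
  set R := Nat.card {x : (Fin (J + 1) → Matrix (Fin n) (Fin d) F) ×
        (Fin (J + 1) → Matrix (Fin d) (Fin d) F) //
          ConsistentPair (companion d f) (fun i => ((v i)⁻¹ * u i).1) x.1 x.2} with hR
  rw [ex_eq_sum, card_tuple, Nat.card_fin]
  push_cast
  rw [div_le_iff₀ (by positivity)]
  have h3 : ∑ z : Fin (J + 1) → Matrix (Fin n) (Fin n) F,
      annCount (partialProd (fun i => z i * (u i).1) (J + 1)) f *
      annCount (partialProd (fun i => z i * (v i).1) (J + 1)) f ≤
      ∑ z : Fin (J + 1) → Matrix (Fin n) (Fin n) F,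
        Nat.card {X // Primal (companion d f) (fun i => z i * (u i).1) X} *
        Nat.card {Y // DualTuple (companion d f) (fun i => z i * (v i).1) Y} := by
    refine Finset.sum_le_sum fun z _ => ?_
    rw [card_primal_companion hf hd hfd h0]
    exact Nat.mul_le_mul_left _ (annCount_le_card_dual hf hd hfd h0 _)
  have h4 := (Nat.mul_le_mul_right (Nat.card F ^ (n * d * (J + 1))) h3).trans h1
  have h5 : (∑ z : Fin (J + 1) → Matrix (Fin n) (Fin n) F,
      (annCount (partialProd (fun i => z i * (u i).1) (J + 1)) f : ℝ) *
      annCount (partialProd (fun i => z i * (v i).1) (J + 1)) f) *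
        (Nat.card F : ℝ) ^ (n * d * (J + 1)) ≤ (Nat.card F : ℝ) ^ (n * n * (J + 1)) * R := by
    exact_mod_cast h4
  have h6 : (0 : ℝ) < (Nat.card F : ℝ) ^ (n * d * (J + 1)) := by positivity
  refine le_of_mul_le_mul_right (h5.trans ?_) h6
  calc (Nat.card F : ℝ) ^ (n * n * (J + 1)) * R ≤ (Nat.card F : ℝ) ^ (n * n * (J + 1)) *
      ((Nat.card F : ℝ) ^ (n * d * (J + 1)) * (1 + 2 / (Nat.card F : ℝ) ^ s)) := by gcongr
    _ = _ := by ring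

end Moments

section Chebyshev

open Matrix Polynomial Module

theorem pr_forall_pow {W I : Type*} [Finite W] [Fintype I] (B : W → Prop) :
    pr (fun x : I → W => ∀ i, B (x i)) = pr B ^ Fintype.card I := by
  rw [pr, pr, Nat.card_congr (Equiv.subtypePiEquivPi (p := fun (_ : I) (w : W) => B w)),
    Nat.card_pi, Nat.card_fun, Finset.prod_const, Finset.card_univ, Nat.card_eq_fintype_card (α := I)]
  push_cast
  rw [div_pow]

theorem pr_forall_prod_pow {W I : Type*} [Finite W] [Fintype I] (B : W × W → Prop) :
    pr (fun x : (I → W) × (I → W) => ∀ i, B (x.1 i, x.2 i)) = pr B ^ Fintype.card I := by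
  rw [← pr_forall_pow, ← pr_equiv (Equiv.arrowProdEquivProdArrow I (fun _ => W) (fun _ => W))]
  rfl

theorem ex_sq {W : Type*} [Finite W] (f : W → ℝ) :
    ex f * ex f = ex (fun p : W × W => f p.1 * f p.2) := by
  rw [ex_prod]
  simp only [ex_mul_left]
  simp only [mul_comm _ (ex f), ex_mul_left]

/-- Chebyshev's inequality for an average of functions of mean close to one whose pairs are
mostly uncorrelated. -/
theorem pr_forall_eq_zero_le {Z U : Type*} [Finite Z] [Finite U] [Nonempty Z] [Nonempty U]
    (a : U → Z → ℝ) (B : U × U → Prop) {δ ε K : ℝ} (hε : 0 ≤ ε)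
    (hmean : ∀ u, 1 - δ ≤ ex (a u))
    (hgood : ∀ p : U × U, ¬ B p → ex (fun z => a p.1 z * a p.2 z) ≤ 1 + ε)
    (hbad : ∀ p : U × U, ex (fun z => a p.1 z * a p.2 z) ≤ K) :
    pr (fun z => ∀ u, a u z = 0) ≤ ε + pr B * K + 2 * δ := by
  classical
  have h1 : pr (fun z => ∀ u, a u z = 0) ≤ ex (fun z => (ex (fun u => a u z) - 1) ^ 2) / 1 := by
    refine pr_le_ex_div one_pos (fun z => sq_nonneg _) fun z hz => ?_
    simp only [hz]
    rw [ex_const]; norm_num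
  have h2 : ex (fun z => (ex (fun u => a u z) - 1) ^ 2) =
      ex (fun p : U × U => ex (fun z => a p.1 z * a p.2 z)) - 2 * ex (fun u => ex (a u)) + 1 := by
    rw [ex_comm (fun (p : U × U) z => a p.1 z * a p.2 z), ex_comm (fun u z => a u z), ← ex_mul_left,
      ← ex_sub, ← ex_const (Ω := Z) 1, ← ex_add]
    congr 1; funext z
    rw [← ex_sq (fun u => a u z), ex_const]; ring
  have h3 : ex (fun p : U × U => ex (fun z => a p.1 z * a p.2 z)) ≤ 1 + ε + pr B * K := by
    rw [pr_eq_ex, mul_comm, ← ex_mul_left, ← ex_const (Ω := U × U) (1 + ε), ← ex_add]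
    refine ex_mono fun p => ?_
    by_cases hp : B p
    · simp only [hp, if_true]; linarith [hbad p]
    · simp only [hp, if_false]; linarith [hgood p hp]
  have h4 : 1 - δ ≤ ex (fun u => ex (a u)) := le_ex_of_le hmean
  rw [div_one, h2] at h1
  linarith

variable {F : Type*} [Field F] [Finite F] {n d J : ℕ} {f : F[X]}

theorem pr_annCount_eq_zero_le (hf : f.Monic) (hd : 0 < d) (hfd : f.natDegree = d)
    (h0 : f.coeff 0 ≠ 0) {W : Type*} [Finite W] [Nonempty W] (ω : W → GL (Fin n) F) {t g s : ℕ}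
    (htg : n ≤ g * (t + 1)) (hs : 0 < s) (hsn : d + 1 + g + s ≤ n) :
    pr (fun z : Fin (J + 1) → Matrix (Fin n) (Fin n) F => ∀ u : Fin (J + 1) → W,
      annCount (partialProd (fun i => z i * (ω (u i)).1) (J + 1)) f = 0) ≤
    2 / (Nat.card F : ℝ) ^ s +
      pr (fun p : W × W => ¬ GoodElt t g ((ω p.2)⁻¹ * ω p.1).1) ^ (J + 1) * (Nat.card F : ℝ) ^ n +
      2 * ((J + 1) * ((Nat.card F : ℝ) ^ d / (Nat.card F : ℝ) ^ n)) := by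
  have hq0 : (0 : ℝ) < Nat.card F := by exact_mod_cast Nat.card_pos
  have h := pr_forall_eq_zero_le (Z := Fin (J + 1) → Matrix (Fin n) (Fin n) F)
    (U := Fin (J + 1) → W)
    (fun u z => (annCount (partialProd (fun i => z i * (ω (u i)).1) (J + 1)) f : ℝ))
    (fun x => ∀ i, ¬ GoodElt t g ((ω (x.2 i))⁻¹ * ω (x.1 i)).1)
    (δ := (J + 1) * ((Nat.card F : ℝ) ^ d / (Nat.card F : ℝ) ^ n))
    (ε := 2 / (Nat.card F : ℝ) ^ s) (K := (Nat.card F : ℝ) ^ n) (by positivity)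
    ?_ ?_ ?_
  · have hB := pr_forall_prod_pow (I := Fin (J + 1))
      (fun p : W × W => ¬ GoodElt t g ((ω p.2)⁻¹ * ω p.1).1)
    rw [Fintype.card_fin] at hB
    rw [← hB]
    refine h.trans' (pr_mono fun z hz u => ?_)
    exact_mod_cast hz u
  · intro u
    rw [ex_annCount hf hd hfd h0]
    have h1 := pr_not (fun X : Fin (J + 1) → Matrix (Fin n) (Fin d) F =>
      ∀ i, Function.Injective (X i).mulVec)
    have h2 := pr_tuple_not_injective (F := F) (n := n) (d := d) (J := J)
    linarith
  · intro p hp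
    simp only [not_forall, not_not] at hp
    obtain ⟨i, hi⟩ := hp
    exact ex_annCount_mul_le hf hd hfd h0 _ _ i hi htg hs hsn
  · intro p
    have h1 : ex (fun z : Fin (J + 1) → Matrix (Fin n) (Fin n) F =>
      (annCount (partialProd (fun i => z i * (ω (p.1 i)).1) (J + 1)) f : ℝ)) ≤ 1 := by
      rw [ex_annCount hf hd hfd h0]; exact pr_le_one _
    calc _ ≤ ex (fun z : Fin (J + 1) → Matrix (Fin n) (Fin n) F => (Nat.card F : ℝ) ^ n *
      (annCount (partialProd (fun i => z i * (ω (p.1 i)).1) (J + 1)) f : ℝ)) := by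
          refine ex_mono fun z => ?_
          rw [mul_comm]
          gcongr
          exact_mod_cast annCount_le _ f
      _ ≤ _ := by
        rw [ex_mul_left]
        exact mul_le_of_le_one_right (by positivity) h1

end Chebyshev

section SpecialPolynomial

open Matrix Polynomial Module

variable {F : Type*} [Field F] {n d : ℕ}

open Classical in
/-- A quadratic polynomial without the roots `0` and `1`. -/
noncomputable def quadFactor (F : Type*) [Field F] : F[X] :=
  if (3 : F) = 0 then X ^ 2 + 1 else X ^ 2 + X + 1

theorem quadFactor_monic : (quadFactor F).Monic := by
  unfold quadFactor
  split_ifs <;> monicity!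

theorem quadFactor_natDegree : (quadFactor F).natDegree = 2 := by
  unfold quadFactor
  split_ifs <;> compute_degree!

theorem quadFactor_coeff_zero : (quadFactor F).coeff 0 = 1 := by
  unfold quadFactor
  split_ifs <;> simp [coeff_one]

theorem quadFactor_eval_one : (quadFactor F).eval 1 ≠ 0 := by
  unfold quadFactor
  split_ifs with h
  · simp only [eval_add, eval_pow, eval_X, eval_one, one_pow]
    intro h2
    have : (1 : F) = 3 - (1 + 1) := by ring
    rw [h, h2, sub_zero] at this
    exact one_ne_zero this
  · simp only [eval_add, eval_pow, eval_X, eval_one, one_pow]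
    intro h2
    exact h (by rw [← h2]; ring)

/-- The polynomial `(X - 1) ^ (d - 2) * h`, where `h` is quadratic without the roots `0`, `1`. -/
noncomputable def specialPoly (F : Type*) [Field F] (d : ℕ) : F[X] :=
  (X - C 1) ^ (d - 2) * quadFactor F

theorem specialPoly_monic : (specialPoly F d).Monic :=
  ((monic_X_sub_C 1).pow _).mul quadFactor_monic

theorem specialPoly_natDegree (hd : 2 ≤ d) : (specialPoly F d).natDegree = d := by
  rw [specialPoly, ((monic_X_sub_C (1 : F)).pow _).natDegree_mul quadFactor_monic,
    natDegree_pow, natDegree_X_sub_C, quadFactor_natDegree]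
  omega

theorem specialPoly_coeff_zero : (specialPoly F d).coeff 0 ≠ 0 := by
  rw [specialPoly, mul_coeff_zero, quadFactor_coeff_zero, mul_one, coeff_zero_eq_eval_zero]
  simp

theorem not_specialPoly_dvd (Q : ℕ) : ¬ specialPoly F d ∣ (X - C 1) ^ Q := by
  intro h
  have h1 : quadFactor F ∣ (X - C 1) ^ Q := (Dvd.intro_left _ rfl).trans h
  have hc : IsCoprime (X - C 1) (quadFactor F) := by
    refine (Polynomial.irreducible_X_sub_C (1 : F)).coprime_iff_not_dvd.2 fun h2 => ?_
    exact quadFactor_eval_one (dvd_iff_isRoot.1 h2)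
  have h3 : IsUnit (quadFactor F) := (hc.pow_left (m := Q)).symm.isUnit_of_dvd' dvd_rfl h1
  have := natDegree_eq_zero_of_isUnit h3
  rw [quadFactor_natDegree] at this
  omega

/-- A matrix with a vector whose annihilator is generated by the special polynomial has a
unipotent-by-small part. -/
theorem rank_sub_one_pow_of_annihilator {w : Matrix (Fin n) (Fin n) F} (hd : 2 ≤ d)
    {x : Fin n → F} (hx : ∀ p : F[X], aeval w p *ᵥ x = 0 ↔ specialPoly F d ∣ p) {Q : ℕ}
    (hQ : d ≤ Q) : (w - 1) ^ Q ≠ 0 ∧ ((w - 1) ^ Q).rank + d ≤ n + 2 := by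
  have hw : ∀ k, aeval w ((X - C 1 : F[X]) ^ k) = (w - 1) ^ k := by
    intro k; simp
  constructor
  · intro h0
    refine not_specialPoly_dvd (F := F) (d := d) Q ((hx _).1 ?_)
    rw [hw, h0, Matrix.zero_mulVec]
  · set v : Fin (d - 2) → Fin n → F := fun i => aeval w (quadFactor F * X ^ (i : ℕ)) *ᵥ x with hv
    have hli : LinearIndependent F v := by
      rw [Fintype.linearIndependent_iff]
      intro c hc
      have h1 : aeval w (quadFactor F * ∑ i : Fin (d - 2), C (c i) * X ^ (i : ℕ)) *ᵥ x = 0 := by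
        rw [← hc, Finset.mul_sum, map_sum, Matrix.sum_mulVec]
        refine Finset.sum_congr rfl fun i _ => ?_
        rw [hv, ← Matrix.smul_mulVec, ← map_smul, smul_eq_C_mul]
        congr 2
        ring
      rw [hx] at h1
      have hdeg : (∑ i : Fin (d - 2), C (c i) * X ^ (i : ℕ)).degree < ((d - 2 : ℕ) : WithBot ℕ) :=
        degree_sum_fin_lt c
      have h2 : quadFactor F * ∑ i : Fin (d - 2), C (c i) * X ^ (i : ℕ) = 0 := by
        by_contra hne
        have hs : (∑ i : Fin (d - 2), C (c i) * X ^ (i : ℕ)) ≠ 0 := fun h => hne (by rw [h, mul_zero])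
        have h3 := natDegree_le_of_dvd h1 hne
        rw [specialPoly_natDegree hd, natDegree_mul quadFactor_monic.ne_zero hs,
          quadFactor_natDegree] at h3
        have h4 := (natDegree_lt_iff_degree_lt hs).2 hdeg
        omega
      have h5 := (mul_eq_zero.1 h2).resolve_left quadFactor_monic.ne_zero
      intro i
      have := congrArg (fun p : F[X] => p.coeff (i : ℕ)) h5
      simp only [finsetSum_coeff, coeff_C_mul, coeff_X_pow, mul_ite, mul_one, mul_zero,
        coeff_zero] at this
      rw [Finset.sum_eq_single i] at this
      · simpa using this
      · intro b _ hb
        rw [if_neg fun h => hb (Fin.ext h.symm)]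
      · simp
    have hker : ∀ i, v i ∈ LinearMap.ker ((w - 1) ^ Q).mulVecLin := by
      intro i
      rw [LinearMap.mem_ker, Matrix.mulVecLin_apply, hv, ← hw Q, Matrix.mulVec_mulVec, ← map_mul, hx]
      refine Dvd.intro ((X - C 1) ^ (Q - (d - 2)) * X ^ (i : ℕ)) ?_
      obtain ⟨k, rfl⟩ : ∃ k, Q = (d - 2) + k := ⟨Q - (d - 2), by omega⟩
      rw [specialPoly, Nat.add_sub_cancel_left, pow_add]
      ring
    have hspan : Submodule.span F (Set.range v) ≤ LinearMap.ker ((w - 1) ^ Q).mulVecLin := by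
      rw [Submodule.span_le]; rintro _ ⟨i, rfl⟩; exact hker i
    have h6 := Submodule.finrank_mono hspan
    rw [finrank_span_eq_card hli, Fintype.card_fin] at h6
    have h7 := LinearMap.finrank_range_add_finrank_ker ((w - 1) ^ Q).mulVecLin
    rw [Module.finrank_fin_fun] at h7
    rw [Matrix.rank]
    omega

variable [Finite F]

/-- A power of the characteristic in a given range. -/
theorem exists_charPow (n : ℕ) (hn : 2 ≤ n) : ∃ Q : ℕ, n ≤ Q ∧ Q ≤ Nat.card F * n ∧
    ∀ (m : ℕ) (w : Matrix (Fin m) (Fin m) F), (w - 1) ^ Q = w ^ Q - 1 := by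
  have := Fintype.ofFinite F
  obtain ⟨p, hp⟩ := CharP.exists F
  have hpp : p.Prime := CharP.char_is_prime F p
  have : Fact p.Prime := ⟨hpp⟩
  obtain ⟨e, hpe, hcard⟩ := FiniteField.card F p
  have hpq : p ≤ Nat.card F := by
    rw [Nat.card_eq_fintype_card, hcard]
    exact Nat.le_self_pow e.pos.ne' p
  have h1 := Nat.le_pow_clog hpp.one_lt n
  have h2 := Nat.pow_pred_clog_lt_self hpp.one_lt (by omega : 1 < n)
  refine ⟨p ^ Nat.clog p n, h1, ?_, fun m w => ?_⟩
  · have h3 : Nat.clog p n = (Nat.clog p n).pred + 1 := by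
      have := Nat.clog_pos hpp.one_lt hn
      rw [Nat.pred_eq_sub_one]
      omega
    rw [h3, pow_succ, mul_comm]
    exact Nat.mul_le_mul hpq h2.le
  · rcases Nat.eq_zero_or_pos m with rfl | hm
    · exact Subsingleton.elim _ _
    · have : Nonempty (Fin m) := ⟨⟨0, hm⟩⟩
      have := Matrix.charP (n := Fin m) (R := F) p
      rw [sub_pow_char_pow_of_commute _ _ (Commute.one_right w), one_pow]

end SpecialPolynomial

section Balls

variable {Γ : Type*} [Group Γ]

/-- Products of at most `L` elements of `S`. -/
def ball (S : Set Γ) (L : ℕ) : Set Γ :=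
  {g | ∃ l : List Γ, (∀ a ∈ l, a ∈ S) ∧ l.prod = g ∧ l.length ≤ L}

/-- The values of a family together with their inverses. -/
def symSet {ι : Type*} (x : ι → Γ) : Set Γ := {g | ∃ i, g = x i ∨ g = (x i)⁻¹}

variable {S T : Set Γ} {K L : ℕ} {g h : Γ}

theorem ball_mono (hKL : K ≤ L) (hg : g ∈ ball S K) : g ∈ ball S L := by
  obtain ⟨l, h1, h2, h3⟩ := hg
  exact ⟨l, h1, h2, h3.trans hKL⟩

theorem ball_subset (hST : S ⊆ T) (hg : g ∈ ball S K) : g ∈ ball T K := by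
  obtain ⟨l, h1, h2, h3⟩ := hg
  exact ⟨l, fun a ha => hST (h1 a ha), h2, h3⟩

theorem one_mem_ball : (1 : Γ) ∈ ball S K := ⟨[], by simp, rfl, Nat.zero_le _⟩

theorem mem_ball_one (hg : g ∈ S) : g ∈ ball S 1 := ⟨[g], by simpa using hg, by simp, by simp⟩

theorem mul_mem_ball (hg : g ∈ ball S K) (hh : h ∈ ball S L) : g * h ∈ ball S (K + L) := by
  obtain ⟨l, h1, h2, h3⟩ := hg
  obtain ⟨l', h1', h2', h3'⟩ := hh
  refine ⟨l ++ l', ?_, by rw [List.prod_append, h2, h2'], by rw [List.length_append]; omega⟩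
  intro a ha
  rcases List.mem_append.1 ha with ha | ha
  · exact h1 a ha
  · exact h1' a ha

theorem pow_mem_wordBall (hg : g ∈ ball S K) (m : ℕ) : g ^ m ∈ ball S (m * K) := by
  induction m with
  | zero => rw [pow_zero]; exact one_mem_ball
  | succ m ih => rw [pow_succ, Nat.succ_mul]; exact mul_mem_ball ih hg

theorem inv_mem_ball (hS : ∀ a ∈ S, a⁻¹ ∈ S) (hg : g ∈ ball S K) : g⁻¹ ∈ ball S K := by
  obtain ⟨l, h1, h2, h3⟩ := hg
  refine ⟨(l.map fun a => a⁻¹).reverse, ?_, ?_, by simpa using h3⟩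
  · intro a ha
    simp only [List.mem_reverse, List.mem_map] at ha
    obtain ⟨b, hb, rfl⟩ := ha
    exact hS b (h1 b hb)
  · rw [← h2, List.prod_inv_reverse]

theorem ball_trans (hS : S ⊆ ball T K) (hg : g ∈ ball S L) : g ∈ ball T (L * K) := by
  obtain ⟨l, h1, rfl, h3⟩ := hg
  refine ball_mono (Nat.mul_le_mul_right K h3) ?_
  clear h3
  induction l with
  | nil => exact one_mem_ball
  | cons a l ih =>
    rw [List.prod_cons, List.length_cons, Nat.succ_mul, add_comm]
    exact mul_mem_ball (hS (h1 a (by simp))) (ih fun b hb => h1 b (by simp [hb]))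

theorem prod_mem_ball {l : List Γ} (h : ∀ a ∈ l, a ∈ ball S K) :
    l.prod ∈ ball S (l.length * K) :=
  ball_trans (S := ball S K) (fun _ ha => ha) ⟨l, h, rfl, le_rfl⟩

theorem inv_mem_symSet {ι : Type*} {x : ι → Γ} : ∀ a ∈ symSet x, a⁻¹ ∈ symSet x := by
  rintro _ ⟨i, rfl | rfl⟩
  · exact ⟨i, Or.inr rfl⟩
  · exact ⟨i, Or.inl (inv_inv _)⟩

theorem apply_mem_symSet {ι : Type*} (x : ι → Γ) (i : ι) : x i ∈ symSet x := ⟨i, Or.inl rfl⟩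

theorem symSet_comp_subset {ι κ : Type*} (x : κ → Γ) (e : ι → κ) :
    symSet (fun i => x (e i)) ⊆ symSet x := by
  rintro _ ⟨i, h⟩
  exact ⟨e i, h⟩

theorem conj_commutator_mem_ball (hS : ∀ a ∈ S, a⁻¹ ∈ S) (hg : g ∈ ball S K) (hh : h ∈ ball S L) :
    g * h * g⁻¹ * h⁻¹ ∈ ball S (K + L + K + L) :=
  mul_mem_ball (mul_mem_ball (mul_mem_ball hg hh) (inv_mem_ball hS hg)) (inv_mem_ball hS hh)

end Balls

section Words

variable {ι : Type*}

theorem wordProd_mem_ball {Γ : Type*} [Group Γ] {G : Subgroup Γ} (τ : ι → G) (u : List ι) :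
    ((wordProd τ u : G) : Γ) ∈ ball (symSet fun i => (τ i : Γ)) u.length := by
  refine ⟨u.map fun i => (τ i : Γ), ?_, ?_, by simp⟩
  · intro a ha
    obtain ⟨i, _, rfl⟩ := List.mem_map.1 ha
    exact ⟨i, Or.inl rfl⟩
  · rw [wordProd, ← Subgroup.coe_subtype, map_list_prod, List.map_map]
    rfl

/-- The average over the sample space of the proportion of bad pairs. -/
theorem ex_pr_pair_le {Ω W : Type*} [Finite Ω] [Nonempty Ω] [Finite W] [Nonempty W]
    (B : Ω → W × W → Prop) {δ : ℝ} (hδ : 0 ≤ δ)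
    (h : ∀ u v, u ≠ v → pr (fun τ => B τ (u, v)) ≤ δ) :
    ex (fun τ => pr (B τ)) ≤ 1 / Nat.card W + δ := by
  classical
  have h1 : pr (fun p : W × W => p.1 = p.2) = 1 / Nat.card W := by
    rw [pr, Nat.card_prod, Nat.card_congr (β := W) ⟨fun p => p.1.1, fun w => ⟨(w, w), rfl⟩,
      fun p => Subtype.ext (Prod.ext rfl p.2), fun w => rfl⟩]
    have : (Nat.card W : ℝ) ≠ 0 := by exact_mod_cast Nat.card_pos.ne'
    push_cast
    field_simp
  have h2 : ex (fun τ => pr (B τ)) = ex (fun p : W × W => pr (fun τ => B τ p)) := by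
    simp only [pr_eq_ex]
    rw [ex_comm]
  rw [h2, ← h1, pr_eq_ex, ← ex_const (Ω := W × W) δ, ← ex_add]
  refine ex_mono fun p => ?_
  by_cases hp : p.1 = p.2
  · rw [if_pos hp]
    linarith [pr_le_one (fun τ => B τ p)]
  · rw [if_neg hp, zero_add]
    exact h p.1 p.2 hp

theorem pr_transfer_le {n : ℕ} {F : Type*} [Field F] [Finite F] {G : Subgroup (GL (Fin n) F)}
    (hn : 0 < n) (hG : ContainsSL G) {I : Type*} [Fintype I]
    (p : (I → Matrix (Fin n) (Fin n) F) → Prop) :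
    pr (fun z : I → G => p (fun i => (z i).1.1)) ≤ (4 * Nat.card F : ℝ) ^ Fintype.card I * pr p := by
  have he : Function.Injective (fun (z : I → G) (i : I) => (z i).1.1) := by
    intro z z' h
    funext i
    exact Subtype.ext (Units.ext (congrFun h i))
  refine (pr_le_of_injective he p).trans ?_
  refine mul_le_mul_of_nonneg_right ?_ (pr_nonneg p)
  rw [Nat.card_fun, Nat.card_fun, Nat.card_eq_fintype_card (α := I)]
  push_cast
  rw [← div_pow]
  exact pow_le_pow_left₀ (by positivity) (card_matrix_div_le hn hG) _

end Words

section LowRank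

open Matrix Polynomial Module

open Fin.CommRing in
theorem exists_partialProd_mem_ball {F : Type*} [Field F] {n J : ℕ} {S : Set (GL (Fin n) F)} {K : ℕ}
    (a : Fin (J + 1) → GL (Fin n) F) (ha : ∀ i, a i ∈ ball S K) (m : ℕ) :
    ∃ w ∈ ball S (m * K), w.1 = partialProd (fun i => (a i).1) m := by
  induction m with
  | zero => exact ⟨1, one_mem_ball, rfl⟩
  | succ m ih =>
    obtain ⟨w, hw, h⟩ := ih
    refine ⟨a (m : Fin (J + 1)) * w, ?_, ?_⟩
    · rw [Nat.succ_mul, add_comm]; exact mul_mem_ball (ha _) hw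
    · rw [Units.val_mul, h, partialProd]

variable {F : Type*} [Field F] [Finite F] {n d J ℓ t g s : ℕ} {G : Subgroup (GL (Fin n) F)}

theorem pr_not_exists_lowRank (hG : ContainsSL G) {A : Type*} [Finite A] [Nonempty A] (hd : 2 ≤ d)
    (htg : n ≤ g * (t + 1)) (hs : 0 < s) (hsn : d + 1 + g + s ≤ n) {β : ℝ} (hβ : 0 < β) :
    pr (fun x : A ⊕ Fin (J + 1) → G =>
      ¬ ∃ a ∈ ball (symSet fun i => (x i).1) (Nat.card F * n * ((J + 1) * (1 + ℓ))),
        a.1 - 1 ≠ 0 ∧ (a.1 - 1).rank + d ≤ n + 2) ≤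
      (1 / (Nat.card A : ℝ) ^ ℓ + (Nat.card F : ℝ) ^ (2 * ℓ * t + 2) / (Nat.card F : ℝ) ^ g) / β +
      (4 * Nat.card F : ℝ) ^ (J + 1) * (2 / (Nat.card F : ℝ) ^ s + β ^ (J + 1) * (Nat.card F : ℝ) ^ n +
        2 * ((J + 1) * ((Nat.card F : ℝ) ^ d / (Nat.card F : ℝ) ^ n))) := by
  have hq0 : (0 : ℝ) < Nat.card F := by exact_mod_cast Nat.card_pos
  set W := Fin ℓ → A with hW
  set bad : (A → G) → ℝ := fun τ => pr (fun p : W × W =>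
    ¬ GoodElt t g ((wordProd τ (List.ofFn p.2))⁻¹ * wordProd τ (List.ofFn p.1)).1.1) with hbad
  set E : (A → G) → (Fin (J + 1) → G) → Prop := fun τ z =>
    ∀ u : Fin (J + 1) → W, annCount (partialProd
      (fun i => (z i).1.1 * (wordProd τ (List.ofFn (u i))).1.1) (J + 1)) (specialPoly F d) = 0 with hE
  have hQ := exists_charPow (F := F) n (by omega)
  obtain ⟨Q, hnQ, hQn, hQp⟩ := hQ
  have h1 : pr (fun x : A ⊕ Fin (J + 1) → G =>
      ¬ ∃ a ∈ ball (symSet fun i => (x i).1) (Nat.card F * n * ((J + 1) * (1 + ℓ))),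
        a.1 - 1 ≠ 0 ∧ (a.1 - 1).rank + d ≤ n + 2) ≤
      pr (fun x : A ⊕ Fin (J + 1) → G => E (fun i => x (Sum.inl i)) (fun i => x (Sum.inr i))) := by
    refine pr_mono fun x hx u => ?_
    by_contra hne
    apply hx
    obtain ⟨w, hw, hwp⟩ := exists_partialProd_mem_ball (S := symSet fun i => (x i).1) (K := 1 + ℓ)
      (fun i : Fin (J + 1) => (x (Sum.inr i)).1 *
        (wordProd (fun j => x (Sum.inl j)) (List.ofFn (u i))).1) (fun i => by
        refine mul_mem_ball (mem_ball_one (apply_mem_symSet (fun i => (x i).1) _)) ?_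
        have := wordProd_mem_ball (fun j => x (Sum.inl j)) (List.ofFn (u i))
        rw [List.length_ofFn] at this
        exact ball_subset (symSet_comp_subset (fun i => (x i).1) Sum.inl) this) (J + 1)
    have hne' : annCount w.1 (specialPoly F d) ≠ 0 := by
      rw [hwp]; exact hne
    rw [annCount, Nat.card_ne_zero] at hne'
    obtain ⟨⟨v, hv⟩⟩ := hne'.1
    have h3 := rank_sub_one_pow_of_annihilator hd hv (Q := Q) (by omega)
    refine ⟨w ^ Q, ball_mono (Nat.mul_le_mul_right _ hQn) (pow_mem_wordBall hw Q), ?_⟩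
    rw [Units.val_pow_eq_pow_val, ← hQp]
    exact h3
  refine h1.trans ?_
  rw [pr_sum_arrow]
  refine (pr_prod_le (p := fun τ => bad τ ≤ β) (by positivity) ?_).trans (add_le_add_left ?_ _)
  · intro τ hτ
    have h4 := pr_transfer_le (by omega) hG (I := Fin (J + 1)) (fun z => ∀ u : Fin (J + 1) → W,
      annCount (partialProd (fun i => z i * (wordProd τ (List.ofFn (u i))).1.1) (J + 1))
        (specialPoly F d) = 0)
    have h5 := pr_annCount_eq_zero_le (J := J) specialPoly_monic (by omega)
      (specialPoly_natDegree hd) specialPoly_coeff_zero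
      (fun u : W => (wordProd τ (List.ofFn u)).1) htg hs hsn
    rw [Fintype.card_fin] at h4
    refine h4.trans (mul_le_mul_of_nonneg_left (h5.trans ?_) (by positivity))
    have h6 : 0 ≤ bad τ := pr_nonneg _
    have h7 : bad τ ^ (J + 1) ≤ β ^ (J + 1) := pow_le_pow_left₀ h6 hτ _
    have h8 : bad τ ^ (J + 1) * (Nat.card F : ℝ) ^ n ≤ β ^ (J + 1) * (Nat.card F : ℝ) ^ n := by
      gcongr
    refine add_le_add_left (add_le_add_right h8 _) _
  · have h9 : ex bad ≤ 1 / (Nat.card A : ℝ) ^ ℓ +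
        (Nat.card F : ℝ) ^ (2 * ℓ * t + 2) / (Nat.card F : ℝ) ^ g := by
      have := ex_pr_pair_le (fun (τ : A → G) (p : W × W) =>
        ¬ GoodElt t g ((wordProd τ (List.ofFn p.2))⁻¹ * wordProd τ (List.ofFn p.1)).1.1)
        (δ := (Nat.card F : ℝ) ^ (2 * ℓ * t + 2) / (Nat.card F : ℝ) ^ g) (by positivity) ?_
      · have hc : Nat.card W = Nat.card A ^ ℓ := by rw [hW, Nat.card_fun, Nat.card_fin]
        rw [hc, Nat.cast_pow] at this
        exact this
      · intro u v huv
        exact pr_not_good hG (by simp) (by simp) (fun h => huv (List.ofFn_injective h).symm) t g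
    refine (pr_le_ex_div hβ (fun τ => pr_nonneg _) fun τ hτ => ?_).trans
      (div_le_div_of_nonneg_right h9 hβ.le)
    exact (not_le.1 hτ).le

end LowRank

section TwoPoint

open Matrix Polynomial

/-- Second moment bound for the event that no member of a nearly pairwise uncorrelated family of
events occurs. -/
theorem sq_mul_pr_le {Z U : Type*} [Finite Z] [Finite U] [Nonempty U]
    (f : U → Z → ℝ) (B : U × U → Prop) {p m : ℝ} (E : Z → Prop)
    (hgood : ∀ w : U × U, ¬ B w → ex (fun z => f w.1 z * f w.2 z) ≤ 0)
    (hbad : ∀ w : U × U, ex (fun z => f w.1 z * f w.2 z) ≤ m)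
    (hE : ∀ z, E z → ∀ u, f u z = -p) : p ^ 2 * pr E ≤ m * pr B := by
  classical
  have h1 : p ^ 2 * pr E ≤ ex (fun z => ex (fun u => f u z) * ex (fun u => f u z)) := by
    refine ex_mul_pr_le (fun z => mul_self_nonneg _) fun z hz => ?_
    simp only [hE z hz, ex_const]
    exact le_of_eq (by ring)
  refine h1.trans ?_
  have h2 : (fun z => ex (fun u => f u z) * ex (fun u => f u z)) =
      fun z => ex (fun w : U × U => f w.1 z * f w.2 z) := by
    funext z; exact ex_sq (fun u => f u z)
  rw [h2, ex_comm, pr_eq_ex, ← ex_mul_left]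
  refine ex_mono fun w => ?_
  by_cases hw : B w
  · rw [if_pos hw, mul_one]; exact hbad w
  · rw [if_neg hw, mul_zero]; exact hgood w hw

variable {F : Type*} [Field F] [Finite F] {n s : ℕ}

/-- The rows of three matrices are jointly independent. -/
def JointlyIndep (R₀ R₁ R₂ : Matrix (Fin s) (Fin n) F) : Prop :=
  ∀ α β γ, α ᵥ* R₀ + β ᵥ* R₁ + γ ᵥ* R₂ = 0 → α = 0 ∧ β = 0 ∧ γ = 0

theorem JointlyIndep.exists_mul_eq {R₀ R₁ R₂ : Matrix (Fin s) (Fin n) F}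
    (h : JointlyIndep R₀ R₁ R₂) {r : ℕ} (Y₀ Y₁ Y₂ : Matrix (Fin s) (Fin r) F) :
    ∃ A : Matrix (Fin n) (Fin r) F, R₀ * A = Y₀ ∧ R₁ * A = Y₁ ∧ R₂ * A = Y₂ := by
  set R := fromRows R₀ (fromRows R₁ R₂) with hR
  have hinj : Function.Injective Rᵀ.mulVec := by
    rw [← Matrix.coe_mulVecLin, injective_iff_map_eq_zero]
    intro x hx
    rw [Matrix.mulVecLin_apply, mulVec_transpose, hR] at hx
    obtain ⟨x₀, x', rfl⟩ : ∃ a b, x = Sum.elim a b := ⟨_, _, (Sum.elim_comp_inl_inr x).symm⟩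
    obtain ⟨x₁, x₂, rfl⟩ : ∃ a b, x' = Sum.elim a b := ⟨_, _, (Sum.elim_comp_inl_inr x').symm⟩
    simp only [Matrix.vecMul_fromRows, Sum.elim_comp_inl, Sum.elim_comp_inr, ← add_assoc] at hx
    obtain ⟨rfl, rfl, rfl⟩ := h _ _ _ hx
    funext i
    rcases i with i | i | i <;> rfl
  obtain ⟨B, hB⟩ := exists_mul_eq_one_of_injective hinj
  have hB' : R * Bᵀ = 1 := by
    rw [← Matrix.transpose_transpose R, ← Matrix.transpose_mul, hB, Matrix.transpose_one]
  refine ⟨Bᵀ * fromRows Y₀ (fromRows Y₁ Y₂), ?_⟩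
  have h1 : R * (Bᵀ * fromRows Y₀ (fromRows Y₁ Y₂)) = fromRows Y₀ (fromRows Y₁ Y₂) := by
    rw [← Matrix.mul_assoc, hB', Matrix.one_mul]
  rw [hR, Matrix.fromRows_mul, Matrix.fromRows_mul, Matrix.fromRows_inj.eq_iff,
    Matrix.fromRows_inj.eq_iff] at h1
  exact h1

open Classical in
theorem ex_pair_eq_zero {Q₁ Q₂ U U' V V' : Matrix (Fin s) (Fin n) F} (h₁ : JointlyIndep Q₂ U V)
    (h₂ : JointlyIndep Q₁ U' V') (K : Matrix (Fin s) (Fin s) F)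
    (T : Matrix (Fin s) (Fin s) F × Matrix (Fin s) (Fin s) F → Prop) :
    ex (fun A : Matrix (Fin n) (Fin s) F × Matrix (Fin n) (Fin s) F =>
      ((if Q₁ * A.1 = K ∧ Q₂ * A.2 = K then (1 : ℝ) else 0) *
          ((if T (U * A.2, U' * A.1) then 1 else 0) - pr T)) *
        ((if Q₁ * A.1 = K ∧ Q₂ * A.2 = K then (1 : ℝ) else 0) *
          ((if T (V * A.2, V' * A.1) then 1 else 0) - pr T))) = 0 := by
  let L : Matrix (Fin n) (Fin s) F × Matrix (Fin n) (Fin s) F →+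
      (Matrix (Fin s) (Fin s) F × Matrix (Fin s) (Fin s) F) ×
        (Matrix (Fin s) (Fin s) F × Matrix (Fin s) (Fin s) F) ×
          (Matrix (Fin s) (Fin s) F × Matrix (Fin s) (Fin s) F) :=
    { toFun := fun A => ((Q₁ * A.1, Q₂ * A.2), (U * A.2, U' * A.1), (V * A.2, V' * A.1))
      map_zero' := by simp
      map_add' := fun A B => by simp [Matrix.mul_add] }
  have hL : Function.Surjective L := by
    rintro ⟨⟨a, b⟩, ⟨c, c'⟩, d, d'⟩
    obtain ⟨A₂, e1, e2, e3⟩ := h₁.exists_mul_eq b c d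
    obtain ⟨A₁, e4, e5, e6⟩ := h₂.exists_mul_eq a c' d'
    refine ⟨(A₁, A₂), ?_⟩
    simp only [L, AddMonoidHom.coe_mk, ZeroHom.coe_mk, e1, e2, e3, e4, e5, e6]
  let φ : Matrix (Fin s) (Fin s) F × Matrix (Fin s) (Fin s) F → ℝ :=
    fun t => (if T t then (1 : ℝ) else 0) - pr T
  let ψ : Matrix (Fin s) (Fin s) F × Matrix (Fin s) (Fin s) F → ℝ :=
    fun t => if t.1 = K ∧ t.2 = K then (1 : ℝ) else 0
  have h := ex_comp_surjective L hL (fun y => (ψ y.1 * φ y.2.1) * (ψ y.1 * φ y.2.2))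
  have h0 : ex φ = 0 := by
    rw [ex_sub, ← pr_eq_ex, ex_const, sub_self]
  refine Eq.trans h ?_
  rw [ex_prod]
  simp only [ex_prod (Ω := Matrix (Fin s) (Fin s) F × Matrix (Fin s) (Fin s) F), ← mul_assoc]
  simp only [ex_mul_left, h0, mul_zero, ex_const]

theorem exists_right_inverse_of_injective {Q : Matrix (Fin s) (Fin n) F}
    (hQ : Function.Injective Qᵀ.mulVec) : ∃ B : Matrix (Fin n) (Fin s) F, Q * B = 1 := by
  obtain ⟨B, hB⟩ := exists_mul_eq_one_of_injective hQ
  exact ⟨Bᵀ, by rw [← Matrix.transpose_transpose Q, ← Matrix.transpose_mul, hB,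
    Matrix.transpose_one]⟩

theorem pr_fibre_eq {Q₁ Q₂ : Matrix (Fin s) (Fin n) F} (h₁ : Function.Injective Q₁ᵀ.mulVec)
    (h₂ : Function.Injective Q₂ᵀ.mulVec) (K : Matrix (Fin s) (Fin s) F) :
    pr (fun A : Matrix (Fin n) (Fin s) F × Matrix (Fin n) (Fin s) F =>
      Q₁ * A.1 = K ∧ Q₂ * A.2 = K) = 1 / (Nat.card F : ℝ) ^ (2 * (s * s)) := by
  let L : Matrix (Fin n) (Fin s) F × Matrix (Fin n) (Fin s) F →+
      Matrix (Fin s) (Fin s) F × Matrix (Fin s) (Fin s) F :=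
    { toFun := fun A => (Q₁ * A.1, Q₂ * A.2)
      map_zero' := by simp
      map_add' := fun A B => by simp [Matrix.mul_add] }
  obtain ⟨B₁, hB₁⟩ := exists_right_inverse_of_injective h₁
  obtain ⟨B₂, hB₂⟩ := exists_right_inverse_of_injective h₂
  have hL : Function.Surjective L := by
    rintro ⟨a, b⟩
    refine ⟨(B₁ * a, B₂ * b), ?_⟩
    simp only [L, AddMonoidHom.coe_mk, ZeroHom.coe_mk, ← Matrix.mul_assoc, hB₁, hB₂,
      Matrix.one_mul]
  have h := pr_comp_surjective L hL (fun y => y = (K, K))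
  rw [pr_eq_singleton, Nat.card_prod, card_matrix] at h
  rw [two_mul, pow_add]
  push_cast at h
  rw [← h]
  congr 1
  funext A
  simp [L, Prod.ext_iff]

theorem sq_mul_pr_fibre_le {W : Type*} [Finite W] [Nonempty W] (U U' : W → Matrix (Fin n) (Fin n) F)
    {Q₁ Q₂ : Matrix (Fin s) (Fin n) F} (h₁ : Function.Injective Q₁ᵀ.mulVec)
    (h₂ : Function.Injective Q₂ᵀ.mulVec) (K : Matrix (Fin s) (Fin s) F)
    (T : Matrix (Fin s) (Fin s) F × Matrix (Fin s) (Fin s) F → Prop) :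
    pr T ^ 2 * pr (fun A : Matrix (Fin n) (Fin s) F × Matrix (Fin n) (Fin s) F =>
      (Q₁ * A.1 = K ∧ Q₂ * A.2 = K) ∧ ∀ w, ¬ T (Q₁ * U w * A.2, Q₂ * U' w * A.1)) ≤
      1 / (Nat.card F : ℝ) ^ (2 * (s * s)) * pr (fun p : W × W =>
        ¬ (JointlyIndep Q₂ (Q₁ * U p.1) (Q₁ * U p.2) ∧
          JointlyIndep Q₁ (Q₂ * U' p.1) (Q₂ * U' p.2))) := by
  classical
  refine sq_mul_pr_le (fun w (A : Matrix (Fin n) (Fin s) F × Matrix (Fin n) (Fin s) F) =>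
    (if Q₁ * A.1 = K ∧ Q₂ * A.2 = K then (1 : ℝ) else 0) *
      ((if T (Q₁ * U w * A.2, Q₂ * U' w * A.1) then 1 else 0) - pr T)) _ _ ?_ ?_ ?_
  · intro w hw
    rw [not_not] at hw
    exact (ex_pair_eq_zero hw.1 hw.2 K T).le
  · intro w
    have hfib := pr_eq_ex (fun A : Matrix (Fin n) (Fin s) F × Matrix (Fin n) (Fin s) F =>
      Q₁ * A.1 = K ∧ Q₂ * A.2 = K)
    rw [← pr_fibre_eq h₁ h₂ K, hfib]
    refine ex_mono fun A => ?_
    have hp0 := pr_nonneg T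
    have hp1 := pr_le_one T
    by_cases hf : Q₁ * A.1 = K ∧ Q₂ * A.2 = K
    · simp only [if_pos hf, one_mul]
      split_ifs <;> nlinarith
    · simp only [if_neg hf, zero_mul, mul_zero, le_refl]
  · rintro A ⟨hA, hT⟩ w
    simp only [if_pos hA, if_neg (hT w), one_mul, zero_sub]

end TwoPoint

section TwoPoint

open Matrix Polynomial

variable {F : Type*} [Field F] [Finite F] {n s : ℕ} {G : Subgroup (GL (Fin n) F)}

/-- A pair of random group elements is distributed almost like independent linear data. -/
theorem pr_two_le (hn : 0 < n) (hsn : s ≤ n) (hG : ContainsSL G) {P : Matrix (Fin n) (Fin s) F}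
    {Q : Matrix (Fin s) (Fin n) F} (hP : Function.Injective P.mulVec)
    (hQ : Function.Injective Qᵀ.mulVec)
    (E : (Matrix (Fin s) (Fin n) F × Matrix (Fin s) (Fin n) F) →
      (Matrix (Fin n) (Fin s) F × Matrix (Fin n) (Fin s) F) → Prop) :
    pr (fun y : Fin 2 → G => E (Q * (y 0).1.1, Q * ((y 1).1⁻¹).1) (((y 0).1⁻¹).1 * P, (y 1).1.1 * P)) ≤
      (4 * Nat.card F : ℝ) ^ 2 * ((Nat.card F : ℝ) ^ (2 * (s * s)) *
        pr (fun D : (Matrix (Fin s) (Fin n) F × Matrix (Fin s) (Fin n) F) ×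
            (Matrix (Fin n) (Fin s) F × Matrix (Fin n) (Fin s) F) =>
          (Function.Injective D.1.1ᵀ.mulVec ∧ Function.Injective D.1.2ᵀ.mulVec) ∧
          (D.1.1 * D.2.1 = Q * P ∧ D.1.2 * D.2.2 = Q * P) ∧ E D.1 D.2)) := by
  set E' : (Matrix (Fin s) (Fin n) F × Matrix (Fin s) (Fin n) F) ×
      (Matrix (Fin n) (Fin s) F × Matrix (Fin n) (Fin s) F) → Prop := fun D =>
    Function.Injective D.2.1.mulVec ∧
    (Function.Injective D.1.1ᵀ.mulVec ∧ Function.Injective D.1.2ᵀ.mulVec) ∧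
      (D.1.1 * D.2.1 = Q * P ∧ D.1.2 * D.2.2 = Q * P) ∧ E D.1 D.2 with hE'
  have hgi : ∀ g : GL (Fin n) F, (g⁻¹).1 * g.1 = 1 := fun g => by
    rw [← Units.val_mul, inv_mul_cancel, Units.val_one]
  have hgi' : ∀ g : GL (Fin n) F, g.1 * (g⁻¹).1 = 1 := fun g => by
    rw [← Units.val_mul, mul_inv_cancel, Units.val_one]
  have hQg : ∀ g : GL (Fin n) F, Function.Injective (Q * g.1)ᵀ.mulVec := fun g => by
    rw [Matrix.transpose_mul]
    exact injective_mulVec_mul (injective_mulVec_of_isUnit (by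
      rw [Matrix.isUnit_transpose]; exact g.isUnit)) hQ
  have hcard : Nat.card {y : Fin 2 → G // E (Q * (y 0).1.1, Q * ((y 1).1⁻¹).1)
      (((y 0).1⁻¹).1 * P, (y 1).1.1 * P)} ≤ Nat.card {D // E' D} *
        (Nat.card F ^ ((n - s) * (n - s)) * Nat.card F ^ ((n - s) * (n - s))) := by
    refine card_le_mul_of_fibre_le (fun y => (⟨((Q * (y.1 0).1.1, Q * ((y.1 1).1⁻¹).1),
      (((y.1 0).1⁻¹).1 * P, (y.1 1).1.1 * P)), ?_⟩ : {D // E' D})) _ ?_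
    · refine ⟨?_, ⟨hQg _, hQg _⟩, ⟨?_, ?_⟩, y.2⟩
      · exact injective_mulVec_mul (injective_mulVec_of_isUnit (Units.isUnit _)) hP
      · change Q * (y.1 0).1.1 * (((y.1 0).1⁻¹).1 * P) = Q * P
        rw [Matrix.mul_assoc, ← Matrix.mul_assoc _ _ P, hgi', Matrix.one_mul]
      · change Q * ((y.1 1).1⁻¹).1 * ((y.1 1).1.1 * P) = Q * P
        rw [Matrix.mul_assoc, ← Matrix.mul_assoc _ _ P, hgi, Matrix.one_mul]
    · rintro ⟨⟨⟨Q₁, Q₂⟩, A₁, A₂⟩, hA₁, ⟨hQ₁, hQ₂⟩, -⟩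
      refine le_trans ?_ (Nat.mul_le_mul (card_sandwich_le A₁ P Q Q₁ hA₁ hQ)
        (card_sandwich_le P A₂ Q₂ Q hP hQ₂))
      rw [← Nat.card_prod]
      refine Nat.card_le_card_of_injective (fun y => (⟨(y.1.1 0).1.1, ?_⟩, ⟨(y.1.1 1).1.1, ?_⟩)) ?_
      · have h := y.2
        simp only [Subtype.mk.injEq, Prod.mk.injEq] at h
        refine ⟨?_, h.1.1⟩
        have e : (y.1.1 0).1.1 * (((y.1.1 0).1⁻¹).1 * P) = P := by
          rw [← Matrix.mul_assoc, hgi', Matrix.one_mul]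
        exact (congrArg _ h.2.1.symm).trans e
      · have h := y.2
        simp only [Subtype.mk.injEq, Prod.mk.injEq] at h
        refine ⟨h.2.2, ?_⟩
        have e : Q * ((y.1.1 1).1⁻¹).1 * (y.1.1 1).1.1 = Q := by
          rw [Matrix.mul_assoc, hgi, Matrix.mul_one]
        exact (congrArg (· * (y.1.1 1).1.1) h.1.2.symm).trans e
      · intro y y' h
        simp only [Prod.mk.injEq, Subtype.mk.injEq] at h
        apply Subtype.ext
        apply Subtype.ext
        funext i
        apply Subtype.ext
        apply Units.ext
        fin_cases i
        · exact h.1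
        · exact h.2
  have hmono : pr E' ≤ pr (fun D : (Matrix (Fin s) (Fin n) F × Matrix (Fin s) (Fin n) F) ×
            (Matrix (Fin n) (Fin s) F × Matrix (Fin n) (Fin s) F) =>
          (Function.Injective D.1.1ᵀ.mulVec ∧ Function.Injective D.1.2ᵀ.mulVec) ∧
          (D.1.1 * D.2.1 = Q * P ∧ D.1.2 * D.2.2 = Q * P) ∧ E D.1 D.2) :=
    pr_mono fun D h => h.2
  refine le_trans ?_ (mul_le_mul_of_nonneg_left (mul_le_mul_of_nonneg_left hmono (by positivity))
    (by positivity))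
  have hG0 : (0 : ℝ) < Nat.card G := by exact_mod_cast Nat.card_pos
  have hcE := card_mul_pr E'
  simp only [Nat.card_prod, card_matrix] at hcE
  rw [pr, Nat.card_fun, Nat.card_fin, Nat.cast_pow]
  push_cast at hcE
  rw [div_le_iff₀ (by positivity)]
  have h1 : (Nat.card (Matrix (Fin n) (Fin n) F) : ℝ) ≤ 4 * Nat.card F * Nat.card G := by
    have := card_matrix_div_le hn hG
    rwa [div_le_iff₀ hG0] at this
  rw [card_matrix] at h1
  push_cast at h1
  have h2 : ((Nat.card F : ℝ) ^ (n * n)) ^ 2 ≤ (4 * Nat.card F * Nat.card G) ^ 2 :=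
    pow_le_pow_left₀ (by positivity) h1 2
  have h3 : (Nat.card {y : Fin 2 → G // E (Q * (y 0).1.1, Q * ((y 1).1⁻¹).1)
      (((y 0).1⁻¹).1 * P, (y 1).1.1 * P)} : ℝ) ≤ Nat.card {D // E' D} *
        ((Nat.card F : ℝ) ^ ((n - s) * (n - s)) * (Nat.card F : ℝ) ^ ((n - s) * (n - s))) := by
    exact_mod_cast hcard
  refine h3.trans ?_
  rw [hcE]
  have hp := pr_nonneg E'
  calc _ = ((Nat.card F : ℝ) ^ (n * n)) ^ 2 * ((Nat.card F : ℝ) ^ (2 * (s * s)) * pr E') := by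
        obtain ⟨m, rfl⟩ := Nat.exists_eq_add_of_le hsn
        rw [Nat.add_sub_cancel_left]
        ring
    _ ≤ (4 * Nat.card F * Nat.card G) ^ 2 * ((Nat.card F : ℝ) ^ (2 * (s * s)) * pr E') := by gcongr
    _ = _ := by ring

theorem exists_smul_or_exists_dotProduct (β γ : Fin s → F) (h : ¬ (β = 0 ∧ γ = 0)) :
    (∃ ψ, β ⬝ᵥ ψ = 1 ∧ γ ⬝ᵥ ψ = 0) ∨ (γ ≠ 0 ∧ ∃ b : F, β = b • γ) := by
  by_cases hγ : γ = 0
  · left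
    have hβ : β ≠ 0 := fun h' => h ⟨h', hγ⟩
    obtain ⟨j, hj⟩ := Function.ne_iff.1 hβ
    refine ⟨Pi.single j (β j)⁻¹, ?_, by simp [hγ]⟩
    rw [dotProduct_single]
    exact mul_inv_cancel₀ hj
  · obtain ⟨j, hj⟩ := Function.ne_iff.1 hγ
    by_cases hb : β = (β j / γ j) • γ
    · exact Or.inr ⟨hγ, _, hb⟩
    · left
      obtain ⟨i, hi⟩ := Function.ne_iff.1 hb
      have hi' : β i - γ i / γ j * β j ≠ 0 := by
        intro h'
        apply hi
        simp only [Pi.smul_apply, smul_eq_mul]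
        linear_combination h'
      have hj' : γ j ≠ 0 := hj
      refine ⟨(β i - γ i / γ j * β j)⁻¹ • (Pi.single i 1 - Pi.single j (γ i / γ j)), ?_, ?_⟩
      · rw [dotProduct_smul, dotProduct_sub, dotProduct_single, dotProduct_single, smul_eq_mul,
          mul_one, mul_comm (β j), inv_mul_cancel₀ hi']
      · rw [dotProduct_smul, dotProduct_sub, dotProduct_single, dotProduct_single, smul_eq_mul]
        field_simp
        simp

theorem pr_not_jointlyIndep_le {u v : Matrix (Fin n) (Fin n) F} (hu : IsUnit u) {g : ℕ}
    (hker : ∀ b : F, Nat.card {x : Fin n → F // (b • u + v) *ᵥ x = 0} ≤ Nat.card F ^ g) :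
    pr (fun R : Matrix (Fin s) (Fin n) F × Matrix (Fin s) (Fin n) F =>
      ¬ JointlyIndep R.2 (R.1 * u) (R.1 * v)) ≤
      (Nat.card F : ℝ) ^ (3 * s) / (Nat.card F : ℝ) ^ n +
        (Nat.card F : ℝ) ^ (s + 1) * ((Nat.card F : ℝ) ^ g / (Nat.card F : ℝ) ^ n) := by
  have := Fintype.ofFinite F
  have hvec : Nat.card (Fin n → F) = Nat.card F ^ n := by rw [card_vec, Nat.card_fin]
  have hvecs : Nat.card (Fin s → F) = Nat.card F ^ s := by rw [card_vec, Nat.card_fin]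
  set R₁ : (Fin s → F) × (Fin s → F) × (Fin s → F) →
      Matrix (Fin s) (Fin n) F × Matrix (Fin s) (Fin n) F → Prop := fun t R =>
    (t.1 ≠ 0 ∨ ∃ ψ, t.2.1 ⬝ᵥ ψ = 1 ∧ t.2.2 ⬝ᵥ ψ = 0) ∧
      t.1 ᵥ* R.2 + t.2.1 ᵥ* (R.1 * u) + t.2.2 ᵥ* (R.1 * v) = 0 with hR₁
  set R₂ : (Fin s → F) × F → Matrix (Fin s) (Fin n) F × Matrix (Fin s) (Fin n) F → Prop :=
    fun t R => t.1 ≠ 0 ∧ t.1 ᵥ* R.1 ᵥ* (t.2 • u + v) = 0 with hR₂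
  have hsplit : pr (fun R : Matrix (Fin s) (Fin n) F × Matrix (Fin s) (Fin n) F =>
      ¬ JointlyIndep R.2 (R.1 * u) (R.1 * v)) ≤
      pr (fun R => (∃ t, R₁ t R) ∨ (∃ t, R₂ t R)) := by
    refine pr_mono fun R hR => ?_
    unfold JointlyIndep at hR
    push Not at hR
    obtain ⟨α, β, γ, h1, h2⟩ := hR
    by_cases hα : α = 0
    · have hβγ : ¬ (β = 0 ∧ γ = 0) := fun h => h2 hα h.1 h.2
      rcases exists_smul_or_exists_dotProduct β γ hβγ with h | ⟨hγ, b, rfl⟩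
      · exact Or.inl ⟨(α, β, γ), Or.inr h, h1⟩
      · refine Or.inr ⟨(γ, b), hγ, ?_⟩
        rw [hα, Matrix.zero_vecMul, zero_add, Matrix.smul_vecMul, ← Matrix.vecMul_vecMul,
          ← Matrix.vecMul_vecMul] at h1
        rw [Matrix.vecMul_add, Matrix.vecMul_smul]
        exact h1
    · exact Or.inl ⟨(α, β, γ), Or.inl hα, h1⟩
  refine hsplit.trans ((pr_or_le _ _).trans (add_le_add ?_ ?_))
  · refine (pr_exists_le R₁).trans ?_
    have hb : ∀ t, pr (R₁ t) ≤ 1 / (Nat.card F : ℝ) ^ n := by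
      intro t
      by_cases ht : t.1 ≠ 0 ∨ ∃ ψ, t.2.1 ⬝ᵥ ψ = 1 ∧ t.2.2 ⬝ᵥ ψ = 0
      · let L : Matrix (Fin s) (Fin n) F × Matrix (Fin s) (Fin n) F →+ (Fin n → F) :=
          { toFun := fun R => t.1 ᵥ* R.2 + t.2.1 ᵥ* (R.1 * u) + t.2.2 ᵥ* (R.1 * v)
            map_zero' := by simp
            map_add' := fun R R' => by
              simp only [Prod.fst_add, Prod.snd_add, Matrix.add_mul, Matrix.vecMul_add]
              abel }
        have hL : Function.Surjective L := by
          intro w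
          rcases ht with ht | ⟨ψ, h1, h2⟩
          · obtain ⟨j, hj⟩ := Function.ne_iff.1 ht
            refine ⟨(0, Matrix.vecMulVec (Pi.single j (t.1 j)⁻¹) w), ?_⟩
            change t.1 ᵥ* Matrix.vecMulVec (Pi.single j (t.1 j)⁻¹) w +
              t.2.1 ᵥ* ((0 : Matrix (Fin s) (Fin n) F) * u) +
              t.2.2 ᵥ* ((0 : Matrix (Fin s) (Fin n) F) * v) = w
            rw [Matrix.zero_mul, Matrix.zero_mul, Matrix.vecMul_zero, Matrix.vecMul_zero, add_zero,
              add_zero, Matrix.vecMul_vecMulVec, dotProduct_single, mul_inv_cancel₀ hj, one_smul]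
          · obtain ⟨u', rfl⟩ := hu
            refine ⟨(Matrix.vecMulVec ψ (w ᵥ* (u'⁻¹).1), 0), ?_⟩
            change t.1 ᵥ* 0 + t.2.1 ᵥ* (Matrix.vecMulVec ψ (w ᵥ* (u'⁻¹).1) * u'.1) +
              t.2.2 ᵥ* (Matrix.vecMulVec ψ (w ᵥ* (u'⁻¹).1) * v) = w
            rw [← Matrix.vecMul_vecMul, ← Matrix.vecMul_vecMul, Matrix.vecMul_vecMulVec,
              Matrix.vecMul_vecMulVec, h1, h2, one_smul, zero_smul, Matrix.zero_vecMul,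
              Matrix.vecMul_zero, add_zero, zero_add, Matrix.vecMul_vecMul, ← Units.val_mul,
              inv_mul_cancel, Units.val_one, Matrix.vecMul_one]
        have h := pr_comp_surjective L hL (fun w => w = 0)
        rw [pr_eq_singleton, hvec] at h
        push_cast at h
        rw [← h]
        exact pr_mono fun R hR => hR.2
      · rw [pr_eq_zero fun R hR => ht hR.1]
        positivity
    refine (Finset.sum_le_sum fun t _ => hb t).trans ?_
    rw [Finset.sum_const, Finset.card_univ, ← Nat.card_eq_fintype_card, Nat.card_prod,
      Nat.card_prod, hvecs, nsmul_eq_mul]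
    push_cast
    rw [mul_one_div, ← pow_add, ← pow_add]
    exact le_of_eq (by congr 2; ring)
  · refine (pr_exists_le R₂).trans ?_
    have hb : ∀ t, pr (R₂ t) ≤ (Nat.card F : ℝ) ^ g / (Nat.card F : ℝ) ^ n := by
      intro t
      by_cases ht : t.1 ≠ 0
      · let L : Matrix (Fin s) (Fin n) F × Matrix (Fin s) (Fin n) F →+ (Fin n → F) :=
          { toFun := fun R => t.1 ᵥ* R.1
            map_zero' := by simp
            map_add' := fun R R' => by simp only [Prod.fst_add, Matrix.vecMul_add] }
        have hL : Function.Surjective L := by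
          intro w
          obtain ⟨j, hj⟩ := Function.ne_iff.1 ht
          refine ⟨(Matrix.vecMulVec (Pi.single j (t.1 j)⁻¹) w, 0), ?_⟩
          change t.1 ᵥ* Matrix.vecMulVec (Pi.single j (t.1 j)⁻¹) w = w
          rw [Matrix.vecMul_vecMulVec, dotProduct_single, mul_inv_cancel₀ hj, one_smul]
        have h := pr_comp_surjective L hL (fun w => w ᵥ* (t.2 • u + v) = 0)
        refine (pr_mono (p' := fun R => L R ᵥ* (t.2 • u + v) = 0) fun R hR => hR.2).trans ?_
        rw [h, pr, hvec]
        push_cast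
        gcongr
        have h2 := card_ker_mulVec_transpose (t.2 • u + v)
        simp only [Matrix.mulVec_transpose] at h2
        rw [h2]
        exact_mod_cast hker t.2
      · rw [pr_eq_zero fun R hR => ht hR.1]
        positivity
    refine (Finset.sum_le_sum fun t _ => hb t).trans ?_
    rw [Finset.sum_const, Finset.card_univ, ← Nat.card_eq_fintype_card, Nat.card_prod, hvecs,
      nsmul_eq_mul]
    push_cast
    rw [pow_succ]

end TwoPoint

section TwoPoint

open Matrix Polynomial

variable {F : Type*} [Field F] [Finite F] {n s : ℕ} {G : Subgroup (GL (Fin n) F)}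

theorem card_ker_smul_add_le {u v : GL (Fin n) F} {g : ℕ} (h : GoodElt 1 g (u⁻¹ * v).1) (b : F) :
    Nat.card {x : Fin n → F // (b • u.1 + v.1) *ᵥ x = 0} ≤ Nat.card F ^ g := by
  have h1 := h (X + C b) (X_add_C_ne_zero b) (natDegree_X_add_C b).le
  refine le_trans (le_of_eq ?_) h1
  refine Nat.card_congr (Equiv.subtypeEquivRight fun x => ?_)
  have e : b • u.1 + v.1 = u.1 * aeval (u⁻¹ * v).1 (X + C b) := by
    have : u.1 * (u⁻¹ * v).1 = v.1 := by rw [← Units.val_mul, mul_inv_cancel_left]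
    rw [map_add, aeval_X, aeval_C, Matrix.mul_add, this, Algebra.algebraMap_eq_smul_one,
      Matrix.mul_smul, Matrix.mul_one, add_comm]
  rw [e, ← Matrix.mulVec_mulVec]
  constructor
  · intro hx
    have := congrArg (fun y => (u⁻¹).1 *ᵥ y) hx
    simpa only [Matrix.mulVec_mulVec, ← Units.val_mul, inv_mul_cancel, Units.val_one,
      Matrix.one_mulVec, Matrix.mulVec_zero, ← Matrix.mul_assoc, Matrix.one_mul] using this
  · intro hx
    rw [hx, Matrix.mulVec_zero]

theorem card_ker_smul_add_inv_le {u v : GL (Fin n) F} {g : ℕ} (h : GoodElt 1 g (u⁻¹ * v).1)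
    (b : F) :
    Nat.card {x : Fin n → F // (b • (u⁻¹).1 + (v⁻¹).1) *ᵥ x = 0} ≤ Nat.card F ^ g := by
  have hne : (C b * X + 1 : F[X]) ≠ 0 := fun h0 => by
    have := congrArg (fun p => coeff p 0) h0
    simp at this
  have h1 := h (C b * X + 1) hne (by compute_degree)
  refine le_trans ?_ h1
  refine Nat.card_le_card_of_injective (fun x => ⟨(v⁻¹).1 *ᵥ x.1, ?_⟩) ?_
  · have e : b • (u⁻¹).1 + (v⁻¹).1 = aeval (u⁻¹ * v).1 (C b * X + 1) * (v⁻¹).1 := by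
      have : (u⁻¹ * v).1 * (v⁻¹).1 = (u⁻¹).1 := by rw [← Units.val_mul, mul_inv_cancel_right]
      rw [map_add, map_mul, aeval_X, aeval_C, map_one, Matrix.add_mul, Matrix.one_mul,
        Algebra.algebraMap_eq_smul_one, Matrix.smul_mul, Matrix.one_mul, Matrix.smul_mul, this]
    rw [Matrix.mulVec_mulVec, ← e]
    exact x.2
  · intro x y hxy
    apply Subtype.ext
    exact injective_mulVec_of_isUnit (Units.isUnit _) (Subtype.mk.inj hxy)

/-- Words of length `ℓ` between two fresh letters realise any prescribed not too sparse set of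
values of `(Q h P, Q h⁻¹ P)`. -/
theorem pr_not_exists_twoPoint (hG : ContainsSL G) {A : Type*} [Finite A] [Nonempty A] (hn : 0 < n)
    (hsn : s ≤ n) {P : Matrix (Fin n) (Fin s) F} {Q : Matrix (Fin s) (Fin n) F}
    (hP : Function.Injective P.mulVec) (hQ : Function.Injective Qᵀ.mulVec) (ℓ g : ℕ)
    (T : Matrix (Fin s) (Fin s) F × Matrix (Fin s) (Fin s) F → Prop) :
    pr T ^ 2 * pr (fun x : A ⊕ Fin 2 → G => ¬ ∃ u : Fin ℓ → A,
      T (Q * (x (Sum.inr 0) * wordProd (fun a => x (Sum.inl a)) (List.ofFn u) *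
          x (Sum.inr 1)).1.1 * P,
        Q * ((x (Sum.inr 0) * wordProd (fun a => x (Sum.inl a)) (List.ofFn u) *
          x (Sum.inr 1)).1⁻¹).1 * P)) ≤
      (4 * Nat.card F : ℝ) ^ 2 * (1 / (Nat.card A : ℝ) ^ ℓ +
        ((Nat.card F : ℝ) ^ (2 * ℓ * 1 + 2) / (Nat.card F : ℝ) ^ g +
          ((Nat.card F : ℝ) ^ (3 * s) / (Nat.card F : ℝ) ^ n +
            (Nat.card F : ℝ) ^ (s + 1) * ((Nat.card F : ℝ) ^ g / (Nat.card F : ℝ) ^ n) +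
          ((Nat.card F : ℝ) ^ (3 * s) / (Nat.card F : ℝ) ^ n +
            (Nat.card F : ℝ) ^ (s + 1) * ((Nat.card F : ℝ) ^ g / (Nat.card F : ℝ) ^ n))))) := by
  obtain ⟨p, hp⟩ : ∃ p, p = pr T := ⟨_, rfl⟩
  rw [← hp]
  set δ := (Nat.card F : ℝ) ^ (3 * s) / (Nat.card F : ℝ) ^ n +
            (Nat.card F : ℝ) ^ (s + 1) * ((Nat.card F : ℝ) ^ g / (Nat.card F : ℝ) ^ n) with hδ
  have hδ0 : 0 ≤ δ := by positivity
  set U : (A → G) → (Fin ℓ → A) → Matrix (Fin n) (Fin n) F :=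
    fun τ u => (wordProd τ (List.ofFn u)).1.1 with hU
  set U' : (A → G) → (Fin ℓ → A) → Matrix (Fin n) (Fin n) F :=
    fun τ u => ((wordProd τ (List.ofFn u)).1⁻¹).1 with hU'
  set B : (A → G) × (Matrix (Fin s) (Fin n) F × Matrix (Fin s) (Fin n) F) →
      (Fin ℓ → A) × (Fin ℓ → A) → Prop := fun ω p =>
    ¬ (JointlyIndep ω.2.2 (ω.2.1 * U ω.1 p.1) (ω.2.1 * U ω.1 p.2) ∧
      JointlyIndep ω.2.1 (ω.2.2 * U' ω.1 p.1) (ω.2.2 * U' ω.1 p.2)) with hB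
  have hpair : ex (fun ω => pr (B ω)) ≤ 1 / (Nat.card A : ℝ) ^ ℓ +
      ((Nat.card F : ℝ) ^ (2 * ℓ * 1 + 2) / (Nat.card F : ℝ) ^ g + (δ + δ)) := by
    have hcard : (Nat.card (Fin ℓ → A) : ℝ) = (Nat.card A : ℝ) ^ ℓ := by
      rw [Nat.card_fun, Nat.card_fin, Nat.cast_pow]
    rw [← hcard]
    refine ex_pr_pair_le B (by positivity) fun u v huv => ?_
    have huv' : List.ofFn u ≠ List.ofFn v := fun h => huv (List.ofFn_injective h)
    have hgood := pr_not_good (F := F) (n := n) hG (List.length_ofFn (f := u)) (List.length_ofFn (f := v))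
      huv' 1 g
    refine le_trans ?_ (add_le_add_left hgood (δ + δ))
    refine pr_prod_le (add_nonneg hδ0 hδ0) fun τ hτ => ?_
    have e1 := pr_not_jointlyIndep_le (s := s) (wordProd τ (List.ofFn u)).1.isUnit
      (card_ker_smul_add_le hτ)
    have e2 := pr_not_jointlyIndep_le (s := s) ((wordProd τ (List.ofFn u)).1⁻¹).isUnit
      (card_ker_smul_add_inv_le hτ)
    rw [← pr_equiv (Equiv.prodComm _ _)] at e2
    refine (add_le_add e1 e2).trans' ((pr_or_le _ _).trans' ?_)
    refine pr_mono fun R hR => ?_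
    exact not_and_or.1 hR
  have hτ : ∀ τ : A → G, p ^ 2 * pr (fun y : Fin 2 → G => ¬ ∃ u : Fin ℓ → A,
      T (Q * (y 0 * wordProd τ (List.ofFn u) * y 1).1.1 * P,
        Q * ((y 0 * wordProd τ (List.ofFn u) * y 1).1⁻¹).1 * P)) ≤
      (4 * Nat.card F : ℝ) ^ 2 * ex (fun R : Matrix (Fin s) (Fin n) F × Matrix (Fin s) (Fin n) F =>
        pr (B (τ, R))) := by
    intro τ
    have h1 := pr_two_le hn hsn hG hP hQ (fun R D => ∀ u, ¬ T (R.1 * U τ u * D.2, R.2 * U' τ u * D.1))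
    rw [pr_prod] at h1
    have h2 := mul_le_mul_of_nonneg_left h1 (sq_nonneg p)
    have h3 : ∀ R : Matrix (Fin s) (Fin n) F × Matrix (Fin s) (Fin n) F,
        p ^ 2 * pr (fun D : Matrix (Fin n) (Fin s) F × Matrix (Fin n) (Fin s) F =>
          (Function.Injective R.1ᵀ.mulVec ∧ Function.Injective R.2ᵀ.mulVec) ∧
          (R.1 * D.1 = Q * P ∧ R.2 * D.2 = Q * P) ∧
            ∀ u, ¬ T (R.1 * U τ u * D.2, R.2 * U' τ u * D.1)) ≤
          1 / (Nat.card F : ℝ) ^ (2 * (s * s)) * pr (B (τ, R)) := by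
      intro R
      by_cases hR : Function.Injective R.1ᵀ.mulVec ∧ Function.Injective R.2ᵀ.mulVec
      · rw [hp]
        refine (sq_mul_pr_fibre_le (U τ) (U' τ) hR.1 hR.2 (Q * P) T).trans' ?_
        exact mul_le_mul_of_nonneg_left (pr_mono fun D hD => hD.2) (sq_nonneg _)
      · rw [pr_eq_zero fun D hD => hR hD.1, mul_zero]
        exact mul_nonneg (by positivity) (pr_nonneg _)
    have h4 := ex_mono h3
    rw [ex_mul_left, ex_mul_left] at h4
    have hq : (0 : ℝ) < (Nat.card F : ℝ) ^ (2 * (s * s)) := by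
      have : (0 : ℝ) < Nat.card F := by exact_mod_cast Nat.card_pos
      positivity
    have h5 : pr (fun y : Fin 2 → G => ¬ ∃ u : Fin ℓ → A,
      T (Q * (y 0 * wordProd τ (List.ofFn u) * y 1).1.1 * P,
        Q * ((y 0 * wordProd τ (List.ofFn u) * y 1).1⁻¹).1 * P)) ≤
        pr (fun y : Fin 2 → G => ∀ u, ¬ T (Q * (y 0).1.1 * U τ u * ((y 1).1.1 * P),
          Q * ((y 1).1⁻¹).1 * U' τ u * (((y 0).1⁻¹).1 * P))) := by
      refine pr_mono fun y hy u hu => hy ⟨u, ?_⟩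
      convert hu using 2
      · simp only [hU, Subgroup.coe_mul, Units.val_mul, Matrix.mul_assoc]
      · simp only [hU', Subgroup.coe_mul, _root_.mul_inv_rev, Units.val_mul, Matrix.mul_assoc]
    refine (mul_le_mul_of_nonneg_left h5 (sq_nonneg p)).trans (h2.trans ?_)
    calc _ = (4 * Nat.card F : ℝ) ^ 2 * (Nat.card F : ℝ) ^ (2 * (s * s)) * (p ^ 2 * _) := by ring
      _ ≤ (4 * Nat.card F : ℝ) ^ 2 * (Nat.card F : ℝ) ^ (2 * (s * s)) * _ :=
        mul_le_mul_of_nonneg_left h4 (by positivity)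
      _ = _ := by field_simp
  rw [pr_sum_arrow (fun (τ : A → G) (y : Fin 2 → G) => ¬ ∃ u : Fin ℓ → A,
      T (Q * (y 0 * wordProd τ (List.ofFn u) * y 1).1.1 * P,
        Q * ((y 0 * wordProd τ (List.ofFn u) * y 1).1⁻¹).1 * P)), pr_prod, ← ex_mul_left]
  refine (ex_mono hτ).trans ?_
  rw [ex_mul_left, ← ex_prod (fun ω => pr (B ω))]
  exact mul_le_mul_of_nonneg_left hpair (by positivity)

end TwoPoint

section RankReduction

open Matrix Polynomial

variable {F : Type*} [Field F] {n s : ℕ}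

/-- The pairs `(τ, τ')` for which the block matrix `blockCommutator A τ τ'` is a two-fold extension
of matrices conjugate to `J` and `J⁻¹`. -/
def ReducingPair (A J : GL (Fin s) F) (p : Matrix (Fin s) (Fin s) F × Matrix (Fin s) (Fin s) F) :
    Prop :=
  ∃ X Y Z : GL (Fin s) F, p.1 * Y.1 = X.1 - (A * X * J⁻¹).1 ∧
    p.2 * X.1 = (Y * J).1 - (A⁻¹ * Y).1 ∧ A * X * J⁻¹ * Y⁻¹ * A⁻¹ * Y = X * Z⁻¹ * J⁻¹ * Z

/-- The action of a commutator on the sum of the two relevant images. -/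
def blockCommutator (A : GL (Fin s) F) (τ τ' : Matrix (Fin s) (Fin s) F) :
    Matrix (Fin s ⊕ Fin s) (Fin s ⊕ Fin s) F :=
  fromBlocks (A.1 + τ * τ') (τ * (A⁻¹).1) τ' (A⁻¹).1

variable {A J : GL (Fin s) F} {τ τ' : Matrix (Fin s) (Fin s) F} {X Y Z : GL (Fin s) F}

theorem blockCommutator_mul_fromRows (h₁ : τ * Y.1 = X.1 - (A * X * J⁻¹).1)
    (h₂ : τ' * X.1 = (Y * J).1 - (A⁻¹ * Y).1) :
    blockCommutator A τ τ' * fromRows X.1 Y.1 = fromRows X.1 Y.1 * J.1 := by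
  rw [blockCommutator, fromBlocks_mul_fromRows, fromRows_mul, Matrix.add_mul, Matrix.mul_assoc τ τ',
    h₂]
  have h3 : τ * (Y * J).1 = (X * J).1 - (A * X).1 := by
    rw [Units.val_mul, ← Matrix.mul_assoc, h₁, Matrix.sub_mul, ← Units.val_mul, ← Units.val_mul,
      inv_mul_cancel_right]
  rw [Matrix.mul_sub, h3, Matrix.mul_assoc τ, ← Units.val_mul, ← Units.val_mul, ← Units.val_mul,
    ← Units.val_mul]
  congr 1 <;> abel

theorem blockCommutator_mul_fromBlocks (h₁ : τ * Y.1 = X.1 - (A * X * J⁻¹).1)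
    (h₂ : τ' * X.1 = (Y * J).1 - (A⁻¹ * Y).1) :
    blockCommutator A τ τ' * fromBlocks X.1 1 Y.1 0 = fromBlocks X.1 1 Y.1 0 *
      fromBlocks J.1 ((Y⁻¹).1 * τ') 0 (A * X * J⁻¹ * Y⁻¹ * A⁻¹ * Y * X⁻¹).1 := by
  have h := blockCommutator_mul_fromRows h₁ h₂
  rw [blockCommutator, fromBlocks_mul_fromRows, fromRows_mul, fromRows_ext_iff] at h
  obtain ⟨e1, e2⟩ := h
  rw [blockCommutator, fromBlocks_multiply, fromBlocks_multiply, e1, e2]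
  have hτ : τ = (X * Y⁻¹).1 - (A * X * J⁻¹ * Y⁻¹).1 := by
    rw [Units.val_mul (A * X * J⁻¹), Units.val_mul X, ← Matrix.sub_mul, ← h₁, Matrix.mul_assoc,
      ← Units.val_mul, mul_inv_cancel, Units.val_one, Matrix.mul_one]
  have hτ' : τ' = (Y * J * X⁻¹).1 - (A⁻¹ * Y * X⁻¹).1 := by
    rw [Units.val_mul (Y * J), Units.val_mul (A⁻¹ * Y), ← Matrix.sub_mul, ← h₂, Matrix.mul_assoc,
      ← Units.val_mul, mul_inv_cancel, Units.val_one, Matrix.mul_one]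
  have e3 : A.1 + τ * τ' = X.1 * ((Y⁻¹).1 * τ') + (A * X * J⁻¹ * Y⁻¹ * A⁻¹ * Y * X⁻¹).1 := by
    have : τ * τ' = (X * Y⁻¹).1 * τ' - (A * X * J⁻¹ * Y⁻¹).1 * τ' := by
      rw [← Matrix.sub_mul, ← hτ]
    rw [this, ← Matrix.mul_assoc, ← Units.val_mul]
    have h4 : (A * X * J⁻¹ * Y⁻¹).1 * τ' = A.1 - (A * X * J⁻¹ * Y⁻¹ * A⁻¹ * Y * X⁻¹).1 := by
      rw [hτ', Matrix.mul_sub, ← Units.val_mul, ← Units.val_mul]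
      congr 2 <;> group
    rw [h4]; abel
  have e4 : τ' = Y.1 * ((Y⁻¹).1 * τ') := by
    rw [← Matrix.mul_assoc, ← Units.val_mul, mul_inv_cancel, Units.val_one, Matrix.one_mul]
  simp only [Matrix.mul_zero, Matrix.mul_one, Matrix.zero_mul, Matrix.one_mul, add_zero]
  rw [e3, ← e4]

theorem fromBlocks_zero_pow {m k : Type*} [Fintype m] [Fintype k] [DecidableEq m] [DecidableEq k]
    (A : Matrix m m F) (B : Matrix m k F) (D : Matrix k k F) (r : ℕ) :
    ∃ B' : Matrix m k F, (fromBlocks A B 0 D) ^ r = fromBlocks (A ^ r) B' 0 (D ^ r) := by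
  induction r with
  | zero => exact ⟨0, by simp⟩
  | succ r ih =>
    obtain ⟨B', h⟩ := ih
    refine ⟨A ^ r * B + B' * D, ?_⟩
    rw [pow_succ, h, fromBlocks_multiply]
    simp [pow_succ]

theorem Matrix.rank_add_le' {m k : Type*} [Fintype m] [Fintype k] (A B : Matrix m k F) :
    (A + B).rank ≤ A.rank + B.rank := by
  rw [Matrix.rank, Matrix.rank, Matrix.rank, Matrix.mulVecLin_add]
  refine (Submodule.finrank_mono (LinearMap.range_add_le _ _)).trans ?_
  exact Submodule.finrank_add_le_finrank_add_finrank _ _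

theorem rank_fromBlocks_zero_sq_le {m k : Type*} [Fintype m] [Fintype k] [DecidableEq m]
    [DecidableEq k] (A : Matrix m m F) (B : Matrix m k F) (D : Matrix k k F) :
    ((fromBlocks A B 0 D) ^ 2).rank ≤ A.rank + D.rank := by
  have h : (fromBlocks A B 0 D) ^ 2 =
      fromRows (1 : Matrix m m F) (0 : Matrix k m F) * A * fromCols (1 : Matrix m m F) (0 : Matrix m k F) *
        fromBlocks A B 0 D + fromBlocks A B 0 D * (fromRows (0 : Matrix m k F) (1 : Matrix k k F) *
        D * fromCols (0 : Matrix k m F) (1 : Matrix k k F)) := by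
    have e1 : fromRows (1 : Matrix m m F) (0 : Matrix k m F) * A *
        fromCols (1 : Matrix m m F) (0 : Matrix m k F) = fromBlocks A 0 0 0 := by
      rw [fromRows_mul, fromRows_mul_fromCols]; simp
    have e2 : fromRows (0 : Matrix m k F) (1 : Matrix k k F) * D *
        fromCols (0 : Matrix k m F) (1 : Matrix k k F) = fromBlocks 0 0 0 D := by
      rw [fromRows_mul, fromRows_mul_fromCols]; simp
    rw [e1, e2, pow_two, fromBlocks_multiply, fromBlocks_multiply, fromBlocks_multiply,
      fromBlocks_add]
    simp
  rw [h]
  refine (Matrix.rank_add_le' _ _).trans (add_le_add ?_ ?_)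
  · exact (rank_mul_le_left _ _).trans ((rank_mul_le_left _ _).trans (rank_mul_le_right _ _))
  · exact (rank_mul_le_right _ _).trans ((rank_mul_le_left _ _).trans (rank_mul_le_right _ _))

theorem sub_one_pow_mul_eq {R : Type*} [Ring R] {M U N : R} (h : M * U = U * N) (k : ℕ) :
    (M - 1) ^ k * U = U * (N - 1) ^ k := by
  have h' : (M - 1) * U = U * (N - 1) := by rw [sub_mul, mul_sub, h, one_mul, mul_one]
  induction k with
  | zero => simp
  | succ k ih => rw [pow_succ, mul_assoc, h', ← mul_assoc, ih, mul_assoc, ← pow_succ]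

theorem ReducingPair.rank_le {k : ℕ} (hJ : ((J.1 - 1) ^ k).rank ≤ 2)
    (h : ReducingPair A J (τ, τ')) : ((blockCommutator A τ τ' - 1) ^ (k * 2)).rank ≤ 4 := by
  obtain ⟨X, Y, Z, h₁, h₂, h₃⟩ := h
  have h := blockCommutator_mul_fromBlocks h₁ h₂
  set U : Matrix (Fin s ⊕ Fin s) (Fin s ⊕ Fin s) F := fromBlocks X.1 1 Y.1 0 with hU
  set L : GL (Fin s) F := A * X * J⁻¹ * Y⁻¹ * A⁻¹ * Y * X⁻¹ with hL
  have hL' : L * (X * Z⁻¹) = (X * Z⁻¹) * J⁻¹ := by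
    rw [hL, h₃]; group
  have hLr : ((L.1 - 1) ^ k).rank ≤ 2 := by
    have e := sub_one_pow_mul_eq (congrArg Units.val hL') k
    have e2 : (L.1 - 1) ^ k = (X * Z⁻¹).1 * ((J⁻¹).1 - 1) ^ k * ((X * Z⁻¹)⁻¹).1 := by
      rw [← e, Matrix.mul_assoc, ← Units.val_mul, mul_inv_cancel, Units.val_one, Matrix.mul_one]
    have e3 : (J⁻¹).1 - 1 = (-(J⁻¹).1) * (J.1 - 1) := by
      rw [Matrix.neg_mul, Matrix.mul_sub, ← Units.val_mul, inv_mul_cancel, Matrix.mul_one,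
        Units.val_one]
      abel
    have e4 : Commute (-(J⁻¹).1) (J.1 - 1) := by
      refine Commute.neg_left (Commute.sub_right ?_ (Commute.one_right _))
      exact (Commute.refl J).inv_left.units_val
    rw [e2, e3, e4.mul_pow]
    exact (rank_mul_le_left _ _).trans ((rank_mul_le_right _ _).trans
      ((rank_mul_le_right _ _).trans hJ))
  have hUV : U * fromBlocks (0 : Matrix (Fin s) (Fin s) F) (Y⁻¹).1 1 (-(X * Y⁻¹).1) = 1 := by
    rw [hU, fromBlocks_multiply]
    simp only [Matrix.mul_zero, Matrix.mul_one, Matrix.zero_mul, Matrix.one_mul, add_zero,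
      zero_add, ← Units.val_mul, mul_inv_cancel, Units.val_one, add_neg_cancel]
    exact fromBlocks_one
  have e := sub_one_pow_mul_eq h (k * 2)
  have e2 : (blockCommutator A τ τ' - 1) ^ (k * 2) = U * (fromBlocks J.1 ((Y⁻¹).1 * τ') 0 L.1 - 1) ^
      (k * 2) * fromBlocks (0 : Matrix (Fin s) (Fin s) F) (Y⁻¹).1 1 (-(X * Y⁻¹).1) := by
    rw [← e, Matrix.mul_assoc, hUV, Matrix.mul_one]
  have e3 : fromBlocks J.1 ((Y⁻¹).1 * τ') 0 L.1 - 1 =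
      fromBlocks (J.1 - 1) ((Y⁻¹).1 * τ') 0 (L.1 - 1) := by
    rw [← fromBlocks_one, sub_eq_add_neg, fromBlocks_neg, fromBlocks_add]
    simp [sub_eq_add_neg]
  rw [e2, e3]
  obtain ⟨B', hB⟩ := fromBlocks_zero_pow (J.1 - 1) ((Y⁻¹).1 * τ') (L.1 - 1) k
  rw [pow_mul, hB]
  exact (rank_mul_le_left _ _).trans ((rank_mul_le_right _ _).trans
    ((rank_fromBlocks_zero_sq_le _ _ _).trans (by omega)))

theorem ReducingPair.sub_one_pow_ne_zero {k : ℕ} (hJ : (J.1 - 1) ^ k ≠ 0)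
    (h : ReducingPair A J (τ, τ')) : (blockCommutator A τ τ' - 1) ^ k ≠ 0 := by
  obtain ⟨X, Y, Z, h₁, h₂, h₃⟩ := h
  have h := blockCommutator_mul_fromBlocks h₁ h₂
  have e := sub_one_pow_mul_eq h k
  intro h0
  have e3 : fromBlocks J.1 ((Y⁻¹).1 * τ') 0 (A * X * J⁻¹ * Y⁻¹ * A⁻¹ * Y * X⁻¹).1 - 1 =
      fromBlocks (J.1 - 1) ((Y⁻¹).1 * τ') 0 ((A * X * J⁻¹ * Y⁻¹ * A⁻¹ * Y * X⁻¹).1 - 1) := by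
    rw [← fromBlocks_one, sub_eq_add_neg, fromBlocks_neg, fromBlocks_add]
    simp [sub_eq_add_neg]
  obtain ⟨B', hB⟩ := fromBlocks_zero_pow (J.1 - 1) ((Y⁻¹).1 * τ')
    ((A * X * J⁻¹ * Y⁻¹ * A⁻¹ * Y * X⁻¹).1 - 1) k
  rw [h0, Matrix.zero_mul, e3, hB, fromBlocks_multiply] at e
  have e4 : X.1 * (J.1 - 1) ^ k = 0 := by
    have := congrArg toBlocks₁₁ e
    rw [toBlocks_fromBlocks₁₁, Matrix.mul_zero, add_zero] at this
    rw [← this]; rfl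
  apply hJ
  have := congrArg ((X⁻¹).1 * ·) e4
  simpa only [← Matrix.mul_assoc, ← Units.val_mul, inv_mul_cancel, Units.val_one, Matrix.one_mul,
    Matrix.mul_zero] using this

end RankReduction

section RankReduction

open Matrix Polynomial

theorem card_sq_le_card_mul_card_fibrePairs {α β : Type*} [Finite α] [Finite β] (f : α → β) :
    Nat.card α ^ 2 ≤ Nat.card β * Nat.card {p : α × α // f p.1 = f p.2} := by
  classical
  have := Fintype.ofFinite α
  have := Fintype.ofFinite β
  have h1 : Nat.card α = ∑ b : β, Nat.card {a // f a = b} := by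
    rw [← Nat.card_sigma]
    exact Nat.card_congr (Equiv.sigmaFiberEquiv f).symm
  have h2 : Nat.card {p : α × α // f p.1 = f p.2} = ∑ b : β, Nat.card {a // f a = b} ^ 2 := by
    have : ∀ b : β, Nat.card {a // f a = b} ^ 2 = Nat.card ({a // f a = b} × {a // f a = b}) :=
      fun b => by rw [Nat.card_prod, sq]
    rw [Finset.sum_congr rfl fun b _ => this b, ← Nat.card_sigma]
    exact Nat.card_congr
      { toFun := fun p => ⟨f p.1.1, ⟨p.1.1, rfl⟩, ⟨p.1.2, p.2.symm⟩⟩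
        invFun := fun t => ⟨(t.2.1.1, t.2.2.1), t.2.1.2.trans t.2.2.2.symm⟩
        left_inv := fun p => rfl
        right_inv := by rintro ⟨b, ⟨a, rfl⟩, ⟨a', ha'⟩⟩; rfl }
  rw [h1, h2, Nat.card_eq_fintype_card]
  exact sq_sum_le_card_mul_sum_sq

theorem card_sq_le_card_conj_triples {Γ : Type*} [Group Γ] [Finite Γ] (φ : Γ → Γ) :
    Nat.card Γ ^ 2 ≤ Nat.card {t : Γ × Γ × Γ // φ t.1 = t.2.2⁻¹ * φ t.2.1 * t.2.2} := by
  have h := card_sq_le_card_mul_card_fibrePairs (fun p : Γ × Γ => p.2 * φ p.1 * p.2⁻¹)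
  have e : Nat.card {p : (Γ × Γ) × (Γ × Γ) // p.1.2 * φ p.1.1 * p.1.2⁻¹ =
      p.2.2 * φ p.2.1 * p.2.2⁻¹} =
      Nat.card (Γ × {t : Γ × Γ × Γ // φ t.1 = t.2.2⁻¹ * φ t.2.1 * t.2.2}) := by
    refine Nat.card_congr
      { toFun := fun p => (p.1.1.2, ⟨(p.1.1.1, p.1.2.1, p.1.2.2⁻¹ * p.1.1.2), ?_⟩)
        invFun := fun t => ⟨((t.2.1.1, t.1), (t.2.1.2.1, t.1 * t.2.1.2.2⁻¹)), ?_⟩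
        left_inv := fun p => ?_
        right_inv := fun t => ?_ }
    · have h1 := p.2
      change φ p.1.1.1 = (p.1.2.2⁻¹ * p.1.1.2)⁻¹ * φ p.1.2.1 * (p.1.2.2⁻¹ * p.1.1.2)
      rw [mul_inv_eq_iff_eq_mul] at h1
      rw [eq_comm, _root_.mul_inv_rev, inv_inv]
      have : φ p.1.1.1 = p.1.1.2⁻¹ * (p.1.2.2 * φ p.1.2.1 * p.1.2.2⁻¹ * p.1.1.2) := by
        rw [← h1, inv_mul_cancel_left]
      rw [this]; group
    · change t.1 * φ t.2.1.1 * t.1⁻¹ = t.1 * t.2.1.2.2⁻¹ * φ t.2.1.2.1 * (t.1 * t.2.1.2.2⁻¹)⁻¹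
      rw [t.2.2]; group
    · apply Subtype.ext
      simp
    · refine Prod.ext rfl (Subtype.ext ?_)
      simp
  rw [e, Nat.card_prod, Nat.card_prod] at h
  have hpos : 0 < Nat.card Γ := Nat.card_pos
  have h' : (Nat.card Γ * Nat.card Γ) * Nat.card Γ ^ 2 ≤ (Nat.card Γ * Nat.card Γ) *
      Nat.card {t : Γ × Γ × Γ // φ t.1 = t.2.2⁻¹ * φ t.2.1 * t.2.2} := by
    calc _ = (Nat.card Γ * Nat.card Γ) ^ 2 := by ring
      _ ≤ _ := h
      _ = _ := by ring
  exact Nat.le_of_mul_le_mul_left h' (Nat.mul_pos hpos hpos)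

theorem card_sq_le_card_commutator_triples {Γ : Type*} [Group Γ] [Finite Γ] (A J : Γ) :
    Nat.card Γ ^ 2 ≤ Nat.card {t : Γ × Γ × Γ // A * t.1 * J⁻¹ * t.2.1⁻¹ * A⁻¹ * t.2.1 =
      t.1 * t.2.2⁻¹ * J⁻¹ * t.2.2} := by
  refine (card_sq_le_card_conj_triples (fun X : Γ => X⁻¹ * A * X * J⁻¹)).trans ?_
  refine Nat.card_le_card_of_injective
    (fun t => ⟨(t.1.1, t.1.2.1 * (J⁻¹ * t.1.2.2), J⁻¹ * t.1.2.2), ?_⟩) ?_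
  · obtain ⟨⟨X, W, Z⟩, ht⟩ := t
    change X⁻¹ * A * X * J⁻¹ = Z⁻¹ * (W⁻¹ * A * W * J⁻¹) * Z at ht
    change A * X * J⁻¹ * (W * (J⁻¹ * Z))⁻¹ * A⁻¹ * (W * (J⁻¹ * Z)) =
      X * (J⁻¹ * Z)⁻¹ * J⁻¹ * (J⁻¹ * Z)
    have : A * X * J⁻¹ = X * (X⁻¹ * A * X * J⁻¹) := by group
    rw [this, ht]
    group
  · rintro ⟨⟨X, W, Z⟩, ht⟩ ⟨⟨X', W', Z'⟩, ht'⟩ h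
    simp only [Subtype.mk.injEq, Prod.mk.injEq] at h
    obtain ⟨rfl, h2, h3⟩ := h
    rw [h3] at h2
    have h4 := mul_right_cancel h2
    have h5 := mul_left_cancel h3
    subst h4; subst h5; rfl

theorem inv_mul_inv_of_commutator {Γ : Type*} [Group Γ] {A J X Y Z : Γ}
    (h : A * X * J⁻¹ * Y⁻¹ * A⁻¹ * Y = X * Z⁻¹ * J⁻¹ * Z) :
    (X⁻¹ * A * X * J⁻¹ * Y⁻¹ * A⁻¹ * Y)⁻¹ * Z⁻¹ = Z⁻¹ * J := by
  have : X⁻¹ * A * X * J⁻¹ * Y⁻¹ * A⁻¹ * Y = X⁻¹ * (A * X * J⁻¹ * Y⁻¹ * A⁻¹ * Y) := by group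
  rw [this, h]; group

variable {F : Type*} [Field F] [Finite F] {n s : ℕ}

theorem eq_zero_of_intertwines_companion {m : Type*} [Fintype m] [DecidableEq m] {f : F[X]}
    (hs : 0 < s) {B : Matrix m m F} {U : Matrix m (Fin s) F} (h : B * U = U * companion s f)
    (h0 : U *ᵥ Pi.single (⟨0, hs⟩ : Fin s) 1 = 0) : U = 0 := by
  have hp : ∀ k : ℕ, B ^ k * U = U * companion s f ^ k := by
    intro k
    induction k with
    | zero => simp
    | succ k ih => rw [pow_succ, Matrix.mul_assoc, h, ← Matrix.mul_assoc, ih, Matrix.mul_assoc,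
        ← pow_succ]
  ext i j
  have := companion_pow_mulVec f hs j j.2
  have h2 : U *ᵥ Pi.single j 1 = 0 := by
    rw [← this, Matrix.mulVec_mulVec, ← hp, ← Matrix.mulVec_mulVec, h0, Matrix.mulVec_zero]
  rw [Matrix.mulVec_single_one] at h2
  exact congrFun h2 i

theorem card_GL_sq_le_card_reducingPair (hs : 0 < s) {f : F[X]} {A J : GL (Fin s) F}
    (hJ : J.1 = companion s f) : Nat.card (GL (Fin s) F) ^ 2 ≤
      Nat.card {p : Matrix (Fin s) (Fin s) F × Matrix (Fin s) (Fin s) F // ReducingPair A J p} *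
        Nat.card F ^ (3 * s) := by
  refine (card_sq_le_card_commutator_triples A J).trans (card_le_mul_of_fibre_le (fun t :
    {t : GL (Fin s) F × GL (Fin s) F × GL (Fin s) F // A * t.1 * J⁻¹ * t.2.1⁻¹ * A⁻¹ * t.2.1 =
      t.1 * t.2.2⁻¹ * J⁻¹ * t.2.2} =>
    (⟨((t.1.1.1 - (A * t.1.1 * J⁻¹).1) * (t.1.2.1⁻¹).1,
      ((t.1.2.1 * J).1 - (A⁻¹ * t.1.2.1).1) * (t.1.1⁻¹).1), t.1.1, t.1.2.1, t.1.2.2, by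
        rw [Matrix.mul_assoc, ← Units.val_mul, inv_mul_cancel, Units.val_one, Matrix.mul_one], by
        rw [Matrix.mul_assoc, ← Units.val_mul, inv_mul_cancel, Units.val_one, Matrix.mul_one],
        t.2⟩ : {p // ReducingPair A J p})) _ ?_)
  rintro ⟨⟨τ, τ'⟩, -⟩
  set e : Fin s → F := Pi.single ⟨0, hs⟩ 1 with he
  have hcard : Nat.card F ^ (3 * s) = Nat.card ((Fin s → F) × (Fin s → F) × (Fin s → F)) := by
    rw [Nat.card_prod, Nat.card_prod, card_vec, Nat.card_fin, ← pow_add, ← pow_add]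
    congr 1; omega
  rw [hcard]
  refine Nat.card_le_card_of_injective
    (fun t => (t.1.1.1.1 *ᵥ e, t.1.1.2.1.1 *ᵥ e, (t.1.1.2.2⁻¹).1 *ᵥ e)) ?_
  rintro ⟨⟨⟨X, Y, Z⟩, hXYZ⟩, ht⟩ ⟨⟨⟨X', Y', Z'⟩, hXYZ'⟩, ht'⟩ h
  replace ht := Prod.ext_iff.1 (congrArg Subtype.val ht)
  replace ht' := Prod.ext_iff.1 (congrArg Subtype.val ht')
  simp only [Prod.mk.injEq] at h
  obtain ⟨hX, hY, hZ⟩ := h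
  have key : ∀ {X Y : GL (Fin s) F}, (X.1 - (A * X * J⁻¹).1) * (Y⁻¹).1 = τ →
      ((Y * J).1 - (A⁻¹ * Y).1) * (X⁻¹).1 = τ' →
      blockCommutator A τ τ' * fromRows X.1 Y.1 = fromRows X.1 Y.1 * J.1 := by
    intro X Y h1 h2
    refine blockCommutator_mul_fromRows ?_ ?_
    · rw [← h1, Matrix.mul_assoc, ← Units.val_mul, inv_mul_cancel, Units.val_one, Matrix.mul_one]
    · rw [← h2, Matrix.mul_assoc, ← Units.val_mul, inv_mul_cancel, Units.val_one, Matrix.mul_one]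
  have hXY : fromRows X.1 Y.1 - fromRows X'.1 Y'.1 = 0 := by
    refine eq_zero_of_intertwines_companion (f := f) (B := blockCommutator A τ τ') hs ?_ ?_
    · rw [Matrix.mul_sub, key ht.1 ht.2, key ht'.1 ht'.2, Matrix.sub_mul, hJ]
    · rw [Matrix.sub_mulVec, fromRows_mulVec, fromRows_mulVec, ← he, hX, hY, sub_self]
  rw [sub_eq_zero, fromRows_ext_iff] at hXY
  have hX' : X = X' := Units.ext hXY.1
  have hY' : Y = Y' := Units.ext hXY.2
  subst hX'; subst hY'
  have hZZ : (Z⁻¹).1 - (Z'⁻¹).1 = 0 := by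
    refine eq_zero_of_intertwines_companion (f := f)
      (B := ((X⁻¹ * A * X * J⁻¹ * Y⁻¹ * A⁻¹ * Y)⁻¹).1) hs ?_ ?_
    · rw [Matrix.mul_sub, ← Units.val_mul, ← Units.val_mul, inv_mul_inv_of_commutator hXYZ,
        inv_mul_inv_of_commutator hXYZ', Matrix.sub_mul,
        Units.val_mul, Units.val_mul, hJ]
    · rw [Matrix.sub_mulVec, ← he, hZ, sub_self]
  have hZ' : Z = Z' := inv_injective (Units.ext (sub_eq_zero.1 hZZ))
  subst hZ'
  rfl

end RankReduction

section TwoPointStage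

open Matrix

variable {F : Type*} [Field F]

theorem exists_rank_factorization {n : ℕ} (D : Matrix (Fin n) (Fin n) F) :
    ∃ (P : Matrix (Fin n) (Fin D.rank) F) (Q : Matrix (Fin D.rank) (Fin n) F),
      D = P * Q ∧ Function.Injective P.mulVec ∧ Function.Injective Qᵀ.mulVec := by
  let b : Module.Basis (Fin D.rank) F (LinearMap.range D.mulVecLin) :=
    Module.finBasisOfFinrankEq F _ rfl
  let P : Matrix (Fin n) (Fin D.rank) F := Matrix.of fun i j => (b j : Fin n → F) i
  let f : (Fin n → F) →ₗ[F] (Fin D.rank → F) := b.equivFun.toLinearMap ∘ₗ D.mulVecLin.rangeRestrict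
  have hP : ∀ v : Fin D.rank → F, P *ᵥ v = (b.equivFun.symm v : LinearMap.range D.mulVecLin).1 := by
    intro v
    rw [Module.Basis.equivFun_symm_apply]
    funext i
    simp only [P, Matrix.mulVec, dotProduct, Matrix.of_apply, Submodule.coe_sum, Finset.sum_apply,
      Submodule.coe_smul, Pi.smul_apply, smul_eq_mul]
    exact Finset.sum_congr rfl fun j _ => mul_comm _ _
  have hf : Function.Surjective f :=
    b.equivFun.surjective.comp (LinearMap.surjective_rangeRestrict _)
  refine ⟨P, LinearMap.toMatrix' f, ?_, ?_, ?_⟩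
  · refine Matrix.toLin'.injective (LinearMap.ext fun v => ?_)
    rw [Matrix.toLin'_apply, Matrix.toLin'_apply, ← Matrix.mulVec_mulVec,
      LinearMap.toMatrix'_mulVec, hP]
    simp only [f, LinearMap.comp_apply, LinearEquiv.coe_coe, LinearEquiv.symm_apply_apply]
    rfl
  · intro v w h
    rw [hP, hP] at h
    exact b.equivFun.symm.injective (Subtype.ext h)
  · intro v w h
    refine dotProduct_eq _ _ fun u => ?_
    obtain ⟨z, rfl⟩ := hf u
    rw [← LinearMap.toMatrix'_mulVec, dotProduct_mulVec, dotProduct_mulVec, ← mulVec_transpose,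
      ← mulVec_transpose]
    exact congrArg (· ⬝ᵥ z) h

variable {n s : ℕ}

theorem inv_eq_one_sub {a : GL (Fin n) F} {P : Matrix (Fin n) (Fin s) F}
    {Q : Matrix (Fin s) (Fin n) F} (ha : a.1 - 1 = P * Q) {A : GL (Fin s) F}
    (hA : A.1 = 1 + Q * P) : (a⁻¹).1 = 1 - P * (A⁻¹).1 * Q := by
  have hQP : Q * P = A.1 - 1 := by rw [hA]; abel
  have hAA : A.1 * (A⁻¹).1 = 1 := by rw [← Units.val_mul, mul_inv_cancel, Units.val_one]
  have ha' : a.1 = 1 + P * Q := by rw [← ha]; abel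
  have h1 : a.1 * (1 - P * (A⁻¹).1 * Q) = 1 := by
    rw [ha', Matrix.add_mul, Matrix.one_mul, Matrix.mul_sub, Matrix.mul_one]
    have : P * Q * (P * (A⁻¹).1 * Q) = P * (Q * P) * (A⁻¹).1 * Q := by
      simp only [Matrix.mul_assoc]
    rw [this, hQP, Matrix.mul_sub, Matrix.sub_mul, Matrix.mul_assoc P A.1, hAA]
    simp only [Matrix.mul_one, Matrix.sub_mul]
    abel
  calc (a⁻¹).1 = (a⁻¹).1 * (a.1 * (1 - P * (A⁻¹).1 * Q)) := by rw [h1, Matrix.mul_one]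
    _ = _ := by rw [← Matrix.mul_assoc, ← Units.val_mul, inv_mul_cancel, Units.val_one,
      Matrix.one_mul]

theorem exists_compression {a : GL (Fin n) F} {P : Matrix (Fin n) (Fin s) F}
    {Q : Matrix (Fin s) (Fin n) F} (ha : a.1 - 1 = P * Q) : ∃ A : GL (Fin s) F, A.1 = 1 + Q * P := by
  have h : IsUnit (1 + Q * P) := by
    rw [Matrix.isUnit_iff_isUnit_det, Matrix.det_one_add_mul_comm, ← ha, add_sub_cancel]
    exact (Matrix.isUnit_iff_isUnit_det _).1 a.isUnit
  exact ⟨h.unit, rfl⟩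

theorem commutator_sub_one {a h : GL (Fin n) F} {P : Matrix (Fin n) (Fin s) F}
    {Q : Matrix (Fin s) (Fin n) F} (ha : a.1 - 1 = P * Q) {A : GL (Fin s) F}
    (hA : A.1 = 1 + Q * P) :
    ∃ (U : Matrix (Fin n) (Fin s ⊕ Fin s) F) (V : Matrix (Fin s ⊕ Fin s) (Fin n) F),
      (a * h * a⁻¹ * h⁻¹).1 - 1 = U * V ∧
      V * U = blockCommutator A (-(Q * h.1 * P) * (A⁻¹).1) (Q * (h⁻¹).1 * P) - 1 := by
  have hQP : Q * P = A.1 - 1 := by rw [hA]; abel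
  have hAA : A.1 * (A⁻¹).1 = 1 := by rw [← Units.val_mul, mul_inv_cancel, Units.val_one]
  have ha' : a.1 = 1 + P * Q := by rw [← ha]; abel
  have hinv := inv_eq_one_sub ha hA
  have hh : h.1 * (h⁻¹).1 = 1 := by rw [← Units.val_mul, mul_inv_cancel, Units.val_one]
  have hh' : (h⁻¹).1 * h.1 = 1 := by rw [← Units.val_mul, inv_mul_cancel, Units.val_one]
  set P' : Matrix (Fin n) (Fin s) F := -(h.1 * P * (A⁻¹).1) with hP'
  set Q' : Matrix (Fin s) (Fin n) F := Q * (h⁻¹).1 with hQ'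
  set τ : Matrix (Fin s) (Fin s) F := -(Q * h.1 * P) * (A⁻¹).1 with hτ
  have e1 : Q * P' = τ := by
    rw [hP', hτ, Matrix.mul_neg, Matrix.neg_mul]; simp only [Matrix.mul_assoc]
  have e2 : Q' * P' = (A⁻¹).1 - 1 := by
    have : Q' * P' = -(Q * ((h⁻¹).1 * h.1) * P * (A⁻¹).1) := by
      rw [hP', hQ', Matrix.mul_neg]; simp only [Matrix.mul_assoc]
    rw [this, hh', Matrix.mul_one, hQP, Matrix.sub_mul, hAA, Matrix.one_mul]; abel
  have e3 : h.1 * (a⁻¹).1 * (h⁻¹).1 = 1 + P' * Q' := by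
    rw [hinv, hP', hQ', Matrix.mul_sub, Matrix.sub_mul, Matrix.mul_one, hh, Matrix.neg_mul,
      sub_eq_add_neg]
    simp only [Matrix.mul_assoc]
  refine ⟨fromCols P P', fromRows (Q + τ * Q') Q', ?_, ?_⟩
  · rw [fromCols_mul_fromRows]
    have : (a * h * a⁻¹ * h⁻¹).1 = a.1 * (h.1 * (a⁻¹).1 * (h⁻¹).1) := by
      simp only [Units.val_mul, Matrix.mul_assoc]
    rw [this, e3, ha', Matrix.add_mul, Matrix.mul_add, Matrix.mul_add, Matrix.one_mul,
      Matrix.one_mul, Matrix.mul_one, ← e1, Matrix.mul_add]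
    simp only [Matrix.mul_assoc]
    abel
  · rw [fromRows_mul_fromCols, blockCommutator, Matrix.add_mul, Matrix.add_mul, e1, hQP,
      Matrix.mul_assoc τ Q' P, Matrix.mul_assoc τ Q' P', e2, ← fromBlocks_one,
      sub_eq_add_neg (fromBlocks _ _ _ _),
      fromBlocks_neg, fromBlocks_add, Matrix.mul_sub, Matrix.mul_one]
    congr 1 <;> abel

theorem mul_pow_succ_eq {m k : Type*} [Fintype m] [Fintype k] [DecidableEq m] [DecidableEq k]
    (U : Matrix m k F) (V : Matrix k m F) (r : ℕ) : (U * V) ^ (r + 1) = U * (V * U) ^ r * V := by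
  induction r with
  | zero => simp
  | succ r ih => rw [pow_succ, ih, pow_succ (V * U)]; simp only [Matrix.mul_assoc]

variable [Finite F]

theorem exists_specialCompanion (hs : 2 ≤ s) : ∃ J : GL (Fin s) F,
    J.1 = companion s (specialPoly F s) ∧ ∀ k, s ≤ k → (J.1 - 1) ^ k ≠ 0 ∧
      ((J.1 - 1) ^ k).rank ≤ 2 := by
  obtain ⟨J, hJ⟩ := isUnit_companion (specialPoly F s) specialPoly_monic (by omega)
    (specialPoly_natDegree hs) specialPoly_coeff_zero
  refine ⟨J, hJ, fun k hk => ?_⟩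
  have := rank_sub_one_pow_of_annihilator hs (w := J.1) (x := Pi.single ⟨0, by omega⟩ 1) (fun p => by
    rw [hJ]
    exact aeval_companion_mulVec_eq_zero_iff _ specialPoly_monic (by omega)
      (specialPoly_natDegree hs) p) hk
  exact ⟨this.1, by omega⟩

theorem le_pr_reducingPair (hs : 0 < s) {f : Polynomial F} {A J : GL (Fin s) F}
    (hJ : J.1 = companion s f) : 1 / (16 * (Nat.card F : ℝ) ^ (3 * s)) ≤
      pr (fun p : Matrix (Fin s) (Fin s) F × Matrix (Fin s) (Fin s) F =>
        ReducingPair A J (-p.1 * (A⁻¹).1, p.2)) := by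
  have hq0 : (0 : ℝ) < Nat.card F := by exact_mod_cast Nat.card_pos
  have h1 := card_GL_sq_le_card_reducingPair hs (A := A) hJ
  have e : Nat.card {p : Matrix (Fin s) (Fin s) F × Matrix (Fin s) (Fin s) F //
      ReducingPair A J (-p.1 * (A⁻¹).1, p.2)} = Nat.card {p : Matrix (Fin s) (Fin s) F ×
        Matrix (Fin s) (Fin s) F // ReducingPair A J p} := by
    have h2 : ∀ T : Matrix (Fin s) (Fin s) F, -(-(T * A.1)) * (A⁻¹).1 = T := by
      intro T
      rw [neg_neg, Matrix.mul_assoc, ← Units.val_mul, mul_inv_cancel, Units.val_one, Matrix.mul_one]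
    have h3 : ∀ T : Matrix (Fin s) (Fin s) F, -(-T * (A⁻¹).1 * A.1) = T := by
      intro T
      rw [Matrix.mul_assoc, ← Units.val_mul, inv_mul_cancel, Units.val_one, Matrix.mul_one, neg_neg]
    exact Nat.card_congr
      { toFun := fun p => ⟨(-p.1.1 * (A⁻¹).1, p.1.2), p.2⟩
        invFun := fun p => ⟨(-(p.1.1 * A.1), p.1.2), by rw [h2]; exact p.2⟩
        left_inv := fun p => Subtype.ext (Prod.ext (h3 p.1.1) rfl)
        right_inv := fun p => Subtype.ext (Prod.ext (h2 p.1.1) rfl) }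
  rw [pr, e, Nat.card_prod]
  have h4 := card_matrix_le_card_GL (F := F) hs
  rw [div_le_div_iff₀ (by positivity) (by
    have : 0 < Nat.card (Matrix (Fin s) (Fin s) F) := Nat.card_pos
    positivity), one_mul]
  have h5 : ((Nat.card (GL (Fin s) F) : ℝ)) ^ 2 ≤ Nat.card {p : Matrix (Fin s) (Fin s) F ×
        Matrix (Fin s) (Fin s) F // ReducingPair A J p} * (Nat.card F : ℝ) ^ (3 * s) := by
    exact_mod_cast h1
  push_cast
  nlinarith

end TwoPointStage

section TwoPointStage

open Matrix

theorem pow_div_pow_le_one_div {q : ℝ} (hq : 1 ≤ q) {a b c : ℕ} (h : a + c ≤ b) :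
    q ^ a / q ^ b ≤ 1 / q ^ c := by
  have : 0 < q := by linarith
  rw [div_le_div_iff₀ (by positivity) (by positivity), ← pow_add, one_mul]
  exact pow_le_pow_right₀ hq h

theorem one_div_pow_le {q : ℝ} (hq : 1 ≤ q) {b c : ℕ} (h : c ≤ b) : 1 / q ^ b ≤ 1 / q ^ c := by
  have := pow_div_pow_le_one_div hq (a := 0) (b := b) (c := c) (by omega)
  rwa [pow_zero] at this

theorem two_le_card_field (F : Type*) [Field F] [Finite F] : (2 : ℝ) ≤ Nat.card F := by
  exact_mod_cast one_lt_card_field (F := F)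

variable {F : Type*} [Field F] [Finite F] {n s ℓ : ℕ} {G : Subgroup (GL (Fin n) F)}

theorem pr_not_exists_mem_ball_twoPoint (hG : ContainsSL G) {A : Type*} [Finite A]
    (hA : Nat.card F ^ 20000 ≤ Nat.card A) (hℓ : 1000 ≤ ℓ) (hn : 20000 * ℓ ≤ n)
    (hs : s ≤ 1000 * ℓ + 2) {P : Matrix (Fin n) (Fin s) F} {Q : Matrix (Fin s) (Fin n) F}
    (hP : Function.Injective P.mulVec) (hQ : Function.Injective Qᵀ.mulVec)
    {T : Matrix (Fin s) (Fin s) F × Matrix (Fin s) (Fin s) F → Prop}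
    (hT : 1 / (Nat.card F : ℝ) ^ (4400 * ℓ) ≤ pr T) :
    pr (fun x : A ⊕ Fin 2 → G => ¬ ∃ h ∈ ball (symSet fun i => (x i).1) (ℓ + 2),
      T (Q * h.1 * P, Q * (h⁻¹).1 * P)) ≤ 1 / (Nat.card F : ℝ) ^ (2 * ℓ) := by
  have hA0 : 0 < Nat.card A := lt_of_lt_of_le (pow_pos Nat.card_pos _) hA
  have : Nonempty A := (Nat.card_pos_iff.1 hA0).1
  have hq := two_le_card_field F
  have h0 := pr_not_exists_twoPoint hG (A := A) (by omega) (by omega) hP hQ ℓ (10000 * ℓ) T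
  have h1 : pr (fun x : A ⊕ Fin 2 → G => ¬ ∃ h ∈ ball (symSet fun i => (x i).1) (ℓ + 2),
      T (Q * h.1 * P, Q * (h⁻¹).1 * P)) ≤ pr (fun x : A ⊕ Fin 2 → G => ¬ ∃ u : Fin ℓ → A,
      T (Q * (x (Sum.inr 0) * wordProd (fun a => x (Sum.inl a)) (List.ofFn u) *
          x (Sum.inr 1)).1.1 * P,
        Q * ((x (Sum.inr 0) * wordProd (fun a => x (Sum.inl a)) (List.ofFn u) *
          x (Sum.inr 1)).1⁻¹).1 * P)) := by
    refine pr_mono fun x hx => ?_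
    rintro ⟨u, hu⟩
    refine hx ⟨_, ?_, hu⟩
    have h2 := wordProd_mem_ball (fun j => x (Sum.inl j)) (List.ofFn u)
    rw [List.length_ofFn] at h2
    have h3 := ball_subset (symSet_comp_subset (fun i => (x i).1) Sum.inl) h2
    exact ball_mono (by omega) (mul_mem_ball (mul_mem_ball
      (mem_ball_one (apply_mem_symSet (fun i => (x i).1) (Sum.inr 0))) h3)
      (mem_ball_one (apply_mem_symSet (fun i => (x i).1) (Sum.inr 1))))
  refine h1.trans ?_
  clear h1
  revert h0
  generalize pr (fun x : A ⊕ Fin 2 → G => ¬ ∃ u : Fin ℓ → A,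
      T (Q * (x (Sum.inr 0) * wordProd (fun a => x (Sum.inl a)) (List.ofFn u) *
          x (Sum.inr 1)).1.1 * P,
        Q * ((x (Sum.inr 0) * wordProd (fun a => x (Sum.inl a)) (List.ofFn u) *
          x (Sum.inr 1)).1⁻¹).1 * P)) = Y
  revert hT
  generalize pr T = p
  intro hT h0
  have hAr : ((Nat.card F : ℝ)) ^ (20000 * ℓ) ≤ (Nat.card A : ℝ) ^ ℓ := by
    rw [pow_mul]
    exact pow_le_pow_left₀ (by positivity) (by exact_mod_cast hA) _
  revert hT h0 hAr hq
  generalize (Nat.card F : ℝ) = q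
  generalize (Nat.card A : ℝ) ^ ℓ = a
  intro hq hT h0 hAr
  have hq1 : 1 ≤ q := by linarith
  have hq0 : 0 < q := by linarith
  have t1 : 1 / a ≤ 1 / q ^ (8990 * ℓ) :=
    (one_div_le_one_div_of_le (by positivity) hAr).trans (one_div_pow_le hq1 (by omega))
  have t2 : q ^ (2 * ℓ * 1 + 2) / q ^ (10000 * ℓ) ≤ 1 / q ^ (8990 * ℓ) :=
    pow_div_pow_le_one_div hq1 (by omega)
  have t3 : q ^ (3 * s) / q ^ n ≤ 1 / q ^ (8990 * ℓ) := pow_div_pow_le_one_div hq1 (by omega)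
  have t4 : q ^ (s + 1) * (q ^ (10000 * ℓ) / q ^ n) ≤ 1 / q ^ (8990 * ℓ) := by
    rw [← mul_div_assoc, ← pow_add]
    exact pow_div_pow_le_one_div hq1 (by omega)
  have t5 : (4 * q) ^ 2 * 6 ≤ q ^ 9 := by
    nlinarith [pow_le_pow_left₀ (by norm_num) hq 7, pow_pos hq0 2]
  have hp2 : 1 / q ^ (8800 * ℓ) ≤ p ^ 2 := by
    have : 1 / q ^ (8800 * ℓ) = (1 / q ^ (4400 * ℓ)) ^ 2 := by
      rw [div_pow, one_pow, ← pow_mul]; congr 2; ring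
    rw [this]
    exact pow_le_pow_left₀ (by positivity) hT _
  have hp0 : 0 < p := lt_of_lt_of_le (by positivity) hT
  have h3 : p ^ 2 * Y ≤ q ^ 9 * (1 / q ^ (8990 * ℓ)) := by
    refine h0.trans (le_trans ?_ (mul_le_mul_of_nonneg_right t5
      (one_div_nonneg.2 (pow_nonneg hq0.le (8990 * ℓ)))))
    rw [mul_assoc ((4 * q) ^ 2)]
    exact mul_le_mul_of_nonneg_left (by linarith) (sq_nonneg (4 * q))
  have h4 : q ^ 9 * (1 / q ^ (8990 * ℓ)) ≤ p ^ 2 * (1 / q ^ (2 * ℓ)) := by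
    refine le_trans ?_ (mul_le_mul_of_nonneg_right hp2 (by positivity))
    rw [mul_one_div, div_mul_div_comm, one_mul, ← pow_add]
    exact pow_div_pow_le_one_div hq1 (by omega)
  have h5 := h3.trans h4
  exact le_of_mul_le_mul_left h5 (by positivity)

theorem pr_not_exists_rank_le_four (hG : ContainsSL G) {A : Type*} [Finite A]
    (hA : Nat.card F ^ 20000 ≤ Nat.card A) (hℓ : 1000 ≤ ℓ) (hn : 20000 * ℓ ≤ n)
    {a : GL (Fin n) F} (ha : a.1 - 1 ≠ 0) (hs : (a.1 - 1).rank ≤ 1000 * ℓ + 2) :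
    pr (fun x : A ⊕ Fin 2 → G => ¬ ∃ b ∈ ball (insert a (insert a⁻¹ (symSet fun i => (x i).1)))
      (Nat.card F * (2 * n + 1) * (2 * ℓ + 6)), b.1 - 1 ≠ 0 ∧ (b.1 - 1).rank ≤ 4) ≤
      1 / (Nat.card F : ℝ) ^ (2 * ℓ) := by
  have hq := two_le_card_field F
  have hq1 : (1 : ℝ) ≤ Nat.card F := by linarith
  by_cases h4 : (a.1 - 1).rank ≤ 4
  · rw [pr_eq_zero]
    · positivity
    · intro x hx
      refine hx ⟨a, ball_mono ?_ (mem_ball_one (Set.mem_insert _ _)), ha, h4⟩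
      exact Nat.mul_pos (Nat.mul_pos Nat.card_pos (by omega)) (by omega)
  · obtain ⟨P, Q, hPQ, hP, hQ⟩ := exists_rank_factorization (a.1 - 1)
    revert P Q hs h4
    generalize (a.1 - 1).rank = s
    intro hs h4 P Q hPQ hP hQ
    obtain ⟨K, hK⟩ := exists_compression hPQ
    obtain ⟨J, hJ, hJk⟩ := exists_specialCompanion (F := F) (s := s) (by omega)
    have hT := le_pr_reducingPair (by omega) (A := K) hJ
    have hT' : 1 / (Nat.card F : ℝ) ^ (4400 * ℓ) ≤ 1 / (16 * (Nat.card F : ℝ) ^ (3 * s)) := by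
      refine one_div_le_one_div_of_le (by positivity) ?_
      calc 16 * (Nat.card F : ℝ) ^ (3 * s) ≤ (Nat.card F : ℝ) ^ 4 * (Nat.card F : ℝ) ^ (3 * s) := by
            refine mul_le_mul_of_nonneg_right ?_ (by positivity)
            calc (16 : ℝ) = 2 ^ 4 := by norm_num
              _ ≤ _ := pow_le_pow_left₀ (by norm_num) hq 4
        _ = (Nat.card F : ℝ) ^ (4 + 3 * s) := (pow_add _ _ _).symm
        _ ≤ _ := pow_le_pow_right₀ hq1 (by omega)
    refine (pr_not_exists_mem_ball_twoPoint hG hA hℓ hn hs hP hQ (hT'.trans hT)).trans' ?_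
    refine pr_mono fun x hx => ?_
    rintro ⟨h, hh, hr⟩
    apply hx
    obtain ⟨e, hne, hen, he⟩ := exists_charPow (F := F) (2 * n + 1) (by omega)
    obtain ⟨U, V, hUV, hVU⟩ := commutator_sub_one (h := h) hPQ hK
    have hinj : s ≤ n := by
      have := hP
      rw [Matrix.mulVec_injective_iff] at this
      simpa using this.fintype_card_le_finrank
    set S : Set (GL (Fin n) F) := insert a (insert a⁻¹ (symSet fun i => (x i).1)) with hS
    have hsub : (symSet fun i => (x i).1) ⊆ S :=
      (Set.subset_insert _ _).trans (Set.subset_insert _ _)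
    have hb : a * h * a⁻¹ * h⁻¹ ∈ ball S (2 * ℓ + 6) := by
      refine ball_mono ?_ (mul_mem_ball (mul_mem_ball (mul_mem_ball
        (mem_ball_one (Set.mem_insert _ _)) (ball_subset hsub hh))
        (mem_ball_one (Set.mem_insert_of_mem _ (Set.mem_insert _ _))))
        (ball_subset hsub (inv_mem_ball inv_mem_symSet hh)))
      omega
    refine ⟨(a * h * a⁻¹ * h⁻¹) ^ e, ball_mono (Nat.mul_le_mul_right _ hen)
      (pow_mem_wordBall hb e), ?_⟩
    rw [Units.val_pow_eq_pow_val, ← he, hUV]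
    constructor
    · intro h0
      refine hr.sub_one_pow_ne_zero (hJk (e + 1) (by omega)).1 ?_
      rw [← hVU, mul_pow_succ_eq, h0, Matrix.mul_zero, Matrix.zero_mul]
    · obtain ⟨r, rfl⟩ : ∃ r, e = s * 2 + r + 1 := ⟨e - (s * 2 + 1), by omega⟩
      rw [mul_pow_succ_eq, hVU]
      refine (rank_mul_le_left _ _).trans ((rank_mul_le_right _ _).trans ?_)
      rw [pow_add]
      exact (rank_mul_le_left _ _).trans (hr.rank_le (hJk s le_rfl).2)

theorem commutator_conj_eq_transvection {a h : GL (Fin n) F} {P : Matrix (Fin n) (Fin s) F}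
    {Q : Matrix (Fin s) (Fin n) F} (ha : a.1 - 1 = P * Q) (hP : Function.Injective P.mulVec)
    (hQ : Function.Injective Qᵀ.mulVec) (i : Fin s)
    (h₁ : Q * h.1 * P = vecMulVec (Pi.single i 1) (Pi.single i 1)) (h₂ : Q * (h⁻¹).1 * P = 0) :
    ∃ x φ : Fin n → F, x ≠ 0 ∧ φ ≠ 0 ∧ φ ⬝ᵥ x = 0 ∧
      (a * (h * a * h⁻¹) * a⁻¹ * (h * a * h⁻¹)⁻¹).1 = 1 + vecMulVec x φ := by
  obtain ⟨K, hK⟩ := exists_compression ha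
  have ha' : a.1 = 1 + P * Q := by rw [← ha]; abel
  have hone : (Pi.single i 1 : Fin s → F) ≠ 0 := by simp
  set e : Fin s → F := Pi.single i 1 with he
  have h3 : Q * (a⁻¹).1 * (h⁻¹).1 * P = 0 := by
    rw [inv_eq_one_sub ha hK]
    have : Q * (1 - P * (K⁻¹).1 * Q) * (h⁻¹).1 * P =
        Q * (h⁻¹).1 * P - Q * P * (K⁻¹).1 * (Q * (h⁻¹).1 * P) := by
      rw [Matrix.mul_sub, Matrix.mul_one, Matrix.sub_mul, Matrix.sub_mul]
      simp only [Matrix.mul_assoc]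
    rw [this, h₂, Matrix.mul_zero, sub_zero]
  have h4 : Q * (h⁻¹).1 * (a⁻¹).1 = Q * (h⁻¹).1 := by
    have : Q * (h⁻¹).1 * a.1 = Q * (h⁻¹).1 := by
      rw [ha', Matrix.mul_add, Matrix.mul_one, ← Matrix.mul_assoc, h₂, Matrix.zero_mul, add_zero]
    calc _ = Q * (h⁻¹).1 * a.1 * (a⁻¹).1 := by rw [this]
      _ = _ := by rw [Matrix.mul_assoc, ← Units.val_mul, mul_inv_cancel, Units.val_one,
        Matrix.mul_one]
  have hab : (a * (h * a * h⁻¹)).1 = (h * a * h⁻¹ * a).1 + P * vecMulVec e e * Q * (h⁻¹).1 := by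
    have hh : h.1 * (h⁻¹).1 = 1 := by rw [← Units.val_mul, mul_inv_cancel, Units.val_one]
    have e1 : (h * a * h⁻¹).1 = 1 + h.1 * P * Q * (h⁻¹).1 := by
      rw [Units.val_mul, Units.val_mul, ha', Matrix.mul_add, Matrix.add_mul, Matrix.mul_one, hh]
      simp only [Matrix.mul_assoc]
    rw [Units.val_mul, Units.val_mul (h * a * h⁻¹), e1, ha', ← h₁]
    have e2 : h.1 * P * Q * (h⁻¹).1 * (P * Q) = 0 := by
      have : h.1 * P * Q * (h⁻¹).1 * (P * Q) = h.1 * P * (Q * (h⁻¹).1 * P) * Q := by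
        simp only [Matrix.mul_assoc]
      rw [this, h₂, Matrix.mul_zero, Matrix.zero_mul]
    rw [Matrix.add_mul, Matrix.mul_add, Matrix.mul_add, Matrix.mul_add, Matrix.add_mul,
      Matrix.add_mul, e2]
    simp only [Matrix.mul_assoc, Matrix.mul_one, Matrix.one_mul]
    abel
  refine ⟨P *ᵥ e, e ᵥ* (Q * (a⁻¹).1 * (h⁻¹).1), ?_, ?_, ?_, ?_⟩
  · intro h0
    exact hone (hP (h0.trans (Matrix.mulVec_zero _).symm))
  · intro h0
    have h5 : e ᵥ* Q = 0 := by
      have := congrArg (· ᵥ* ((h * a).1)) h0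
      simp only [Matrix.vecMul_vecMul, Matrix.zero_vecMul] at this
      rw [← this, Matrix.mul_assoc, Matrix.mul_assoc, ← Units.val_mul, ← Units.val_mul]
      simp
    rw [← mulVec_transpose] at h5
    exact hone (hQ (h5.trans (Matrix.mulVec_zero _).symm))
  · rw [← dotProduct_mulVec, Matrix.mulVec_mulVec, h3, Matrix.zero_mulVec, dotProduct_zero]
  · have e5 : (a * (h * a * h⁻¹) * a⁻¹ * (h * a * h⁻¹)⁻¹).1 =
        (a * (h * a * h⁻¹)).1 * (a⁻¹ * (h * a * h⁻¹)⁻¹).1 := by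
      rw [← Units.val_mul, mul_assoc]
    rw [e5, hab, Matrix.add_mul, ← Units.val_mul]
    have e6 : h * a * h⁻¹ * a * (a⁻¹ * (h * a * h⁻¹)⁻¹) = 1 := by group
    rw [e6, Units.val_one]
    congr 1
    have e7 : (a⁻¹ * (h * a * h⁻¹)⁻¹).1 = (a⁻¹).1 * (h * a⁻¹ * h⁻¹).1 := by
      rw [← Units.val_mul]; congr 1; group
    have e8 : P * vecMulVec e e * Q * (h⁻¹).1 * ((a⁻¹).1 * (h * a⁻¹ * h⁻¹).1) =
        P * vecMulVec e e * (Q * (h⁻¹).1 * (a⁻¹).1 * (h * a⁻¹ * h⁻¹).1) := by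
      simp only [Matrix.mul_assoc]
    rw [e7, e8, h4]
    have e9 : Q * (h⁻¹).1 * (h * a⁻¹ * h⁻¹).1 = Q * (a⁻¹).1 * (h⁻¹).1 := by
      rw [Matrix.mul_assoc, Matrix.mul_assoc, ← Units.val_mul, ← Units.val_mul]
      congr 2; group
    rw [e9, mul_vecMulVec, vecMulVec_mul]

theorem pr_not_exists_transvection (hG : ContainsSL G) {A : Type*} [Finite A]
    (hA : Nat.card F ^ 20000 ≤ Nat.card A) (hℓ : 1000 ≤ ℓ) (hn : 20000 * ℓ ≤ n)
    {a : GL (Fin n) F} (ha : a.1 - 1 ≠ 0) (hs : (a.1 - 1).rank ≤ 4) :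
    pr (fun x : A ⊕ Fin 2 → G => ¬ ∃ b ∈ ball (insert a (insert a⁻¹ (symSet fun i => (x i).1)))
      (4 * ℓ + 12), ∃ v φ : Fin n → F, v ≠ 0 ∧ φ ≠ 0 ∧ φ ⬝ᵥ v = 0 ∧ b.1 = 1 + vecMulVec v φ) ≤
      1 / (Nat.card F : ℝ) ^ (2 * ℓ) := by
  have hq := two_le_card_field F
  have hq1 : (1 : ℝ) ≤ Nat.card F := by linarith
  have hs0 : (a.1 - 1).rank ≠ 0 := by
    rw [Matrix.rank, Ne, Submodule.finrank_eq_zero, LinearMap.range_eq_bot]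
    intro h
    exact ha (Matrix.toLin'.injective (by rw [Matrix.toLin'_apply', h, map_zero]))
  obtain ⟨P, Q, hPQ, hP, hQ⟩ := exists_rank_factorization (a.1 - 1)
  revert P Q hs hs0
  generalize (a.1 - 1).rank = s
  intro hs hs0 P Q hPQ hP hQ
  set i : Fin s := ⟨0, by omega⟩ with hi
  have hT : 1 / (Nat.card F : ℝ) ^ (4400 * ℓ) ≤ pr (fun p : Matrix (Fin s) (Fin s) F ×
      Matrix (Fin s) (Fin s) F => p = (vecMulVec (Pi.single i 1) (Pi.single i 1), 0)) := by
    rw [pr_eq_singleton, Nat.card_prod, card_matrix]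
    push_cast
    rw [← pow_add]
    refine one_div_pow_le hq1 ?_
    have : s * s ≤ 4 * 4 := Nat.mul_le_mul hs hs
    omega
  refine (pr_not_exists_mem_ball_twoPoint hG hA hℓ hn (by omega) hP hQ hT).trans' ?_
  refine pr_mono fun x hx => ?_
  rintro ⟨h, hh, hr⟩
  apply hx
  obtain ⟨hr1, hr2⟩ := Prod.ext_iff.1 hr
  set S : Set (GL (Fin n) F) := insert a (insert a⁻¹ (symSet fun i => (x i).1)) with hS
  have hsub : (symSet fun i => (x i).1) ⊆ S :=
    (Set.subset_insert _ _).trans (Set.subset_insert _ _)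
  have hSinv : ∀ b ∈ S, b⁻¹ ∈ S := by
    rintro b (rfl | rfl | hb)
    · exact Set.mem_insert_of_mem _ (Set.mem_insert _ _)
    · rw [inv_inv]; exact Set.mem_insert _ _
    · exact hsub (inv_mem_symSet _ hb)
  have hh' := ball_subset hsub hh
  have haS : a ∈ ball S 1 := mem_ball_one (Set.mem_insert _ _)
  refine ⟨_, ?_, commutator_conj_eq_transvection hPQ hP hQ i hr1 hr2⟩
  exact ball_mono (by omega) (conj_commutator_mem_ball hSinv haS
    (mul_mem_ball (mul_mem_ball hh' haS) (inv_mem_ball hSinv hh')))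

end TwoPointStage

section VectorTargets

open Matrix

theorem ex_ite {Ω : Type*} [Finite Ω] (p : Ω → Prop) [DecidablePred p] :
    ex (fun ω => if p ω then (1 : ℝ) else 0) = pr p := by
  rw [pr_eq_ex]
  congr 1; funext ω
  congr

theorem sq_mul_pr_le_ex {Z U : Type*} [Finite Z] [Finite U] [Nonempty U] (f : U → Z → ℝ)
    (m : U × U → ℝ) {p : ℝ} (E : Z → Prop) (h : ∀ w, ex (fun z => f w.1 z * f w.2 z) ≤ m w)
    (hE : ∀ z, E z → ∀ u, f u z = -p) : p ^ 2 * pr E ≤ ex m := by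
  have h1 : p ^ 2 * pr E ≤ ex (fun z => ex (fun u => f u z) * ex (fun u => f u z)) := by
    refine ex_mul_pr_le (fun z => mul_self_nonneg _) fun z hz => ?_
    simp only [hE z hz, ex_const]
    exact le_of_eq (by ring)
  refine h1.trans ?_
  have h2 : (fun z => ex (fun u => f u z) * ex (fun u => f u z)) =
      fun z => ex (fun w : U × U => f w.1 z * f w.2 z) := by
    funext z; exact ex_sq (fun u => f u z)
  rw [h2, ex_comm]
  exact ex_mono h

variable {F : Type*} [Field F] {n : ℕ}

theorem exists_mulVec_eq_of_linearIndependent {κ : Type*} {v : κ → Fin n → F}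
    (hv : LinearIndependent F v) (w : κ → Fin n → F) :
    ∃ z : Matrix (Fin n) (Fin n) F, ∀ c, z *ᵥ v c = w c := by
  obtain ⟨g, hg⟩ := LinearMap.exists_extend ((Module.Basis.span hv).constr F w)
  refine ⟨LinearMap.toMatrix' g, fun c => ?_⟩
  rw [LinearMap.toMatrix'_mulVec]
  have h1 : ((Module.Basis.span hv) c : Fin n → F) = v c :=
    congrArg Subtype.val (Module.Basis.span_apply hv c)
  rw [← h1]
  have h2 := LinearMap.congr_fun hg ((Module.Basis.span hv) c)
  rw [Module.Basis.constr_basis] at h2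
  exact h2

theorem exists_dotProduct_eq {ψ : Fin n → F} (hψ : ψ ≠ 0) (c : F) :
    ∃ w : Fin n → F, ψ ⬝ᵥ w = c := by
  obtain ⟨i, hi⟩ := Function.ne_iff.1 hψ
  refine ⟨Pi.single i ((ψ i)⁻¹ * c), ?_⟩
  rw [dotProduct_single, mul_inv_cancel_left₀ hi]

variable [Finite F]

theorem pr_hom_eq {A B : Type*} [AddCommGroup A] [AddCommGroup B] [Finite A] [Finite B]
    (L : A →+ B) (hL : Function.Surjective L) (b : B) : pr (fun a => L a = b) = 1 / Nat.card B := by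
  rw [pr_comp_surjective L hL (fun x => x = b), pr_eq_singleton]

/-- Second moment bound for hitting one of the targets `z a = t`, `ψ (z b) = c` by a uniformly
random matrix `z`. -/
theorem pr_forall_not_target_le {I : Type*} [Finite I] [Nonempty I] {b : I → Fin 2 → Fin n → F}
    (hb : ∀ i, LinearIndependent F (b i)) (t : I → Fin n → F) {ψ : I → Fin n → F}
    (hψ : ∀ i, ψ i ≠ 0) (c : F) :
    pr (fun z : Matrix (Fin n) (Fin n) F => ∀ i, ¬ (z *ᵥ b i 0 = t i ∧ ψ i ⬝ᵥ (z *ᵥ b i 1) = c)) ≤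
      (Nat.card F : ℝ) ^ 2 * pr (fun w : I × I =>
        ¬ LinearIndependent F (Sum.elim (b w.1) (b w.2))) +
      (Nat.card F : ℝ) ^ (n + 2) * pr (fun w : I × I =>
        ¬ LinearIndependent F (Sum.elim (fun _ : Unit => b w.1 0) (fun _ : Unit => b w.2 0)) ∧
        ¬ LinearIndependent F (Sum.elim (fun _ : Unit => t w.1) (fun _ : Unit => t w.2))) := by
  classical
  have hq0 : (0 : ℝ) < Nat.card F := by exact_mod_cast Nat.card_pos
  set q : ℝ := (Nat.card F : ℝ) with hq
  set E : I → Matrix (Fin n) (Fin n) F → Prop := fun i z =>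
    z *ᵥ b i 0 = t i ∧ ψ i ⬝ᵥ (z *ᵥ b i 1) = c with hE
  set D4 : I × I → Prop := fun w => ¬ LinearIndependent F (Sum.elim (b w.1) (b w.2)) with hD4
  set D2 : I × I → Prop := fun w =>
    ¬ LinearIndependent F (Sum.elim (fun _ : Unit => b w.1 0) (fun _ : Unit => b w.2 0)) ∧
    ¬ LinearIndependent F (Sum.elim (fun _ : Unit => t w.1) (fun _ : Unit => t w.2)) with hD2
  have cV : (Nat.card (Fin n → F) : ℝ) = q ^ n := by
    rw [card_vec, Nat.card_fin, Nat.cast_pow]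
  have hone : ∀ i, pr (E i) = 1 / q ^ (n + 1) := by
    intro i
    let L : Matrix (Fin n) (Fin n) F →+ (Fin n → F) × F :=
      { toFun := fun z => (z *ᵥ b i 0, ψ i ⬝ᵥ (z *ᵥ b i 1))
        map_zero' := by simp
        map_add' := fun z z' => by simp [Matrix.add_mulVec, dotProduct_add] }
    have hL : Function.Surjective L := by
      rintro ⟨v, d⟩
      obtain ⟨w, hw⟩ := exists_dotProduct_eq (hψ i) d
      obtain ⟨z, hz⟩ := exists_mulVec_eq_of_linearIndependent (hb i) ![v, w]
      refine ⟨z, Prod.ext (hz 0) ?_⟩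
      change ψ i ⬝ᵥ (z *ᵥ b i 1) = d
      rw [hz 1]; exact hw
    have h := pr_hom_eq L hL (t i, c)
    rw [Nat.card_prod, Nat.cast_mul, cV, ← hq, ← pow_succ] at h
    rw [← h]
    congr 1; funext z
    exact propext ⟨fun h => Prod.ext h.1 h.2,
      fun h => ⟨congrArg Prod.fst h, congrArg Prod.snd h⟩⟩
  have hpair : ∀ w : I × I, pr (fun z => E w.1 z ∧ E w.2 z) ≤ (1 / q ^ (n + 1)) ^ 2 +
      (1 / q ^ (2 * n) * (if D4 w then 1 else 0) + 1 / q ^ n * (if D2 w then 1 else 0)) := by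
    rintro ⟨i, j⟩
    by_cases h4 : D4 (i, j)
    · by_cases h2 : LinearIndependent F
        (Sum.elim (fun _ : Unit => b i 0) (fun _ : Unit => b j 0))
      · have h5 : pr (fun z => E i z ∧ E j z) ≤ 1 / q ^ (2 * n) := by
          let L : Matrix (Fin n) (Fin n) F →+ (Fin n → F) × (Fin n → F) :=
            { toFun := fun z => (z *ᵥ b i 0, z *ᵥ b j 0)
              map_zero' := by simp
              map_add' := fun z z' => by simp [Matrix.add_mulVec] }
          have hL : Function.Surjective L := by
            rintro ⟨v, v'⟩
            obtain ⟨z, hz⟩ := exists_mulVec_eq_of_linearIndependent h2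
              (Sum.elim (fun _ => v) (fun _ => v'))
            exact ⟨z, Prod.ext (hz (Sum.inl ())) (hz (Sum.inr ()))⟩
          have h := pr_hom_eq L hL (t i, t j)
          rw [Nat.card_prod, Nat.cast_mul, cV, ← pow_add, ← two_mul] at h
          rw [← h]
          exact pr_mono fun z hz => Prod.ext hz.1.1 hz.2.1
        refine h5.trans ?_
        rw [if_pos h4, mul_one]
        have : 0 ≤ 1 / q ^ n * (if D2 (i, j) then (1 : ℝ) else 0) := by positivity
        have : 0 ≤ (1 / q ^ (n + 1)) ^ 2 := by positivity
        linarith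
      · by_cases h3 : LinearIndependent F (Sum.elim (fun _ : Unit => t i) (fun _ : Unit => t j))
        · have h5 : pr (fun z => E i z ∧ E j z) = 0 := by
            refine pr_eq_zero fun z hz => h2 ?_
            have : LinearIndependent F (z.mulVecLin ∘
                (Sum.elim (fun _ : Unit => b i 0) (fun _ : Unit => b j 0))) := by
              convert h3 using 1
              funext s
              rcases s with s | s
              · exact hz.1.1
              · exact hz.2.1
            exact this.of_comp _
          rw [h5]
          positivity
        · have h5 : pr (fun z => E i z ∧ E j z) ≤ 1 / q ^ n := by
            have h6 : pr (fun z => E i z ∧ E j z) ≤ pr (E i) := pr_mono fun z hz => hz.1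
            rw [hone] at h6
            refine h6.trans (one_div_pow_le ?_ (by omega))
            rw [hq]; linarith [two_le_card_field F]
          refine h5.trans ?_
          rw [if_pos (show D2 (i, j) from ⟨h2, h3⟩), mul_one]
          have : 0 ≤ 1 / q ^ (2 * n) * (if D4 (i, j) then (1 : ℝ) else 0) := by positivity
          have : 0 ≤ (1 / q ^ (n + 1)) ^ 2 := by positivity
          linarith
    · have h4' : LinearIndependent F (Sum.elim (b i) (b j)) := not_not.1 h4
      let L : Matrix (Fin n) (Fin n) F →+ ((Fin n → F) × F) × ((Fin n → F) × F) :=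
        { toFun := fun z => ((z *ᵥ b i 0, ψ i ⬝ᵥ (z *ᵥ b i 1)), (z *ᵥ b j 0, ψ j ⬝ᵥ (z *ᵥ b j 1)))
          map_zero' := by simp
          map_add' := fun z z' => by simp [Matrix.add_mulVec, dotProduct_add] }
      have hL : Function.Surjective L := by
        rintro ⟨⟨v, d⟩, ⟨v', d'⟩⟩
        obtain ⟨w, hw⟩ := exists_dotProduct_eq (hψ i) d
        obtain ⟨w', hw'⟩ := exists_dotProduct_eq (hψ j) d'
        obtain ⟨z, hz⟩ := exists_mulVec_eq_of_linearIndependent h4'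
          (Sum.elim ![v, w] ![v', w'])
        refine ⟨z, Prod.ext (Prod.ext (hz (Sum.inl 0)) ?_) (Prod.ext (hz (Sum.inr 0)) ?_)⟩
        · exact (congrArg (ψ i ⬝ᵥ ·) (hz (Sum.inl 1))).trans hw
        · exact (congrArg (ψ j ⬝ᵥ ·) (hz (Sum.inr 1))).trans hw'
      have h := pr_hom_eq L hL ((t i, c), (t j, c))
      rw [Nat.card_prod, Nat.card_prod, Nat.cast_mul, Nat.cast_mul, cV, ← hq, ← pow_succ] at h
      have h5 : pr (fun z => E i z ∧ E j z) ≤ (1 / q ^ (n + 1)) ^ 2 := by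
        rw [div_pow, one_pow, sq (q ^ (n + 1)), ← h]
        exact pr_mono fun z hz => Prod.ext (Prod.ext hz.1.1 hz.1.2) (Prod.ext hz.2.1 hz.2.2)
      have : 0 ≤ 1 / q ^ (2 * n) * (if D4 (i, j) then (1 : ℝ) else 0) := by positivity
      have : 0 ≤ 1 / q ^ n * (if D2 (i, j) then (1 : ℝ) else 0) := by positivity
      linarith
  let f : I → Matrix (Fin n) (Fin n) F → ℝ := fun i z => (if E i z then 1 else 0) - 1 / q ^ (n + 1)
  have hmain := sq_mul_pr_le_ex f (fun w => 1 / q ^ (2 * n) * (if D4 w then 1 else 0) +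
    1 / q ^ n * (if D2 w then 1 else 0)) (p := 1 / q ^ (n + 1)) (fun z => ∀ i, ¬ E i z) (fun w => by
      have e : ∀ z, f w.1 z * f w.2 z = (if E w.1 z ∧ E w.2 z then (1 : ℝ) else 0) -
          1 / q ^ (n + 1) * (if E w.1 z then (1 : ℝ) else 0) -
          1 / q ^ (n + 1) * (if E w.2 z then (1 : ℝ) else 0) + (1 / q ^ (n + 1)) ^ 2 := by
        intro z
        by_cases h1 : E w.1 z <;> by_cases h2 : E w.2 z <;> simp [f, h1, h2] <;> ring
      simp only [e]
      rw [ex_add, ex_sub, ex_sub, ex_mul_left, ex_mul_left, ex_const, ex_ite (E w.1), ex_ite (E w.2),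
        ex_ite (fun z => E w.1 z ∧ E w.2 z), hone, hone]
      have := hpair w
      nlinarith) (fun z hz i => by simp [f, hz i])
  rw [ex_add, ex_mul_left, ex_mul_left, ex_ite D4, ex_ite D2] at hmain
  have hqn : 0 < q ^ (n + 1) := by positivity
  have h7 := mul_le_mul_of_nonneg_left hmain (sq_nonneg (q ^ (n + 1)))
  rw [div_pow, one_pow, ← mul_assoc, mul_one_div_cancel (by positivity), one_mul] at h7
  refine h7.trans (le_of_eq ?_)
  rw [mul_add]
  congr 1
  · rw [← mul_assoc]; congr 1
    rw [show (q ^ (n + 1)) ^ 2 = q ^ 2 * q ^ (2 * n) by ring, mul_one_div, mul_div_assoc,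
      div_self (by positivity), mul_one]
  · rw [← mul_assoc]; congr 1
    rw [show (q ^ (n + 1)) ^ 2 = q ^ (n + 2) * q ^ n by ring, mul_one_div, mul_div_assoc,
      div_self (by positivity), mul_one]

end VectorTargets

section Factorisation

variable {X Y : Type*} [Finite X] [Finite Y]

theorem ex_prod_mul (f : X → ℝ) (g : Y → ℝ) :
    ex (fun y : X × Y => f y.1 * g y.2) = ex f * ex g := by
  rw [ex_prod]
  simp only [ex_mul_left]
  rw [mul_comm, ← ex_mul_left]
  congr 1; funext a; ring

theorem pr_prod_and (P : X → Prop) (Q : Y → Prop) :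
    pr (fun y : X × Y => P y.1 ∧ Q y.2) = pr P * pr Q := by
  classical
  rw [← ex_ite, ← ex_ite, ← ex_ite, ← ex_prod_mul]
  congr 1; funext y
  by_cases hP : P y.1 <;> by_cases hQ : Q y.2 <;> simp [hP, hQ]

/-- Events about the two coordinates of a pair of pairs factorise. -/
theorem pr_pairs_and (P : X × X → Prop) (Q : Y × Y → Prop) :
    pr (fun w : (X × Y) × (X × Y) => P (w.1.1, w.2.1) ∧ Q (w.1.2, w.2.2)) = pr P * pr Q := by
  rw [← pr_prod_and, ← pr_equiv (Equiv.prodProdProdComm X Y X Y)]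
  rfl

end Factorisation

section VectorStage

open Matrix

variable {F : Type*} [Field F] [Finite F] {n ℓ : ℕ} {G : Subgroup (GL (Fin n) F)}

/-- The average proportion of pairs of words of length `ℓ` sending an independent family to
dependent families. -/
theorem ex_pr_words_dependent_le (hG : ContainsSL G) {A κ : Type*} [Finite A] [Nonempty A] [Finite κ]
    (hA : Nat.card F ^ 20000 ≤ Nat.card A) (hℓ : 1000 ≤ ℓ) (hn : 20000 * ℓ ≤ n)
    (hκ : Nat.card κ ≤ 2) {x : κ → Fin n → F} (hx : LinearIndependent F x) :
    ex (fun τ : A → G => pr (fun w : (Fin ℓ → A) × (Fin ℓ → A) => ¬ LinearIndependent F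
      (Sum.elim (fun c => (wordProd τ (List.ofFn w.1)).1.1 *ᵥ x c)
        (fun c => (wordProd τ (List.ofFn w.2)).1.1 *ᵥ x c) : κ ⊕ κ → Fin n → F))) ≤
      1 / (Nat.card F : ℝ) ^ (19990 * ℓ) := by
  have hq := two_le_card_field F
  have hq1 : (1 : ℝ) ≤ Nat.card F := by linarith
  refine (ex_pr_pair_le _ (δ := 1 / (Nat.card F : ℝ) ^ (19991 * ℓ)) (by positivity)
    fun u v huv => ?_).trans ?_
  · refine (pr_words_dependent hG hx (List.length_ofFn) (List.length_ofFn)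
      (fun h => huv (List.ofFn_injective h))).trans (pow_div_pow_le_one_div hq1 ?_)
    have : Nat.card κ * (2 * ℓ + 1) ≤ 2 * (2 * ℓ + 1) := Nat.mul_le_mul_right _ hκ
    omega
  · have hN : (Nat.card F : ℝ) ^ (20000 * ℓ) ≤ (Nat.card (Fin ℓ → A) : ℝ) := by
      have : Nat.card (Fin ℓ → A) = Nat.card A ^ ℓ := by
        rw [Nat.card_fun, Nat.card_fin]
      rw [this, pow_mul]
      exact_mod_cast Nat.pow_le_pow_left hA ℓ
    have h1 : 1 / (Nat.card (Fin ℓ → A) : ℝ) ≤ 1 / (Nat.card F : ℝ) ^ (19991 * ℓ) :=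
      (one_div_le_one_div_of_le (by positivity) hN).trans (one_div_pow_le hq1 (by omega))
    generalize (Nat.card F : ℝ) = q at *
    have h2 : 1 / q ^ (19991 * ℓ) * q ≤ 1 / q ^ (19990 * ℓ) := by
      have := pow_div_pow_le_one_div hq1 (a := 1) (b := 19991 * ℓ) (c := 19990 * ℓ) (by omega)
      rwa [pow_one, ← one_div_mul_eq_div] at this
    have h3 : 0 ≤ 1 / q ^ (19991 * ℓ) := by positivity
    nlinarith

theorem pr_not_exists_mulVec_eq (hG : ContainsSL G) {A : Type*} [Finite A]
    (hA : Nat.card F ^ 20000 ≤ Nat.card A) (hℓ : 1000 ≤ ℓ) (hn : 20000 * ℓ ≤ n)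
    (hn' : n ≤ 20020 * ℓ) {x y x' φ : Fin n → F} (hxy : LinearIndependent F ![x, y]) (hx' : x' ≠ 0)
    (hφ : φ ≠ 0) (c : F) :
    pr (fun X : (A ⊕ A) ⊕ Unit → G => ¬ ∃ f ∈ ball (symSet fun i => (X i).1) (2 * ℓ + 1),
      f.1 *ᵥ x = x' ∧ φ ⬝ᵥ (f.1 *ᵥ y) = c) ≤ 1 / (Nat.card F : ℝ) ^ (1000 * ℓ) := by
  have hq := two_le_card_field F
  have hq1 : (1 : ℝ) ≤ Nat.card F := by linarith
  have : Nonempty A := by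
    refine (Nat.card_pos_iff.1 (lt_of_lt_of_le ?_ hA)).1
    exact pow_pos Nat.card_pos _
  let W := (Fin ℓ → A)
  let b : (A → G) → W × W → Fin 2 → Fin n → F := fun τ i k =>
    (wordProd τ (List.ofFn i.2)).1.1 *ᵥ ![x, y] k
  let t : (A → G) → W × W → Fin n → F := fun τ i => (wordProd τ (List.ofFn i.1)).1.1 *ᵥ x'
  let ψ : (A → G) → W × W → Fin n → F := fun τ i => φ ᵥ* ((wordProd τ (List.ofFn i.1)).1⁻¹).1
  let Z : (A → G) × (A → G) → (Unit → Matrix (Fin n) (Fin n) F) → Prop := fun τ z =>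
    ∀ i, ¬ (z () *ᵥ b τ.2 i 0 = t τ.1 i ∧ ψ τ.1 i ⬝ᵥ (z () *ᵥ b τ.2 i 1) = c)
  let D4 : (A → G) → (W × W) → Prop := fun τ w => ¬ LinearIndependent F
      (Sum.elim (fun c => (wordProd τ (List.ofFn w.1)).1.1 *ᵥ ![x, y] c)
        (fun c => (wordProd τ (List.ofFn w.2)).1.1 *ᵥ ![x, y] c) : Fin 2 ⊕ Fin 2 → Fin n → F)
  let D2 : (Fin n → F) → (A → G) → (W × W) → Prop := fun v τ w => ¬ LinearIndependent F
      (Sum.elim (fun _ => (wordProd τ (List.ofFn w.1)).1.1 *ᵥ v)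
        (fun _ => (wordProd τ (List.ofFn w.2)).1.1 *ᵥ v) : Unit ⊕ Unit → Fin n → F)
  have hx : x ≠ 0 := hxy.ne_zero 0
  have hD4 : ex (fun τ => pr (D4 τ)) ≤ 1 / (Nat.card F : ℝ) ^ (19990 * ℓ) :=
    ex_pr_words_dependent_le hG hA hℓ hn (by simp) hxy
  have hD2 : ∀ v : Fin n → F, v ≠ 0 →
      ex (fun τ => pr (D2 v τ)) ≤ 1 / (Nat.card F : ℝ) ^ (19990 * ℓ) := fun v hv =>
    ex_pr_words_dependent_le (κ := Unit) hG hA hℓ hn (by simp) (x := fun _ => v)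
      (linearIndependent_unique_iff.2 hv)
  have h_union : pr (fun X : (A ⊕ A) ⊕ Unit → G => ¬ ∃ f ∈ ball (symSet fun i => (X i).1) (2 * ℓ + 1),
      f.1 *ᵥ x = x' ∧ φ ⬝ᵥ (f.1 *ᵥ y) = c) ≤ pr (fun X : (A ⊕ A) ⊕ Unit → G =>
        Z (fun i => X (Sum.inl (Sum.inl i)), fun i => X (Sum.inl (Sum.inr i)))
          (fun i => (X (Sum.inr i)).1.1)) := by
    refine pr_mono fun X hX i hi => hX ?_
    set τ : A → G := fun i => X (Sum.inl (Sum.inl i)) with hτ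
    set τ' : A → G := fun i => X (Sum.inl (Sum.inr i)) with hτ'
    refine ⟨(wordProd τ (List.ofFn i.1)).1⁻¹ * (X (Sum.inr ())).1 * (wordProd τ' (List.ofFn i.2)).1,
      ?_, ?_, ?_⟩
    · have m1 := wordProd_mem_ball τ (List.ofFn i.1)
      have m2 := wordProd_mem_ball τ' (List.ofFn i.2)
      rw [List.length_ofFn] at m1 m2
      refine ball_mono (by omega) (mul_mem_ball (mul_mem_ball (inv_mem_ball inv_mem_symSet
        (ball_subset (symSet_comp_subset (fun i => (X i).1) _) m1))
        (mem_ball_one (apply_mem_symSet (fun i => (X i).1) (Sum.inr ()))))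
        (ball_subset (symSet_comp_subset (fun i => (X i).1) _) m2))
    · have h := hi.1
      change (X (Sum.inr ())).1.1 *ᵥ ((wordProd τ' (List.ofFn i.2)).1.1 *ᵥ x) =
        (wordProd τ (List.ofFn i.1)).1.1 *ᵥ x' at h
      rw [Units.val_mul, Units.val_mul, ← mulVec_mulVec, ← mulVec_mulVec, h, mulVec_mulVec,
        ← Units.val_mul, inv_mul_cancel, Units.val_one, one_mulVec]
    · have h := hi.2
      change (φ ᵥ* ((wordProd τ (List.ofFn i.1)).1⁻¹).1) ⬝ᵥ
        ((X (Sum.inr ())).1.1 *ᵥ ((wordProd τ' (List.ofFn i.2)).1.1 *ᵥ y)) = c at h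
      rw [Units.val_mul, Units.val_mul, ← mulVec_mulVec, ← mulVec_mulVec, dotProduct_mulVec, h]
  have h_split : pr (fun X : (A ⊕ A) ⊕ Unit → G =>
        Z (fun i => X (Sum.inl (Sum.inl i)), fun i => X (Sum.inl (Sum.inr i)))
          (fun i => (X (Sum.inr i)).1.1)) =
      ex (fun τ : (A → G) × (A → G) => pr (fun z : Unit → G => Z τ (fun i => (z i).1.1))) := by
    rw [pr_sum_arrow (fun (σ : A ⊕ A → G) (z : Unit → G) =>
      Z (fun i => σ (Sum.inl i), fun i => σ (Sum.inr i)) (fun i => (z i).1.1)), pr_prod]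
    exact ex_sum_arrow (fun (τ τ' : A → G) => pr (fun z : Unit → G => Z (τ, τ') (fun i => (z i).1.1)))
  have h_fibre : ∀ τ : (A → G) × (A → G), pr (fun z : Unit → G => Z τ (fun i => (z i).1.1)) ≤
      (4 * Nat.card F : ℝ) * ((Nat.card F : ℝ) ^ 2 * (1 * pr (D4 τ.2)) +
        (Nat.card F : ℝ) ^ (n + 2) * (pr (D2 x' τ.1) * pr (D2 x τ.2))) := by
    rintro ⟨τ, τ'⟩
    refine (pr_transfer_le (by omega) hG (Z (τ, τ'))).trans ?_
    rw [Fintype.card_unit, pow_one]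
    refine mul_le_mul_of_nonneg_left ?_ (by positivity)
    have e : pr (Z (τ, τ')) = pr (fun z : Matrix (Fin n) (Fin n) F =>
        ∀ i, ¬ (z *ᵥ b τ' i 0 = t τ i ∧ ψ τ i ⬝ᵥ (z *ᵥ b τ' i 1) = c)) :=
      pr_equiv (Equiv.funUnique Unit (Matrix (Fin n) (Fin n) F)) (fun z =>
        ∀ i, ¬ (z *ᵥ b τ' i 0 = t τ i ∧ ψ τ i ⬝ᵥ (z *ᵥ b τ' i 1) = c))
    rw [e]
    refine (pr_forall_not_target_le (fun i => (linearIndependent_mulVec_iff _ _).2 hxy) (t τ)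
      (ψ := ψ τ) (fun i h => hφ ?_) c).trans (le_of_eq ?_)
    · have := congrArg (· ᵥ* (wordProd τ (List.ofFn i.1)).1.1) h
      simp only [ψ, vecMul_vecMul, zero_vecMul] at this
      rwa [← Units.val_mul, inv_mul_cancel, Units.val_one, vecMul_one] at this
    · have e1 : pr (D4 τ') = pr (fun w : (W × W) × (W × W) =>
          ¬ LinearIndependent F (Sum.elim (b τ' w.1) (b τ' w.2))) := by
        have := pr_pairs_and (X := W) (fun _ => True) (D4 τ')
        rw [show pr (fun _ : W × W => True) = 1 by
          rw [← ex_ite]; simp only [if_true]; exact ex_const _, one_mul] at this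
        rw [← this]
        simp only [true_and]; rfl
      rw [one_mul, e1]
      congr 2
      rw [← pr_pairs_and]
      congr 1; funext w
      exact propext and_comm
  refine h_union.trans (h_split.le.trans ((ex_mono h_fibre).trans ?_))
  rw [ex_mul_left, ex_add, ex_mul_left ((Nat.card F : ℝ) ^ 2), ex_mul_left ((Nat.card F : ℝ) ^ (n + 2)),
    ex_prod_mul (fun τ : A → G => pr (D2 x' τ)) (fun τ : A → G => pr (D2 x τ)),
    ex_prod_mul (fun τ : A → G => 1) (fun τ : A → G => pr (D4 τ)), ex_const, one_mul]
  have h1 := hD2 x hx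
  have h2 := hD2 x' hx'
  have h1' : 0 ≤ ex (fun τ => pr (D2 x τ)) := ex_nonneg fun _ => pr_nonneg _
  clear h_union h_split h_fibre
  generalize ex (fun τ => pr (D2 x τ)) = u at *
  generalize ex (fun τ => pr (D2 x' τ)) = v at *
  generalize ex (fun τ => pr (D4 τ)) = w at *
  generalize (Nat.card F : ℝ) = q at *
  have h3 : v * u ≤ 1 / q ^ (19990 * ℓ) * (1 / q ^ (19990 * ℓ)) :=
    mul_le_mul h2 h1 h1' (by positivity)
  have hq4 : 4 ≤ q ^ 2 := by nlinarith
  have h4 : q ^ 2 * w ≤ 1 / q ^ (1000 * ℓ + 4) := by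
    refine (mul_le_mul_of_nonneg_left hD4 (by positivity)).trans ?_
    rw [mul_one_div]
    exact pow_div_pow_le_one_div hq1 (by omega)
  have h5 : q ^ (n + 2) * (v * u) ≤ 1 / q ^ (1000 * ℓ + 4) := by
    refine (mul_le_mul_of_nonneg_left h3 (by positivity)).trans ?_
    rw [one_div_mul_one_div, ← pow_add, mul_one_div]
    exact pow_div_pow_le_one_div hq1 (by omega)
  have h6 : 4 * q * (q ^ 2 * w + q ^ (n + 2) * (v * u)) ≤
      q ^ 4 * (1 / q ^ (1000 * ℓ + 4)) := by
    have e : 4 * q * (1 / q ^ (1000 * ℓ + 4) + 1 / q ^ (1000 * ℓ + 4)) ≤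
        q ^ 4 * (1 / q ^ (1000 * ℓ + 4)) := by
      have e0 : 0 ≤ 1 / q ^ (1000 * ℓ + 4) := by positivity
      have e1 : 8 * q ≤ q ^ 4 := by nlinarith [mul_self_nonneg (q ^ 2), sq_nonneg q]
      nlinarith
    refine (mul_le_mul_of_nonneg_left (add_le_add h4 h5) (by positivity)).trans e
  refine h6.trans ?_
  rw [mul_one_div]
  exact pow_div_pow_le_one_div hq1 (by omega)

end VectorStage

section CovectorStage

open Matrix

variable {F : Type*} [Field F] {n ℓ : ℕ}

/-- The inverse transpose automorphism of the general linear group. -/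
def contragredient (F : Type*) [Field F] (n : ℕ) : GL (Fin n) F →* GL (Fin n) F where
  toFun g := ⟨(g⁻¹).1ᵀ, g.1ᵀ, by rw [← transpose_mul, ← Units.val_mul, mul_inv_cancel]; simp,
    by rw [← transpose_mul, ← Units.val_mul, inv_mul_cancel]; simp⟩
  map_one' := Units.ext (by simp)
  map_mul' g h := Units.ext (by
    change ((g * h)⁻¹).1ᵀ = (g⁻¹).1ᵀ * (h⁻¹).1ᵀ
    rw [_root_.mul_inv_rev, Units.val_mul, transpose_mul])

theorem contragredient_val (g : GL (Fin n) F) : (contragredient F n g).1 = (g⁻¹).1ᵀ := rfl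

theorem contragredient_contragredient (g : GL (Fin n) F) :
    contragredient F n (contragredient F n g) = g :=
  Units.ext (by rw [contragredient_val]; exact transpose_transpose _)

theorem contragredient_injective : Function.Injective (contragredient F n) :=
  Function.LeftInverse.injective contragredient_contragredient

theorem ContainsSL.mem_of_det_eq_one {G : Subgroup (GL (Fin n) F)} (hG : ContainsSL G)
    {g : GL (Fin n) F} (hg : g.1.det = 1) : g ∈ G := by
  have := hG ⟨g.1, hg⟩
  rwa [show SpecialLinearGroup.toGL ⟨g.1, hg⟩ = g from Units.ext rfl] at this

theorem ContainsSL.map_contragredient {G : Subgroup (GL (Fin n) F)} (hG : ContainsSL G) :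
    ContainsSL (G.map (contragredient F n)) := by
  intro A
  refine ⟨contragredient F n (SpecialLinearGroup.toGL A), ?_, contragredient_contragredient _⟩
  exact hG.mem_of_det_eq_one (by rw [contragredient_val, ← map_inv, det_transpose]; exact (A⁻¹).2)

variable [Finite F] {G : Subgroup (GL (Fin n) F)}

theorem pr_not_exists_vecMul_eq (hG : ContainsSL G) {A : Type*} [Finite A]
    (hA : Nat.card F ^ 20000 ≤ Nat.card A) (hℓ : 1000 ≤ ℓ) (hn : 20000 * ℓ ≤ n)
    (hn' : n ≤ 20020 * ℓ) {x y x' v : Fin n → F} (hxy : LinearIndependent F ![x, y]) (hx' : x' ≠ 0)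
    (hv : v ≠ 0) (c : F) :
    pr (fun X : (A ⊕ A) ⊕ Unit → G => ¬ ∃ f ∈ ball (symSet fun i => (X i).1) (2 * ℓ + 1),
      x ᵥ* f.1 = x' ∧ (y ᵥ* f.1) ⬝ᵥ v = c) ≤ 1 / (Nat.card F : ℝ) ^ (1000 * ℓ) := by
  let E : G ≃ G.map (contragredient F n) :=
    (G.equivMapOfInjective _ contragredient_injective).toEquiv
  have hE : ∀ g : G, (E g).1 = contragredient F n g.1 := fun g => rfl
  refine (pr_not_exists_mulVec_eq hG.map_contragredient hA hℓ hn hn' hxy hx' hv c).trans' ?_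
  rw [← pr_equiv (Equiv.arrowCongr (Equiv.refl _) E)]
  refine pr_mono fun X hX => ?_
  rintro ⟨f, ⟨l, hl, hlf, hlen⟩, h1, h2⟩
  apply hX
  have hf : (contragredient F n f) ∈ ball (symSet fun i => (X i).1) (2 * ℓ + 1) := by
    refine ⟨l.map (contragredient F n), ?_, by rw [← map_list_prod, hlf], by simpa using hlen⟩
    intro a ha
    obtain ⟨b, hb, rfl⟩ := List.mem_map.1 ha
    obtain ⟨i, hi⟩ := hl b hb
    refine ⟨i, hi.imp (fun h => ?_) (fun h => ?_)⟩
    · rw [h]; exact contragredient_contragredient _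
    · rw [h, map_inv]; exact congrArg _ (contragredient_contragredient _)
  refine ⟨_, inv_mem_ball inv_mem_symSet hf, ?_⟩
  have e : ((contragredient F n f)⁻¹).1 = f.1ᵀ := by
    rw [← map_inv, contragredient_val, inv_inv]
  rw [e, vecMul_transpose, vecMul_transpose, dotProduct_comm]
  exact ⟨h1, h2⟩

end CovectorStage

section ElementaryStage

open Matrix

variable {F : Type*} [Field F] {n ℓ : ℕ}

theorem conj_one_add_vecMulVec {t g : GL (Fin n) F} {v φ : Fin n → F} (ht : t.1 = 1 + vecMulVec v φ) :
    (g * t * g⁻¹).1 = 1 + vecMulVec (g.1 *ᵥ v) (φ ᵥ* (g⁻¹).1) := by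
  rw [Units.val_mul, Units.val_mul, ht, mul_add, add_mul, mul_one, ← Units.val_mul, mul_inv_cancel,
    mul_vecMulVec, vecMulVec_mul, Units.val_one]

/-- The commutator of two transvections whose product in one order vanishes. -/
theorem commutator_transvections_eq {g h : GL (Fin n) F} {α y : Fin n → F} {i j : Fin n} {c : F}
    (hij : i ≠ j) (hg : g.1 = 1 + vecMulVec (Pi.single i 1) α)
    (hh : h.1 = 1 + vecMulVec y (Pi.single j 1)) (hαy : α ⬝ᵥ y = c)
    (hy : y j = 0) : (g * h * g⁻¹ * h⁻¹).1 = transvection i j c := by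
  have key : (g * h).1 = transvection i j c * (h * g).1 := by
    have e1 : vecMulVec (Pi.single i 1) α * vecMulVec y (Pi.single j 1) = single i j c := by
      rw [vecMulVec_mul_vecMulVec, hαy]
      ext a b
      simp [vecMulVec_apply, Matrix.single_apply, Pi.single_apply]
      grind
    have e2 : vecMulVec y (Pi.single j 1) * vecMulVec (Pi.single i 1) α = 0 := by
      rw [vecMulVec_mul_vecMulVec, single_dotProduct, Pi.single_eq_of_ne hij.symm]
      simp
    have e3 : vecMulVec y (Pi.single j 1) * vecMulVec y (Pi.single j 1) = 0 := by
      rw [vecMulVec_mul_vecMulVec, single_dotProduct, hy]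
      simp
    rw [Units.val_mul, Units.val_mul, hg, hh, transvection, ← e1]
    generalize vecMulVec (Pi.single i 1) α = N at *
    generalize vecMulVec y (Pi.single j 1) = M at *
    have e4 : N * M * (1 + M) * (1 + N) = N * M := by
      simp only [mul_add, mul_one, mul_assoc, e2, e3, mul_zero, add_zero]
    calc (1 + N) * (1 + M) = 1 + N + M + N * M := by noncomm_ring
      _ = 1 + N + M + M * N + N * M * (1 + M) * (1 + N) := by rw [e2, e4, add_zero]
      _ = _ := by noncomm_ring
  have e : (g * h * g⁻¹ * h⁻¹) * (h * g) = g * h := by group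
  rw [← e, Units.val_mul] at key
  exact (Units.mul_left_inj _).1 key

theorem linearIndependent_single_pair {i a : Fin n} (hia : a ≠ i) {y : Fin n → F} (hy : y a = 1) :
    LinearIndependent F ![Pi.single i 1, y] := by
  rw [LinearIndependent.pair_iff]
  intro s t h
  have ha := congrFun h a
  have ht : t = 0 := by simpa [hia, hy] using ha
  have hi := congrFun h i
  exact ⟨by simpa [ht] using hi, ht⟩

variable [Finite F] {G : Subgroup (GL (Fin n) F)}

theorem pr_exists_le_card_mul {Ω ι : Type*} [Finite Ω] [Fintype ι] {p : ι → Ω → Prop} {ε : ℝ}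
    (h : ∀ i, pr (p i) ≤ ε) : pr (fun ω => ∃ i, p i ω) ≤ Fintype.card ι * ε := by
  refine (pr_exists_le p).trans ((Finset.sum_le_sum fun i _ => h i).trans (le_of_eq ?_))
  rw [Finset.sum_const, Finset.card_univ, nsmul_eq_mul]

theorem natCast_sq_mul_add_le {q : ℝ} (hq : 2 ≤ q) (hℓ : 1000 ≤ ℓ) (hn' : n ≤ 20020 * ℓ) :
    (n * n : ℝ) * (1 / q ^ (1000 * ℓ)) + (n * n * q : ℝ) * (1 / q ^ (1000 * ℓ)) ≤
      1 / q ^ (2 * ℓ) := by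
  have hq1 : 1 ≤ q := by linarith
  have h0 : n ≤ 2 ^ (2 * ℓ) := by
    have h : ℓ < 2 ^ ℓ := Nat.lt_two_pow_self
    have h' : 2 ^ 15 ≤ 2 ^ ℓ := Nat.pow_le_pow_right (by norm_num) (by omega)
    rw [two_mul, pow_add]
    exact (by omega : n ≤ 2 ^ 15 * ℓ).trans (Nat.mul_le_mul h' h.le)
  have h1 : (n : ℝ) ≤ q ^ (2 * ℓ) :=
    (show (n : ℝ) ≤ 2 ^ (2 * ℓ) by exact_mod_cast h0).trans (pow_le_pow_left₀ (by norm_num) hq _)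
  have h2 : (n * n : ℝ) ≤ q ^ (4 * ℓ) := by
    rw [show 4 * ℓ = 2 * ℓ + 2 * ℓ by ring, pow_add]
    exact mul_le_mul h1 h1 (by positivity) (by positivity)
  rw [← add_mul, mul_one_div]
  refine le_trans (div_le_div_of_nonneg_right (c := q ^ (1000 * ℓ)) (b := q ^ (4 * ℓ + 2)) ?_
    (by positivity)) (pow_div_pow_le_one_div hq1 (by omega))
  rw [pow_add, ← mul_one_add]
  exact mul_le_mul h2 (by nlinarith) (by positivity) (by positivity)

theorem pr_not_forall_transvection (hG : ContainsSL G) {A : Type*} [Finite A]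
    (hA : Nat.card F ^ 20000 ≤ Nat.card A) (hℓ : 1000 ≤ ℓ) (hn : 20000 * ℓ ≤ n)
    (hn' : n ≤ 20020 * ℓ) {t : GL (Fin n) F} {v φ : Fin n → F} (hv : v ≠ 0) (hφ : φ ≠ 0)
    (hφv : φ ⬝ᵥ v = 0) (ht : t.1 = 1 + vecMulVec v φ) :
    pr (fun X : ((A ⊕ A) ⊕ Unit) ⊕ ((A ⊕ A) ⊕ Unit) → G => ¬ ∀ i j, i ≠ j → ∀ c,
      ∃ g ∈ ball (insert t (insert t⁻¹ (symSet fun i => (X i).1))) (16 * ℓ + 12),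
        g.1 = transvection i j c) ≤ 1 / (Nat.card F : ℝ) ^ (2 * ℓ) := by
  have := Fintype.ofFinite F
  have hq := two_le_card_field F
  have hq1 : (1 : ℝ) ≤ Nat.card F := by linarith
  let K := (A ⊕ A) ⊕ Unit
  let H : (K → G) → Prop := fun τ => ∀ p : Fin n × Fin n, p.1 ≠ p.2 →
    ∃ h ∈ ball (symSet fun i => (τ i).1) (2 * ℓ + 1),
      (Pi.single p.1 1 : Fin n → F) ᵥ* h.1 = φ ∧ ((Pi.single p.2 1 : Fin n → F) ᵥ* h.1) ⬝ᵥ v = 1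
  have hH : pr (fun τ => ¬ H τ) ≤ (n * n : ℝ) * (1 / (Nat.card F : ℝ) ^ (1000 * ℓ)) := by
    have h1 : (fun τ => ¬ H τ) = fun τ => ∃ p : Fin n × Fin n, ¬ (p.1 ≠ p.2 →
        ∃ h ∈ ball (symSet fun i => (τ i).1) (2 * ℓ + 1), (Pi.single p.1 1 : Fin n → F) ᵥ* h.1 = φ ∧
          ((Pi.single p.2 1 : Fin n → F) ᵥ* h.1) ⬝ᵥ v = 1) :=
      funext fun τ => propext not_forall
    rw [h1]
    refine (pr_exists_le_card_mul (ε := 1 / (Nat.card F : ℝ) ^ (1000 * ℓ)) fun p => ?_).trans ?_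
    · by_cases hp : p.1 = p.2
      · rw [pr_eq_zero]
        · positivity
        · intro τ h
          exact h fun h' => absurd hp h'
      · refine (pr_not_exists_vecMul_eq hG hA hℓ hn hn' (linearIndependent_single_pair
          (Ne.symm hp) (Pi.single_eq_same _ _)) hφ hv 1).trans' ?_
        refine pr_mono fun τ h h' => h fun _ => h'
    · rw [Fintype.card_prod, Fintype.card_fin]
      push_cast
      exact le_rfl
  let Good : (K → G) → (K → G) → Prop := fun τ τ' => ∀ p : (Fin n × Fin n) × F, p.1.1 ≠ p.1.2 →
    ∃ h ∈ ball (symSet fun i => (τ i).1) (2 * ℓ + 1),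
    ∃ f ∈ ball (symSet fun i => (τ' i).1) (2 * ℓ + 1),
      (Pi.single p.1.2 1 : Fin n → F) ᵥ* h.1 = φ ∧ f.1 *ᵥ (Pi.single p.1.1 1 : Fin n → F) = v ∧
        φ ⬝ᵥ (f.1 *ᵥ (h.1 *ᵥ v)) = p.2
  have h_split : pr (fun X : K ⊕ K → G => ¬ ∀ i j, i ≠ j → ∀ c,
      ∃ g ∈ ball (insert t (insert t⁻¹ (symSet fun i => (X i).1))) (16 * ℓ + 12),
        g.1 = transvection i j c) ≤
      pr (fun X : K ⊕ K → G => ¬ Good (fun i => X (Sum.inl i)) (fun i => X (Sum.inr i))) := by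
    refine pr_mono fun X hX hgood => hX fun i j hij c => ?_
    obtain ⟨h, hh, f, hf, h1, h2, h3⟩ := hgood ((i, j), c) hij
    set S : Set (GL (Fin n) F) := insert t (insert t⁻¹ (symSet fun i => (X i).1)) with hS
    have hsub : (symSet fun i => (X i).1) ⊆ S :=
      (Set.subset_insert _ _).trans (Set.subset_insert _ _)
    have hSinv : ∀ b ∈ S, b⁻¹ ∈ S := by
      rintro b (rfl | rfl | hb)
      · exact Set.mem_insert_of_mem _ (Set.mem_insert _ _)
      · rw [inv_inv]; exact Set.mem_insert _ _
      · exact hsub (inv_mem_symSet _ hb)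
    have htS : t ∈ ball S 1 := mem_ball_one (Set.mem_insert _ _)
    have hh' := ball_subset ((symSet_comp_subset (fun i => (X i).1) Sum.inl).trans hsub) hh
    have hf' := ball_subset ((symSet_comp_subset (fun i => (X i).1) Sum.inr).trans hsub) hf
    have m1 : f⁻¹ * t * f⁻¹⁻¹ ∈ ball S (4 * ℓ + 3) := ball_mono (by omega)
      (mul_mem_ball (mul_mem_ball (inv_mem_ball hSinv hf') htS)
        (inv_mem_ball hSinv (inv_mem_ball hSinv hf')))
    have m2 : h * t * h⁻¹ ∈ ball S (4 * ℓ + 3) := ball_mono (by omega)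
      (mul_mem_ball (mul_mem_ball hh' htS) (inv_mem_ball hSinv hh'))
    refine ⟨_, ball_mono (by omega) (conj_commutator_mem_ball hSinv m1 m2),
      commutator_transvections_eq hij (α := φ ᵥ* f.1) (y := h.1 *ᵥ v) ?_ ?_ ?_ ?_⟩
    · rw [conj_one_add_vecMulVec ht, inv_inv, ← h2, mulVec_mulVec, ← Units.val_mul, inv_mul_cancel,
        Units.val_one, one_mulVec]
    · rw [conj_one_add_vecMulVec ht, ← h1, vecMul_vecMul, ← Units.val_mul, mul_inv_cancel,
        Units.val_one, vecMul_one]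
    · rw [← dotProduct_mulVec]; exact h3
    · have : (Pi.single j 1 : Fin n → F) ⬝ᵥ (h.1 *ᵥ v) = (h.1 *ᵥ v) j := by simp
      rw [← this, dotProduct_mulVec, h1, hφv]
  have : Nonempty (K → G) := ⟨fun _ => 1⟩
  refine h_split.trans ?_
  rw [pr_sum_arrow (fun τ τ' => ¬ Good τ τ')]
  refine (pr_prod_le (p := H)
    (ε := (n * n * Nat.card F : ℝ) * (1 / (Nat.card F : ℝ) ^ (1000 * ℓ))) (by positivity)
    fun τ hτ => ?_).trans ((add_le_add_left hH _).trans (natCast_sq_mul_add_le hq hℓ hn'))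
  have hex : ∀ p : Fin n × Fin n, ∃ h : GL (Fin n) F, p.1 ≠ p.2 →
      h ∈ ball (symSet fun i => (τ i).1) (2 * ℓ + 1) ∧ (Pi.single p.2 1 : Fin n → F) ᵥ* h.1 = φ ∧
        LinearIndependent F ![Pi.single p.1 1, h.1 *ᵥ v] := by
    intro p
    by_cases hp : p.1 = p.2
    · exact ⟨1, fun h => absurd hp h⟩
    obtain ⟨a, ha⟩ : ∃ a : Fin n, a ∉ ({p.1, p.2} : Finset (Fin n)) := by
      refine Finset.exists_mem_notMem_of_card_lt_card (s := {p.1, p.2}) (t := Finset.univ) ?_ |>.imp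
        fun _ h => h.2
      rw [Finset.card_univ, Fintype.card_fin]
      exact lt_of_le_of_lt Finset.card_le_two (by omega)
    simp only [Finset.mem_insert, Finset.mem_singleton, not_or] at ha
    obtain ⟨h, hh, h1, h2⟩ := hτ (p.2, a) (Ne.symm ha.2)
    refine ⟨h, fun _ => ⟨hh, h1, linearIndependent_single_pair ha.1 ?_⟩⟩
    rw [← dotProduct_mulVec] at h2
    simpa using h2
  choose h hh using hex
  have e : pr (fun τ' => ¬ Good τ τ') ≤ pr (fun τ' : K → G => ∃ p : (Fin n × Fin n) × F,
      p.1.1 ≠ p.1.2 ∧ ¬ ∃ f ∈ ball (symSet fun i => (τ' i).1) (2 * ℓ + 1),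
        f.1 *ᵥ (Pi.single p.1.1 1 : Fin n → F) = v ∧ φ ⬝ᵥ (f.1 *ᵥ ((h p.1).1 *ᵥ v)) = p.2) := by
    refine pr_mono fun τ' hn => ?_
    by_contra! hcon
    refine hn fun p hp => ?_
    obtain ⟨f, hf, h1, h2⟩ := hcon p hp
    exact ⟨h p.1, (hh p.1 hp).1, f, hf, (hh p.1 hp).2.1, h1, h2⟩
  refine e.trans ((pr_exists_le_card_mul (ε := 1 / (Nat.card F : ℝ) ^ (1000 * ℓ)) fun p => ?_).trans ?_)
  · by_cases hp : p.1.1 = p.1.2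
    · rw [pr_eq_zero]
      · positivity
      · exact fun τ' h => h.1 hp
    · refine (pr_not_exists_mulVec_eq hG hA hℓ hn hn' (hh p.1 hp).2.2 hv hφ p.2).trans' ?_
      exact pr_mono fun τ' h => h.2
  · rw [Fintype.card_prod, Fintype.card_prod, Fintype.card_fin, ← Nat.card_eq_fintype_card]
    push_cast
    exact le_rfl

end ElementaryStage

section Elimination

open Matrix

variable {F : Type*} [Field F] {n : ℕ}

/-- `M` is a product of at most `k` elementary transvections. -/
def IsTransvectionProd (k : ℕ) (M : Matrix (Fin n) (Fin n) F) : Prop :=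
  ∃ L : List (TransvectionStruct (Fin n) F), L.length ≤ k ∧
    (L.map TransvectionStruct.toMatrix).prod = M

theorem isTransvectionProd_one (k : ℕ) :
    IsTransvectionProd k (1 : Matrix (Fin n) (Fin n) F) := ⟨[], Nat.zero_le _, rfl⟩

theorem isTransvectionProd_transvection {i j : Fin n} (hij : i ≠ j) (c : F) :
    IsTransvectionProd 1 (transvection i j c) := ⟨[⟨i, j, hij, c⟩], le_rfl, by simp⟩

theorem IsTransvectionProd.mono {k k' : ℕ} {M : Matrix (Fin n) (Fin n) F}
    (h : IsTransvectionProd k M) (hk : k ≤ k') : IsTransvectionProd k' M := by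
  obtain ⟨L, h1, h2⟩ := h
  exact ⟨L, h1.trans hk, h2⟩

theorem IsTransvectionProd.mul {k k' : ℕ} {M M' : Matrix (Fin n) (Fin n) F}
    (h : IsTransvectionProd k M) (h' : IsTransvectionProd k' M') :
    IsTransvectionProd (k + k') (M * M') := by
  obtain ⟨L, h1, rfl⟩ := h
  obtain ⟨L', h1', rfl⟩ := h'
  exact ⟨L ++ L', by rw [List.length_append]; omega, by rw [List.map_append, List.prod_append]⟩

theorem IsTransvectionProd.det_eq_one {k : ℕ} {M : Matrix (Fin n) (Fin n) F}
    (h : IsTransvectionProd k M) : M.det = 1 := by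
  obtain ⟨L, _, rfl⟩ := h
  exact TransvectionStruct.det_toMatrix_prod L

theorem IsTransvectionProd.exists_left_inverse {k : ℕ} {M : Matrix (Fin n) (Fin n) F}
    (h : IsTransvectionProd k M) : ∃ M', IsTransvectionProd k M' ∧ M' * M = 1 := by
  obtain ⟨L, h1, rfl⟩ := h
  refine ⟨_, ⟨(L.map TransvectionStruct.inv).reverse, by simpa using h1, rfl⟩, ?_⟩
  have := TransvectionStruct.reverse_inv_prod_mul_prod L
  rw [List.map_reverse, List.map_map, ← List.map_reverse]
  exact this

theorem transvection_eq_one_add_vecMulVec (i j : Fin n) (c : F) :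
    transvection i j c = 1 + vecMulVec (Pi.single i c) (Pi.single j 1) := by
  rw [transvection]
  congr 1
  ext a b
  simp only [Matrix.single_apply, vecMulVec_apply, Pi.single_apply]
  grind

theorem one_add_vecMulVec_mulVec (u w : Fin n → F) (j : Fin n) :
    (1 + vecMulVec u (Pi.single j 1)) *ᵥ w = w + w j • u := by
  rw [add_mulVec, one_mulVec, vecMulVec_mulVec, single_dotProduct, one_mul, op_smul_eq_smul]

theorem isTransvectionProd_column {m : Fin n} {u : Fin n → F} (hu : u m = 0) :
    IsTransvectionProd n (1 + vecMulVec u (Pi.single m 1)) := by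
  have key : ∀ s : Finset (Fin n), IsTransvectionProd s.card
      (1 + vecMulVec (fun i => if i ∈ s then u i else 0) (Pi.single m 1)) := by
    intro s
    induction s using Finset.induction_on with
    | empty =>
      rw [show (1 + vecMulVec (fun i => if i ∈ (∅ : Finset (Fin n)) then u i else 0)
        (Pi.single m 1) : Matrix (Fin n) (Fin n) F) = 1 by ext; simp [vecMulVec_apply]]
      exact isTransvectionProd_one _
    | insert a s ha ih =>
      by_cases ham : a = m
      · subst ham
        convert ih.mono (Finset.card_le_card (Finset.subset_insert a s)) using 3
        funext i
        by_cases hi : i = a <;> simp [hi, hu]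
      · rw [Finset.card_insert_of_notMem ha, add_comm]
        convert (isTransvectionProd_transvection ham (u a)).mul ih using 1
        rw [transvection_eq_one_add_vecMulVec, add_mul, one_mul, mul_add, mul_one,
          vecMulVec_mul_vecMulVec, single_dotProduct, hu, ite_self, mul_zero, zero_smul,
          vecMulVec_zero, add_zero, add_assoc, add_comm (vecMulVec _ _), ← add_vecMulVec]
        congr 2
        funext i
        by_cases hi : i = a
        · subst hi; simp [ha]
        · simp [hi]
  convert key Finset.univ using 1
  · simp
  · simp

theorem exists_pivot {M : Matrix (Fin n) (Fin n) F} (hdet : M.det = 1) (m : Fin n)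
    (hM : ∀ k < m, M *ᵥ Pi.single k 1 = Pi.single k 1) : ∃ j, m ≤ j ∧ (M *ᵥ Pi.single m 1) j ≠ 0 := by
  by_contra! hcon
  have hinj : Function.Injective M.mulVec :=
    mulVec_injective_of_isUnit ((isUnit_iff_isUnit_det _).2 (by rw [hdet]; exact isUnit_one))
  set w := M *ᵥ Pi.single m 1 with hw
  have h1 : M *ᵥ w = w := by
    have hsum : w = ∑ k, w k • (Pi.single k 1 : Fin n → F) := by
      ext i; simp [Finset.sum_apply, Pi.single_apply]
    conv_lhs => rw [hsum]
    rw [mulVec_sum]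
    conv_rhs => rw [hsum]
    refine Finset.sum_congr rfl fun k _ => ?_
    rw [mulVec_smul]
    by_cases hk : k < m
    · rw [hM k hk]
    · rw [hcon k (not_lt.1 hk), zero_smul, zero_smul]
  have h2 : w = Pi.single m 1 := hinj (h1.trans hw)
  have := hcon m le_rfl
  rw [h2] at this
  simp at this

theorem exists_pivot_one {M : Matrix (Fin n) (Fin n) F} (hdet : M.det = 1) (m : Fin n)
    (hM : ∀ k < m, M *ᵥ Pi.single k 1 = Pi.single k 1) :
    ∃ P : Matrix (Fin n) (Fin n) F, IsTransvectionProd 2 P ∧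
      (∀ k < m, P *ᵥ Pi.single k 1 = Pi.single k 1) ∧ (P *ᵥ (M *ᵥ Pi.single m 1)) m = 1 := by
  set w := M *ᵥ Pi.single m 1 with hw
  have hfix : ∀ (i j : Fin n) (c : F), m ≤ j → ∀ k < m,
      transvection i j c *ᵥ (Pi.single k 1 : Fin n → F) = Pi.single k 1 := by
    intro i j c hj k hk
    rw [transvection_eq_one_add_vecMulVec, one_add_vecMulVec_mulVec,
      Pi.single_eq_of_ne (by omega : j ≠ k), zero_smul, add_zero]
  have happ : ∀ (j : Fin n) (w : Fin n → F), w j ≠ 0 →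
      (transvection m j ((1 - w m) / w j) *ᵥ w) m = 1 := by
    intro j w hj
    rw [transvection_eq_one_add_vecMulVec, one_add_vecMulVec_mulVec]
    simp only [Pi.add_apply, Pi.smul_apply, Pi.single_eq_same, smul_eq_mul]
    field_simp
    ring
  obtain ⟨j, hmj, hj⟩ := exists_pivot hdet m hM
  rw [← hw] at hj
  rcases hmj.lt_or_eq with hlt | rfl
  · exact ⟨_, (isTransvectionProd_transvection hlt.ne _).mono (by norm_num), hfix m j _ hmj,
      happ j w hj⟩
  · by_cases hm : m.1 + 1 < n
    · set j : Fin n := ⟨m.1 + 1, hm⟩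
      have hmj : m ≠ j := fun h => by simpa [j] using congrArg Fin.val h
      have hle : m ≤ j := Fin.le_def.2 (Nat.le_succ _)
      by_cases hwj : w j = 0
      · set w' := transvection j m 1 *ᵥ w with hw'
        have hw'j : w' j ≠ 0 := by
          rw [hw', transvection_eq_one_add_vecMulVec, one_add_vecMulVec_mulVec]
          simpa [hwj] using hj
        refine ⟨transvection m j ((1 - w' m) / w' j) * transvection j m 1,
          (isTransvectionProd_transvection hmj _).mul (isTransvectionProd_transvection hmj.symm _),
          fun k hk => ?_, ?_⟩
        · rw [← mulVec_mulVec, hfix _ _ _ le_rfl k hk, hfix _ _ _ hle k hk]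
        · rw [← mulVec_mulVec]; exact happ j w' hw'j
      · exact ⟨_, (isTransvectionProd_transvection hmj _).mono (by norm_num), hfix m j _ hle,
          happ j w hwj⟩
    · refine ⟨1, isTransvectionProd_one _, fun k _ => one_mulVec _, ?_⟩
      rw [one_mulVec]
      have hcol : ∀ k < m, ∀ i, M i k = (Pi.single k 1 : Fin n → F) i := fun k hk i => by
        rw [← hM k hk, mulVec_single_one]; rfl
      have htri : M.BlockTriangular id := by
        intro i k hik
        have hik' : k < i := hik
        rw [hcol k (by omega), Pi.single_eq_of_ne hik'.ne']
      rw [det_of_isUpperTriangular htri, Finset.prod_eq_single m] at hdet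
      · rw [← hdet, hw, mulVec_single_one]; rfl
      · intro b _ hb
        rw [hcol b (by omega), Pi.single_eq_same]
      · simp

/-- Gaussian elimination with a bound on the number of steps. -/
theorem isTransvectionProd_of_det_eq_one {M : Matrix (Fin n) (Fin n) F} (hdet : M.det = 1) :
    IsTransvectionProd (n * (n + 2)) M := by
  have key : ∀ d m : ℕ, m + d = n → ∀ M : Matrix (Fin n) (Fin n) F, M.det = 1 →
      (∀ k : Fin n, k.1 < m → M *ᵥ Pi.single k 1 = Pi.single k 1) →
      IsTransvectionProd (d * (n + 2)) M := by
    intro d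
    induction d with
    | zero =>
      intro m hm M _ hM
      have : M = 1 := by
        ext i k
        have := congrFun (hM k (by omega)) i
        rw [mulVec_single_one] at this
        rw [one_apply]
        simpa [Pi.single_apply] using this
      rw [this]
      exact isTransvectionProd_one _
    | succ d ih =>
      intro m hmd M hdet hM
      let m' : Fin n := ⟨m, by omega⟩
      obtain ⟨P, hP, hPfix, hP1⟩ := exists_pivot_one hdet m' (fun k hk => hM k hk)
      set w := P *ᵥ (M *ᵥ Pi.single m' 1) with hw
      have hQ : IsTransvectionProd n (1 + vecMulVec (Pi.single m' 1 - w) (Pi.single m' 1)) :=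
        isTransvectionProd_column (by simp [hP1])
      set Q := 1 + vecMulVec (Pi.single m' 1 - w) (Pi.single m' 1) with hQdef
      obtain ⟨R, hR, hRinv⟩ := (hQ.mul hP).exists_left_inverse
      have hfin := ih (m + 1) (by omega) (Q * P * M) (by
        rw [det_mul, (hQ.mul hP).det_eq_one, hdet, one_mul]) (fun k hk => by
        rw [← mulVec_mulVec, ← mulVec_mulVec]
        rcases Nat.lt_succ_iff_lt_or_eq.1 hk with hk | hk
        · rw [hM k hk, hPfix k hk, hQdef, one_add_vecMulVec_mulVec,
            Pi.single_eq_of_ne (fun h => by rw [← h] at hk; simp [m'] at hk), zero_smul, add_zero]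
        · have : k = m' := Fin.ext hk
          rw [this, ← hw, hQdef, one_add_vecMulVec_mulVec, hP1, one_smul]
          abel)
      have e : M = R * (Q * P * M) := by rw [← mul_assoc, hRinv, one_mul]
      rw [e]
      exact (hR.mul hfin).mono (by ring_nf; omega)
  exact key n 0 (by omega) M hdet (fun k hk => absurd hk (by omega))

theorem mem_ball_of_det_eq_one {S : Set (GL (Fin n) F)} {K : ℕ}
    (hS : ∀ i j, i ≠ j → ∀ c, ∃ g ∈ ball S K, g.1 = transvection i j c) {g : GL (Fin n) F}
    (hg : g.1.det = 1) : g ∈ ball S (n * (n + 2) * K) := by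
  obtain ⟨L, hL, hprod⟩ := isTransvectionProd_of_det_eq_one hg
  choose f hf using fun t : TransvectionStruct (Fin n) F => hS t.i t.j t.hij t.c
  have e : (L.map f).prod = g := by
    apply Units.ext
    rw [← hprod, ← Units.coeHom_apply, map_list_prod, List.map_map]
    congr 1
    exact List.map_congr_left fun t _ => (hf t).2
  rw [← e]
  refine ball_mono (Nat.mul_le_mul_right K hL) ?_
  have := prod_mem_ball (S := S) (K := K) (l := L.map f) (by
    intro a ha
    obtain ⟨t, _, rfl⟩ := List.mem_map.1 ha
    exact (hf t).1)
  rwa [List.length_map] at this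

end Elimination

section Determinant

open Matrix

theorem exists_list_map_prod_eq {Γ H : Type*} [Group Γ] [Monoid H] [Finite H] (f : Γ →* H)
    {S : Set Γ} (l : List Γ) (hl : ∀ a ∈ l, a ∈ S) :
    ∃ l' : List Γ, (∀ a ∈ l', a ∈ S) ∧ f l'.prod = f l.prod ∧ l'.length ≤ Nat.card H := by
  induction h : l.length using Nat.strong_induction_on generalizing l with
  | _ N ih =>
    by_cases hN : N ≤ Nat.card H
    · exact ⟨l, hl, rfl, h.trans_le hN⟩
    · have : ¬ Function.Injective fun i : Fin (N + 1) => f (l.take i).prod := fun hinj => by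
        have := Nat.card_le_card_of_injective _ hinj
        rw [Nat.card_fin] at this
        omega
      obtain ⟨i, j, hij, hlt⟩ : ∃ i j : Fin (N + 1),
          f (l.take i).prod = f (l.take j).prod ∧ i < j := by
        simp only [Function.Injective, not_forall] at this
        obtain ⟨i, j, hij, hne⟩ := this
        rcases lt_or_gt_of_ne hne with hlt | hlt
        · exact ⟨i, j, hij, hlt⟩
        · exact ⟨j, i, hij.symm, hlt⟩
      have hi : i.1 < j.1 := hlt
      have hj : j.1 < N + 1 := j.2
      obtain ⟨l', h1, h2, h3⟩ := ih (l.take i ++ l.drop j).length (by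
        rw [List.length_append, List.length_take, List.length_drop]; omega) (l.take i ++ l.drop j)
        (fun a ha => by
          rcases List.mem_append.1 ha with ha | ha
          · exact hl a (List.mem_of_mem_take ha)
          · exact hl a (List.mem_of_mem_drop ha)) rfl
      refine ⟨l', h1, h2.trans ?_, h3⟩
      rw [List.prod_append, map_mul, hij, ← map_mul, ← List.prod_append, List.take_append_drop]

variable {F : Type*} [Field F] [Finite F] {n : ℕ}

theorem mem_ball_of_mem_closure {S : Set (GL (Fin n) F)} (hinv : ∀ a ∈ S, a⁻¹ ∈ S) {K : ℕ}
    (hS : ∀ i j, i ≠ j → ∀ c, ∃ g ∈ ball S K, g.1 = transvection i j c) {g : GL (Fin n) F}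
    (hg : g ∈ Subgroup.closure S) : g ∈ ball S (Nat.card F + n * (n + 2) * K) := by
  rw [← Subgroup.mem_toSubmonoid, Subgroup.closure_toSubmonoid] at hg
  obtain ⟨l, hl, rfl⟩ := Submonoid.exists_list_of_mem_closure hg
  let D : GL (Fin n) F →* F := (Matrix.detMonoidHom).comp (Units.coeHom _)
  have hD : ∀ g, D g = g.1.det := fun g => rfl
  obtain ⟨l', h1, h2, h3⟩ := exists_list_map_prod_eq D l (S := S) (fun a ha => by
    rcases hl a ha with h | h
    · exact h
    · simpa using hinv _ h)
  have h4 : D (l'.prod⁻¹ * l.prod) = 1 := by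
    rw [map_mul, ← h2, ← map_mul, inv_mul_cancel, map_one]
  have h5 := mul_mem_ball (⟨l', h1, rfl, h3⟩ : l'.prod ∈ ball S (Nat.card F))
    (mem_ball_of_det_eq_one hS (g := l'.prod⁻¹ * l.prod) ((hD _).symm.trans h4))
  rwa [mul_inv_cancel_left] at h5

end Determinant

section Combination

open Matrix

variable {Γ : Type*} [Group Γ] [Finite Γ] {G : Subgroup Γ} {ι κ : Type*} [Finite ι] [Finite κ]

/-- Elements satisfying `T` found in a ball over the first letters serve as additional generators
for the remaining letters. -/
theorem pr_not_ball_sum {T : Γ → Prop} {R : Set Γ → Prop} {L M : ℕ} {ε ε' : ℝ} (hL : 1 ≤ L)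
    (hR : ∀ U V, U ⊆ V → R U → R V) (hε' : 0 ≤ ε')
    (h : pr (fun x : ι → G => ¬ ∃ a ∈ ball (symSet fun i => (x i).1) L, T a) ≤ ε)
    (h' : ∀ a, T a → pr (fun y : κ → G =>
      ¬ R (ball (insert a (insert a⁻¹ (symSet fun i => (y i).1))) M)) ≤ ε') :
    pr (fun x : ι ⊕ κ → G => ¬ R (ball (symSet fun i => (x i).1) (M * L))) ≤ ε + ε' := by
  have h0 := pr_prod_le (Ω := ι → G) (Ω' := κ → G)
    (p := fun x => ∃ a ∈ ball (symSet fun i => (x i).1) L, T a)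
    (p' := fun y => ¬ R (ball (symSet fun i => (Sum.elim y.1 y.2 i).1) (M * L))) hε' ?_
  · rw [← pr_sum_arrow (fun (y : ι → G) (z : κ → G) =>
      ¬ R (ball (symSet fun i => (Sum.elim y z i).1) (M * L)))] at h0
    refine (le_trans (le_of_eq ?_) h0).trans (by gcongr)
    congr 1
    funext x
    congr 4
    funext i
    rcases i with i | i <;> rfl
  · rintro x ⟨a, ha, hT⟩
    refine (h' a hT).trans' ?_
    refine pr_mono fun y hy hn => hy (hR _ _ ?_ hn)
    intro g hg
    refine ball_trans ?_ hg
    have hle : ball (symSet fun i => (x i).1) L ⊆ ball (symSet fun i => (Sum.elim x y i).1) L :=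
      fun b hb => ball_subset (symSet_comp_subset (fun i => (Sum.elim x y i).1) Sum.inl) hb
    rintro b (rfl | rfl | hb)
    · exact hle ha
    · exact inv_mem_ball inv_mem_symSet (hle ha)
    · exact ball_mono hL (mem_ball_one
        (symSet_comp_subset (fun i => (Sum.elim x y i).1) Sum.inr hb))

end Combination

section LowRankStage

open Matrix

variable {F : Type*} [Field F] [Finite F] {n ℓ : ℕ} {G : Subgroup (GL (Fin n) F)}

theorem lowRank_error_le {q a : ℝ} (hq : 2 ≤ q) {d : ℕ} (ha : q ^ 20000 ≤ a) (hℓ : 1000 ≤ ℓ)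
    (hn' : n ≤ 20020 * ℓ) (hd : d + 1000 * ℓ = n) :
    (1 / a ^ ℓ + q ^ (2 * ℓ * 60 + 2) / q ^ (400 * ℓ)) / (1 / q ^ (100 * ℓ)) +
      (4 * q) ^ (399 + 1) * (2 / q ^ (500 * ℓ) + (1 / q ^ (100 * ℓ)) ^ (399 + 1) * q ^ n +
        2 * (((399 : ℕ) + 1) * (q ^ d / q ^ n))) ≤ 1 / q ^ (2 * ℓ) := by
  have hq1 : 1 ≤ q := by linarith
  have hq0 : 0 < q := by linarith
  have h1 : 1 / a ^ ℓ ≤ 1 / q ^ (110 * ℓ) := by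
    calc 1 / a ^ ℓ ≤ 1 / (q ^ 20000) ^ ℓ := by gcongr
      _ = 1 / q ^ (20000 * ℓ) := by rw [← pow_mul]
      _ ≤ _ := one_div_pow_le hq1 (by omega)
  have h2 : q ^ (2 * ℓ * 60 + 2) / q ^ (400 * ℓ) ≤ 1 / q ^ (110 * ℓ) :=
    pow_div_pow_le_one_div hq1 (by omega)
  have h3 : (1 / a ^ ℓ + q ^ (2 * ℓ * 60 + 2) / q ^ (400 * ℓ)) / (1 / q ^ (100 * ℓ)) ≤
      2 * (1 / q ^ (10 * ℓ)) := by
    rw [div_div_eq_mul_div, div_one]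
    calc _ ≤ (1 / q ^ (110 * ℓ) + 1 / q ^ (110 * ℓ)) * q ^ (100 * ℓ) := by gcongr
      _ = 2 * (q ^ (100 * ℓ) / q ^ (110 * ℓ)) := by ring
      _ ≤ _ := mul_le_mul_of_nonneg_left (pow_div_pow_le_one_div hq1 (by omega)) zero_le_two
  have h4 : (4 * q) ^ (399 + 1) ≤ q ^ 1200 := by
    have h : 4 * q ≤ q ^ 3 := by
      nlinarith [mul_nonneg hq0.le (sub_nonneg.2 hq),
        mul_nonneg hq0.le (mul_nonneg hq0.le (sub_nonneg.2 hq))]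
    calc (4 * q) ^ (399 + 1) ≤ (q ^ 3) ^ (399 + 1) := by gcongr
      _ = q ^ 1200 := by rw [← pow_mul]
  have h5 : (1 / q ^ (100 * ℓ)) ^ (399 + 1) * q ^ n ≤ 1 / q ^ (500 * ℓ) := by
    rw [_root_.one_div_pow, ← pow_mul, one_div_mul_eq_div]
    exact pow_div_pow_le_one_div hq1 (by omega)
  have h6 : q ^ d / q ^ n ≤ 1 / q ^ (500 * ℓ) := pow_div_pow_le_one_div hq1 (by omega)
  have h7 : (803 : ℝ) ≤ q ^ 10 := by
    calc (803 : ℝ) ≤ 2 ^ 10 := by norm_num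
      _ ≤ _ := by gcongr
  have h8 : (4 * q) ^ (399 + 1) * (2 / q ^ (500 * ℓ) + (1 / q ^ (100 * ℓ)) ^ (399 + 1) * q ^ n +
        2 * (((399 : ℕ) + 1) * (q ^ d / q ^ n))) ≤ 1 / q ^ (10 * ℓ) := by
    calc _ ≤ q ^ 1200 * (2 / q ^ (500 * ℓ) + 1 / q ^ (500 * ℓ) +
          2 * (((399 : ℕ) + 1) * (1 / q ^ (500 * ℓ)))) := by gcongr
      _ = q ^ 1200 * (803 * (1 / q ^ (500 * ℓ))) := by push_cast; ring
      _ ≤ q ^ 1200 * (q ^ 10 * (1 / q ^ (500 * ℓ))) := by gcongr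
      _ = q ^ 1210 / q ^ (500 * ℓ) := by rw [← mul_assoc, ← pow_add, mul_one_div]
      _ ≤ _ := pow_div_pow_le_one_div hq1 (by omega)
  calc _ ≤ 2 * (1 / q ^ (10 * ℓ)) + 1 / q ^ (10 * ℓ) := add_le_add h3 h8
    _ = 3 * (1 / q ^ (10 * ℓ)) := by ring
    _ ≤ q ^ 2 * (1 / q ^ (10 * ℓ)) := by gcongr; nlinarith
    _ = q ^ 2 / q ^ (10 * ℓ) := mul_one_div _ _
    _ ≤ _ := pow_div_pow_le_one_div hq1 (by omega)

theorem pr_not_exists_rank_le (hG : ContainsSL G) {A : Type*} [Finite A]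
    (hA : Nat.card F ^ 20000 ≤ Nat.card A) (hℓ : 1000 ≤ ℓ) (hn : 20000 * ℓ ≤ n)
    (hn' : n ≤ 20020 * ℓ) :
    pr (fun x : A ⊕ Fin 400 → G =>
      ¬ ∃ a ∈ ball (symSet fun i => (x i).1) (Nat.card F * n * (400 * (1 + ℓ))),
        a.1 - 1 ≠ 0 ∧ (a.1 - 1).rank ≤ 1000 * ℓ + 2) ≤ 1 / (Nat.card F : ℝ) ^ (2 * ℓ) := by
  have hq := two_le_card_field F
  have : Nonempty A := by
    refine (Nat.card_pos_iff.1 (lt_of_lt_of_le ?_ hA)).1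
    exact pow_pos Nat.card_pos _
  have hA' : (Nat.card F : ℝ) ^ 20000 ≤ Nat.card A := by exact_mod_cast hA
  have hd : n - 1000 * ℓ + 1000 * ℓ = n := by omega
  have hB := pr_not_exists_lowRank (t := 60) (g := 400 * ℓ) (d := n - 1000 * ℓ) (s := 500 * ℓ)
    (J := 399) (ℓ := ℓ) (A := A) (β := 1 / (Nat.card F : ℝ) ^ (100 * ℓ)) hG (by omega) (by omega)
    (by omega) (by omega) (by positivity)
  refine (hB.trans (lowRank_error_le hq hA' hℓ hn' hd)).trans' ?_
  refine pr_mono fun x hx hn => hx ?_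
  obtain ⟨a, h1, h2, h3⟩ := hn
  exact ⟨a, h1, h2, by omega⟩

end LowRankStage

section AllStages

open Matrix

variable {F : Type*} [Field F] [Finite F] {n ℓ : ℕ} {G : Subgroup (GL (Fin n) F)}

/-- The letters used to produce all elementary transvections, starting from an alphabet `A`. -/
abbrev StageIndex (A : Type*) : Type _ :=
  (((A ⊕ Fin 400) ⊕ (A ⊕ Fin 2)) ⊕ (A ⊕ Fin 2)) ⊕ (((A ⊕ A) ⊕ Unit) ⊕ ((A ⊕ A) ⊕ Unit))

/-- The length of words producing elementary transvections. -/
def stageRadius (q n ℓ : ℕ) : ℕ :=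
  (16 * ℓ + 12) * ((4 * ℓ + 12) * (q * (2 * n + 1) * (2 * ℓ + 6) * (q * n * (400 * (1 + ℓ)))))

theorem pr_not_forall_transvection_stageRadius (hG : ContainsSL G) {A : Type*} [Finite A]
    (hA : Nat.card F ^ 20000 ≤ Nat.card A) (hℓ : 1000 ≤ ℓ) (hn : 20000 * ℓ ≤ n)
    (hn' : n ≤ 20020 * ℓ) :
    pr (fun x : StageIndex A → G => ¬ ∀ i j, i ≠ j → ∀ c,
      ∃ g ∈ ball (symSet fun i => (x i).1) (stageRadius (Nat.card F) n ℓ),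
        g.1 = transvection i j c) ≤ 4 * (1 / (Nat.card F : ℝ) ^ (2 * ℓ)) := by
  have hq0 : 0 < Nat.card F := Nat.card_pos
  have hn0 : 0 < n := by omega
  have h0 : (0 : ℝ) ≤ 1 / (Nat.card F : ℝ) ^ (2 * ℓ) := by positivity
  obtain ⟨T₁, hT₁⟩ : ∃ T : GL (Fin n) F → Prop, ∀ b, T b ↔
      b.1 - 1 ≠ 0 ∧ (b.1 - 1).rank ≤ 1000 * ℓ + 2 := ⟨_, fun _ => Iff.rfl⟩
  obtain ⟨T₂, hT₂⟩ : ∃ T : GL (Fin n) F → Prop, ∀ b, T b ↔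
      b.1 - 1 ≠ 0 ∧ (b.1 - 1).rank ≤ 4 := ⟨_, fun _ => Iff.rfl⟩
  obtain ⟨T₃, hT₃⟩ : ∃ T : GL (Fin n) F → Prop, ∀ b, T b ↔
      ∃ v φ : Fin n → F, v ≠ 0 ∧ φ ≠ 0 ∧ φ ⬝ᵥ v = 0 ∧ b.1 = 1 + vecMulVec v φ :=
    ⟨_, fun _ => Iff.rfl⟩
  have hex : ∀ T : GL (Fin n) F → Prop, ∀ U V : Set (GL (Fin n) F), U ⊆ V →
      (∃ b ∈ U, T b) → ∃ b ∈ V, T b := fun T U V hUV ⟨b, hb, hT⟩ => ⟨b, hUV hb, hT⟩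
  have h1 := pr_not_exists_rank_le hG hA hℓ hn hn'
  have h2 := fun a (ha : T₁ a) =>
    pr_not_exists_rank_le_four hG hA hℓ hn ((hT₁ a).1 ha).1 ((hT₁ a).1 ha).2
  have h3 := fun a (ha : T₂ a) =>
    pr_not_exists_transvection hG hA hℓ hn ((hT₂ a).1 ha).1 ((hT₂ a).1 ha).2
  simp only [← hT₁] at h1
  simp only [← hT₂] at h2
  simp only [← hT₃] at h3
  have h12 := pr_not_ball_sum (R := fun U => ∃ b ∈ U, T₂ b)
    (Nat.one_le_iff_ne_zero.2 (by positivity)) (hex T₂) h0 h1 h2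
  have h123 := pr_not_ball_sum (R := fun U => ∃ b ∈ U, T₃ b)
    (Nat.one_le_iff_ne_zero.2 (by positivity)) (hex T₃) h0 h12 h3
  have h4 := pr_not_ball_sum (R := fun U : Set (GL (Fin n) F) =>
      ∀ i j, i ≠ j → ∀ c, ∃ b ∈ U, b.1 = transvection i j c)
    (Nat.one_le_iff_ne_zero.2 (by positivity))
    (fun U V hUV h i j hij c => hex (fun b => b.1 = transvection i j c) U V hUV (h i j hij c)) h0 h123
    (fun a ha => by
      obtain ⟨v, φ, hv, hφ, hφv, ha⟩ := (hT₃ a).1 ha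
      exact pr_not_forall_transvection hG hA hℓ hn hn' hv hφ hφv ha)
  unfold stageRadius
  refine h4.trans (le_of_eq ?_)
  ring

end AllStages

section Final

theorem length_le_sq_mul_pow {q n ℓ : ℕ} (hq : 2 ≤ q) (hℓ : 1000 ≤ ℓ) (hn : 20000 * ℓ ≤ n) :
    q + n * (n + 2) * stageRadius q n ℓ ≤ q ^ 2 * n ^ 9 := by
  have h1 : stageRadius q n ℓ ≤ n * (n * (q * (3 * n) * n * (q * n * n))) := by
    unfold stageRadius
    gcongr <;> omega
  have h2 : q ≤ q ^ 2 * n ^ 8 := by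
    calc q = q * 1 * 1 := by ring
      _ ≤ q * q * n ^ 8 := by gcongr; exacts [by omega, Nat.one_le_pow _ _ (by omega)]
      _ = _ := by ring
  calc q + n * (n + 2) * stageRadius q n ℓ
      ≤ q ^ 2 * n ^ 8 + n * (n + n) * (n * (n * (q * (3 * n) * n * (q * n * n)))) := by
        gcongr; omega
    _ = q ^ 2 * n ^ 8 * 7 := by ring
    _ ≤ q ^ 2 * n ^ 8 * n := by gcongr; omega
    _ = q ^ 2 * n ^ 9 := by ring

theorem card_stageIndex_le {q : ℕ} (hq : 2 ≤ q) :
    Nat.card (StageIndex (Fin (q ^ 20000))) ≤ q ^ 20010 := by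
  have h1 : (413 : ℕ) ≤ q ^ 10 :=
    (by norm_num : (413 : ℕ) ≤ 2 ^ 10).trans (Nat.pow_le_pow_left hq 10)
  have h2 : 1 ≤ q ^ 20000 := Nat.one_le_pow _ _ (by omega)
  have h3 : q ^ 20010 = q ^ 20000 * q ^ 10 := by rw [← pow_add]
  rw [h3]
  simp only [Nat.card_sum, Nat.card_fin, Nat.card_unique]
  generalize q ^ 20000 = a at *
  nlinarith

theorem four_mul_one_div_pow_le {q : ℝ} (hq : 2 ≤ q) {n ℓ : ℕ} (hℓ : 1000 ≤ ℓ)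
    (hn' : n ≤ 20020 * ℓ) :
    4 * (1 / q ^ (2 * ℓ)) ≤ q ^ (-((1 / 30000 : ℝ) * n)) := by
  have hq0 : 0 < q := by linarith
  have hn'' : (n : ℝ) ≤ 20020 * ℓ := by exact_mod_cast hn'
  have hℓ' : (1000 : ℝ) ≤ ℓ := by exact_mod_cast hℓ
  calc 4 * (1 / q ^ (2 * ℓ)) ≤ q ^ 2 * (1 / q ^ (2 * ℓ)) := by gcongr; nlinarith
    _ = q ^ ((2 : ℝ) - 2 * ℓ) := by
      rw [Real.rpow_sub hq0, mul_one_div, ← Real.rpow_natCast, ← Real.rpow_natCast]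
      push_cast
      rfl
    _ ≤ _ := Real.rpow_le_rpow_of_exponent_le (by linarith) (by linarith)

theorem mem_closure_of_mem_ball {Γ : Type*} [Group Γ] {S : Set Γ} {K : ℕ} {g : Γ}
    (hg : g ∈ ball S K) : g ∈ Subgroup.closure S := by
  obtain ⟨l, hl, rfl, -⟩ := hg
  exact Subgroup.list_prod_mem _ fun a ha => Subgroup.subset_closure (hl a ha)

end Final

/-- **Babai's conjecture for `SL_n(q)` with `q^C` random generators**
(linear case of Theorem 1.4). There are absolute constants `c, C > 0` such that
for every finite field `F_q`, every `n > C`, every group `G` with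
`SL_n(q) ≤ G ≤ GL_n(q)` and every `k > q^C`: for uniformly random
`x_1, …, x_k ∈ G`, with probability at least `1 - q^{-c·n}` the set
`S = {x_1^{±1}, …, x_k^{±1}}` generates a subgroup containing `SL_n(q)` and
every element of `⟨S⟩` is a product of at most `q²·n^C` elements of `S`. -/
theorem stmt3 :
    ∃ c C : ℝ, 0 < c ∧ 0 < C ∧
      ∀ (F : Type) [Field F] [Fintype F] (n : ℕ), C < (n : ℝ) →
        ∀ G : Subgroup (GL (Fin n) F),
          (∀ A : Matrix.SpecialLinearGroup (Fin n) F,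
              Matrix.SpecialLinearGroup.toGL A ∈ G) →
          ∀ k : ℕ, ((Fintype.card F : ℝ) ^ (C : ℝ) < (k : ℝ)) →
            (1 : ℝ) - (Fintype.card F : ℝ) ^ (-(c * n)) ≤
              (Nat.card {x : Fin k → ↥G //
                  ∀ S : Set (GL (Fin n) F),
                    S = {g | ∃ i : Fin k, g = ↑(x i) ∨ g = (↑(x i) : GL (Fin n) F)⁻¹} →
                    (∀ A : Matrix.SpecialLinearGroup (Fin n) F,
                        Matrix.SpecialLinearGroup.toGL A ∈ Subgroup.closure S) ∧
                    ∀ g ∈ Subgroup.closure S,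
                      ∃ l : List (GL (Fin n) F),
                        (∀ a ∈ l, a ∈ S) ∧ l.prod = g ∧
                          (l.length : ℝ) ≤ (Fintype.card F : ℝ) ^ 2 * (n : ℝ) ^ (C : ℝ)} : ℝ) /
                (Nat.card ↥G : ℝ) ^ k := by
  refine ⟨1 / 30000, 20000000, by norm_num, by norm_num, ?_⟩
  intro F _ _ n hn G hG k hk
  rw [← Nat.card_eq_fintype_card] at hk ⊢
  have hq := two_le_card_field F
  have hq' : 2 ≤ Nat.card F := by exact_mod_cast hq
  have hn1 : 20000000 < n := by exact_mod_cast hn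
  obtain ⟨ℓ, hℓ, hnℓ, hnℓ'⟩ : ∃ ℓ, 1000 ≤ ℓ ∧ 20000 * ℓ ≤ n ∧ n ≤ 20020 * ℓ :=
    ⟨n / 20000, by omega, by omega, by omega⟩
  have hcard : Nat.card (StageIndex (Fin (Nat.card F ^ 20000))) ≤ k := by
    refine (card_stageIndex_le hq').trans ?_
    have : ((Nat.card F ^ 20010 : ℕ) : ℝ) ≤ k := by
      refine le_trans ?_ hk.le
      rw [Nat.cast_pow, ← Real.rpow_natCast]
      exact Real.rpow_le_rpow_of_exponent_le (by linarith) (by norm_num)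
    exact_mod_cast this
  obtain ⟨e⟩ : Nonempty (StageIndex (Fin (Nat.card F ^ 20000)) ↪ Fin k) := by
    have := Fintype.ofFinite (StageIndex (Fin (Nat.card F ^ 20000)))
    rw [Function.Embedding.nonempty_iff_card_le, ← Nat.card_eq_fintype_card, Fintype.card_fin]
    exact hcard
  have hfail := pr_not_forall_transvection_stageRadius (ℓ := ℓ) (A := Fin (Nat.card F ^ 20000)) hG
    (Nat.card_fin _).ge hℓ hnℓ hnℓ'
  rw [← pr_comp_injective e.injective] at hfail
  have hsucc := pr_not (fun x : Fin k → G => ∀ i j, i ≠ j → ∀ c,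
    ∃ g ∈ ball (symSet fun i => (x (e i)).1) (stageRadius (Nat.card F) n ℓ),
      g.1 = Matrix.transvection i j c)
  have hfin : 1 - (Nat.card F : ℝ) ^ (-((1 / 30000 : ℝ) * n)) ≤
      pr (fun x : Fin k → G => ∀ i j, i ≠ j → ∀ c,
        ∃ g ∈ ball (symSet fun i => (x (e i)).1) (stageRadius (Nat.card F) n ℓ),
          g.1 = Matrix.transvection i j c) := by
    have := hfail.trans (four_mul_one_div_pow_le hq hℓ hnℓ')
    linarith
  refine (hfin.trans (pr_mono (p' := fun x : Fin k → G => ∀ S : Set (GL (Fin n) F),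
    S = {g | ∃ i : Fin k, g = ↑(x i) ∨ g = (↑(x i) : GL (Fin n) F)⁻¹} →
      (∀ A : Matrix.SpecialLinearGroup (Fin n) F,
        Matrix.SpecialLinearGroup.toGL A ∈ Subgroup.closure S) ∧
      ∀ g ∈ Subgroup.closure S, ∃ l : List (GL (Fin n) F),
        (∀ a ∈ l, a ∈ S) ∧ l.prod = g ∧
          (l.length : ℝ) ≤ (Nat.card F : ℝ) ^ 2 * (n : ℝ) ^ (20000000 : ℝ)) ?_)).trans (le_of_eq ?_)
  · intro x hx S hS
    replace hS : S = symSet fun i => (x i).1 := hS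
    have hT : ∀ i j, i ≠ j → ∀ c, ∃ g ∈ ball S (stageRadius (Nat.card F) n ℓ),
        g.1 = Matrix.transvection i j c := fun i j hij c => by
      obtain ⟨g, hg, hgc⟩ := hx i j hij c
      exact ⟨g, hS ▸ ball_subset (symSet_comp_subset (fun i => (x i).1) e) hg, hgc⟩
    refine ⟨fun A => mem_closure_of_mem_ball (mem_ball_of_det_eq_one hT A.2), fun g hg => ?_⟩
    obtain ⟨l, h1, h2, h3⟩ := mem_ball_of_mem_closure (hS ▸ inv_mem_symSet) hT hg
    refine ⟨l, h1, h2, ?_⟩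
    have h4 : (l.length : ℝ) ≤ (Nat.card F : ℝ) ^ 2 * (n : ℝ) ^ 9 := by
      exact_mod_cast h3.trans (length_le_sq_mul_pow hq' hℓ hnℓ)
    refine h4.trans (mul_le_mul_of_nonneg_left ?_ (by positivity))
    rw [← Real.rpow_natCast]
    exact Real.rpow_le_rpow_of_exponent_le (by linarith) (by norm_num)
  · rw [pr, Nat.card_fun, Nat.card_fin, Nat.cast_pow]
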